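/- Let n ≥ 2 and q > 2, and let f be a positive smooth even function on the unit sphere S^{n−1}. Then there exist a convex body Ω in ℝⁿ that is origin-symmetric with smooth, strictly convex boundary, and a constant τ₂ > 0, such that the support function h of Ω satisfies τ₂ · Ṽ_{γ,q}(Ω, ∇h(x) + h(x)x) · h(x) · det(∇²h(x) + h(x)I) = f(x) for every x ∈ S^{n−1}, where ∇ and ∇² denote the covariant gradient and Hessian on S^{n−1}. (Smooth even solution to the log-Gaussian chord Minkowski problem.) -/

import Mathlib

open MeasureTheory Filter
open scoped RealInnerProductSpace Topology

noncomputable section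

/-- `n`-dimensional Euclidean space. -/
abbrev Eucl (n : ℕ) := EuclideanSpace ℝ (Fin n)

/-- The support function of `K`, as a `1`-homogeneous function on all of `ℝⁿ`;
its restriction to the unit sphere is the usual support function `h_K`. -/
def suppFun {n : ℕ} (K : Set (Eucl n)) (x : Eucl n) : ℝ :=
  sSup ((fun y => ⟪x, y⟫) '' K)

/-- The radial function `ρ_K(ξ) = max {c > 0 : c • ξ ∈ K}`. -/
def radFun {n : ℕ} (K : Set (Eucl n)) (ξ : Eucl n) : ℝ :=
  sSup {c : ℝ | 0 < c ∧ c • ξ ∈ K}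

/-- `Ṽ_{γ,q}(K, y) = 2 e^{-|y|²/2} ∫_K e^{-|z|²/2} |z - y|^{-(n-q+1)} dz`. -/
def Vtilde {n : ℕ} (q : ℝ) (K : Set (Eucl n)) (y : Eucl n) : ℝ :=
  2 * Real.exp (-‖y‖ ^ 2 / 2) *
    ∫ z in K, Real.exp (-‖z‖ ^ 2 / 2) / ‖z - y‖ ^ ((n : ℝ) - q + 1)

/-- The Gaussian chord integral
`I_{γ,q}(K) = ∫_K ∫_K e^{-(|z|²+|y|²)/2} |z - y|^{-(n-q+1)} dz dy`. -/
def gaussChord {n : ℕ} (q : ℝ) (K : Set (Eucl n)) : ℝ :=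
  ∫ y in K, ∫ z in K,
    Real.exp (-(‖z‖ ^ 2 + ‖y‖ ^ 2) / 2) / ‖z - y‖ ^ ((n : ℝ) - q + 1)

/-- The rank-one map `v ↦ ⟪x, v⟫ • x` (orthogonal projection onto `ℝ x` when `‖x‖ = 1`). -/
def rankOne {n : ℕ} (x : Eucl n) : Eucl n →ₗ[ℝ] Eucl n where
  toFun v := ⟪x, v⟫ • x
  map_add' v w := by simp [inner_add_right, add_smul]
  map_smul' c v := by simp [inner_smul_right, mul_smul]

/-- For the `1`-homogeneous extension `H` of the support function `h` of a smooth strictly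
convex body, `fderiv ℝ (gradient H) x` vanishes on `ℝ x` and restricts on the tangent space
`x^⊥` to the matrix of principal radii of curvature `∇²h + h I`.  Adding the rank-one
projection onto `ℝ x` therefore makes the determinant of the ambient map equal to
`det(∇²h + h I)`, the reciprocal Gauss curvature. -/
def curvDet {n : ℕ} (H : Eucl n → ℝ) (x : Eucl n) : ℝ :=
  LinearMap.det
    ((fderiv ℝ (fun y => gradient H y) x : Eucl n →ₗ[ℝ] Eucl n) + rankOne x)

/-- A convex body in `ℝⁿ` which is origin-symmetric and has smooth, strictly convex
boundary (encoded via smoothness of its support function away from the origin and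
positivity of the curvature determinant on the sphere). -/
def IsSmoothBody {n : ℕ} (Ω : Set (Eucl n)) : Prop :=
  IsCompact Ω ∧ Convex ℝ Ω ∧ (0 : Eucl n) ∈ interior Ω ∧ (∀ x ∈ Ω, -x ∈ Ω) ∧
    ContDiffOn ℝ (⊤ : ℕ∞) (suppFun Ω) {(0 : Eucl n)}ᶜ ∧
    ∀ x ∈ Metric.sphere (0 : Eucl n) 1, 0 < curvDet (suppFun Ω) x

/-- The normalizing factor
`θ(t) = (∫_{S^{n-1}} Ṽ_{γ,q}(Ω, ρ(ξ)ξ) ρ(ξ)ⁿ dξ) / (∫_{S^{n-1}} h(x)^p f(x) dx)`. -/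
def theta {n : ℕ} (q p : ℝ) (f : Eucl n → ℝ) (K : Set (Eucl n)) : ℝ :=
  (∫ ξ in Metric.sphere (0 : Eucl n) 1,
      Vtilde q K (radFun K ξ • ξ) * radFun K ξ ^ n ∂μH[(n : ℝ) - 1]) /
  ∫ x in Metric.sphere (0 : Eucl n) 1, suppFun K x ^ p * f x ∂μH[(n : ℝ) - 1]

/-- The right-hand side `-θ h^p 𝒦 f / Ṽ_{γ,q}(K, ∇h + h x) + h` of the normalized Gauss
curvature flow, expressed through the `1`-homogeneous extension of the support function
(`gradient (suppFun K) x = ∇h(x) + h(x) x` and `𝒦 = (curvDet (suppFun K) x)⁻¹`). -/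
def flowRHS {n : ℕ} (q p : ℝ) (f : Eucl n → ℝ) (K : Set (Eucl n)) (x : Eucl n) : ℝ :=
  -(theta q p f K) * suppFun K x ^ p * (curvDet (suppFun K) x)⁻¹ * f x /
      Vtilde q K (gradient (suppFun K) x) + suppFun K x

/-- `K : ℝ → Set (Eucl n)` solves the normalized Gauss curvature flow
`∂h/∂t = -θ(t) h^p 𝒦 f / Ṽ_{γ,q} + h` on the time set `S`. -/
def IsGaussChordFlow {n : ℕ} (q p : ℝ) (f : Eucl n → ℝ) (S : Set ℝ)
    (K : ℝ → Set (Eucl n)) : Prop :=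
  ∀ t ∈ S, ∀ x ∈ Metric.sphere (0 : Eucl n) 1,
    HasDerivWithinAt (fun s => suppFun (K s) x) (flowRHS q p f (K t) x) S t

/-- The Wulff shape (Aleksandrov body) of a function `φ` on the unit sphere. -/
def wulff {n : ℕ} (φ : Eucl n → ℝ) : Set (Eucl n) :=
  {x | ∀ u ∈ Metric.sphere (0 : Eucl n) 1, ⟪x, u⟫ ≤ φ u}

/-- `ν` is a Gauss map of `∂K`: at every boundary point `y` of `K`, `ν y` is an outer
unit normal, i.e. `y · ν y = h_K(ν y)`. -/
def IsGaussMap {n : ℕ} (K : Set (Eucl n)) (ν : Eucl n → Eucl n) : Prop :=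
  ∀ y ∈ frontier K, ν y ∈ Metric.sphere (0 : Eucl n) 1 ∧ ⟪y, ν y⟫ = suppFun K (ν y)

section

/-! ### The orthogonal group and its Haar measure -/

/-- The orthogonal group of `ℝⁿ`. -/
abbrev Gp (n : ℕ) := ↥(unitary (Eucl n →L[ℝ] Eucl n))

/-! Shortcut instances, which speed up type class inference considerably. -/

section Shortcuts
variable (n : ℕ)

instance : CompleteSpace (Eucl n →L[ℝ] Eucl n) := inferInstance
instance : NormedRing (Eucl n →L[ℝ] Eucl n) := inferInstance
instance : Ring (Eucl n →L[ℝ] Eucl n) := inferInstance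
instance : Semiring (Eucl n →L[ℝ] Eucl n) := inferInstance
instance : NonAssocSemiring (Eucl n →L[ℝ] Eucl n) := inferInstance
instance : NonUnitalNonAssocSemiring (Eucl n →L[ℝ] Eucl n) := inferInstance
instance : MulOneClass (Eucl n →L[ℝ] Eucl n) := inferInstance
instance : IsTopologicalRing (Eucl n →L[ℝ] Eucl n) := inferInstance
instance : ContinuousMul (Eucl n →L[ℝ] Eucl n) := inferInstance
instance : ContinuousSMul ℝ (Eucl n →L[ℝ] Eucl n) := inferInstance
instance : StarModule ℝ (Eucl n →L[ℝ] Eucl n) := inferInstance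
instance : CommRing C(Gp n, ℝ) := inferInstance
instance : Ring C(Gp n, ℝ) := inferInstance
instance : CommSemiring C(Gp n, ℝ) := inferInstance
instance : Semiring C(Gp n, ℝ) := inferInstance
instance : NonAssocSemiring C(Gp n, ℝ) := inferInstance
instance : NonUnitalNonAssocSemiring C(Gp n, ℝ) := inferInstance
instance : NonAssocRing C(Gp n, ℝ) := inferInstance
instance : NonUnitalNonAssocRing C(Gp n, ℝ) := inferInstance
instance : MulOneClass C(Gp n, ℝ) := inferInstance
instance : AddCommGroup C(Gp n, ℝ) := inferInstance
instance : AddCommMonoid C(Gp n, ℝ) := inferInstance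
instance : Module ℝ C(Gp n, ℝ) := inferInstance
instance : Algebra ℝ C(Gp n, ℝ) := inferInstance

end Shortcuts

instance instContinuousStarEnd (n : ℕ) : ContinuousStar (Eucl n →L[ℝ] Eucl n) where
  continuous_star := (ContinuousLinearMap.adjoint (𝕜 := ℝ) (E := Eucl n) (F := Eucl n)).continuous

section Group

variable {n : ℕ}

theorem Gp.norm_apply (k : Gp n) (v : Eucl n) : ‖k.1 v‖ = ‖v‖ :=
  (Unitary.linearIsometryEquiv k).norm_map v

theorem Gp.inner_apply (k : Gp n) (v w : Eucl n) : ⟪k.1 v, k.1 w⟫ = ⟪v, w⟫ :=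
  (Unitary.linearIsometryEquiv k).inner_map_map v w

theorem Gp.opNorm_le (k : Gp n) : ‖k.1‖ ≤ 1 :=
  ContinuousLinearMap.opNorm_le_bound _ zero_le_one fun v => by rw [k.norm_apply, one_mul]

theorem Gp.inv_apply_apply (k : Gp n) (v : Eucl n) : (k⁻¹).1 (k.1 v) = v := by
  have : (k⁻¹ * k).1 v = v := by rw [inv_mul_cancel]; rfl
  exact this

theorem Gp.apply_inv_apply (k : Gp n) (v : Eucl n) : k.1 ((k⁻¹).1 v) = v := by
  have : (k * k⁻¹).1 v = v := by rw [mul_inv_cancel]; rfl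
  exact this

instance instCompactSpaceGp : CompactSpace (Gp n) := by
  refine isCompact_iff_compactSpace.mp ?_
  refine Metric.isCompact_of_isClosed_isBounded isClosed_unitary ?_
  refine (Metric.isBounded_closedBall (x := (0 : Eucl n →L[ℝ] Eucl n)) (r := 1)).subset ?_
  intro k hk
  simpa using Gp.opNorm_le ⟨k, hk⟩

/-- Normalized Haar measure on the orthogonal group. -/
def muG (n : ℕ) : Measure (Gp n) := Measure.haarMeasure ⊤

instance : (muG n).IsHaarMeasure := by unfold muG; infer_instance

instance : IsProbabilityMeasure (muG n) := by
  constructor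
  simpa [muG] using Measure.haarMeasure_self (K₀ := (⊤ : TopologicalSpace.PositiveCompacts (Gp n)))

instance : (muG n).IsMulRightInvariant where
  map_mul_right_eq_self g := by
    have : IsProbabilityMeasure (Measure.map (· * g) (muG n)) :=
      Measure.isProbabilityMeasure_map (measurable_mul_const g).aemeasurable
    exact Measure.isHaarMeasure_eq_of_isProbabilityMeasure _ _

/-! ### The `L²` norm of continuous functions -/

theorem Gp.integrable (y : C(Gp n, ℝ)) : Integrable (fun k => y k) (muG n) :=
  y.continuous.integrable_of_hasCompactSupport (HasCompactSupport.of_compactSpace _)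

/-- The embedding of `C(G)` in `L²(G)`. -/
abbrev toL2 (n : ℕ) : C(Gp n, ℝ) →L[ℝ] Lp ℝ 2 (muG n) := ContinuousMap.toLp 2 (muG n) ℝ

/-- The `L²` norm of a continuous function. -/
def n2 (y : C(Gp n, ℝ)) : ℝ := ‖toL2 n y‖

/-- The `L²` inner product of continuous functions. -/
def ip (y z : C(Gp n, ℝ)) : ℝ := ∫ k, y k * z k ∂muG n

theorem inner_toL2 (y z : C(Gp n, ℝ)) : ⟪toL2 n y, toL2 n z⟫ = ip y z := by
  rw [ContinuousMap.inner_toLp]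
  simp [ip, mul_comm]

theorem n2_sq (y : C(Gp n, ℝ)) : n2 y ^ 2 = ip y y := by
  rw [← inner_toL2, n2, real_inner_self_eq_norm_sq]

theorem toL2_injective : Function.Injective (toL2 n) := ContinuousMap.toLp_injective (muG n)

theorem n2_nonneg (y : C(Gp n, ℝ)) : 0 ≤ n2 y := norm_nonneg _

theorem n2_add_le (y z : C(Gp n, ℝ)) : n2 (y + z) ≤ n2 y + n2 z := by
  unfold n2; rw [map_add]; exact norm_add_le _ _

theorem n2_smul (c : ℝ) (y : C(Gp n, ℝ)) : n2 (c • y) = |c| * n2 y := by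
  unfold n2; rw [map_smul, norm_smul, Real.norm_eq_abs]

theorem n2_zero : n2 (0 : C(Gp n, ℝ)) = 0 := by simp [n2]

theorem n2_neg (y : C(Gp n, ℝ)) : n2 (-y) = n2 y := by simp [n2]

theorem n2_eq_zero {y : C(Gp n, ℝ)} (h : n2 y = 0) : y = 0 :=
  toL2_injective (by rw [map_zero]; exact norm_eq_zero.mp h)

theorem n2_le_norm (y : C(Gp n, ℝ)) : n2 y ≤ ‖y‖ := by
  refine (ContinuousLinearMap.le_opNorm _ _).trans ?_
  refine mul_le_of_le_one_left (norm_nonneg _) ?_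
  refine (ContinuousMap.toLp_norm_le (muG n)).trans ?_
  simp [measureUnivNNReal]

theorem ip_comm (y z : C(Gp n, ℝ)) : ip y z = ip z y := by simp [ip, mul_comm]

theorem ip_add_left (y y' z : C(Gp n, ℝ)) : ip (y + y') z = ip y z + ip y' z := by
  simp only [← inner_toL2, map_add, inner_add_left]

theorem ip_smul_left (c : ℝ) (y z : C(Gp n, ℝ)) : ip (c • y) z = c * ip y z := by
  simp only [← inner_toL2, map_smul, inner_smul_left]; simp

theorem ip_neg_left (y z : C(Gp n, ℝ)) : ip (-y) z = -ip y z := by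
  simp only [← inner_toL2, map_neg, inner_neg_left]

theorem ip_add_right (y z z' : C(Gp n, ℝ)) : ip y (z + z') = ip y z + ip y z' := by
  simp only [← inner_toL2, map_add, inner_add_right]

theorem ip_smul_right (c : ℝ) (y z : C(Gp n, ℝ)) : ip y (c • z) = c * ip y z := by
  rw [ip_comm, ip_smul_left, ip_comm]

theorem ip_neg_right (y z : C(Gp n, ℝ)) : ip y (-z) = -ip y z := by
  rw [ip_comm, ip_neg_left, ip_comm]

theorem ip_sum_left {ι : Type*} (s : Finset ι) (y : ι → C(Gp n, ℝ)) (z : C(Gp n, ℝ)) :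
    ip (∑ i ∈ s, y i) z = ∑ i ∈ s, ip (y i) z := by
  simp only [← inner_toL2, map_sum, sum_inner]

theorem abs_ip_le (y z : C(Gp n, ℝ)) : |ip y z| ≤ n2 y * n2 z := by
  rw [← inner_toL2]; exact abs_real_inner_le_norm _ _

theorem n2_mul_le (y z : C(Gp n, ℝ)) : n2 (y * z) ≤ ‖y‖ * n2 z := by
  refine le_of_sq_le_sq ?_ (mul_nonneg (norm_nonneg _) (n2_nonneg _))
  rw [mul_pow, n2_sq, n2_sq, ip, ip, ← integral_const_mul]
  refine integral_mono (Gp.integrable ((y * z) * (y * z)))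
    ((Gp.integrable (z * z)).const_mul _) fun k => ?_
  have h : |y k| ≤ ‖y‖ := y.norm_coe_le_norm k
  have : y k ^ 2 ≤ ‖y‖ ^ 2 := sq_le_sq' (by linarith [neg_abs_le (y k)]) (le_of_abs_le h)
  simp only [ContinuousMap.mul_apply]
  nlinarith [mul_le_mul_of_nonneg_right this (sq_nonneg (z k))]

/-! ### Translations -/

/-- Right translation `y ↦ y(· g)`. -/
def Rt (g : Gp n) : C(Gp n, ℝ) →ₐ[ℝ] C(Gp n, ℝ) :=
  ContinuousMap.compRightAlgHom ℝ ℝ ⟨fun k => k * g, by fun_prop⟩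

/-- Left translation `y ↦ y(g ·)`. -/
def Lt (g : Gp n) : C(Gp n, ℝ) →ₐ[ℝ] C(Gp n, ℝ) :=
  ContinuousMap.compRightAlgHom ℝ ℝ ⟨fun k => g * k, by fun_prop⟩

@[simp] theorem Rt_apply (g : Gp n) (y : C(Gp n, ℝ)) (k : Gp n) : Rt g y k = y (k * g) := rfl
@[simp] theorem Lt_apply (g : Gp n) (y : C(Gp n, ℝ)) (k : Gp n) : Lt g y k = y (g * k) := rfl

theorem ip_Rt (g : Gp n) (y z : C(Gp n, ℝ)) : ip (Rt g y) (Rt g z) = ip y z :=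
  integral_mul_right_eq_self (fun k => y k * z k) g

theorem ip_Lt (g : Gp n) (y z : C(Gp n, ℝ)) : ip (Lt g y) (Lt g z) = ip y z :=
  integral_mul_left_eq_self (fun k => y k * z k) g

theorem n2_Rt (g : Gp n) (y : C(Gp n, ℝ)) : n2 (Rt g y) = n2 y := by
  rw [← sq_eq_sq₀ (n2_nonneg _) (n2_nonneg _), n2_sq, n2_sq, ip_Rt]

theorem n2_Lt (g : Gp n) (y : C(Gp n, ℝ)) : n2 (Lt g y) = n2 y := by
  rw [← sq_eq_sq₀ (n2_nonneg _) (n2_nonneg _), n2_sq, n2_sq, ip_Lt]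

/-! ### Sup bound on translation invariant subspaces -/

theorem exists_orthonormal_of_injective {X H : Type*} [AddCommGroup X] [Module ℝ X]
    [FiniteDimensional ℝ X] [NormedAddCommGroup H] [InnerProductSpace ℝ H] (T : X →ₗ[ℝ] H)
    (hT : Function.Injective T) :
    ∃ c : Fin (Module.finrank ℝ X) → X,
      (∀ i j, ⟪T (c i), T (c j)⟫ = if i = j then (1 : ℝ) else 0) ∧
      ∀ z, z = ∑ i, ⟪T (c i), T z⟫ • c i := by
  let e : X ≃ₗ[ℝ] LinearMap.range T := LinearEquiv.ofInjective T hT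
  have := e.finiteDimensional
  obtain ⟨b⟩ : Nonempty (OrthonormalBasis (Fin (Module.finrank ℝ X)) ℝ (LinearMap.range T)) :=
    ⟨(stdOrthonormalBasis ℝ _).reindex (finCongr e.finrank_eq.symm)⟩
  have hin : ∀ z z' : X, ⟪e z, e z'⟫ = ⟪T z, T z'⟫ := fun z z' => rfl
  refine ⟨fun i => e.symm (b i), fun i j => ?_, fun z => ?_⟩
  · rw [← hin, e.apply_symm_apply, e.apply_symm_apply]
    exact orthonormal_iff_ite.mp b.orthonormal i j
  · have h := congrArg e.symm (b.sum_repr' (e z))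
    rw [e.symm_apply_apply, map_sum] at h
    refine h.symm.trans (Finset.sum_congr rfl fun i _ => ?_)
    rw [map_smul, ← hin, e.apply_symm_apply]

theorem exists_orthonormal_family (W : Submodule ℝ C(Gp n, ℝ)) [FiniteDimensional ℝ W] :
    ∃ c : Fin (Module.finrank ℝ W) → C(Gp n, ℝ), (∀ i, c i ∈ W) ∧
      (∀ i j, ip (c i) (c j) = if i = j then 1 else 0) ∧
      ∀ z ∈ W, z = ∑ i, ip (c i) z • c i := by
  obtain ⟨c, h1, h2⟩ := exists_orthonormal_of_injective
    ((toL2 n : C(Gp n, ℝ) →ₗ[ℝ] Lp ℝ 2 (muG n)) ∘ₗ W.subtype)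
    (toL2_injective.comp W.injective_subtype)
  have h3 : ∀ z z' : W, ⟪((toL2 n : C(Gp n, ℝ) →ₗ[ℝ] Lp ℝ 2 (muG n)) ∘ₗ W.subtype) z,
      ((toL2 n : C(Gp n, ℝ) →ₗ[ℝ] Lp ℝ 2 (muG n)) ∘ₗ W.subtype) z'⟫ = ip z.1 z'.1 :=
    fun z z' => inner_toL2 _ _
  refine ⟨fun i => (c i).1, fun i => (c i).2, fun i j => (h3 _ _).symm.trans (h1 i j),
    fun z hz => ?_⟩
  have := congrArg Subtype.val (h2 ⟨z, hz⟩)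
  simp only [h3] at this
  refine this.trans ?_
  rw [Submodule.coe_sum]
  rfl

theorem sq_apply_le_finrank_mul (W : Submodule ℝ C(Gp n, ℝ)) [FiniteDimensional ℝ W]
    (hW : ∀ g, ∀ y ∈ W, Lt g y ∈ W) {y : C(Gp n, ℝ)} (hy : y ∈ W) (k : Gp n) :
    y k ^ 2 ≤ Module.finrank ℝ W * n2 y ^ 2 := by
  classical
  obtain ⟨c, hcW, hcc, hexp⟩ := exists_orthonormal_family W
  have hpars : ∀ z ∈ W, n2 z ^ 2 = ∑ i, ip (c i) z ^ 2 := fun z hz => by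
    conv_lhs => rw [n2_sq, hexp z hz]
    rw [ip_sum_left]
    simp only [ip_smul_left]
    rw [← hexp z hz]
    exact Finset.sum_congr rfl fun i _ => by ring
  let D : C(Gp n, ℝ) := ∑ i, c i * c i
  have hD : ∀ k, D k = ∑ i, c i k ^ 2 := fun k => by
    simp [D, ContinuousMap.sum_apply, pow_two]
  have hD0 : ∀ k, 0 ≤ D k := fun k => by rw [hD]; positivity
  have hcs : ∀ z ∈ W, ∀ k, z k ^ 2 ≤ n2 z ^ 2 * D k := fun z hz k => by
    rw [hD, hpars z hz]
    conv_lhs => rw [hexp z hz]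
    simp only [ContinuousMap.sum_apply, ContinuousMap.smul_apply, smul_eq_mul]
    exact Finset.sum_mul_sq_le_sq_mul_sq _ _ _
  have hDle : ∀ g k, D (g * k) ≤ D k := fun g k => by
    let z : C(Gp n, ℝ) := ∑ i, c i (g * k) • c i
    have hz : z ∈ W := Submodule.sum_mem _ fun i _ => Submodule.smul_mem _ _ (hcW i)
    have hzk : z (g * k) = D (g * k) := by
      simp [z, hD, ContinuousMap.sum_apply, pow_two]
    have hzn : n2 z ^ 2 = D (g * k) := by
      rw [hpars z hz, hD]
      refine Finset.sum_congr rfl fun i _ => ?_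
      rw [ip_comm, ip_sum_left]
      simp [ip_smul_left, hcc]
    have := hcs _ (hW g z hz) k
    rw [Lt_apply, hzk, n2_Lt, hzn] at this
    rcases (hD0 (g * k)).eq_or_lt with h | h
    · rw [← h]; exact hD0 k
    · nlinarith
  have hDk : D k ≤ Module.finrank ℝ W := by
    have h1 : ∫ h, D h ∂muG n = Module.finrank ℝ W := by
      have h2 : ∀ y, ∫ h, y h ∂muG n = ip y 1 := fun y => by simp [ip]
      have h3 : ∀ i, ip (c i * c i) 1 = 1 := fun i => by
        have h4 : ip (c i * c i) 1 = ip (c i) (c i) := by simp [ip]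
        rw [h4, hcc i i, if_pos rfl]
      rw [h2, ip_sum_left]
      simp [h3]
    rw [← h1, show D k = ∫ _, D k ∂muG n by simp]
    refine integral_mono (integrable_const _) (Gp.integrable D) fun h => ?_
    have := hDle (k * h⁻¹) h
    rwa [inv_mul_cancel_right] at this
  calc y k ^ 2 ≤ n2 y ^ 2 * D k := hcs y hy k
    _ ≤ n2 y ^ 2 * Module.finrank ℝ W := by gcongr
    _ = _ := mul_comm _ _

end Group

end

section

section Filtration

variable {n : ℕ}

/-- The matrix coefficient `k ↦ ⟪v, k w⟫`. -/
def cf (v w : Eucl n) : C(Gp n, ℝ) :=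
  ⟨fun k => ⟪v, k.1 w⟫, by fun_prop⟩

@[simp] theorem cf_apply (v w : Eucl n) (k : Gp n) : cf v w k = ⟪v, k.1 w⟫ := rfl

theorem cf_add_left (v v' w : Eucl n) : cf (v + v') w = cf v w + cf v' w := by
  ext k; simp [inner_add_left]

theorem cf_smul_left (c : ℝ) (v w : Eucl n) : cf (c • v) w = c • cf v w := by
  ext k; simp [inner_smul_left]

theorem cf_sub_left (v v' w : Eucl n) : cf (v - v') w = cf v w - cf v' w := by
  ext k; simp [inner_sub_left]

/-- The standard basis vectors. -/
abbrev eb (i : Fin n) : Eucl n := EuclideanSpace.single i (1 : ℝ)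

theorem sum_inner_eb (v : Eucl n) : ∑ i, ⟪eb i, v⟫ • eb i = v := by
  simpa using (EuclideanSpace.basisFun (Fin n) ℝ).sum_repr' v

theorem cf_eq_sum (v w : Eucl n) :
    cf v w = ∑ p : Fin n × Fin n, (⟪eb p.1, v⟫ * ⟪eb p.2, w⟫) • cf (eb p.1) (eb p.2) := by
  ext k
  rw [Fintype.sum_prod_type]
  simp only [cf_apply, ContinuousMap.sum_apply, ContinuousMap.smul_apply, smul_eq_mul]
  conv_lhs => rw [← sum_inner_eb v, ← sum_inner_eb w]
  simp only [map_sum, sum_inner, inner_sum, inner_smul_left, inner_smul_right, map_smul]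
  rw [Finset.sum_comm]
  refine Finset.sum_congr rfl fun i _ => ?_
  rw [Finset.mul_sum]
  refine Finset.sum_congr rfl fun j _ => ?_
  simp only [conj_trivial]
  ring

/-- The span of `1` and the matrix coefficients. -/
def V1 (n : ℕ) : Submodule ℝ C(Gp n, ℝ) :=
  Submodule.span ℝ (insert 1 (Set.range fun p : Fin n × Fin n => cf (eb p.1) (eb p.2)))

/-- Polynomials of degree at most `l` in the matrix coefficients. -/
def Vp (n l : ℕ) : Submodule ℝ C(Gp n, ℝ) := V1 n ^ l

theorem one_mem_V1 : (1 : C(Gp n, ℝ)) ∈ V1 n := Submodule.subset_span (Set.mem_insert _ _)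

theorem cf_mem_V1 (v w : Eucl n) : cf v w ∈ V1 n := by
  rw [cf_eq_sum]
  exact Submodule.sum_mem _ fun p _ => Submodule.smul_mem _ _
    (Submodule.subset_span (Set.mem_insert_of_mem _ ⟨p, rfl⟩))

theorem V1_le_of {S : Submodule ℝ C(Gp n, ℝ)} (h1 : 1 ∈ S) (h2 : ∀ v w, cf v w ∈ S) :
    V1 n ≤ S := by
  refine Submodule.span_le.mpr ?_
  rintro y (rfl | ⟨p, rfl⟩)
  exacts [h1, h2 _ _]

theorem Vp_mul_mem {j k : ℕ} {y z : C(Gp n, ℝ)} (hy : y ∈ Vp n j) (hz : z ∈ Vp n k) :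
    y * z ∈ Vp n (j + k) := by
  rw [Vp, pow_add]; exact Submodule.mul_mem_mul hy hz

theorem one_mem_Vp (l : ℕ) : (1 : C(Gp n, ℝ)) ∈ Vp n l := by
  induction l with
  | zero => rw [Vp, pow_zero]; exact Submodule.one_le.mp le_rfl
  | succ l ih => simpa using Vp_mul_mem ih (show (1 : C(Gp n, ℝ)) ∈ Vp n 1 by
      rw [Vp, pow_one]; exact one_mem_V1)

theorem cf_mem_Vp (v w : Eucl n) : cf v w ∈ Vp n 1 := by
  rw [Vp, pow_one]; exact cf_mem_V1 v w

theorem Vp_mono : Monotone (Vp n) := monotone_nat_of_le_succ fun l y hy => by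
  simpa using Vp_mul_mem hy (one_mem_Vp 1)

/-- Induction principle for the filtration. -/
theorem Vp_induction {P : ℕ → C(Gp n, ℝ) → Prop} (h1 : P 0 1)
    (hadd : ∀ l y z, P l y → P l z → P l (y + z)) (hsmul : ∀ l (c : ℝ) y, P l y → P l (c • y))
    (hone : ∀ l y, P l y → P (l + 1) y) (hcf : ∀ l y v w, y ∈ Vp n l → P l y → P (l + 1) (y * cf v w))
    {l : ℕ} {y : C(Gp n, ℝ)} (hy : y ∈ Vp n l) : P l y := by
  have hz : ∀ l, P l 0 := fun l => by
    induction l with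
    | zero => simpa using hsmul 0 0 1 h1
    | succ l ih => exact hone l 0 ih
  induction l generalizing y with
  | zero =>
    rw [Vp, pow_zero, Submodule.mem_one] at hy
    obtain ⟨c, rfl⟩ := hy
    rw [Algebra.algebraMap_eq_smul_one]
    exact hsmul 0 c 1 h1
  | succ l ih =>
    rw [Vp, pow_succ] at hy
    refine Submodule.mul_induction_on hy (fun a ha b hb => ?_) fun a b ha hb => hadd _ _ _ ha hb
    let S : Submodule ℝ C(Gp n, ℝ) :=
      { carrier := {b | P (l + 1) (a * b)}
        add_mem' := fun {b b'} hb hb' => by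
          simp only [Set.mem_ofPred_eq, mul_add] at *; exact hadd _ _ _ hb hb'
        zero_mem' := by simpa using hz (l + 1)
        smul_mem' := fun c b hb => by
          simp only [Set.mem_ofPred_eq, mul_smul_comm] at *; exact hsmul _ _ _ hb }
    have : V1 n ≤ S := V1_le_of (show P (l + 1) (a * 1) by rw [mul_one]; exact hone _ _ (ih ha))
      fun v w => hcf l a v w ha (ih ha)
    exact this hb

instance (l : ℕ) : FiniteDimensional ℝ (Vp n l) := by
  refine Module.Finite.iff_fg.mpr (Submodule.FG.pow ?_ l)
  exact Submodule.fg_span ((Set.finite_range _).insert 1)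

theorem Rt_cf (g : Gp n) (v w : Eucl n) : Rt g (cf v w) = cf v (g.1 w) := rfl

theorem Lt_cf (g : Gp n) (v w : Eucl n) : Lt g (cf v w) = cf ((g⁻¹).1 v) w := by
  ext k
  simp only [Lt_apply, cf_apply]
  rw [show (g * k).1 w = g.1 (k.1 w) from rfl, ← Gp.inner_apply g ((g⁻¹).1 v), Gp.apply_inv_apply]

theorem Vp_map_mem (T : C(Gp n, ℝ) →ₐ[ℝ] C(Gp n, ℝ)) (hT : ∀ v w, T (cf v w) ∈ Vp n 1) {l : ℕ}
    {y : C(Gp n, ℝ)} (hy : y ∈ Vp n l) : T y ∈ Vp n l := by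
  refine Vp_induction (P := fun l y => T y ∈ Vp n l) ?_ ?_ ?_ ?_ ?_ hy
  · rw [map_one]; exact one_mem_Vp 0
  · intro l y z hy hz; rw [map_add]; exact add_mem hy hz
  · intro l c y hy; rw [map_smul]; exact Submodule.smul_mem _ _ hy
  · intro l y hy; exact Vp_mono l.le_succ hy
  · intro l y v w _ hy; rw [map_mul]; exact Vp_mul_mem hy (hT v w)

theorem Rt_mem (g : Gp n) {l : ℕ} {y : C(Gp n, ℝ)} (hy : y ∈ Vp n l) : Rt g y ∈ Vp n l :=
  Vp_map_mem _ (fun v w => by rw [Rt_cf]; exact cf_mem_Vp _ _) hy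

theorem Lt_mem (g : Gp n) {l : ℕ} {y : C(Gp n, ℝ)} (hy : y ∈ Vp n l) : Lt g y ∈ Vp n l :=
  Vp_map_mem _ (fun v w => by rw [Lt_cf]; exact cf_mem_Vp _ _) hy

theorem Vp_le_span_monomials (l : ℕ) :
    Vp n l ≤ Submodule.span ℝ (Set.range fun a : Fin n × Fin n → Fin (l + 1) =>
      ∏ p, cf (eb p.1) (eb p.2) ^ (a p : ℕ)) := by
  have key : ∀ l, Vp n l ≤ Submodule.span ℝ {y | ∃ a : Fin n × Fin n → ℕ, (∀ p, a p ≤ l) ∧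
      y = ∏ p, cf (eb p.1) (eb p.2) ^ a p} := by
    intro l y hy
    refine Vp_induction (P := fun l y => y ∈ Submodule.span ℝ
      {y | ∃ a : Fin n × Fin n → ℕ, (∀ p, a p ≤ l) ∧
        y = ∏ p, cf (eb p.1) (eb p.2) ^ a p}) ?_ ?_ ?_ ?_ ?_ hy
    · exact Submodule.subset_span ⟨0, by simp, by simp⟩
    · intro l y z hy hz; exact add_mem hy hz
    · intro l c y hy; exact Submodule.smul_mem _ _ hy
    · intro l y hy
      refine Submodule.span_mono ?_ hy
      rintro _ ⟨a, ha, rfl⟩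
      exact ⟨a, fun p => (ha p).trans l.le_succ, rfl⟩
    · intro l y v w _ hy
      rw [cf_eq_sum, Finset.mul_sum]
      refine Submodule.sum_mem _ fun p _ => ?_
      rw [mul_smul_comm]
      refine Submodule.smul_mem _ _ ?_
      clear v w
      refine Submodule.span_induction (p := fun y _ => y * cf (eb p.1) (eb p.2) ∈ _)
        ?_ ?_ ?_ ?_ hy
      · rintro _ ⟨a, ha, rfl⟩
        refine Submodule.subset_span ⟨fun r => a r + if r = p then 1 else 0, fun r => ?_, ?_⟩
        · have := ha r
          show a r + (if r = p then 1 else 0) ≤ l + 1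
          split_ifs <;> omega
        · simp only [pow_add, Finset.prod_mul_distrib]
          congr 1
          rw [Finset.prod_eq_single p] <;> simp +contextual
      · simp
      · intro a b _ _ ha hb; rw [add_mul]; exact add_mem ha hb
      · intro c a _ ha; rw [smul_mul_assoc]; exact Submodule.smul_mem _ _ ha
  refine (key l).trans (Submodule.span_mono ?_)
  rintro _ ⟨a, ha, rfl⟩
  exact ⟨fun p => ⟨a p, Nat.lt_succ_of_le (ha p)⟩, rfl⟩

theorem finrank_Vp_le (l : ℕ) : Module.finrank ℝ (Vp n l) ≤ (l + 1) ^ (n * n) := by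
  have : FiniteDimensional ℝ (Submodule.span ℝ (Set.range
      fun a : Fin n × Fin n → Fin (l + 1) => ∏ p, cf (eb p.1) (eb p.2) ^ (a p : ℕ))) :=
    FiniteDimensional.span_of_finite ℝ (Set.finite_range _)
  refine (Submodule.finrank_mono (Vp_le_span_monomials l)).trans ?_
  refine (finrank_range_le_card (R := ℝ) _).trans ?_
  simp

/-- On `Vp n l` the sup norm is controlled polynomially by the `L²` norm. -/
theorem norm_le_of_mem_Vp {l : ℕ} {y : C(Gp n, ℝ)} (hy : y ∈ Vp n l) :
    ‖y‖ ≤ (1 + l : ℝ) ^ (n * n) * n2 y := by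
  refine (ContinuousMap.norm_le _ (mul_nonneg (by positivity) (n2_nonneg _))).mpr fun k => ?_
  refine abs_le_of_sq_le_sq ?_ (mul_nonneg (by positivity) (n2_nonneg _))
  refine (sq_apply_le_finrank_mul (Vp n l) (fun g y hy => Lt_mem g hy) hy k).trans ?_
  rw [mul_pow]
  refine mul_le_mul_of_nonneg_right ?_ (sq_nonneg _)
  have h1 : (Module.finrank ℝ (Vp n l) : ℝ) ≤ (1 + l : ℝ) ^ (n * n) := by
    rw [add_comm]; exact_mod_cast finrank_Vp_le l
  refine h1.trans (le_self_pow₀ ?_ two_ne_zero)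
  exact one_le_pow₀ (by linarith [(Nat.cast_nonneg l : (0 : ℝ) ≤ l)])

end Filtration

end

section

section LieDerivative

variable {n : ℕ}

/-- Skew-symmetric endomorphisms. -/
abbrev Sk (n : ℕ) := ↥(skewAdjoint (Eucl n →L[ℝ] Eucl n))

theorem Sk.inner_left (A : Sk n) (v w : Eucl n) : ⟪A.1 v, w⟫ = -⟪v, A.1 w⟫ := by
  have h : ContinuousLinearMap.adjoint A.1 = -A.1 := skewAdjoint.mem_iff.mp A.2
  rw [← ContinuousLinearMap.adjoint_inner_right, h]
  simp

/-- Scalar restriction, needed for the generic exponential series. -/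
abbrev ratAlgebraEnd (n : ℕ) : NormedAlgebra ℚ (Eucl n →L[ℝ] Eucl n) :=
  NormedAlgebra.restrictScalars ℚ ℝ _

attribute [local instance] ratAlgebraEnd

/-- The one-parameter group generated by a skew endomorphism. -/
def exG (A : Sk n) (t : ℝ) : Gp n :=
  ⟨NormedSpace.exp (t • A.1),
    NormedSpace.exp_mem_unitary_of_mem_skewAdjoint (skewAdjoint.smul_mem t A.2)⟩

theorem exG_add (A : Sk n) (s t : ℝ) : exG A (s + t) = exG A s * exG A t := by
  apply Subtype.ext
  change NormedSpace.exp ((s + t) • A.1) = NormedSpace.exp (s • A.1) * NormedSpace.exp (t • A.1)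
  have h : (s + t) • A.1 = s • A.1 + t • A.1 := add_smul s t A.1
  rw [h]
  refine NormedSpace.exp_add_of_commute (ContinuousLinearMap.ext fun v => ?_)
  change s • A.1 (t • A.1 v) = t • A.1 (s • A.1 v)
  rw [map_smul, map_smul, smul_comm]

theorem exG_zero (A : Sk n) : exG A 0 = 1 := by
  apply Subtype.ext
  change NormedSpace.exp ((0 : ℝ) • A.1) = 1
  have h : (0 : ℝ) • A.1 = 0 := zero_smul ℝ A.1
  rw [h, NormedSpace.exp_zero]

theorem hasDerivAt_exG (A : Sk n) : HasDerivAt (fun t => (exG A t).1) A.1 0 := by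
  have h := hasDerivAt_exp_smul_const (𝕂 := ℝ) A.1 (0 : ℝ)
  have h0 : (0 : ℝ) • A.1 = 0 := zero_smul ℝ A.1
  rw [h0, NormedSpace.exp_zero, one_mul] at h
  exact h

theorem hasDerivAt_exG_mul (A : Sk n) (k : Gp n) :
    HasDerivAt (fun t => (exG A t * k).1) (A.1 * k.1) 0 :=
  (hasDerivAt_exG A).mul_const k.1

/-- `y'` is the derivative of `y` along the right-invariant field generated by `A`. -/
def HasLD (A : Sk n) (y y' : C(Gp n, ℝ)) : Prop :=
  ∀ k, HasDerivAt (fun t => y (exG A t * k)) (y' k) 0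

theorem HasLD.unique {A : Sk n} {y y' y'' : C(Gp n, ℝ)} (h : HasLD A y y') (h' : HasLD A y y'') :
    y' = y'' := ContinuousMap.ext fun k => (h k).unique (h' k)

theorem HasLD.add {A : Sk n} {y y' z z' : C(Gp n, ℝ)} (h : HasLD A y y') (h' : HasLD A z z') :
    HasLD A (y + z) (y' + z') := fun k => (h k).add (h' k)

theorem HasLD.smul {A : Sk n} (c : ℝ) {y y' : C(Gp n, ℝ)} (h : HasLD A y y') :
    HasLD A (c • y) (c • y') := fun k => (h k).const_mul c

theorem HasLD.mul {A : Sk n} {y y' z z' : C(Gp n, ℝ)} (h : HasLD A y y') (h' : HasLD A z z') :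
    HasLD A (y * z) (y' * z + y * z') := fun k => by
  have := (h k).mul (h' k)
  rw [exG_zero, one_mul] at this
  exact this

theorem hasLD_const (A : Sk n) (c : ℝ) : HasLD A (c • 1) 0 := fun k => by
  simpa using hasDerivAt_const (0 : ℝ) c

theorem hasLD_cf (A : Sk n) (v w : Eucl n) : HasLD A (cf v w) (-cf (A.1 v) w) := fun k => by
  have h1 : HasDerivAt (fun t => (exG A t * k).1 w) ((A.1 * k.1) w) 0 :=
    ((ContinuousLinearMap.apply ℝ (Eucl n) w).hasFDerivAt).comp_hasDerivAt (0 : ℝ)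
      (hasDerivAt_exG_mul A k)
  have h2 : HasDerivAt (fun t => ⟪v, (exG A t * k).1 w⟫) ⟪v, (A.1 * k.1) w⟫ 0 := by
    simpa using (hasDerivAt_const (0 : ℝ) v).inner ℝ h1
  refine h2.congr_deriv ?_
  symm
  change -⟪A.1 v, k.1 w⟫ = ⟪v, A.1 (k.1 w)⟫
  rw [A.inner_left, neg_neg]

theorem HasLD.hasDerivAt {A : Sk n} {y y' : C(Gp n, ℝ)} (h : HasLD A y y') (k : Gp n) (t : ℝ) :
    HasDerivAt (fun t => y (exG A t * k)) (y' (exG A t * k)) t := by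
  have h1 := h (exG A t * k)
  have h2 : HasDerivAt (fun s : ℝ => s - t) 1 t := (hasDerivAt_id t).sub_const t
  rw [← sub_self t] at h1
  have h3 := HasDerivAt.scomp (h := fun s : ℝ => s - t) t h1 h2
  rw [one_smul] at h3
  refine h3.congr_of_eventuallyEq (Eventually.of_forall fun s => ?_)
  simp only [Function.comp]
  rw [← mul_assoc, ← exG_add, sub_add_cancel]

theorem HasLD.integral_eq_zero {A : Sk n} {y y' : C(Gp n, ℝ)} (h : HasLD A y y') :
    ∫ k, y' k ∂muG n = 0 := by
  have h1 := hasDerivAt_integral_of_dominated_loc_of_deriv_le (μ := muG n)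
    (F := fun t k => y (exG A t * k)) (F' := fun t k => y' (exG A t * k)) (x₀ := (0 : ℝ))
    (s := Set.univ) (bound := fun _ => ‖y'‖) univ_mem
    (Eventually.of_forall fun t => (Lt (exG A t) y).continuous.aestronglyMeasurable)
    (Gp.integrable (Lt (exG A 0) y)) (Lt (exG A 0) y').continuous.aestronglyMeasurable
    (Eventually.of_forall fun k t _ => y'.norm_coe_le_norm _) (integrable_const _)
    (Eventually.of_forall fun k t _ => h.hasDerivAt k t)
  have h2 : ∀ t, ∫ k, y (exG A t * k) ∂muG n = ∫ k, y k ∂muG n := fun t =>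
    integral_mul_left_eq_self (fun k => y k) (exG A t)
  have h3 := h1.2
  simp only [h2, exG_zero, one_mul] at h3
  exact h3.unique (hasDerivAt_const _ _)

theorem HasLD.ip_eq {A : Sk n} {y y' z z' : C(Gp n, ℝ)} (h : HasLD A y y') (h' : HasLD A z z') :
    ip y' z = -ip y z' := by
  have h1 := (h.mul h').integral_eq_zero
  have h2 : ip y' z + ip y z' = 0 := by
    rw [← h1]
    exact (integral_add (Gp.integrable (y' * z)) (Gp.integrable (y * z'))).symm
  linarith

/-! ### Smooth functions on the group -/

/-- Restrictions to `G` of functions smooth near `G`. -/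
def IsSm (y : C(Gp n, ℝ)) : Prop :=
  ∃ F : (Eucl n →L[ℝ] Eucl n) → ℝ, (∀ k : Gp n, ContDiffAt ℝ (⊤ : ℕ∞) F k.1) ∧ ∀ k, y k = F k.1

theorem IsSm.add {y z : C(Gp n, ℝ)} : IsSm y → IsSm z → IsSm (y + z) := by
  rintro ⟨F, hF, h⟩ ⟨F', hF', h'⟩
  exact ⟨fun k => F k + F' k, fun k => (hF k).add (hF' k), fun k => by simp [h, h']⟩

theorem IsSm.mul {y z : C(Gp n, ℝ)} : IsSm y → IsSm z → IsSm (y * z) := by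
  rintro ⟨F, hF, h⟩ ⟨F', hF', h'⟩
  exact ⟨fun k => F k * F' k, fun k => (hF k).mul (hF' k), fun k => by simp [h, h']⟩

theorem IsSm.smul (c : ℝ) {y : C(Gp n, ℝ)} : IsSm y → IsSm (c • y) := by
  rintro ⟨F, hF, h⟩
  exact ⟨fun k => c * F k, fun k => contDiffAt_const.mul (hF k), fun k => by simp [h]⟩

theorem isSm_one : IsSm (1 : C(Gp n, ℝ)) := ⟨fun _ => 1, fun _ => contDiffAt_const, fun _ => rfl⟩

theorem isSm_cf (v w : Eucl n) : IsSm (cf v w) :=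
  ⟨fun k => ⟪v, k w⟫, fun _ => contDiffAt_const.inner ℝ
    (ContinuousLinearMap.apply ℝ (Eucl n) w).contDiff.contDiffAt, fun _ => rfl⟩

theorem isSm_of_mem {l : ℕ} {y : C(Gp n, ℝ)} (hy : y ∈ Vp n l) : IsSm y :=
  Vp_induction (P := fun _ y => IsSm y) isSm_one (fun _ _ _ h h' => h.add h')
    (fun _ c _ h => h.smul c) (fun _ _ h => h) (fun _ _ v w _ h => h.mul (isSm_cf v w)) hy

theorem IsSm.exists_hasLD {y : C(Gp n, ℝ)} (h : IsSm y) (A : Sk n) :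
    ∃ y', HasLD A y y' ∧ IsSm y' := by
  obtain ⟨F, hF, h⟩ := h
  have h1 : ∀ k : Gp n, ContDiffAt ℝ (⊤ : ℕ∞) (fun k => fderiv ℝ F k (A.1 * k)) k.1 := fun k => by
    refine ContDiffAt.clm_apply ?_ (contDiffAt_const.mul contDiffAt_id)
    exact (hF k).fderiv_right (by simp)
  refine ⟨⟨fun k => fderiv ℝ F k.1 (A.1 * k.1), ?_⟩, fun k => ?_, _, h1, fun k => rfl⟩
  · exact continuous_iff_continuousAt.mpr fun k =>
      (h1 k).continuousAt.comp (f := fun k : Gp n => k.1) continuous_subtype_val.continuousAt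
  · simp only [h]
    have h2 : HasFDerivAt F (fderiv ℝ F k.1) (exG A 0 * k).1 := by
      rw [exG_zero, one_mul]
      exact ((hF k).differentiableAt (by simp)).hasFDerivAt
    exact h2.comp_hasDerivAt 0 (hasDerivAt_exG_mul A k)

theorem exists_Ld (A : Sk n) : ∃ T : C(Gp n, ℝ) →ₗ[ℝ] C(Gp n, ℝ), ∀ y, IsSm y → HasLD A y (T y) := by
  let S : Submodule ℝ C(Gp n, ℝ) :=
    { carrier := {y | IsSm y}
      add_mem' := fun h h' => h.add h'
      zero_mem' := by simpa using isSm_one.smul 0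
      smul_mem' := fun c _ h => h.smul c }
  have hS : ∀ y : S, ∃ y', HasLD A y.1 y' := fun y => (y.2.exists_hasLD A).imp fun _ h => h.1
  choose f hf using hS
  let T : S →ₗ[ℝ] C(Gp n, ℝ) :=
    { toFun := f
      map_add' := fun y z => (hf (y + z)).unique ((hf y).add (hf z))
      map_smul' := fun c y => (hf (c • y)).unique ((hf y).smul c) }
  obtain ⟨T', hT'⟩ := LinearMap.exists_extend T
  refine ⟨T', fun y hy => ?_⟩
  have : T' y = f ⟨y, hy⟩ := LinearMap.congr_fun hT' ⟨y, hy⟩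
  rw [this]
  exact hf ⟨y, hy⟩

/-- The derivative along the right-invariant field of `A` (a linear extension from the smooth
functions). -/
def Ld (A : Sk n) : C(Gp n, ℝ) →ₗ[ℝ] C(Gp n, ℝ) := (exists_Ld A).choose

theorem hasLD_Ld (A : Sk n) {y : C(Gp n, ℝ)} (hy : IsSm y) : HasLD A y (Ld A y) :=
  (exists_Ld A).choose_spec y hy

theorem IsSm.Ld {y : C(Gp n, ℝ)} (hy : IsSm y) (A : Sk n) : IsSm (Ld A y) := by
  obtain ⟨y', h1, h2⟩ := hy.exists_hasLD A
  rwa [(hasLD_Ld A hy).unique h1]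

theorem Ld_mul (A : Sk n) {y z : C(Gp n, ℝ)} (hy : IsSm y) (hz : IsSm z) :
    Ld A (y * z) = Ld A y * z + y * Ld A z :=
  (hasLD_Ld A (hy.mul hz)).unique ((hasLD_Ld A hy).mul (hasLD_Ld A hz))

theorem Ld_one (A : Sk n) : Ld A (1 : C(Gp n, ℝ)) = 0 := by
  have := hasLD_const A 1
  rw [one_smul] at this
  exact (hasLD_Ld A isSm_one).unique this

theorem Ld_cf (A : Sk n) (v w : Eucl n) : Ld A (cf v w) = -cf (A.1 v) w :=
  (hasLD_Ld A (isSm_cf v w)).unique (hasLD_cf A v w)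

theorem ip_Ld (A : Sk n) {y z : C(Gp n, ℝ)} (hy : IsSm y) (hz : IsSm z) :
    ip (Ld A y) z = -ip y (Ld A z) := (hasLD_Ld A hy).ip_eq (hasLD_Ld A hz)

theorem Ld_mem (A : Sk n) {l : ℕ} {y : C(Gp n, ℝ)} (hy : y ∈ Vp n l) : Ld A y ∈ Vp n l := by
  refine Vp_induction (P := fun l y => Ld A y ∈ Vp n l) ?_ ?_ ?_ ?_ ?_ hy
  · rw [Ld_one]; exact zero_mem _
  · intro l y z h h'; rw [map_add]; exact add_mem h h'
  · intro l c y h; rw [map_smul]; exact Submodule.smul_mem _ _ h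
  · intro l y h; exact Vp_mono l.le_succ h
  · intro l y v w hy h
    rw [Ld_mul A (isSm_of_mem hy) (isSm_cf v w), Ld_cf]
    exact add_mem (Vp_mul_mem h (cf_mem_Vp _ _)) (Vp_mul_mem hy (neg_mem (cf_mem_Vp _ _)))

theorem Ld_Rt (A : Sk n) (g : Gp n) {l : ℕ} {y : C(Gp n, ℝ)} (hy : y ∈ Vp n l) :
    Ld A (Rt g y) = Rt g (Ld A y) := by
  refine (hasLD_Ld A (isSm_of_mem (Rt_mem g hy))).unique fun k => ?_
  simpa [mul_assoc] using hasLD_Ld A (isSm_of_mem hy) (k * g)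

theorem eq_zero_of_leibniz (T : C(Gp n, ℝ) →ₗ[ℝ] C(Gp n, ℝ)) (h1 : T 1 = 0)
    (h : ∀ v w l, ∀ y ∈ Vp n l, T (y * cf v w) = T y * cf v w + y * T (cf v w))
    (h0 : ∀ v w, T (cf v w) = 0) {l : ℕ} {y : C(Gp n, ℝ)} (hy : y ∈ Vp n l) : T y = 0 := by
  refine Vp_induction (P := fun _ y => T y = 0) h1 ?_ ?_ (fun _ _ h => h) ?_ hy
  · intro _ y z hy hz; rw [map_add, hy, hz, add_zero]
  · intro _ c y hy; rw [map_smul, hy, smul_zero]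
  · intro l y v w hy hy'
    rw [h v w l y hy, hy', h0, zero_mul, mul_zero, add_zero]

end LieDerivative

end

section

section Bernstein

variable {n : ℕ}

theorem le_mul_of_logConvex {a : ℕ → ℝ} (h0 : ∀ m, 0 ≤ a m)
    (h : ∀ m, a (m + 1) ^ 2 ≤ a m * a (m + 2)) {D σ : ℝ} (hσ : 0 ≤ σ)
    (hD : ∀ m, a m ≤ D * σ ^ m) : a 1 ≤ σ * a 0 := by
  by_contra! hlt
  have ha0 : 0 < a 0 := by
    rcases (h0 0).eq_or_lt with h' | h'
    · have := h 0
      rw [← h', zero_mul] at this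
      have h1 : a 1 = 0 := by simpa using le_antisymm this (sq_nonneg _)
      rw [← h', h1] at hlt; simp at hlt
    · exact h'
  set r := a 1 / a 0 with hr
  have hra : a 1 = r * a 0 := by rw [hr]; field_simp
  have hσr : σ < r := by rw [hra] at hlt; exact lt_of_mul_lt_mul_right hlt ha0.le
  have hrpos : 0 < r := hσ.trans_lt hσr
  have key : ∀ m, 0 < a m ∧ r * a m ≤ a (m + 1) := fun m => by
    induction m with
    | zero => exact ⟨ha0, hra.ge⟩
    | succ m ih =>
      have h1 : 0 < a (m + 1) := (mul_pos hrpos ih.1).trans_le ih.2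
      refine ⟨h1, ?_⟩
      have h2 := h m
      have h3 : a m * (r * a (m + 1)) ≤ a m * a (m + 2) := by
        refine le_trans ?_ h2
        nlinarith [ih.2]
      exact le_of_mul_le_mul_left h3 ih.1
  have hlow : ∀ m, a 0 * r ^ m ≤ a m := fun m => by
    induction m with
    | zero => simp
    | succ m ih =>
      rw [pow_succ]
      nlinarith [(key m).2]
  have hD0 : a 0 ≤ D := by simpa using hD 0
  have h1 : ∀ m, (a 0 / D) * r ^ m ≤ σ ^ m := fun m => by
    have := (hlow m).trans (hD m)
    rw [div_mul_eq_mul_div, div_le_iff₀ (ha0.trans_le hD0)]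
    linarith
  have hq : 0 < a 0 / D := div_pos ha0 (ha0.trans_le hD0)
  obtain ⟨m, hm⟩ := exists_pow_lt_of_lt_one hq ((div_lt_one hrpos).mpr hσr)
  have h2 := h1 m
  rw [div_pow, div_lt_iff₀ (by positivity)] at hm
  linarith

theorem isSm_iterate_Ld {y : C(Gp n, ℝ)} (hy : IsSm y) (A : Sk n) (m : ℕ) :
    IsSm ((Ld A)^[m] y) := by
  induction m with
  | zero => exact hy
  | succ m ih => rw [Function.iterate_succ_apply']; exact ih.Ld A

theorem norm_iterate_Ld_mul_le (A : Sk n) {y z : C(Gp n, ℝ)} (hy : IsSm y) (hz : IsSm z)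
    {D D' ρ σ : ℝ} (hD : 0 ≤ D) (hρ : 0 ≤ ρ) (h : ∀ m, ‖(Ld A)^[m] y‖ ≤ D * ρ ^ m)
    (h' : ∀ m, ‖(Ld A)^[m] z‖ ≤ D' * σ ^ m) (m : ℕ) :
    ‖(Ld A)^[m] (y * z)‖ ≤ D * D' * (ρ + σ) ^ m := by
  suffices H : ∀ m i j, ‖(Ld A)^[m] ((Ld A)^[i] y * (Ld A)^[j] z)‖ ≤
      D * D' * ρ ^ i * σ ^ j * (ρ + σ) ^ m by simpa using H m 0 0
  intro m
  induction m with
  | zero =>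
    intro i j
    simp only [Function.iterate_zero, id, pow_zero, mul_one]
    refine (norm_mul_le _ _).trans ?_
    calc _ ≤ (D * ρ ^ i) * (D' * σ ^ j) :=
          mul_le_mul (h i) (h' j) (norm_nonneg _) (by positivity)
      _ = _ := by ring
  | succ m ih =>
    intro i j
    rw [Function.iterate_succ_apply, Ld_mul A (isSm_iterate_Ld hy A i) (isSm_iterate_Ld hz A j),
      ← Function.iterate_succ_apply' (Ld A) i y, ← Function.iterate_succ_apply' (Ld A) j z,
      iterate_map_add]
    refine (norm_add_le _ _).trans ((add_le_add (ih _ _) (ih _ _)).trans_eq ?_)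
    simp only [Nat.succ_eq_add_one, pow_succ]
    ring

theorem norm_cf_le (v w : Eucl n) : ‖cf v w‖ ≤ ‖v‖ * ‖w‖ := by
  refine (ContinuousMap.norm_le _ (by positivity)).mpr fun k => ?_
  rw [cf_apply, Real.norm_eq_abs, ← Gp.norm_apply k w]
  exact abs_real_inner_le_norm _ _

theorem norm_iterate_Ld_cf_le (A : Sk n) (v w : Eucl n) (m : ℕ) :
    ‖(Ld A)^[m] (cf v w)‖ ≤ ‖v‖ * ‖w‖ * ‖A.1‖ ^ m := by
  induction m generalizing v with
  | zero => simpa using norm_cf_le v w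
  | succ m ih =>
    rw [Function.iterate_succ_apply, Ld_cf, iterate_map_neg, norm_neg]
    refine (ih _).trans ?_
    have := A.1.le_opNorm v
    calc _ ≤ ‖A.1‖ * ‖v‖ * ‖w‖ * ‖A.1‖ ^ m := by gcongr
      _ = _ := by ring

theorem exists_norm_iterate_Ld_le (A : Sk n) {l : ℕ} {y : C(Gp n, ℝ)} (hy : y ∈ Vp n l) :
    ∃ D, 0 ≤ D ∧ ∀ m, ‖(Ld A)^[m] y‖ ≤ D * (l * ‖A.1‖) ^ m := by
  refine Vp_induction (P := fun l y => ∃ D, 0 ≤ D ∧ ∀ m, ‖(Ld A)^[m] y‖ ≤ D * (l * ‖A.1‖) ^ m)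
    ?_ ?_ ?_ ?_ ?_ hy
  · refine ⟨‖(1 : C(Gp n, ℝ))‖, norm_nonneg _, fun m => ?_⟩
    cases m with
    | zero => simp
    | succ m => rw [Function.iterate_succ_apply, Ld_one, iterate_map_zero]; simp
  · rintro l y z ⟨D, hD, h⟩ ⟨D', hD', h'⟩
    refine ⟨D + D', by positivity, fun m => ?_⟩
    rw [iterate_map_add, add_mul]
    exact (norm_add_le _ _).trans (add_le_add (h m) (h' m))
  · rintro l c y ⟨D, hD, h⟩
    refine ⟨|c| * D, by positivity, fun m => ?_⟩
    have : (Ld A)^[m] (c • y) = c • (Ld A)^[m] y := by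
      rw [← Module.End.pow_apply, ← Module.End.pow_apply, map_smul]
    rw [this, norm_smul, mul_assoc, Real.norm_eq_abs]
    exact mul_le_mul_of_nonneg_left (h m) (abs_nonneg _)
  · rintro l y ⟨D, hD, h⟩
    refine ⟨D, hD, fun m => (h m).trans ?_⟩
    gcongr; simp
  · rintro l y v w hy ⟨D, hD, h⟩
    refine ⟨D * (‖v‖ * ‖w‖), by positivity, fun m => ?_⟩
    refine (norm_iterate_Ld_mul_le A (isSm_of_mem hy) (isSm_cf v w) hD (by positivity) h
      (norm_iterate_Ld_cf_le A v w) m).trans_eq ?_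
    push_cast; ring

/-- Bernstein's inequality. -/
theorem n2_Ld_le (A : Sk n) {l : ℕ} {y : C(Gp n, ℝ)} (hy : y ∈ Vp n l) :
    n2 (Ld A y) ≤ l * ‖A.1‖ * n2 y := by
  obtain ⟨D, hD, h⟩ := exists_norm_iterate_Ld_le A hy
  refine le_mul_of_logConvex (a := fun m => n2 ((Ld A)^[m] y)) (fun m => n2_nonneg _) (fun m => ?_)
    (by positivity) (D := D) fun m => (n2_le_norm _).trans (h m)
  have h1 := isSm_iterate_Ld (isSm_of_mem hy) A m
  simp only [Function.iterate_succ_apply' (Ld A)]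
  rw [n2_sq, ip_Ld A h1 (h1.Ld A)]
  exact (neg_le_abs _).trans (abs_ip_le _ _)

end Bernstein

section Casimir

variable {n : ℕ}

/-- The skew endomorphism `x ↦ ⟪w, x⟫ v - ⟪v, x⟫ w`. -/
def wd (v w : Eucl n) : Sk n :=
  ⟨(innerSL ℝ w).smulRight v - (innerSL ℝ v).smulRight w, by
    rw [skewAdjoint.mem_iff, ContinuousLinearMap.star_eq_adjoint]
    refine ContinuousLinearMap.ext fun x => ext_inner_right ℝ fun z => ?_
    rw [ContinuousLinearMap.adjoint_inner_left]
    simp [inner_sub_left, inner_sub_right, inner_smul_left, inner_smul_right, real_inner_comm]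
    ring⟩

theorem wd_apply (v w x : Eucl n) : (wd v w).1 x = ⟪w, x⟫ • v - ⟪v, x⟫ • w := rfl

/-- The derivation along the `(i, j)` rotation. -/
def Lij (i j : Fin n) : C(Gp n, ℝ) →ₗ[ℝ] C(Gp n, ℝ) := Ld (wd (eb i) (eb j))

theorem Lij_cf (i j : Fin n) (v w : Eucl n) :
    Lij i j (cf v w) = ⟪eb i, v⟫ • cf (eb j) w - ⟪eb j, v⟫ • cf (eb i) w := by
  rw [Lij, Ld_cf, wd_apply, cf_sub_left, cf_smul_left, cf_smul_left, neg_sub]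

theorem IsSm.Lij {y : C(Gp n, ℝ)} (hy : IsSm y) (i j : Fin n) : IsSm (Lij i j y) := hy.Ld _

theorem Lij_mem (i j : Fin n) {l : ℕ} {y : C(Gp n, ℝ)} (hy : y ∈ Vp n l) : Lij i j y ∈ Vp n l :=
  Ld_mem _ hy

theorem Lij_mul (i j : Fin n) {y z : C(Gp n, ℝ)} (hy : IsSm y) (hz : IsSm z) :
    Lij i j (y * z) = Lij i j y * z + y * Lij i j z := Ld_mul _ hy hz

theorem ip_Lij (i j : Fin n) {y z : C(Gp n, ℝ)} (hy : IsSm y) (hz : IsSm z) :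
    ip (Lij i j y) z = -ip y (Lij i j z) := ip_Ld _ hy hz

theorem sum_inner_mul_inner_eb (v w : Eucl n) : ∑ m, ⟪eb m, v⟫ * ⟪eb m, w⟫ = ⟪v, w⟫ := by
  conv_rhs => rw [← sum_inner_eb v]
  rw [sum_inner]
  simp only [inner_smul_left, conj_trivial]

theorem Lij_Ld_sub (B : Sk n) (i j : Fin n) {l : ℕ} {y : C(Gp n, ℝ)} (hy : y ∈ Vp n l) :
    Lij i j (Ld B y) - Ld B (Lij i j y) =
      ∑ m, (⟪eb m, B.1 (eb i)⟫ • Lij m j y + ⟪eb m, B.1 (eb j)⟫ • Lij i m y) := by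
  let T : C(Gp n, ℝ) →ₗ[ℝ] C(Gp n, ℝ) := Lij i j ∘ₗ Ld B - Ld B ∘ₗ Lij i j -
      ∑ m, (⟪eb m, B.1 (eb i)⟫ • Lij m j + ⟪eb m, B.1 (eb j)⟫ • Lij i m)
  have hT : ∀ y, T y = Lij i j (Ld B y) - Ld B (Lij i j y) -
      ∑ m, (⟪eb m, B.1 (eb i)⟫ • Lij m j y + ⟪eb m, B.1 (eb j)⟫ • Lij i m y) := fun y => by
    simp [T, LinearMap.sum_apply]
  rw [← sub_eq_zero, ← hT]
  have hone : ∀ i j : Fin n, Lij i j (1 : C(Gp n, ℝ)) = 0 := fun i j => Ld_one _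
  refine eq_zero_of_leibniz T ?_ (fun v w l y hy => ?_) (fun v w => ?_) hy
  · simp [hT, Ld_one, hone]
  · have h1 := isSm_of_mem hy
    have h2 := isSm_cf v w
    simp only [hT]
    rw [Ld_mul B h1 h2, Lij_mul i j h1 h2, map_add, map_add, Lij_mul i j (h1.Ld B) h2,
      Lij_mul i j h1 (h2.Ld B), Ld_mul B (h1.Lij i j) h2, Ld_mul B h1 (h2.Lij i j)]
    have h3 : ∀ m, ⟪eb m, B.1 (eb i)⟫ • Lij m j (y * cf v w) +
        ⟪eb m, B.1 (eb j)⟫ • Lij i m (y * cf v w) =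
        (⟪eb m, B.1 (eb i)⟫ • Lij m j y + ⟪eb m, B.1 (eb j)⟫ • Lij i m y) * cf v w +
        y * (⟪eb m, B.1 (eb i)⟫ • Lij m j (cf v w) +
          ⟪eb m, B.1 (eb j)⟫ • Lij i m (cf v w)) := fun m => by
      rw [Lij_mul m j h1 h2, Lij_mul i m h1 h2]
      simp only [smul_add, add_mul, mul_add, smul_mul_assoc, mul_smul_comm]
      abel
    rw [Finset.sum_congr rfl fun m _ => h3 m, Finset.sum_add_distrib, ← Finset.sum_mul,
      ← Finset.mul_sum]
    ring
  · rw [hT]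
    ext k
    simp only [Ld_cf, Lij_cf, map_neg, map_sub, map_smul, ContinuousMap.sub_apply,
      ContinuousMap.sum_apply, ContinuousMap.add_apply, ContinuousMap.smul_apply,
      ContinuousMap.neg_apply, cf_apply, smul_eq_mul, ContinuousMap.zero_apply]
    generalize k.1 w = u
    have h1 : ∀ a : Eucl n, ∑ m, ⟪eb m, B.1 a⟫ * ⟪eb m, v⟫ = -⟪a, B.1 v⟫ := fun a => by
      rw [sum_inner_mul_inner_eb, B.inner_left]
    have h2 : ∀ a : Eucl n, ∑ m, ⟪eb m, B.1 a⟫ * ⟪eb m, u⟫ = ⟪B.1 a, u⟫ := fun a =>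
      sum_inner_mul_inner_eb _ _
    have h3 : ∑ m, (⟪eb m, B.1 (eb i)⟫ * (⟪eb m, v⟫ * ⟪eb j, u⟫ - ⟪eb j, v⟫ * ⟪eb m, u⟫) +
        ⟪eb m, B.1 (eb j)⟫ * (⟪eb i, v⟫ * ⟪eb m, u⟫ - ⟪eb m, v⟫ * ⟪eb i, u⟫)) =
        (∑ m, ⟪eb m, B.1 (eb i)⟫ * ⟪eb m, v⟫) * ⟪eb j, u⟫ -
        (∑ m, ⟪eb m, B.1 (eb i)⟫ * ⟪eb m, u⟫) * ⟪eb j, v⟫ +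
        (∑ m, ⟪eb m, B.1 (eb j)⟫ * ⟪eb m, u⟫) * ⟪eb i, v⟫ -
        (∑ m, ⟪eb m, B.1 (eb j)⟫ * ⟪eb m, v⟫) * ⟪eb i, u⟫ := by
      simp only [Finset.sum_mul, ← Finset.sum_sub_distrib, ← Finset.sum_add_distrib]
      exact Finset.sum_congr rfl fun m _ => by ring
    rw [h3, h1, h1, h2, h2]
    ring

/-- The Casimir operator. -/
def Cas : C(Gp n, ℝ) →ₗ[ℝ] C(Gp n, ℝ) := (1 / 2 : ℝ) • ∑ i, ∑ j, Lij i j ∘ₗ Lij i j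

theorem Cas_apply (y : C(Gp n, ℝ)) : Cas y = (1 / 2 : ℝ) • ∑ i, ∑ j, Lij i j (Lij i j y) := by
  simp [Cas, LinearMap.sum_apply]

theorem Cas_mem {l : ℕ} {y : C(Gp n, ℝ)} (hy : y ∈ Vp n l) : Cas y ∈ Vp n l := by
  rw [Cas_apply]
  exact Submodule.smul_mem _ _ (Submodule.sum_mem _ fun i _ => Submodule.sum_mem _ fun j _ =>
    Lij_mem i j (Lij_mem i j hy))

theorem ip_Cas_left {y z : C(Gp n, ℝ)} (hy : IsSm y) (hz : IsSm z) :
    ip (Cas y) z = -(1 / 2) * ∑ i, ∑ j, ip (Lij i j y) (Lij i j z) := by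
  rw [Cas_apply, ip_smul_left, ip_sum_left]
  simp only [ip_sum_left, ip_Lij _ _ (hy.Lij _ _) hz, Finset.sum_neg_distrib]
  ring

theorem ip_Cas {y z : C(Gp n, ℝ)} (hy : IsSm y) (hz : IsSm z) : ip (Cas y) z = ip y (Cas z) := by
  rw [ip_Cas_left hy hz, ip_comm y, ip_Cas_left hz hy]
  simp only [ip_comm]

theorem Cas_Ld (B : Sk n) {l : ℕ} {y : C(Gp n, ℝ)} (hy : y ∈ Vp n l) :
    Cas (Ld B y) = Ld B (Cas y) := by
  have hc : ∀ i j z, z ∈ Vp n l → Lij i j (Ld B z) = Ld B (Lij i j z) +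
      ∑ m, (⟪eb m, B.1 (eb i)⟫ • Lij m j z + ⟪eb m, B.1 (eb j)⟫ • Lij i m z) := fun i j z hz => by
    rw [← Lij_Ld_sub B i j hz]; abel
  have hs : ∀ m i : Fin n, ⟪eb i, B.1 (eb m)⟫ = -⟪eb m, B.1 (eb i)⟫ := fun m i => by
    rw [← B.inner_left, real_inner_comm]
  rw [Cas_apply, Cas_apply, map_smul]
  congr 1
  simp only [map_sum]
  have hij : ∀ i j, Lij i j (Lij i j (Ld B y)) = Ld B (Lij i j (Lij i j y)) +
      (∑ m, ⟪eb m, B.1 (eb i)⟫ • (Lij m j (Lij i j y) + Lij i j (Lij m j y)) +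
       ∑ m, ⟪eb m, B.1 (eb j)⟫ • (Lij i m (Lij i j y) + Lij i j (Lij i m y))) := fun i j => by
    rw [hc i j y hy, map_add, hc i j _ (Lij_mem i j hy), map_sum]
    simp only [map_add, map_smul, smul_add, Finset.sum_add_distrib]
    abel
  simp only [hij, Finset.sum_add_distrib]
  have h1 : ∀ f : Fin n → Fin n → C(Gp n, ℝ), (∀ m i, f m i = f i m) →
      ∑ i, ∑ m, ⟪eb m, B.1 (eb i)⟫ • f m i = 0 := fun f hf => by
    have : ∑ i, ∑ m, ⟪eb m, B.1 (eb i)⟫ • f m i = -∑ i, ∑ m, ⟪eb m, B.1 (eb i)⟫ • f m i := by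
      conv_lhs => rw [Finset.sum_comm]
      rw [← Finset.sum_neg_distrib]
      refine Finset.sum_congr rfl fun i _ => ?_
      rw [← Finset.sum_neg_distrib]
      refine Finset.sum_congr rfl fun m _ => ?_
      rw [hs, hf i m, neg_smul]
    ext k
    have h' := congrArg (fun F : C(Gp n, ℝ) => F k) this
    simp only [ContinuousMap.neg_apply] at h'
    rw [ContinuousMap.zero_apply]
    linarith
  have h2 : ∑ i, ∑ j, ∑ m, ⟪eb m, B.1 (eb i)⟫ • (Lij m j (Lij i j y) + Lij i j (Lij m j y)) = 0 := by
    rw [Finset.sum_comm]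
    exact Finset.sum_eq_zero fun j _ =>
      h1 (fun m i => Lij m j (Lij i j y) + Lij i j (Lij m j y)) fun m i => add_comm _ _
  have h3 : ∑ i, ∑ j, ∑ m, ⟪eb m, B.1 (eb j)⟫ • (Lij i m (Lij i j y) + Lij i j (Lij i m y)) = 0 :=
    Finset.sum_eq_zero fun i _ =>
      h1 (fun m j => Lij i m (Lij i j y) + Lij i j (Lij i m y)) fun m j => add_comm _ _
  rw [h2, h3, add_zero, add_zero]

theorem sum_n2_Lij_sq {y : C(Gp n, ℝ)} (hy : IsSm y) :
    ∑ i, ∑ j, n2 (Lij i j y) ^ 2 = -2 * ip (Cas y) y := by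
  rw [ip_Cas_left hy hy]
  simp only [n2_sq]
  ring

theorem sum_n2_Lij_Lij_sq {l : ℕ} {y : C(Gp n, ℝ)} (hy : y ∈ Vp n l) :
    ∑ i, ∑ j, ∑ i', ∑ j', n2 (Lij i' j' (Lij i j y)) ^ 2 = 4 * n2 (Cas y) ^ 2 := by
  have h : ∀ i j, ∑ i', ∑ j', n2 (Lij i' j' (Lij i j y)) ^ 2 =
      -2 * ip (Lij i j (Cas y)) (Lij i j y) := fun i j => by
    rw [sum_n2_Lij_sq (isSm_of_mem (Lij_mem i j hy)), Lij, Cas_Ld _ hy]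
  simp only [h]
  have h2 := ip_Cas_left (isSm_of_mem (Cas_mem hy)) (isSm_of_mem hy)
  have h3 : ip (Cas (Cas y)) y = ip (Cas y) (Cas y) :=
    ip_Cas (isSm_of_mem (Cas_mem hy)) (isSm_of_mem hy)
  rw [n2_sq, ← h3, h2]
  simp only [← Finset.mul_sum]
  ring

end Casimir

end

section

section Resolvent

variable {n : ℕ}

theorem le_sum_sum {F : Fin n → Fin n → ℝ} (h : ∀ i j, 0 ≤ F i j) (i j : Fin n) :
    F i j ≤ ∑ i, ∑ j, F i j :=
  (Finset.single_le_sum (fun j _ => h i j) (Finset.mem_univ j)).trans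
    (Finset.single_le_sum (f := fun i => ∑ j, F i j)
      (fun i _ => Finset.sum_nonneg fun j _ => h i j) (Finset.mem_univ i))

theorem sum_sum_nonneg {F : Fin n → Fin n → ℝ} (h : ∀ i j, 0 ≤ F i j) : 0 ≤ ∑ i, ∑ j, F i j :=
  Finset.sum_nonneg fun i _ => Finset.sum_nonneg fun j _ => h i j

/-- The operator `1 - ε Cas` on `Vp n l`. -/
def oneSubCas (n : ℕ) (ε : ℝ) (l : ℕ) : Vp n l →ₗ[ℝ] Vp n l where
  toFun y := ⟨y - ε • Cas (y : C(Gp n, ℝ)),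
    Submodule.sub_mem _ y.2 (Submodule.smul_mem _ _ (Cas_mem y.2))⟩
  map_add' y z := Subtype.ext <| by
    simp only [Submodule.coe_add, map_add, smul_add]; abel
  map_smul' c y := Subtype.ext <| by
    simp only [Submodule.coe_smul, map_smul, RingHom.id_apply, smul_sub, smul_comm ε c]

theorem coe_oneSubCas (ε : ℝ) (l : ℕ) (y : Vp n l) :
    (oneSubCas n ε l y : C(Gp n, ℝ)) = y - ε • Cas (y : C(Gp n, ℝ)) := rfl

theorem n2_oneSubCas_sq (ε : ℝ) {l : ℕ} (y : Vp n l) :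
    n2 (oneSubCas n ε l y : C(Gp n, ℝ)) ^ 2 = n2 (y : C(Gp n, ℝ)) ^ 2 +
      ε * ∑ i, ∑ j, n2 (Lij i j (y : C(Gp n, ℝ))) ^ 2 +
      ε ^ 2 / 4 * ∑ i, ∑ j, ∑ i', ∑ j', n2 (Lij i' j' (Lij i j (y : C(Gp n, ℝ)))) ^ 2 := by
  rw [sum_n2_Lij_sq (isSm_of_mem y.2), sum_n2_Lij_Lij_sq y.2, coe_oneSubCas, n2_sq, n2_sq, n2_sq]
  rw [sub_eq_add_neg]
  simp only [ip_add_left, ip_add_right, ip_neg_left, ip_neg_right, ip_smul_left, ip_smul_right]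
  rw [ip_comm (y : C(Gp n, ℝ)) (Cas _)]
  ring

theorem n2_le_n2_oneSubCas {ε : ℝ} (hε : 0 ≤ ε) {l : ℕ} (y : Vp n l) :
    n2 (y : C(Gp n, ℝ)) ≤ n2 (oneSubCas n ε l y : C(Gp n, ℝ)) := by
  refine le_of_sq_le_sq ?_ (n2_nonneg _)
  rw [n2_oneSubCas_sq]
  have : 0 ≤ ε * ∑ i, ∑ j, n2 (Lij i j (y : C(Gp n, ℝ))) ^ 2 :=
    mul_nonneg hε (sum_sum_nonneg fun _ _ => sq_nonneg _)
  have : 0 ≤ ε ^ 2 / 4 * ∑ i, ∑ j, ∑ i', ∑ j', n2 (Lij i' j' (Lij i j (y : C(Gp n, ℝ)))) ^ 2 :=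
    mul_nonneg (by positivity) (sum_sum_nonneg fun _ _ => sum_sum_nonneg fun _ _ => sq_nonneg _)
  linarith

theorem sqrt_mul_n2_Lij_le {ε : ℝ} (hε : 0 ≤ ε) {l : ℕ} (y : Vp n l) (i j : Fin n) :
    √ε * n2 (Lij i j (y : C(Gp n, ℝ))) ≤ n2 (oneSubCas n ε l y : C(Gp n, ℝ)) := by
  refine le_of_sq_le_sq ?_ (n2_nonneg _)
  rw [n2_oneSubCas_sq, mul_pow, Real.sq_sqrt hε]
  have h1 := le_sum_sum (F := fun i j => n2 (Lij i j (y : C(Gp n, ℝ))) ^ 2)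
    (fun _ _ => sq_nonneg _) i j
  have h3 : 0 ≤ ∑ i, ∑ j, ∑ i', ∑ j', n2 (Lij i' j' (Lij i j (y : C(Gp n, ℝ)))) ^ 2 :=
    sum_sum_nonneg fun _ _ => sum_sum_nonneg fun _ _ => sq_nonneg _
  have h2 := mul_le_mul_of_nonneg_left h1 hε
  have h4 := mul_nonneg (by positivity : 0 ≤ ε ^ 2 / 4) h3
  have h5 := sq_nonneg (n2 (y : C(Gp n, ℝ)))
  linarith

theorem mul_n2_Lij_Lij_le {ε : ℝ} (hε : 0 ≤ ε) {l : ℕ} (y : Vp n l) (i j i' j' : Fin n) :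
    ε * n2 (Lij i' j' (Lij i j (y : C(Gp n, ℝ)))) ≤
      2 * n2 (oneSubCas n ε l y : C(Gp n, ℝ)) := by
  refine le_of_sq_le_sq ?_ (by have := n2_nonneg (oneSubCas n ε l y : C(Gp n, ℝ)); positivity)
  rw [mul_pow, mul_pow, n2_oneSubCas_sq]
  have h1 := (le_sum_sum (F := fun i' j' => n2 (Lij i' j' (Lij i j (y : C(Gp n, ℝ)))) ^ 2)
    (fun _ _ => sq_nonneg _) i' j').trans
    (le_sum_sum (F := fun i j => ∑ i', ∑ j', n2 (Lij i' j' (Lij i j (y : C(Gp n, ℝ)))) ^ 2)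
    (fun _ _ => sum_sum_nonneg fun _ _ => sq_nonneg _) i j)
  have h2 := mul_le_mul_of_nonneg_left h1 (sq_nonneg ε)
  have : 0 ≤ ε * ∑ i, ∑ j, n2 (Lij i j (y : C(Gp n, ℝ))) ^ 2 :=
    mul_nonneg hε (sum_sum_nonneg fun _ _ => sq_nonneg _)
  nlinarith [sq_nonneg (n2 (y : C(Gp n, ℝ)))]

theorem oneSubCas_injective {ε : ℝ} (hε : 0 ≤ ε) (l : ℕ) :
    Function.Injective (oneSubCas n ε l) := by
  rw [injective_iff_map_eq_zero]
  intro y hy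
  have h := n2_le_n2_oneSubCas hε y
  rw [hy, Submodule.coe_zero, n2_zero] at h
  exact Subtype.ext (n2_eq_zero (le_antisymm h (n2_nonneg _)))

/-- The resolvent `(1 - ε Cas)⁻¹` on `Vp n l`. -/
def resol (n : ℕ) {ε : ℝ} (hε : 0 ≤ ε) (l : ℕ) : Vp n l →ₗ[ℝ] Vp n l :=
  (LinearEquiv.ofInjectiveEndo _ (oneSubCas_injective hε l)).symm.toLinearMap

theorem oneSubCas_resol {ε : ℝ} (hε : 0 ≤ ε) {l : ℕ} (y : Vp n l) :
    oneSubCas n ε l (resol n hε l y) = y :=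
  (LinearEquiv.ofInjectiveEndo _ (oneSubCas_injective hε l)).apply_symm_apply y

theorem resol_sub_Cas {ε : ℝ} (hε : 0 ≤ ε) {l : ℕ} (y : Vp n l) :
    (resol n hε l y : C(Gp n, ℝ)) - ε • Cas (resol n hε l y : C(Gp n, ℝ)) = y := by
  rw [← coe_oneSubCas, oneSubCas_resol]

theorem n2_resol_le {ε : ℝ} (hε : 0 ≤ ε) {l : ℕ} (y : Vp n l) :
    n2 (resol n hε l y : C(Gp n, ℝ)) ≤ n2 (y : C(Gp n, ℝ)) := by
  simpa [oneSubCas_resol] using n2_le_n2_oneSubCas hε (resol n hε l y)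

theorem sqrt_mul_n2_Lij_resol_le {ε : ℝ} (hε : 0 ≤ ε) {l : ℕ} (y : Vp n l) (i j : Fin n) :
    √ε * n2 (Lij i j (resol n hε l y : C(Gp n, ℝ))) ≤ n2 (y : C(Gp n, ℝ)) := by
  simpa [oneSubCas_resol] using sqrt_mul_n2_Lij_le hε (resol n hε l y) i j

theorem mul_n2_Lij_Lij_resol_le {ε : ℝ} (hε : 0 ≤ ε) {l : ℕ} (y : Vp n l) (i j i' j' : Fin n) :
    ε * n2 (Lij i' j' (Lij i j (resol n hε l y : C(Gp n, ℝ)))) ≤ 2 * n2 (y : C(Gp n, ℝ)) := by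
  simpa [oneSubCas_resol] using mul_n2_Lij_Lij_le hε (resol n hε l y) i j i' j'

theorem Lij_Rt (g : Gp n) (i j : Fin n) {l : ℕ} {y : C(Gp n, ℝ)}
    (hy : y ∈ Vp n l) : Lij i j (Rt g y) = Rt g (Lij i j y) := Ld_Rt _ _ hy

theorem Cas_Rt (g : Gp n) {l : ℕ} {y : C(Gp n, ℝ)} (hy : y ∈ Vp n l) :
    Cas (Rt g y) = Rt g (Cas y) := by
  rw [Cas_apply, Cas_apply, map_smul]
  simp only [map_sum]
  congr 1
  refine Finset.sum_congr rfl fun i _ => Finset.sum_congr rfl fun j _ => ?_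
  rw [Lij_Rt g i j hy, Lij_Rt g i j (Lij_mem i j hy)]

theorem resol_Rt {ε : ℝ} (hε : 0 ≤ ε) {l : ℕ} (g : Gp n) (y : Vp n l) :
    (resol n hε l ⟨Rt g y, Rt_mem g y.2⟩ : C(Gp n, ℝ)) = Rt g (resol n hε l y) := by
  have : resol n hε l ⟨Rt g y, Rt_mem g y.2⟩ =
      ⟨Rt g (resol n hε l y), Rt_mem g (resol n hε l y).2⟩ := by
    apply oneSubCas_injective hε l
    rw [oneSubCas_resol]
    apply Subtype.ext
    rw [coe_oneSubCas]
    simp only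
    rw [Cas_Rt g (resol n hε l y).2, ← map_smul, ← map_sub, resol_sub_Cas]
  rw [this]

end Resolvent

section Path

variable {n : ℕ}

/-- `cf v w` as a continuous linear function of `w`. -/
def cfL (v : Eucl n) : Eucl n →L[ℝ] C(Gp n, ℝ) :=
  LinearMap.mkContinuous
    { toFun := fun w => cf v w
      map_add' := fun a b => by ext k; simp [cf_apply, inner_add_right]
      map_smul' := fun c a => by ext k; simp [cf_apply, inner_smul_right] } ‖v‖
    fun w => norm_cf_le v w

/-- The matrix coefficient `k ↦ ⟪eᵢ, k B k⁻¹ eⱼ⟫`. -/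
def adc (B : Sk n) (i j : Fin n) : C(Gp n, ℝ) :=
  ⟨fun k => ⟪(k⁻¹).1 (eb i), B.1 ((k⁻¹).1 (eb j))⟫, by fun_prop⟩

theorem adc_apply (B : Sk n) (i j : Fin n) (k : Gp n) :
    adc B i j k = ⟪(k⁻¹).1 (eb i), B.1 ((k⁻¹).1 (eb j))⟫ := rfl

theorem norm_eb_le (i : Fin n) : ‖(eb i : Eucl n)‖ ≤ 1 := by simp [eb]

theorem norm_adc_le (B : Sk n) (i j : Fin n) : ‖adc B i j‖ ≤ ‖B.1‖ := by
  refine (ContinuousMap.norm_le _ (norm_nonneg _)).mpr fun k => ?_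
  rw [adc_apply]
  refine (abs_real_inner_le_norm _ _).trans ?_
  have h1 := B.1.le_opNorm ((k⁻¹).1 (eb j))
  rw [Gp.norm_apply] at h1 ⊢
  have h2 := norm_eb_le i
  have h3 := norm_eb_le j
  have h4 : ‖B.1‖ * ‖eb j‖ ≤ ‖B.1‖ := mul_le_of_le_one_right (norm_nonneg _) h3
  calc _ ≤ 1 * ‖B.1‖ := by gcongr; exact h1.trans h4
    _ = _ := one_mul _

/-- The derivative of right translation in the direction `B g`. -/
def Dr (B : Sk n) (g : Gp n) (y : C(Gp n, ℝ)) : C(Gp n, ℝ) :=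
  (1 / 2 : ℝ) • ∑ i, ∑ j, adc B i j * Rt g (Lij i j y)

theorem Dr_cf (B : Sk n) (g : Gp n) (v w : Eucl n) : Dr B g (cf v w) = cf v (B.1 (g.1 w)) := by
  ext k
  simp only [Dr, Lij_cf, map_sub, map_smul, Rt_cf, ContinuousMap.smul_apply,
    ContinuousMap.sum_apply, ContinuousMap.mul_apply, ContinuousMap.sub_apply, cf_apply,
    smul_eq_mul, adc_apply]
  generalize g.1 w = x
  have h : ∀ a b : Eucl n, ∑ i, ∑ j, ⟪(k⁻¹).1 (eb i), B.1 ((k⁻¹).1 (eb j))⟫ *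
      (⟪eb i, k.1 a⟫ * ⟪eb j, k.1 b⟫) = ⟪a, B.1 b⟫ := fun a b => by
    have h1 : ∀ a : Eucl n, a = ∑ i, ⟪eb i, k.1 a⟫ • (k⁻¹).1 (eb i) := fun a => by
      conv_lhs => rw [← Gp.inv_apply_apply k a, ← sum_inner_eb (k.1 a)]
      simp
    conv_rhs => rw [h1 a, h1 b]
    simp only [sum_inner, map_sum, inner_sum, map_smul, inner_smul_left, inner_smul_right,
      conj_trivial, Finset.mul_sum]
    rw [Finset.sum_comm]
    exact Finset.sum_congr rfl fun i _ => Finset.sum_congr rfl fun j _ => by ring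
  have hv : v = k.1 ((k⁻¹).1 v) := (Gp.apply_inv_apply k v).symm
  have e1 := h ((k⁻¹).1 v) x
  have e2 := h x ((k⁻¹).1 v)
  rw [← hv] at e1 e2
  have e3 : ⟪v, k.1 (B.1 x)⟫ = ⟪(k⁻¹).1 v, B.1 x⟫ := by
    conv_lhs => rw [hv, Gp.inner_apply]
  have e4 : ⟪x, B.1 ((k⁻¹).1 v)⟫ = -⟪(k⁻¹).1 v, B.1 x⟫ := by
    rw [← B.inner_left, real_inner_comm]
  rw [e3]
  simp only [mul_sub, Finset.sum_sub_distrib]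
  rw [e1]
  have e5 : ∑ i, ∑ j, ⟪(k⁻¹).1 (eb i), B.1 ((k⁻¹).1 (eb j))⟫ * (⟪eb j, v⟫ * ⟪eb i, k.1 x⟫) =
      ⟪x, B.1 ((k⁻¹).1 v)⟫ := by
    rw [← e2]
    exact Finset.sum_congr rfl fun i _ => Finset.sum_congr rfl fun j _ => by ring
  rw [e5, e4]
  ring

theorem Dr_mul (B : Sk n) (g : Gp n) {y z : C(Gp n, ℝ)} (hy : IsSm y) (hz : IsSm z) :
    Dr B g (y * z) = Dr B g y * Rt g z + Rt g y * Dr B g z := by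
  simp only [Dr, Lij_mul _ _ hy hz, map_add, map_mul, mul_add, Finset.sum_add_distrib, smul_add,
    smul_mul_assoc, mul_smul_comm, Finset.sum_mul, Finset.mul_sum]
  congr 2
  · exact Finset.sum_congr rfl fun i _ => Finset.sum_congr rfl fun j _ => by ring
  · exact Finset.sum_congr rfl fun i _ => Finset.sum_congr rfl fun j _ => by ring

theorem hasDerivAt_Rt {γ : ℝ → Gp n} {B : Sk n} {t : ℝ}
    (h : HasDerivAt (fun s => (γ s).1) (B.1 * (γ t).1) t) {l : ℕ} {y : C(Gp n, ℝ)}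
    (hy : y ∈ Vp n l) : HasDerivAt (fun s => Rt (γ s) y) (Dr B (γ t) y) t := by
  refine Vp_induction (P := fun l y => HasDerivAt (fun s => Rt (γ s) y) (Dr B (γ t) y) t)
    ?_ ?_ ?_ ?_ ?_ hy
  · have : Dr B (γ t) (1 : C(Gp n, ℝ)) = 0 := by
      simp [Dr, Lij, Ld_one]
    rw [this]
    simpa using hasDerivAt_const t (1 : C(Gp n, ℝ))
  · intro l y z h1 h2
    simp only [map_add]
    have : Dr B (γ t) (y + z) = Dr B (γ t) y + Dr B (γ t) z := by
      simp [Dr, mul_add, Finset.sum_add_distrib]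
    rw [this]
    exact h1.add h2
  · intro l c y h1
    simp only [map_smul]
    have : Dr B (γ t) (c • y) = c • Dr B (γ t) y := by
      simp only [Dr, map_smul, mul_smul_comm, ← Finset.smul_sum]
      rw [smul_comm]
    rw [this]
    exact h1.const_smul c
  · exact fun _ _ h => h
  · intro l y v w hy h1
    rw [Dr_mul _ _ (isSm_of_mem hy) (isSm_cf v w), Dr_cf, Rt_cf]
    have h2 : HasDerivAt (fun s => Rt (γ s) (cf v w)) (cf v (B.1 ((γ t).1 w))) t := by
      simp only [Rt_cf]
      exact (cfL v).hasFDerivAt.comp_hasDerivAt t (h.clm_apply (hasDerivAt_const t w) |>.congr_deriv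
        (by simp))
    simp only [map_mul]
    rw [← Rt_cf]
    exact h1.mul h2

theorem n2_sum_le {ι : Type*} (s : Finset ι) (f : ι → C(Gp n, ℝ)) :
    n2 (∑ i ∈ s, f i) ≤ ∑ i ∈ s, n2 (f i) := by
  classical
  induction s using Finset.induction_on with
  | empty => simp [n2_zero]
  | insert a s ha ih =>
    rw [Finset.sum_insert ha, Finset.sum_insert ha]
    exact (n2_add_le _ _).trans (by linarith)

theorem n2_Dr_le (B : Sk n) (g : Gp n) (y : C(Gp n, ℝ)) :
    n2 (Dr B g y) ≤ ‖B.1‖ * ∑ i, ∑ j, n2 (Lij i j y) := by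
  rw [Dr, n2_smul, Finset.mul_sum]
  have h0 : ∀ i j, n2 (adc B i j * Rt g (Lij i j y)) ≤ ‖B.1‖ * n2 (Lij i j y) := fun i j => by
    refine (n2_mul_le _ _).trans ?_
    rw [n2_Rt]
    exact mul_le_mul_of_nonneg_right (norm_adc_le B i j) (n2_nonneg _)
  have h1 : n2 (∑ i, ∑ j, adc B i j * Rt g (Lij i j y)) ≤
      ∑ i, ‖B.1‖ * ∑ j, n2 (Lij i j y) := by
    refine (n2_sum_le _ _).trans (Finset.sum_le_sum fun i _ => (n2_sum_le _ _).trans ?_)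
    rw [Finset.mul_sum]
    exact Finset.sum_le_sum fun j _ => h0 i j
  have h2 := n2_nonneg (∑ i, ∑ j, adc B i j * Rt g (Lij i j y))
  rw [abs_of_pos (by norm_num : (0 : ℝ) < 1 / 2)]
  linarith

theorem n2_Rt_sub_le {γ : ℝ → Gp n} {B : ℝ → Sk n} {C : ℝ}
    (h : ∀ t ∈ Set.Icc (0 : ℝ) 1, HasDerivAt (fun s => (γ s).1) ((B t).1 * (γ t).1) t)
    (hB : ∀ t ∈ Set.Icc (0 : ℝ) 1, ‖(B t).1‖ ≤ C) {l : ℕ} {y : C(Gp n, ℝ)} (hy : y ∈ Vp n l) :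
    n2 (Rt (γ 1) y - Rt (γ 0) y) ≤ C * ∑ i, ∑ j, n2 (Lij i j y) := by
  have h1 := norm_image_sub_le_of_norm_deriv_le_segment_01'
    (f := fun t => toL2 n (Rt (γ t) y)) (f' := fun t => toL2 n (Dr (B t) (γ t) y))
    (C := C * ∑ i, ∑ j, n2 (Lij i j y)) (fun t ht => ?_) (fun t ht => ?_)
  · rw [← map_sub] at h1
    exact h1
  · exact ((toL2 n).hasFDerivAt.comp_hasDerivAt t (hasDerivAt_Rt (h t ht) hy)).hasDerivWithinAt
  · have hs : 0 ≤ ∑ i, ∑ j, n2 (Lij i j y) :=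
      Finset.sum_nonneg fun i _ => Finset.sum_nonneg fun j _ => n2_nonneg _
    exact (n2_Dr_le _ _ _).trans
      (mul_le_mul_of_nonneg_right (hB t ⟨ht.1, ht.2.le⟩) hs)

theorem continuous_Rt {l : ℕ} {y : C(Gp n, ℝ)} (hy : y ∈ Vp n l) :
    Continuous fun g : Gp n => Rt g y := by
  refine Vp_induction (P := fun l y => Continuous fun g : Gp n => Rt g y) ?_ ?_ ?_ ?_ ?_ hy
  · simpa using continuous_const
  · intro l y z h1 h2; simp only [map_add]; exact h1.add h2
  · intro l c y h1; simp only [map_smul]; exact h1.const_smul c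
  · exact fun _ _ h => h
  · intro l y v w hy h1
    have h2 : Continuous fun g : Gp n => Rt g (cf v w) := by
      simp only [Rt_cf]
      exact (cfL v).continuous.comp (by fun_prop)
    simp only [map_mul]; exact h1.mul h2

end Path

end

section

section Reflections

variable {n : ℕ}

/-- The reflection `x ↦ x - 2 ⟪b, x⟫ b / ‖b‖ ^ 2`. -/
def srefL (b : Eucl n) : Eucl n →L[ℝ] Eucl n :=
  ContinuousLinearMap.id ℝ _ - (2 / ‖b‖ ^ 2) • (innerSL ℝ b).smulRight b

theorem srefL_apply (b x : Eucl n) : srefL b x = x - (2 / ‖b‖ ^ 2) • ⟪b, x⟫ • b := rfl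

theorem srefL_srefL (b x : Eucl n) : srefL b (srefL b x) = x := by
  rcases eq_or_ne b 0 with rfl | hb
  · simp [srefL_apply]
  have h : ‖b‖ ^ 2 ≠ 0 := by positivity
  rw [srefL_apply b (srefL b x), srefL_apply b x, inner_sub_right, inner_smul_right,
    inner_smul_right, real_inner_self_eq_norm_sq, smul_smul, smul_smul, sub_sub, ← add_smul]
  have : 2 / ‖b‖ ^ 2 * ⟪b, x⟫ + 2 / ‖b‖ ^ 2 * (⟪b, x⟫ - 2 / ‖b‖ ^ 2 * (⟪b, x⟫ * ‖b‖ ^ 2)) = 0 := by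
    field_simp; ring
  rw [this, zero_smul, sub_zero]

theorem srefL_inner (b x y : Eucl n) : ⟪srefL b x, y⟫ = ⟪x, srefL b y⟫ := by
  simp only [srefL_apply, inner_sub_left, inner_sub_right, inner_smul_left, inner_smul_right,
    conj_trivial, real_inner_comm b x]
  ring

/-- The reflection as a group element. -/
def gref (b : Eucl n) : Gp n :=
  ⟨srefL b, by
    have h : star (srefL b) = srefL b := by
      rw [ContinuousLinearMap.star_eq_adjoint]
      refine ContinuousLinearMap.ext fun x => ext_inner_right ℝ fun y => ?_
      rw [ContinuousLinearMap.adjoint_inner_left, srefL_inner]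
    have h2 : srefL b * srefL b = 1 := ContinuousLinearMap.ext fun x => srefL_srefL b x
    exact Unitary.mem_iff.mpr ⟨by rw [h, h2], by rw [h, h2]⟩⟩

theorem gref_apply (b x : Eucl n) : (gref b).1 x = x - (2 / ‖b‖ ^ 2) • ⟪b, x⟫ • b := rfl

theorem gref_mul_self (b : Eucl n) : gref b * gref b = 1 :=
  Subtype.ext <| ContinuousLinearMap.ext fun x => srefL_srefL b x

theorem gref_smul {c : ℝ} (hc : c ≠ 0) (b : Eucl n) : gref (c • b) = gref b := by
  refine Subtype.ext <| ContinuousLinearMap.ext fun x => ?_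
  rw [gref_apply, gref_apply, norm_smul, inner_smul_left, conj_trivial, smul_smul, smul_smul,
    smul_smul, mul_pow, Real.norm_eq_abs, sq_abs]
  congr 2
  rcases eq_or_ne b 0 with rfl | hb
  · simp
  have h : ‖b‖ ≠ 0 := by positivity
  field_simp

theorem mul_gref (h : Gp n) (b : Eucl n) : h * gref b = gref (h.1 b) * h := by
  refine Subtype.ext <| ContinuousLinearMap.ext fun x => ?_
  change h.1 ((gref b).1 x) = (gref (h.1 b)).1 (h.1 x)
  rw [gref_apply, gref_apply, Gp.norm_apply, Gp.inner_apply, map_sub, map_smul, map_smul]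

/-- A group element carrying `e` to the direction of `z`. -/
def gz (e z : Eucl n) : Gp n := gref (z + ‖z‖ • e) * gref e

theorem gz_smul (e z : Eucl n) {c : ℝ} (hc : 0 < c) : gz e (c • z) = gz e z := by
  rw [gz, gz, norm_smul, Real.norm_of_nonneg hc.le, mul_smul, ← smul_add, gref_smul hc.ne']

theorem gref_self {e : Eucl n} (he : ‖e‖ = 1) : (gref e).1 e = -e := by
  rw [gref_apply, real_inner_self_eq_norm_sq, he]
  simp [two_smul]

theorem gz_apply {e z : Eucl n} (he : ‖e‖ = 1) (hz : z + ‖z‖ • e ≠ 0) :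
    ‖z‖ • (gz e z).1 e = z := by
  change ‖z‖ • (gref (z + ‖z‖ • e)).1 ((gref e).1 e) = z
  rw [gref_self he, ← map_smul, gref_apply, smul_neg, inner_neg_right]
  have h1 : ‖z + ‖z‖ • e‖ ^ 2 = 2 * ⟪z + ‖z‖ • e, ‖z‖ • e⟫ := by
    rw [← real_inner_self_eq_norm_sq]
    simp only [inner_add_left, inner_add_right, inner_smul_left, inner_smul_right,
      real_inner_self_eq_norm_sq, he, conj_trivial, real_inner_comm e z]
    ring
  have h2 : ‖z + ‖z‖ • e‖ ^ 2 ≠ 0 := by positivity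
  rw [smul_smul, h1]
  rw [h1] at h2
  have : 2 / (2 * ⟪z + ‖z‖ • e, ‖z‖ • e⟫) * -⟪z + ‖z‖ • e, ‖z‖ • e⟫ = -1 := by
    have h3 : ⟪z + ‖z‖ • e, ‖z‖ • e⟫ ≠ 0 := right_ne_zero_of_mul h2
    field_simp
  rw [this]
  module

theorem mul_gz {e : Eucl n} {h : Gp n} {χ : ℝ} (hχ : χ * χ = 1) (hh : h.1 e = χ • e)
    (z : Eucl n) : h * gz e z = gz e (χ • h.1 z) * h := by
  have h0 : χ ≠ 0 := by rintro rfl; simp at hχ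
  have h1 : |χ| = 1 := by
    rw [← sq_eq_sq₀ (abs_nonneg _) zero_le_one, sq_abs, one_pow, sq, hχ]
  rw [gz, gz, ← mul_assoc, mul_gref h (z + _), mul_assoc, mul_gref h e, ← mul_assoc, hh,
    gref_smul h0]
  congr 2
  rw [norm_smul, Real.norm_eq_abs, h1, one_mul, Gp.norm_apply, map_add, map_smul, hh,
    ← gref_smul h0 (_ + _), smul_add, smul_smul, smul_smul]
  congr 3
  rw [mul_right_comm, hχ, one_mul]

theorem continuousAt_gref {b : Eucl n} (hb : b ≠ 0) : ContinuousAt gref b := by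
  rw [ContinuousAt, tendsto_subtype_rng]
  have h : ‖b‖ ^ 2 ≠ 0 := by positivity
  change ContinuousAt (fun b : Eucl n => ContinuousLinearMap.id ℝ (Eucl n) -
    (2 / ‖b‖ ^ 2) • ContinuousLinearMap.smulRightL ℝ _ _ (innerSL ℝ b) b) b
  have h1 : ContinuousAt (fun b : Eucl n => 2 / ‖b‖ ^ 2) b :=
    continuousAt_const.div (by fun_prop) h
  have h2 : Continuous (fun b : Eucl n =>
    ContinuousLinearMap.smulRightL ℝ (Eucl n) (Eucl n) (innerSL ℝ b) b) := by fun_prop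
  exact continuousAt_const.sub (h1.smul h2.continuousAt)

theorem continuousAt_gz {e z : Eucl n} (hz : z + ‖z‖ • e ≠ 0) : ContinuousAt (gz e) z := by
  have h : ContinuousAt (fun z : Eucl n => gref (z + ‖z‖ • e)) z :=
    ContinuousAt.comp (f := fun z : Eucl n => z + ‖z‖ • e) (continuousAt_gref hz) (by fun_prop)
  exact h.mul continuousAt_const

/-- The angular velocity of a moving reflection. -/
def refVel (b b' : Eucl n) : Sk n := (-(2 / ‖b‖ ^ 2)) • wd b b'

theorem refVel_apply (b b' x : Eucl n) :
    (refVel b b').1 x = (-(2 / ‖b‖ ^ 2)) • (⟪b', x⟫ • b - ⟪b, x⟫ • b') := rfl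

theorem norm_refVel_le {b : Eucl n} (hb : 1 ≤ ‖b‖) (b' : Eucl n) :
    ‖(refVel b b').1‖ ≤ 4 * ‖b'‖ := by
  refine ContinuousLinearMap.opNorm_le_bound _ (by positivity) fun x => ?_
  rw [refVel_apply, norm_smul, norm_neg, Real.norm_of_nonneg (by positivity)]
  have h1 : ‖⟪b', x⟫ • b - ⟪b, x⟫ • b'‖ ≤ 2 * (‖b'‖ * ‖b‖ * ‖x‖) := by
    refine (norm_sub_le _ _).trans ?_
    rw [norm_smul, norm_smul]
    have := norm_inner_le_norm (𝕜 := ℝ) b' x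
    have := norm_inner_le_norm (𝕜 := ℝ) b x
    calc _ ≤ ‖b'‖ * ‖x‖ * ‖b‖ + ‖b‖ * ‖x‖ * ‖b'‖ := by gcongr
      _ = _ := by ring
  calc _ ≤ 2 / ‖b‖ ^ 2 * (2 * (‖b'‖ * ‖b‖ * ‖x‖)) := by gcongr
    _ = 4 * ‖b'‖ * ‖x‖ / ‖b‖ := by field_simp; ring
    _ ≤ _ := div_le_self (by positivity) hb

theorem hasDerivAt_gref {b : ℝ → Eucl n} {b' : Eucl n} {t : ℝ} (h : HasDerivAt b b' t)
    (hb : b t ≠ 0) :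
    HasDerivAt (fun s => (gref (b s)).1) ((refVel (b t) b').1 * (gref (b t)).1) t := by
  have h0 : ‖b t‖ ^ 2 ≠ 0 := by positivity
  have h1 : HasDerivAt (fun s => 2 / ‖b s‖ ^ 2)
      (-(4 * ⟪b t, b'⟫) / (‖b t‖ ^ 2) ^ 2) t := by
    have h2 := (hasDerivAt_const t (2 : ℝ)).div h.norm_sq h0
    exact h2.congr_deriv (by ring)
  have h3 : HasDerivAt (fun s => ContinuousLinearMap.smulRightL ℝ (Eucl n) (Eucl n)
      (innerSL ℝ (b s)) (b s)) (ContinuousLinearMap.smulRightL ℝ (Eucl n) (Eucl n)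
      (innerSL ℝ b') (b t) + ContinuousLinearMap.smulRightL ℝ (Eucl n) (Eucl n)
      (innerSL ℝ (b t)) b') t := by
    have h4 : HasDerivAt (fun s => ContinuousLinearMap.smulRightL ℝ (Eucl n) (Eucl n)
      (innerSL ℝ (b s))) (ContinuousLinearMap.smulRightL ℝ (Eucl n) (Eucl n) (innerSL ℝ b')) t :=
      ((ContinuousLinearMap.smulRightL ℝ (Eucl n) (Eucl n)).comp
        (innerSL ℝ : Eucl n →L[ℝ] _)).hasFDerivAt.comp_hasDerivAt t h
    exact h4.clm_apply h
  have h5 := (h1.smul h3).const_sub (ContinuousLinearMap.id ℝ (Eucl n))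
  refine h5.congr_deriv ?_
  refine ContinuousLinearMap.ext fun x => ?_
  change -((2 / ‖b t‖ ^ 2) • (⟪b', x⟫ • b t + ⟪b t, x⟫ • b') +
    (-(4 * ⟪b t, b'⟫) / (‖b t‖ ^ 2) ^ 2) • ⟪b t, x⟫ • b t) =
    (refVel (b t) b').1 ((gref (b t)).1 x)
  rw [refVel_apply, gref_apply]
  simp only [inner_sub_right, inner_smul_right, real_inner_self_eq_norm_sq, real_inner_comm b']
  generalize hN : ‖b t‖ ^ 2 = N at *
  have e1 : 2 / N * (⟪b t, x⟫ * N) = 2 * ⟪b t, x⟫ := by field_simp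
  rw [e1]
  match_scalars
  · field_simp; ring
  · ring

theorem n2_Rt_gz_sub_le {e ω : Eucl n} (he : ‖e‖ = 1) (hω : ‖ω‖ = 1) {l : ℕ}
    {y : C(Gp n, ℝ)} (hy : y ∈ Vp n l) :
    n2 (Rt (gz e ω) y - y) ≤ 4 * ‖ω - e‖ * (n2 y + ∑ i, ∑ j, n2 (Lij i j y)) := by
  have hs : 0 ≤ ∑ i, ∑ j, n2 (Lij i j y) := sum_sum_nonneg fun _ _ => n2_nonneg _
  have hy0 := n2_nonneg y
  rcases le_total 0 ⟪ω, e⟫ with h | h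
  · set b : ℝ → Eucl n := fun t => (2 : ℝ) • e + t • (ω - e) with hb
    have hbd : ∀ t, HasDerivAt b (ω - e) t := fun t => by
      exact (((hasDerivAt_id t).smul_const (ω - e)).const_add ((2 : ℝ) • e)).congr_deriv (by simp)
    have hbn : ∀ t ∈ Set.Icc (0 : ℝ) 1, 1 ≤ ‖b t‖ := fun t ht => by
      have h1 : 1 ≤ ⟪b t, e⟫ := by
        simp only [hb, inner_add_left, inner_smul_left, inner_sub_left, real_inner_self_eq_norm_sq,
          he, conj_trivial]
        nlinarith [ht.1, ht.2]
      have h2 := real_inner_le_norm (b t) e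
      rw [he, mul_one] at h2
      exact h1.trans h2
    have key := n2_Rt_sub_le (γ := fun t => gref (b t) * gref e)
      (B := fun t => refVel (b t) (ω - e)) (C := 4 * ‖ω - e‖) (fun t ht => ?_)
      (fun t ht => norm_refVel_le (hbn t ht) _) hy
    · have e1 : gref (b 1) * gref e = gz e ω := by
        rw [gz, hω]; congr 2; simp only [hb]; module
      have e0 : gref (b 0) * gref e = 1 := by
        simp only [hb, zero_smul, add_zero]
        rw [gref_smul two_ne_zero, gref_mul_self]
      have e2 : Rt (1 : Gp n) y = y := by ext k; simp
      simp only [e1, e0, e2] at key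
      refine key.trans ?_
      gcongr
      linarith
    · have hb0 : b t ≠ 0 := by
        intro h0; have := hbn t ht; rw [h0, norm_zero] at this; linarith
      have := (hasDerivAt_gref (hbd t) hb0).mul_const (gref e).1
      rw [mul_assoc] at this
      exact this
  · have h1 : 1 ≤ ‖ω - e‖ := by
      have : 1 ≤ ‖ω - e‖ ^ 2 := by
        rw [norm_sub_sq_real, hω, he]; linarith
      nlinarith [norm_nonneg (ω - e)]
    have h2 : n2 (Rt (gz e ω) y - y) ≤ 2 * n2 y := by
      rw [sub_eq_add_neg]
      refine (n2_add_le _ _).trans ?_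
      rw [n2_neg, n2_Rt]; linarith
    nlinarith [mul_nonneg (norm_nonneg (ω - e)) hs]

end Reflections

end

section

section Rees

theorem summable_antidiagonal {f g : ℕ → ℝ} (hf : Summable f) (hg : Summable g)
    (hf0 : 0 ≤ f) (hg0 : 0 ≤ g) : Summable fun l : ℕ =>
      ∑ p ∈ Finset.HasAntidiagonal.antidiagonal l, f p.1 * g p.2 :=
  summable_sum_mul_antidiagonal_of_summable_mul (hf.mul_of_nonneg hg hf0 hg0)

theorem tsum_mul_tsum_antidiagonal {f g : ℕ → ℝ} (hf : Summable f) (hg : Summable g)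
    (hf0 : 0 ≤ f) (hg0 : 0 ≤ g) : (∑' l, f l) * ∑' l, g l = ∑' l : ℕ,
      ∑ p ∈ Finset.HasAntidiagonal.antidiagonal l, f p.1 * g p.2 :=
  hf.tsum_mul_tsum_eq_tsum_sum_antidiagonal hg (hf.mul_of_nonneg hg hf0 hg0)

/-- A filtration of a commutative algebra by complete normed spaces with submultiplicative norms. -/
structure FiltAlg (A : Type) [CommRing A] [Algebra ℝ A] (E : ℕ → Type)
    [∀ l, NormedAddCommGroup (E l)] [∀ l, NormedSpace ℝ (E l)] where
  i : ∀ l, E l →ₗ[ℝ] A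
  inj : ∀ l, Function.Injective (i l)
  one : E 0
  i_one : i 0 one = 1
  mul : ∀ {j k l : ℕ}, j + k = l → E j → E k → E l
  i_mul : ∀ {j k l : ℕ} (h : j + k = l) (x : E j) (y : E k), i l (mul h x y) = i j x * i k y
  norm_mul : ∀ {j k l : ℕ} (h : j + k = l) (x : E j) (y : E k), ‖mul h x y‖ ≤ ‖x‖ * ‖y‖

variable {A : Type} [CommRing A] [Algebra ℝ A] {E : ℕ → Type}
  [∀ l, NormedAddCommGroup (E l)] [∀ l, NormedSpace ℝ (E l)]

/-- The completed Rees algebra of a filtered algebra. -/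
def Rees (_S : FiltAlg A E) : Type := lp E 1

variable {S : FiltAlg A E}

instance : NormedAddCommGroup (Rees S) := inferInstanceAs (NormedAddCommGroup (lp E 1))

instance : NormedSpace ℝ (Rees S) := inferInstanceAs (NormedSpace ℝ (lp E 1))

instance [∀ l, CompleteSpace (E l)] : CompleteSpace (Rees S) :=
  inferInstanceAs (CompleteSpace (lp E 1))

namespace Rees

/-- The coefficients of an element of the Rees algebra. -/
def coef (X : Rees S) (l : ℕ) : E l := (show lp E 1 from X).1 l

theorem ext' {X Y : Rees S} (h : ∀ l, X.coef l = Y.coef l) : X = Y :=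
  Subtype.ext (funext h)

theorem memℓp_one {f : ∀ l, E l} : Memℓp f 1 ↔ Summable fun l => ‖f l‖ := by
  rw [memℓp_gen_iff (by simp)]; simp

/-- An element from a summable sequence of coefficients. -/
def ofSeq (f : ∀ l, E l) (hf : Summable fun l => ‖f l‖) : Rees S := ⟨f, memℓp_one.mpr hf⟩

@[simp] theorem coef_ofSeq (f : ∀ l, E l) (hf : Summable fun l => ‖f l‖) (l : ℕ) :
    (ofSeq f hf : Rees S).coef l = f l := rfl

@[simp] theorem coef_add (X Y : Rees S) (l : ℕ) : (X + Y).coef l = X.coef l + Y.coef l := rfl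
@[simp] theorem coef_sub (X Y : Rees S) (l : ℕ) : (X - Y).coef l = X.coef l - Y.coef l := rfl
@[simp] theorem coef_neg (X : Rees S) (l : ℕ) : (-X).coef l = -X.coef l := rfl
@[simp] theorem coef_smul (c : ℝ) (X : Rees S) (l : ℕ) : (c • X).coef l = c • X.coef l := rfl
@[simp] theorem coef_zero (l : ℕ) : (0 : Rees S).coef l = 0 := rfl

theorem summable (X : Rees S) : Summable fun l => ‖X.coef l‖ := memℓp_one.mp X.2

theorem norm_eq (X : Rees S) : ‖X‖ = ∑' l, ‖X.coef l‖ := by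
  have := lp.norm_eq_tsum_rpow (p := 1) (by simp) (show lp E 1 from X)
  simp only [ENNReal.toReal_one, Real.rpow_one, div_one] at this
  exact this

theorem norm_coef_le (X : Rees S) (l : ℕ) : ‖X.coef l‖ ≤ ‖X‖ := by
  rw [norm_eq]
  exact X.summable.le_tsum l fun _ _ => norm_nonneg _

theorem norm_le_of_hasSum {X : Rees S} {f : ℕ → ℝ} {c : ℝ} (hf : HasSum f c)
    (h : ∀ l, ‖X.coef l‖ ≤ f l) : ‖X‖ ≤ c := by
  rw [norm_eq, ← hf.tsum_eq]
  exact X.summable.tsum_le_tsum h hf.summable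

/-- The `l`-th homogeneous inclusion. -/
def hom (S : FiltAlg A E) (l : ℕ) : E l →ₗ[ℝ] Rees S where
  toFun x := (lp.single 1 l x : lp E 1)
  map_add' x y := lp.single_add 1 l x y
  map_smul' c x := lp.single_smul 1 l c x

theorem coef_hom_self (l : ℕ) (x : E l) : (hom S l x).coef l = x := by
  change (lp.single 1 l x : lp E 1) l = x
  rw [lp.single_apply_self]

theorem coef_hom_ne {l m : ℕ} (x : E l) (h : m ≠ l) : (hom S l x).coef m = 0 := by
  change (lp.single 1 l x : lp E 1) m = 0
  rw [lp.single_apply_ne _ _ _ h]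

theorem norm_hom (l : ℕ) (x : E l) : ‖hom S l x‖ = ‖x‖ := by
  change ‖(lp.single 1 l x : lp E 1)‖ = ‖x‖
  rw [lp.norm_single zero_lt_one]

theorem hasSum_hom (X : Rees S) : HasSum (fun l => hom S l (X.coef l)) X := by
  exact lp.hasSum_single ENNReal.one_ne_top (X : lp E 1)

/-- Products of coefficients. -/
def mulCoef (X Y : Rees S) (l : ℕ) : E l :=
  ∑ p ∈ (Finset.HasAntidiagonal.antidiagonal l).attach,
    S.mul (Finset.HasAntidiagonal.mem_antidiagonal.mp p.2) (X.coef p.1.1) (Y.coef p.1.2)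

theorem norm_mulCoef_le (X Y : Rees S) (l : ℕ) :
    ‖mulCoef X Y l‖ ≤ ∑ p ∈ Finset.HasAntidiagonal.antidiagonal l, ‖X.coef p.1‖ * ‖Y.coef p.2‖ := by
  rw [← Finset.sum_attach (Finset.HasAntidiagonal.antidiagonal l)]
  exact (norm_sum_le _ _).trans (Finset.sum_le_sum fun p _ => S.norm_mul _ _ _)

theorem summable_mul_aux (X Y : Rees S) :
    Summable fun l => ∑ p ∈ Finset.HasAntidiagonal.antidiagonal l, ‖X.coef p.1‖ * ‖Y.coef p.2‖ :=
  summable_antidiagonal (f := fun l => ‖X.coef l‖) (g := fun l => ‖Y.coef l‖) X.summable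
    Y.summable (fun _ => norm_nonneg _) fun _ => norm_nonneg _

instance : Mul (Rees S) :=
  ⟨fun X Y => ofSeq (mulCoef X Y) ((summable_mul_aux X Y).of_nonneg_of_le
    (fun _ => norm_nonneg _) (norm_mulCoef_le X Y))⟩

instance : One (Rees S) := ⟨hom S 0 S.one⟩

theorem norm_mul_le' (X Y : Rees S) : ‖X * Y‖ ≤ ‖X‖ * ‖Y‖ := by
  refine norm_le_of_hasSum (f := fun l => ∑ p ∈ Finset.HasAntidiagonal.antidiagonal l,
    ‖X.coef p.1‖ * ‖Y.coef p.2‖) ?_ (norm_mulCoef_le X Y)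
  rw [norm_eq X, norm_eq Y, tsum_mul_tsum_antidiagonal X.summable Y.summable
    (fun _ => norm_nonneg _) fun _ => norm_nonneg _]
  exact (summable_mul_aux X Y).hasSum

/-- The embedding in the power series algebra. -/
def toPS (X : Rees S) : PowerSeries A := PowerSeries.mk fun l => S.i l (X.coef l)

theorem toPS_injective : Function.Injective (toPS (S := S)) := fun X Y h =>
  ext' fun l => S.inj l <| by
    have := congrArg (PowerSeries.coeff l) h
    simpa [toPS] using this

theorem i_coef_mul (X Y : Rees S) (l : ℕ) : S.i l ((X * Y).coef l) =
    ∑ p ∈ Finset.HasAntidiagonal.antidiagonal l, S.i _ (X.coef p.1) * S.i _ (Y.coef p.2) := by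
  change S.i l (mulCoef X Y l) = _
  rw [mulCoef, map_sum, ← Finset.sum_attach (Finset.HasAntidiagonal.antidiagonal l)]
  exact Finset.sum_congr rfl fun p _ => S.i_mul _ _ _

theorem toPS_mul (X Y : Rees S) : toPS (X * Y) = toPS X * toPS Y := by
  ext l
  simp [toPS, PowerSeries.coeff_mul, i_coef_mul]

theorem toPS_add (X Y : Rees S) : toPS (X + Y) = toPS X + toPS Y := by
  ext l; simp [toPS]

theorem toPS_zero : toPS (0 : Rees S) = 0 := by ext l; simp [toPS]

theorem coef_one_zero : (1 : Rees S).coef 0 = S.one := coef_hom_self 0 _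

theorem coef_one_succ (l : ℕ) : (1 : Rees S).coef (l + 1) = 0 :=
  coef_hom_ne _ (Nat.succ_ne_zero l)

theorem toPS_one : toPS (1 : Rees S) = 1 := by
  ext l
  cases l with
  | zero => simp [toPS, coef_one_zero, S.i_one]
  | succ l => simp [toPS, coef_one_succ, PowerSeries.coeff_one]

instance : CommRing (Rees S) :=
  { (inferInstance : AddCommGroup (Rees S)) with
    mul := (· * ·)
    one := 1
    mul_assoc := fun X Y Z => toPS_injective (by simp only [toPS_mul, mul_assoc])
    mul_comm := fun X Y => toPS_injective (by simp only [toPS_mul, mul_comm])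
    one_mul := fun X => toPS_injective (by simp only [toPS_mul, toPS_one, one_mul])
    mul_one := fun X => toPS_injective (by simp only [toPS_mul, toPS_one, mul_one])
    left_distrib := fun X Y Z => toPS_injective (by simp only [toPS_mul, toPS_add, mul_add])
    right_distrib := fun X Y Z => toPS_injective (by simp only [toPS_mul, toPS_add, add_mul])
    zero_mul := fun X => toPS_injective (by simp only [toPS_mul, toPS_zero, zero_mul])
    mul_zero := fun X => toPS_injective (by simp only [toPS_mul, toPS_zero, mul_zero]) }

instance : NormedCommRing (Rees S) :=
  { (inferInstance : NormedAddCommGroup (Rees S)), (inferInstance : CommRing (Rees S)) with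
    norm_mul_le := norm_mul_le' }

theorem smul_mul' (c : ℝ) (X Y : Rees S) : c • X * Y = c • (X * Y) :=
  ext' fun l => S.inj l <| by
    simp [i_coef_mul, Finset.smul_sum]

instance : Algebra ℝ (Rees S) :=
  Algebra.ofModule smul_mul' fun c X Y => by rw [mul_comm, smul_mul', mul_comm]

instance : NormedAlgebra ℝ (Rees S) :=
  { (inferInstance : Algebra ℝ (Rees S)) with
    norm_smul_le := fun c X => (norm_smul_le c X) }

section Lift

variable (T : ∀ l, E l →ₗ[ℝ] E l) (c : ℝ) (hT : ∀ l x, ‖T l x‖ ≤ c * ‖x‖)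

/-- A levelwise bounded family of linear maps acts on the Rees algebra. -/
def lift (S : FiltAlg A E) : Rees S →L[ℝ] Rees S :=
  LinearMap.mkContinuous
    { toFun := fun X => ofSeq (fun l => T l (X.coef l))
        ((X.summable.mul_left c).of_nonneg_of_le (fun _ => norm_nonneg _) fun l => hT l _)
      map_add' := fun X Y => ext' fun l => by simp
      map_smul' := fun a X => ext' fun l => by simp } c
    fun X => norm_le_of_hasSum (X.summable.hasSum.mul_left c |> fun h => by
      rw [← norm_eq] at h; exact h) fun l => hT l _

@[simp] theorem coef_lift (X : Rees S) (l : ℕ) : (lift T c hT S X).coef l = T l (X.coef l) := rfl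

theorem norm_lift_le (X : Rees S) : ‖lift T c hT S X‖ ≤ c * ‖X‖ :=
  norm_le_of_hasSum (X.summable.hasSum.mul_left c |> fun h => by
      rw [← norm_eq] at h; exact h) fun l => hT l _

end Lift

section Char

variable (χ : A →ₐ[ℝ] ℝ) (hχ : ∀ l x, |χ (S.i l x)| ≤ ‖x‖)

include hχ in
theorem summable_char (X : Rees S) : Summable fun l => ‖χ (S.i l (X.coef l))‖ :=
  X.summable.of_nonneg_of_le (fun _ => norm_nonneg _) fun l => hχ l _

/-- The character of the Rees algebra induced by a character of `A`. -/
def char : Rees S →ₐ[ℝ] ℝ :=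
  AlgHom.ofLinearMap
    { toFun := fun X => ∑' l, χ (S.i l (X.coef l))
      map_add' := fun X Y => by
        simp only [coef_add, map_add]
        exact (summable_char χ hχ X).of_norm.tsum_add (summable_char χ hχ Y).of_norm
      map_smul' := fun c X => by
        simp only [coef_smul, map_smul, RingHom.id_apply, smul_eq_mul]
        exact tsum_mul_left }
    (by
      change ∑' l, χ (S.i l ((1 : Rees S).coef l)) = 1
      rw [tsum_eq_single 0]
      · rw [coef_one_zero, S.i_one, map_one]
      · intro l hl
        obtain ⟨m, rfl⟩ := Nat.exists_eq_succ_of_ne_zero hl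
        rw [coef_one_succ, map_zero, map_zero])
    (fun X Y => by
      change ∑' l, χ (S.i l ((X * Y).coef l)) =
        (∑' l, χ (S.i l (X.coef l))) * ∑' l, χ (S.i l (Y.coef l))
      rw [tsum_mul_tsum_eq_tsum_sum_antidiagonal_of_summable_norm (summable_char χ hχ X)
        (summable_char χ hχ Y)]
      simp only [i_coef_mul, map_sum, map_mul])

theorem char_apply (X : Rees S) : char χ hχ X = ∑' l, χ (S.i l (X.coef l)) := rfl

theorem hasSum_char (X : Rees S) : HasSum (fun l => χ (S.i l (X.coef l))) (char χ hχ X) :=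
  (summable_char χ hχ X).of_norm.hasSum

theorem abs_char_le (X : Rees S) : |char χ hχ X| ≤ ‖X‖ := by
  rw [char_apply, norm_eq, ← Real.norm_eq_abs]
  exact tsum_of_norm_bounded X.summable.hasSum fun l => hχ l _

end Char

theorem continuous_lift [∀ l, CompleteSpace (E l)] {G : Type*} [TopologicalSpace G] {T : G → ∀ l, E l →ₗ[ℝ] E l} {c : ℝ}
    (hT : ∀ g l x, ‖T g l x‖ ≤ c * ‖x‖) (hc : ∀ l x, Continuous fun g => T g l x) (X : Rees S) :
    Continuous fun g => lift (T g) c (hT g) S X := by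
  have h : ∀ g, lift (T g) c (hT g) S X = ∑' l, hom S l (T g l (X.coef l)) := fun g =>
    (hasSum_hom (lift (T g) c (hT g) S X)).tsum_eq.symm
  simp only [h]
  refine continuous_tsum (u := fun l => c * ‖X.coef l‖) (fun l => ?_) (X.summable.mul_left c)
    fun l g => by rw [norm_hom]; exact hT g l _
  have : Continuous (hom S l) :=
    AddMonoidHomClass.continuous_of_bound (hom S l) 1 fun x => by rw [norm_hom, one_mul]
  exact this.comp (hc l _)

end Rees

end Rees

end

section

/-- Every rapidly decreasing sequence is tamed by a submultiplicative superpolynomial weight. -/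
theorem exists_weight {a : ℕ → ℝ} (ha0 : ∀ l, 0 ≤ a l)
    (ha : ∀ P : ℕ, ∃ C, ∀ l : ℕ, (1 + l : ℝ) ^ P * a l ≤ C) :
    ∃ w : ℕ → ℝ, (∀ l, 1 ≤ w l) ∧ (∀ j k, w (j + k) ≤ w j * w k) ∧
      (∀ P : ℕ, ∃ C, ∀ l : ℕ, (1 + l : ℝ) ^ P ≤ C * w l) ∧
      ∀ P : ℕ, ∃ C, ∀ l : ℕ, w l * ((1 + l : ℝ) ^ P * a l) ≤ C := by
  have hL : ∀ P : ℕ, ∃ L : ℕ, ∀ l, L < l → (1 + l : ℝ) ^ (2 * P) * a l ≤ 1 := by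
    intro P
    obtain ⟨C, hC⟩ := ha (2 * P + 1)
    obtain ⟨L, hL⟩ := exists_nat_ge C
    refine ⟨L, fun l hl => ?_⟩
    have h1 := hC l
    rw [pow_succ'] at h1
    have h2 : (L : ℝ) < l := by exact_mod_cast hl
    have h3 : 0 ≤ (1 + l : ℝ) ^ (2 * P) * a l := mul_nonneg (by positivity) (ha0 l)
    have h4 : (0 : ℝ) ≤ L := Nat.cast_nonneg L
    nlinarith
  choose L hL using hL
  have hK1 : ∀ P, 1 ≤ (1 + P * L P + P : ℝ) := fun P => by
    have : (0 : ℝ) ≤ P * L P := by positivity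
    have h : (0 : ℝ) ≤ P := by positivity
    linarith
  set K : ℕ → ℝ := fun P => 1 + P * L P + P with hK
  have hKpos : ∀ P, 0 < K P := fun P => one_pos.trans_le (hK1 P)
  set t : ℕ → ℕ → ℝ := fun l P => (1 + l / K P) ^ P with ht
  have hexp : ∀ (l P : ℕ) (c : ℝ), (P : ℝ) * l ≤ c * K P → t l P ≤ Real.exp c := by
    intro l P c hc
    have h1 : 1 + l / K P ≤ Real.exp (l / K P) := by
      rw [add_comm]; exact Real.add_one_le_exp _
    have h0 : 0 ≤ 1 + l / K P := by have := (hKpos P).le; positivity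
    refine (pow_le_pow_left₀ h0 h1 P).trans ?_
    rw [← Real.exp_nat_mul]
    refine Real.exp_le_exp.mpr ?_
    rw [mul_div_assoc', div_le_iff₀ (hKpos P)]
    exact hc
  have ht1 : ∀ l P, 1 ≤ t l P := fun l P => one_le_pow₀ (by
    have := (hKpos P).le
    have : (0 : ℝ) ≤ l / K P := by positivity
    linarith)
  have htle : ∀ l P, t l P ≤ (1 + l : ℝ) ^ P := fun l P =>
    pow_le_pow_left₀ (by have := (hKpos P).le; positivity)
      (by gcongr; exact div_le_self (by positivity) (hK1 P)) P
  have hbdd : ∀ l, BddAbove (Set.range (t l)) := fun l => ⟨Real.exp l, by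
    rintro _ ⟨P, rfl⟩
    refine hexp l P l ?_
    have : (P : ℝ) ≤ K P := by
      have : (0 : ℝ) ≤ P * L P := by positivity
      simp only [hK]; linarith
    have h : (0 : ℝ) ≤ l := by positivity
    nlinarith⟩
  refine ⟨fun l => ⨆ P, t l P, fun l => (ht1 l 0).trans (le_ciSup (hbdd l) 0), fun j k => ?_,
    fun P => ⟨K P ^ P, fun l => ?_⟩, fun Q => ?_⟩
  · refine ciSup_le fun P => ?_
    refine le_trans ?_ (mul_le_mul (le_ciSup (hbdd j) P) (le_ciSup (hbdd k) P)
      (zero_le_one.trans (ht1 k P)) ((zero_le_one.trans (ht1 j P)).trans (le_ciSup (hbdd j) P)))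
    simp only [ht]
    rw [← mul_pow]
    have := (hKpos P).le
    refine pow_le_pow_left₀ (by positivity) ?_ P
    push_cast
    have h : 0 ≤ (j / K P : ℝ) * (k / K P) := by positivity
    rw [add_div]
    nlinarith
  · refine le_trans ?_ (mul_le_mul_of_nonneg_left (le_ciSup (hbdd l) P)
      (pow_nonneg (hKpos P).le P))
    simp only [ht]
    rw [← mul_pow]
    refine pow_le_pow_left₀ (by positivity) ?_ P
    rw [mul_add, mul_div_cancel₀ _ (hKpos P).ne', mul_one]
    linarith [hK1 P]
  · obtain ⟨C, hC⟩ := ha (2 * Q)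
    refine ⟨max 1 (Real.exp 1 * C), fun l => ?_⟩
    have hmono : ∀ {i j : ℕ}, i ≤ j → (1 + l : ℝ) ^ i * a l ≤ (1 + l : ℝ) ^ j * a l :=
      fun h => mul_le_mul_of_nonneg_right (pow_le_pow_right₀ (by
        have : (0 : ℝ) ≤ l := by positivity
        linarith) h) (ha0 l)
    have hC0 : 0 ≤ C := (mul_nonneg (by positivity) (ha0 l)).trans (hC l)
    have hb0 : 0 ≤ (1 + l : ℝ) ^ Q * a l := mul_nonneg (by positivity) (ha0 l)
    rw [Real.iSup_mul_of_nonneg hb0]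
    refine ciSup_le fun P => ?_
    have key : t l P * ((1 + l : ℝ) ^ Q * a l) ≤ (1 + l : ℝ) ^ (P + Q) * a l := by
      rw [pow_add, mul_assoc]
      exact mul_le_mul_of_nonneg_right (htle l P) hb0
    rcases lt_or_ge P Q with h | h
    · refine (key.trans ((hmono (by omega)).trans (hC l))).trans (le_trans ?_ (le_max_right _ _))
      have := Real.add_one_le_exp (1 : ℝ)
      nlinarith
    · rcases lt_or_ge (L P) l with h' | h'
      · exact (key.trans ((hmono (by omega)).trans (hL P l h'))).trans (le_max_left _ _)
      · refine le_trans ?_ (le_max_right _ _)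
        refine mul_le_mul (hexp l P 1 ?_) ((hmono (by omega)).trans (hC l)) hb0
          (Real.exp_pos _).le
        have h1 : (l : ℝ) ≤ L P := by exact_mod_cast h'
        have h2 : (P : ℝ) * l ≤ P * L P := by gcongr
        have : (0 : ℝ) ≤ P := by positivity
        simp only [hK]; linarith

end

section

section Concrete

/-- Weights making the spaces `Vp n l` into a submultiplicative filtration. -/
structure Wt (n : ℕ) where
  W : ℕ → ℝ
  ge : ∀ l : ℕ, (1 + l : ℝ) ^ (n * n) ≤ W l
  mul : ∀ {j k : ℕ}, j ≤ k → W (j + k) * (1 + j : ℝ) ^ (n * n) ≤ W j * W k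

variable {n : ℕ}

theorem Wt.pos (w : Wt n) (l : ℕ) : 0 < w.W l := lt_of_lt_of_le (by positivity) (w.ge l)

/-- The space `Vp n l` with the weighted `L²` norm. -/
def El (_w : Wt n) (l : ℕ) : Type := Vp n l

variable {w : Wt n}

instance (l : ℕ) : AddCommGroup (El w l) := inferInstanceAs (AddCommGroup (Vp n l))

instance (l : ℕ) : Module ℝ (El w l) := inferInstanceAs (Module ℝ (Vp n l))

/-- The inclusion of `El w l`. -/
def El.inc (w : Wt n) (l : ℕ) : El w l →ₗ[ℝ] C(Gp n, ℝ) := (Vp n l).subtype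

theorem El.inc_mem {l : ℕ} (x : El w l) : El.inc w l x ∈ Vp n l := Subtype.property (show Vp n l from x)

theorem El.inc_injective (l : ℕ) : Function.Injective (El.inc w l) := (Vp n l).injective_subtype

/-- An element of `El w l`. -/
def El.mk' (w : Wt n) {l : ℕ} {y : C(Gp n, ℝ)} (hy : y ∈ Vp n l) : El w l := ⟨y, hy⟩

@[simp] theorem El.inc_mk' {l : ℕ} {y : C(Gp n, ℝ)} (hy : y ∈ Vp n l) :
    El.inc w l (El.mk' w hy) = y := rfl

instance (l : ℕ) : NormedAddCommGroup (El w l) :=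
  AddGroupNorm.toNormedAddCommGroup
    { toFun := fun x => w.W l * n2 (El.inc w l x)
      map_zero' := by rw [map_zero, n2_zero, mul_zero]
      add_le' := fun x y => by
        rw [map_add, ← mul_add]
        exact mul_le_mul_of_nonneg_left (n2_add_le _ _) (w.pos l).le
      neg' := fun x => by rw [map_neg, n2_neg]
      eq_zero_of_map_eq_zero' := fun x hx =>
        El.inc_injective l (by
          rw [map_zero]
          exact n2_eq_zero ((mul_eq_zero.mp hx).resolve_left (w.pos l).ne')) }

theorem El.norm_def {l : ℕ} (x : El w l) : ‖x‖ = w.W l * n2 (El.inc w l x) := rfl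

instance (l : ℕ) : NormedSpace ℝ (El w l) where
  norm_smul_le c x := by
    rw [El.norm_def, El.norm_def, map_smul, n2_smul, Real.norm_eq_abs]
    exact le_of_eq (by ring)

instance (l : ℕ) : FiniteDimensional ℝ (El w l) := inferInstanceAs (FiniteDimensional ℝ (Vp n l))

instance (l : ℕ) : CompleteSpace (El w l) := FiniteDimensional.complete ℝ _

theorem n2_mul_le_weight {j k : ℕ} {y z : C(Gp n, ℝ)} (hy : y ∈ Vp n j) (hz : z ∈ Vp n k) :
    w.W (j + k) * n2 (y * z) ≤ (w.W j * n2 y) * (w.W k * n2 z) := by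
  wlog h : j ≤ k generalizing j k y z
  · rw [mul_comm y, add_comm j, mul_comm (w.W j * _)]
    exact this hz hy (le_of_not_ge h)
  calc w.W (j + k) * n2 (y * z) ≤ w.W (j + k) * (((1 + j : ℝ) ^ (n * n) * n2 y) * n2 z) :=
        mul_le_mul_of_nonneg_left ((n2_mul_le y z).trans
          (mul_le_mul_of_nonneg_right (norm_le_of_mem_Vp hy) (n2_nonneg z))) (w.pos _).le
    _ = (w.W (j + k) * (1 + j : ℝ) ^ (n * n)) * (n2 y * n2 z) := by ring
    _ ≤ (w.W j * w.W k) * (n2 y * n2 z) :=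
        mul_le_mul_of_nonneg_right (w.mul h) (mul_nonneg (n2_nonneg y) (n2_nonneg z))
    _ = _ := by ring

/-- The filtered algebra of matrix coefficient functions with weighted norms. -/
def FA (w : Wt n) : FiltAlg C(Gp n, ℝ) (El w) where
  i := El.inc w
  inj := El.inc_injective
  one := El.mk' w (one_mem_Vp 0)
  i_one := rfl
  mul {j k l} h x y := El.mk' w (h ▸ Vp_mul_mem (El.inc_mem x) (El.inc_mem y))
  i_mul h x y := rfl
  norm_mul h x y := by
    subst h
    exact n2_mul_le_weight (El.inc_mem x) (El.inc_mem y)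

/-- The Banach algebra in which the equation is solved. -/
abbrev AA (w : Wt n) : Type := Rees (FA w)

/-- Levelwise components as continuous functions. -/
def comp (X : AA w) (l : ℕ) : C(Gp n, ℝ) := El.inc w l (X.coef l)

theorem comp_mem (X : AA w) (l : ℕ) : comp X l ∈ Vp n l := El.inc_mem _

theorem AA_ext {X Y : AA w} (h : ∀ l, comp X l = comp Y l) : X = Y :=
  Rees.ext' fun l => El.inc_injective l (h l)

theorem norm_coef_eq (X : AA w) (l : ℕ) : ‖X.coef l‖ = w.W l * n2 (comp X l) := rfl

theorem n2_comp_le (X : AA w) (l : ℕ) : w.W l * n2 (comp X l) ≤ ‖X‖ := X.norm_coef_le l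

@[simp] theorem comp_add (X Y : AA w) (l : ℕ) : comp (X + Y) l = comp X l + comp Y l := map_add _ _ _
@[simp] theorem comp_sub (X Y : AA w) (l : ℕ) : comp (X - Y) l = comp X l - comp Y l := map_sub _ _ _
@[simp] theorem comp_smul (c : ℝ) (X : AA w) (l : ℕ) : comp (c • X) l = c • comp X l :=
  map_smul (El.inc w l) c (X.coef l)

/-- An element of the algebra from a sequence of functions. -/
def ofFun (w : Wt n) (y : ℕ → C(Gp n, ℝ)) (hy : ∀ l, y l ∈ Vp n l)
    (hs : Summable fun l => w.W l * n2 (y l)) : AA w :=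
  Rees.ofSeq (fun l => El.mk' w (hy l)) hs

@[simp] theorem comp_ofFun {y : ℕ → C(Gp n, ℝ)} (hy : ∀ l, y l ∈ Vp n l)
    (hs : Summable fun l => w.W l * n2 (y l)) (l : ℕ) : comp (ofFun w y hy hs) l = y l := rfl

/-- A linear map of functions preserving each `Vp n l` as a map of `El w l`. -/
def El.map (w : Wt n) (T : C(Gp n, ℝ) →ₗ[ℝ] C(Gp n, ℝ)) {l : ℕ} (hT : ∀ y ∈ Vp n l, T y ∈ Vp n l) :
    El w l →ₗ[ℝ] El w l := T.restrict hT

@[simp] theorem El.inc_map (T : C(Gp n, ℝ) →ₗ[ℝ] C(Gp n, ℝ)) {l : ℕ}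
    (hT : ∀ y ∈ Vp n l, T y ∈ Vp n l) (x : El w l) :
    El.inc w l (El.map w T hT x) = T (El.inc w l x) := rfl

/-- Right translation as a linear map. -/
def Rtl (g : Gp n) : C(Gp n, ℝ) →ₗ[ℝ] C(Gp n, ℝ) := (Rt g).toLinearMap

theorem Rtl_mem (g : Gp n) {l : ℕ} (y : C(Gp n, ℝ)) (hy : y ∈ Vp n l) : Rtl g y ∈ Vp n l :=
  Rt_mem g hy

theorem El.norm_map_Rtl (g : Gp n) {l : ℕ} (x : El w l) : ‖El.map w (Rtl g) (Rtl_mem g) x‖ = ‖x‖ :=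
  congrArg (w.W l * ·) (n2_Rt g (El.inc w l x))

/-- Right translations on the algebra. -/
def RR (w : Wt n) (g : Gp n) : AA w →L[ℝ] AA w :=
  Rees.lift (fun _ => El.map w (Rtl g) (Rtl_mem g)) 1
    (fun l x => by rw [one_mul, El.norm_map_Rtl]) (FA w)

@[simp] theorem comp_RR (g : Gp n) (X : AA w) (l : ℕ) : comp (RR w g X) l = Rt g (comp X l) := rfl

theorem norm_RR_le (g : Gp n) (X : AA w) : ‖RR w g X‖ ≤ ‖X‖ := by
  have : ‖RR w g X‖ ≤ 1 * ‖X‖ := Rees.norm_lift_le _ _ _ X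
  rwa [one_mul] at this

theorem comp_mul (X Y : AA w) (l : ℕ) : comp (X * Y) l =
    ∑ p ∈ Finset.HasAntidiagonal.antidiagonal l, comp X p.1 * comp Y p.2 :=
  Rees.i_coef_mul X Y l

theorem comp_one_zero : comp (1 : AA w) 0 = 1 := by
  change El.inc w 0 ((1 : AA w).coef 0) = 1
  rw [Rees.coef_one_zero]; rfl

theorem comp_one_succ (l : ℕ) : comp (1 : AA w) (l + 1) = 0 := by
  change El.inc w (l + 1) ((1 : AA w).coef (l + 1)) = 0
  rw [Rees.coef_one_succ, map_zero]

theorem RR_mul (g : Gp n) (X Y : AA w) : RR w g (X * Y) = RR w g X * RR w g Y :=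
  AA_ext fun l => by simp only [comp_RR, comp_mul, map_sum, map_mul]

theorem RR_one (g : Gp n) : RR w g 1 = 1 := AA_ext fun l => by
  cases l with
  | zero => simp only [comp_RR, comp_one_zero, map_one]
  | succ l => simp only [comp_RR, comp_one_succ, map_zero]

/-- Right translation as an algebra homomorphism. -/
def RRa (w : Wt n) (g : Gp n) : AA w →ₐ[ℝ] AA w :=
  AlgHom.ofLinearMap (RR w g).toLinearMap (RR_one g) (RR_mul g)

theorem RRa_apply (g : Gp n) (X : AA w) : RRa w g X = RR w g X := rfl

theorem RR_RR (g h : Gp n) (X : AA w) : RR w g (RR w h X) = RR w (g * h) X :=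
  AA_ext fun l => by
    simp only [comp_RR]
    ext k
    change comp X l (k * g * h) = comp X l (k * (g * h))
    rw [mul_assoc]

theorem continuous_RR (X : AA w) : Continuous fun g => RR w g X := by
  refine Rees.continuous_lift (T := fun g _ => El.map w (Rtl g) (Rtl_mem g)) (c := 1) (fun g l x => ?_) (fun l x => ?_) X
  · rw [one_mul, El.norm_map_Rtl]
  · rw [continuous_iff_continuousAt]
    intro g
    rw [ContinuousAt, tendsto_iff_norm_sub_tendsto_zero]
    have h := (continuous_Rt (El.inc_mem x)).tendsto g
    rw [tendsto_iff_norm_sub_tendsto_zero] at h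
    refine squeeze_zero (fun _ => norm_nonneg _) (fun g' => ?_)
      (by simpa using h.const_mul (w.W l))
    rw [El.norm_def, map_sub, El.inc_map, El.inc_map]
    exact mul_le_mul_of_nonneg_left (n2_le_norm _) (w.pos l).le

/-- The matrix coefficients in the algebra. -/
def XX (w : Wt n) (v z : Eucl n) : AA w := Rees.hom (FA w) 1 (El.mk' w (cf_mem_Vp v z))

theorem comp_hom_self {l : ℕ} (x : El w l) : comp (Rees.hom (FA w) l x) l = El.inc w l x := by
  unfold comp; rw [Rees.coef_hom_self]

theorem comp_hom_ne {l m : ℕ} (x : El w l) (h : m ≠ l) : comp (Rees.hom (FA w) l x) m = 0 := by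
  unfold comp; rw [Rees.coef_hom_ne _ h, map_zero]

theorem comp_XX_one (v z : Eucl n) : comp (XX w v z) 1 = cf v z := comp_hom_self _

theorem comp_XX_ne (v z : Eucl n) {m : ℕ} (h : m ≠ 1) : comp (XX w v z) m = 0 := comp_hom_ne _ h

theorem XX_ext {X : AA w} {v z : Eucl n} (h1 : comp X 1 = cf v z) (h : ∀ m ≠ 1, comp X m = 0) :
    X = XX w v z := AA_ext fun l => by
  by_cases hl : l = 1
  · subst hl; rw [h1, comp_XX_one]
  · rw [h l hl, comp_XX_ne _ _ hl]

theorem RR_XX (g : Gp n) (v z : Eucl n) : RR w g (XX w v z) = XX w v (g.1 z) :=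
  XX_ext (by rw [comp_RR, comp_XX_one, Rt_cf]) fun m h => by rw [comp_RR, comp_XX_ne _ _ h, map_zero]

theorem XX_smul_right (c : ℝ) (v z : Eucl n) : XX w v (c • z) = c • XX w v z :=
  (XX_ext (by rw [comp_smul, comp_XX_one]; ext k; simp [cf, inner_smul_right]) fun m h => by
    rw [comp_smul, comp_XX_ne _ _ h, smul_zero]).symm

theorem norm_XX_le (v z : Eucl n) : ‖XX w v z‖ ≤ w.W 1 * (‖v‖ * ‖z‖) := by
  rw [XX, Rees.norm_hom, El.norm_def, El.inc_mk']
  exact mul_le_mul_of_nonneg_left ((n2_le_norm _).trans (norm_cf_le v z)) (w.pos 1).le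

theorem continuous_XX (v : Eucl n) : Continuous fun z => XX w v z := by
  refine AddMonoidHomClass.continuous_of_bound
    (AddMonoidHom.mk' (fun z => XX w v z) fun a b => (XX_ext ?_ fun m h => ?_).symm)
    (w.W 1 * ‖v‖) fun z => ?_
  · rw [comp_add, comp_XX_one, comp_XX_one]; ext k; simp [cf, inner_add_right]
  · rw [comp_add, comp_XX_ne _ _ h, comp_XX_ne _ _ h, add_zero]
  · rw [mul_assoc]; exact norm_XX_le v z

/-- A positive parameter, equal to `ε` if `ε` is positive. -/
def posp (ε : ℝ) : ℝ := if 0 < ε then ε else 1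

theorem posp_pos (ε : ℝ) : 0 < posp ε := by
  unfold posp; split_ifs with h
  exacts [h, one_pos]

theorem posp_eq {ε : ℝ} (h : 0 < ε) : posp ε = ε := if_pos h

/-- The resolvent at level `l`. -/
def El.res (w : Wt n) (ε : ℝ) (l : ℕ) : El w l →ₗ[ℝ] El w l := resol n (posp_pos ε).le l

theorem El.norm_res_le (ε : ℝ) {l : ℕ} (x : El w l) : ‖El.res w ε l x‖ ≤ 1 * ‖x‖ := by
  rw [one_mul]
  exact mul_le_mul_of_nonneg_left (n2_resol_le (posp_pos ε).le (x : Vp n l)) (w.pos l).le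

theorem El.norm_map_Lij_res_le (ε : ℝ) (i j : Fin n) {l : ℕ} (x : El w l) :
    ‖(El.map w (Lij i j) (fun _ hy => Lij_mem i j hy) ∘ₗ El.res w ε l) x‖ ≤
      (√(posp ε))⁻¹ * ‖x‖ := by
  rw [← div_eq_inv_mul, le_div_iff₀' (Real.sqrt_pos.mpr (posp_pos ε))]
  have := mul_le_mul_of_nonneg_left
    (sqrt_mul_n2_Lij_resol_le (posp_pos ε).le (x : Vp n l) i j) (w.pos l).le
  rw [mul_left_comm] at this
  exact this

theorem El.norm_map_Lij_map_Lij_res_le (ε : ℝ) (i' j' i j : Fin n) {l : ℕ} (x : El w l) :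
    ‖(El.map w (Lij i' j') (fun _ hy => Lij_mem i' j' hy) ∘ₗ
      El.map w (Lij i j) (fun _ hy => Lij_mem i j hy) ∘ₗ El.res w ε l) x‖ ≤
      2 / posp ε * ‖x‖ := by
  rw [div_mul_eq_mul_div, le_div_iff₀' (posp_pos ε)]
  have := mul_le_mul_of_nonneg_left
    (mul_n2_Lij_Lij_resol_le (posp_pos ε).le (x : Vp n l) i j i' j') (w.pos l).le
  rw [mul_left_comm, mul_left_comm (w.W l) 2] at this
  exact this

/-- The resolvent on the algebra. -/
def SS (w : Wt n) (ε : ℝ) : AA w →L[ℝ] AA w :=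
  Rees.lift (El.res w ε) 1 (fun _ => El.norm_res_le ε) (FA w)

theorem comp_SS (ε : ℝ) (X : AA w) (l : ℕ) :
    comp (SS w ε X) l = resol n (posp_pos ε).le l ⟨comp X l, comp_mem X l⟩ := rfl

theorem norm_SS_le (ε : ℝ) (X : AA w) : ‖SS w ε X‖ ≤ ‖X‖ := by
  have := Rees.norm_lift_le (El.res w ε) 1 (fun _ => El.norm_res_le ε) (S := FA w) X
  rwa [one_mul] at this

/-- First derivatives of the resolvent. -/
def LS (w : Wt n) (i j : Fin n) (ε : ℝ) : AA w →L[ℝ] AA w :=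
  Rees.lift (fun l => El.map w (Lij i j) (fun _ hy => Lij_mem i j hy) ∘ₗ El.res w ε l)
    (√(posp ε))⁻¹ (fun _ => El.norm_map_Lij_res_le ε i j) (FA w)

theorem comp_LS (i j : Fin n) (ε : ℝ) (X : AA w) (l : ℕ) :
    comp (LS w i j ε X) l = Lij i j (comp (SS w ε X) l) := rfl

theorem norm_LS_le (i j : Fin n) {ε : ℝ} (hε : 0 < ε) (X : AA w) :
    ‖LS w i j ε X‖ ≤ (√ε)⁻¹ * ‖X‖ := by
  have : ‖LS w i j ε X‖ ≤ (√(posp ε))⁻¹ * ‖X‖ := Rees.norm_lift_le _ _ _ X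
  rwa [posp_eq hε] at this

/-- Second derivatives of the resolvent. -/
def LLS (w : Wt n) (i' j' i j : Fin n) (ε : ℝ) : AA w →L[ℝ] AA w :=
  Rees.lift (fun l => El.map w (Lij i' j') (fun _ hy => Lij_mem i' j' hy) ∘ₗ
      El.map w (Lij i j) (fun _ hy => Lij_mem i j hy) ∘ₗ El.res w ε l) (2 / posp ε)
    (fun _ => El.norm_map_Lij_map_Lij_res_le ε i' j' i j) (FA w)

theorem norm_LLS_le (i' j' i j : Fin n) {ε : ℝ} (hε : 0 < ε) (X : AA w) :
    ‖LLS w i' j' i j ε X‖ ≤ 2 / ε * ‖X‖ := by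
  have : ‖LLS w i' j' i j ε X‖ ≤ 2 / posp ε * ‖X‖ := Rees.norm_lift_le _ _ _ X
  rwa [posp_eq hε] at this

theorem RR_SS (g : Gp n) (ε : ℝ) (X : AA w) : RR w g (SS w ε X) = SS w ε (RR w g X) :=
  AA_ext fun l => by
    rw [comp_RR, comp_SS, comp_SS]
    exact (resol_Rt (posp_pos ε).le g ⟨comp X l, comp_mem X l⟩).symm

theorem RR_LS (g : Gp n) (i j : Fin n) (ε : ℝ) (X : AA w) :
    RR w g (LS w i j ε X) = LS w i j ε (RR w g X) :=
  AA_ext fun l => by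
    rw [comp_RR, comp_LS, comp_LS, ← RR_SS, comp_RR, Lij_Rt _ _ _ (comp_mem _ _)]

theorem comp_LLS (i' j' i j : Fin n) (ε : ℝ) (X : AA w) (l : ℕ) :
    comp (LLS w i' j' i j ε X) l = Lij i' j' (Lij i j (comp (SS w ε X) l)) := rfl

/-- `X'` is the derivative `Lij i j X`. -/
def IsL (i j : Fin n) (X X' : AA w) : Prop := ∀ l, comp X' l = Lij i j (comp X l)

theorem isL_LS (i j : Fin n) (ε : ℝ) (X : AA w) : IsL i j (SS w ε X) (LS w i j ε X) :=
  fun _ => rfl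

theorem isL_LLS (i' j' i j : Fin n) (ε : ℝ) (X : AA w) :
    IsL i' j' (LS w i j ε X) (LLS w i' j' i j ε X) := fun _ => rfl

theorem IsL.add {i j : Fin n} {X X' Y Y' : AA w} (h : IsL i j X X') (h' : IsL i j Y Y') :
    IsL i j (X + Y) (X' + Y') := fun l => by rw [comp_add, comp_add, map_add, h, h']

theorem IsL.sub {i j : Fin n} {X X' Y Y' : AA w} (h : IsL i j X X') (h' : IsL i j Y Y') :
    IsL i j (X - Y) (X' - Y') := fun l => by rw [comp_sub, comp_sub, map_sub, h, h']

theorem IsL.smul {i j : Fin n} {X X' : AA w} (h : IsL i j X X') (c : ℝ) :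
    IsL i j (c • X) (c • X') := fun l => by rw [comp_smul, comp_smul, map_smul, h]

theorem comp_zero (l : ℕ) : comp (0 : AA w) l = 0 := map_zero _

theorem IsL.zero (i j : Fin n) : IsL i j (0 : AA w) 0 := fun l => by
  rw [comp_zero, map_zero]

theorem IsL.sum {i j : Fin n} {ι : Type*} (s : Finset ι) {X X' : ι → AA w}
    (h : ∀ a ∈ s, IsL i j (X a) (X' a)) : IsL i j (∑ a ∈ s, X a) (∑ a ∈ s, X' a) := by
  classical
  induction s using Finset.induction_on with
  | empty => exact IsL.zero i j
  | insert a s ha ih =>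
    rw [Finset.sum_insert ha, Finset.sum_insert ha]
    exact (h a (Finset.mem_insert_self a s)).add
      (ih fun b hb => h b (Finset.mem_insert_of_mem hb))

theorem IsL.mul {i j : Fin n} {X X' Y Y' : AA w} (h : IsL i j X X') (h' : IsL i j Y Y') :
    IsL i j (X * Y) (X' * Y + X * Y') := fun l => by
  rw [comp_add, comp_mul, comp_mul, comp_mul, map_sum, ← Finset.sum_add_distrib]
  refine Finset.sum_congr rfl fun p _ => ?_
  rw [h, h', Lij_mul _ _ (isSm_of_mem (comp_mem _ _)) (isSm_of_mem (comp_mem _ _))]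

theorem isL_XX (i j : Fin n) (v z : Eucl n) :
    IsL i j (XX w v z) (⟪eb i, v⟫ • XX w (eb j) z - ⟪eb j, v⟫ • XX w (eb i) z) := fun l => by
  rw [comp_sub, comp_smul, comp_smul]
  by_cases h : l = 1
  · subst h; simp only [comp_XX_one, Lij_cf]
  · simp only [comp_XX_ne _ _ h, smul_zero, sub_zero, map_zero]

theorem norm_RR_gz_sub_le {e ω : Eucl n} (he : ‖e‖ = 1) (hω : ‖ω‖ = 1) {X : AA w}
    {X' : Fin n → Fin n → AA w} (h : ∀ i j, IsL i j X (X' i j)) :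
    ‖RR w (gz e ω) X - X‖ ≤ 4 * ‖ω - e‖ * (‖X‖ + ∑ i, ∑ j, ‖X' i j‖) := by
  have hs : HasSum (fun l => 4 * ‖ω - e‖ * (‖X.coef l‖ + ∑ i, ∑ j, ‖(X' i j).coef l‖))
      (4 * ‖ω - e‖ * (‖X‖ + ∑ i, ∑ j, ‖X' i j‖)) := by
    have hX : ∀ Y : AA w, HasSum (fun l => ‖Y.coef l‖) ‖Y‖ := fun Y => by
      rw [Rees.norm_eq]; exact Y.summable.hasSum
    exact ((hX X).add (hasSum_sum fun i _ => hasSum_sum fun j _ => hX (X' i j))).mul_left _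
  refine Rees.norm_le_of_hasSum hs fun l => ?_
  rw [norm_coef_eq, norm_coef_eq, comp_sub, comp_RR]
  have := mul_le_mul_of_nonneg_left (n2_Rt_gz_sub_le he hω (comp_mem X l)) (w.pos l).le
  refine this.trans (le_of_eq ?_)
  simp only [norm_coef_eq, ← Finset.mul_sum, h _ _ l]
  ring

/-- Point evaluation as a character. -/
def evk (w : Wt n) (k : Gp n) : AA w →ₐ[ℝ] ℝ :=
  Rees.char (S := FA w) (ContinuousMap.evalAlgHom ℝ ℝ k) fun l x => by
    refine ((El.inc w l x).norm_coe_le_norm k).trans ((norm_le_of_mem_Vp (El.inc_mem x)).trans ?_)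
    exact mul_le_mul_of_nonneg_right (w.ge l) (n2_nonneg _)

theorem hasSum_evk (k : Gp n) (X : AA w) : HasSum (fun l => comp X l k) (evk w k X) :=
  Rees.hasSum_char _ _ X

theorem abs_evk_le (k : Gp n) (X : AA w) : |evk w k X| ≤ ‖X‖ := Rees.abs_char_le _ _ X

/-- Point evaluation as a continuous functional. -/
def evkL (w : Wt n) (k : Gp n) : AA w →L[ℝ] ℝ :=
  LinearMap.mkContinuous (evk w k).toLinearMap 1 fun X => by rw [one_mul]; exact abs_evk_le k X

theorem evkL_apply (k : Gp n) (X : AA w) : evkL w k X = evk w k X := rfl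

theorem evk_RR (k g : Gp n) (X : AA w) : evk w k (RR w g X) = evk w (k * g) X :=
  (hasSum_evk k (RR w g X)).unique (hasSum_evk (k * g) X)

theorem evk_XX (k : Gp n) (v z : Eucl n) : evk w k (XX w v z) = ⟪v, k.1 z⟫ := by
  have h := hasSum_evk k (XX w v z)
  have h' := hasSum_single (f := fun l => comp (XX w v z) l k) 1 fun m hm => by
    simp only [comp_XX_ne _ _ hm]; rfl
  rw [h.unique h']
  simp only [comp_XX_one]; rfl

end Concrete

end

section

section BLcalc

set_option linter.unusedSectionVars false

variable {A : Type*} [NormedCommRing A] [NormedAlgebra ℝ A]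

/-- `F` is bounded and Lipschitz on the ball of radius `r`, with scale-invariant norm at most `N`. -/
def BL (r N : ℝ) (F : A → A) : Prop :=
  ∀ g, ‖g‖ ≤ r → 2 * ‖F g‖ ≤ N ∧ ∀ g', ‖g'‖ ≤ r → 2 * r * ‖F g - F g'‖ ≤ N * ‖g - g'‖

namespace BL

variable {r N N' : ℝ} {F F' : A → A}

theorem nonneg (hr : 0 ≤ r) (h : BL r N F) : 0 ≤ N :=
  (by positivity : 0 ≤ 2 * ‖F 0‖).trans (h 0 (by simpa using hr)).1

theorem mono (h : BL r N F) (hN : N ≤ N') : BL r N' F := fun g hg =>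
  ⟨(h g hg).1.trans hN, fun g' hg' => ((h g hg).2 g' hg').trans (by gcongr)⟩

theorem min' (h : BL r N F) (h' : BL r N' F) : BL r (min N N') F := by
  rcases min_choice N N' with e | e <;> rw [e] <;> assumption

theorem add (h : BL r N F) (h' : BL r N' F') : BL r (N + N') fun g => F g + F' g := fun g hg =>
  ⟨by linarith [norm_add_le (F g) (F' g), (h g hg).1, (h' g hg).1], fun g' hg' => by
    have h1 : F g + F' g - (F g' + F' g') = (F g - F g') + (F' g - F' g') := by abel
    have hr : 0 ≤ 2 * r := by linarith [norm_nonneg g]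
    rw [h1, add_mul]
    calc 2 * r * ‖F g - F g' + (F' g - F' g')‖ ≤ 2 * r * (‖F g - F g'‖ + ‖F' g - F' g'‖) :=
          mul_le_mul_of_nonneg_left (norm_add_le _ _) hr
      _ ≤ _ := by rw [mul_add]; exact add_le_add ((h g hg).2 g' hg') ((h' g hg).2 g' hg')⟩

theorem neg (h : BL r N F) : BL r N fun g => -F g := fun g hg =>
  ⟨by rw [norm_neg]; exact (h g hg).1, fun g' hg' => by
    rw [neg_sub_neg, norm_sub_rev]; exact (h g hg).2 g' hg'⟩

theorem mul (h : BL r N F) (h' : BL r N' F') : BL r (N * N') fun g => F g * F' g := fun g hg => by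
  have hr : 0 ≤ r := (norm_nonneg g).trans hg
  have hN := h.nonneg hr
  have hN' := h'.nonneg hr
  refine ⟨?_, fun g' hg' => ?_⟩
  · have a := (h g hg).1
    have b := (h' g hg).1
    have := norm_mul_le (F g) (F' g)
    nlinarith [norm_nonneg (F g), norm_nonneg (F' g)]
  · have h1 : F g * F' g - F g' * F' g' = (F g - F g') * F' g + F g' * (F' g - F' g') := by ring
    rw [h1]
    have a := (h g' hg').1
    have b := (h' g hg).1
    have c := (h g hg).2 g' hg'
    have d := (h' g hg).2 g' hg'
    calc 2 * r * ‖(F g - F g') * F' g + F g' * (F' g - F' g')‖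
        ≤ 2 * r * (‖F g - F g'‖ * ‖F' g‖ + ‖F g'‖ * ‖F' g - F' g'‖) := by
          gcongr
          exact (norm_add_le _ _).trans (add_le_add (norm_mul_le _ _) (norm_mul_le _ _))
      _ = (2 * r * ‖F g - F g'‖) * ‖F' g‖ + ‖F g'‖ * (2 * r * ‖F' g - F' g'‖) := by ring
      _ ≤ (N * ‖g - g'‖) * (N' / 2) + (N / 2) * (N' * ‖g - g'‖) := by
          gcongr <;> linarith
      _ = _ := by ring

theorem const (_ : 0 ≤ r) (c : A) : BL r (2 * ‖c‖) fun _ => c := fun g _ =>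
  ⟨le_rfl, fun g' _ => by rw [sub_self, norm_zero, mul_zero]; positivity⟩

theorem id' : BL r (2 * r) fun g : A => g := fun g hg => ⟨by linarith, fun g' _ => le_rfl⟩

theorem comp_le {T : A → A} {c : ℝ} (hT : ∀ x y, T (x - y) = T x - T y)
    (hc : ∀ x, ‖T x‖ ≤ c * ‖x‖) (hc0 : 0 ≤ c) (h : BL r N F) : BL r (c * N) fun g => T (F g) :=
  fun g hg => by
  have hr : 0 ≤ r := (norm_nonneg g).trans hg
  refine ⟨by nlinarith [hc (F g), (h g hg).1], fun g' hg' => ?_⟩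
  rw [← hT]
  calc 2 * r * ‖T (F g - F g')‖ ≤ 2 * r * (c * ‖F g - F g'‖) := by gcongr; exact hc _
    _ = c * (2 * r * ‖F g - F g'‖) := by ring
    _ ≤ c * (N * ‖g - g'‖) := mul_le_mul_of_nonneg_left ((h g hg).2 g' hg') hc0
    _ = _ := by ring

theorem smul (c : ℝ) (h : BL r N F) : BL r (|c| * N) fun g => c • F g :=
  h.comp_le (T := fun x => c • x) (fun _ _ => smul_sub _ _ _)
    (fun x => (norm_smul_le c x).trans_eq (by rw [Real.norm_eq_abs])) (abs_nonneg c)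

theorem dom {κ : Type*} (s : Finset κ) {G : κ → A → A} {c : ℝ} (hc : 0 ≤ c)
    (h1 : ∀ g, ‖F g‖ ≤ c * ∑ a ∈ s, ‖G a g‖)
    (h2 : ∀ g g', ‖F g - F g'‖ ≤ c * ∑ a ∈ s, ‖G a g - G a g'‖) (h : ∀ a ∈ s, BL r N (G a)) :
    BL r (c * s.card * N) F := fun g hg => by
  have hr : 0 ≤ r := (norm_nonneg g).trans hg
  refine ⟨?_, fun g' hg' => ?_⟩
  · calc 2 * ‖F g‖ ≤ 2 * (c * ∑ a ∈ s, ‖G a g‖) := by gcongr; exact h1 g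
      _ = c * ∑ a ∈ s, 2 * ‖G a g‖ := by rw [← Finset.mul_sum]; ring
      _ ≤ c * ∑ a ∈ s, N := by gcongr with a ha; exact (h a ha g hg).1
      _ = _ := by rw [Finset.sum_const, nsmul_eq_mul, mul_assoc]
  · calc 2 * r * ‖F g - F g'‖ ≤ 2 * r * (c * ∑ a ∈ s, ‖G a g - G a g'‖) := by
          gcongr; exact h2 g g'
      _ = c * ∑ a ∈ s, 2 * r * ‖G a g - G a g'‖ := by rw [← Finset.mul_sum]; ring
      _ ≤ c * ∑ a ∈ s, N * ‖g - g'‖ :=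
          mul_le_mul_of_nonneg_left (Finset.sum_le_sum fun a ha => (h a ha g hg).2 g' hg') hc
      _ = _ := by rw [Finset.sum_const, nsmul_eq_mul]; ring

theorem pow (h : BL r N F) (m : ℕ) : BL r (N ^ (m + 1)) fun g => F g ^ (m + 1) := by
  induction m with
  | zero => simpa using h
  | succ m ih => simpa only [pow_succ _ (m + 1)] using ih.mul h

theorem tsum [CompleteSpace A] {F : ℕ → A → A} {N : ℕ → ℝ} (h : ∀ m, BL r (N m) (F m)) (hN : Summable N) :
    BL r (∑' m, N m) fun g => ∑' m, F m g := fun g hg => by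
  have hs : ∀ g, ‖g‖ ≤ r → Summable fun m => ‖F m g‖ := fun g hg =>
    hN.of_nonneg_of_le (fun _ => norm_nonneg _) fun m => by
      linarith [(h m g hg).1, norm_nonneg (F m g)]
  have hr : 0 ≤ r := (norm_nonneg g).trans hg
  refine ⟨?_, fun g' hg' => ?_⟩
  · have : ‖∑' m, F m g‖ ≤ ∑' m, N m / 2 :=
      tsum_of_norm_bounded (hN.div_const 2).hasSum fun m => by linarith [(h m g hg).1]
    rw [tsum_div_const] at this
    linarith
  · rw [← (hs g hg).of_norm.tsum_sub (hs g' hg').of_norm]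
    rcases hr.eq_or_lt with h0 | h0
    · rw [← h0, mul_zero, zero_mul]
      exact mul_nonneg (tsum_nonneg fun m => (h m).nonneg hr) (norm_nonneg _)
    · have : ‖∑' m, (F m g - F m g')‖ ≤ ∑' m, N m * (‖g - g'‖ / (2 * r)) :=
        tsum_of_norm_bounded (hN.mul_right _).hasSum fun m => by
          rw [mul_div_assoc', le_div_iff₀' (by positivity)]
          exact (h m g hg).2 g' hg'
      rw [tsum_mul_right, mul_div_assoc', le_div_iff₀' (by positivity)] at this
      exact this

end BL

/-- The power series `∑ c m a ^ (m + 1)`. -/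
def ps (c : ℕ → ℝ) (a : A) : A := ∑' m, c m • a ^ (m + 1)

theorem norm_ps_term_le (c : ℕ → ℝ) {ρ : ℝ} {a : A} (ha : ‖a‖ ≤ ρ) (m : ℕ) :
    ‖c m • a ^ (m + 1)‖ ≤ ρ * (|c m| * ρ ^ m) := by
  refine (norm_smul_le _ _).trans ?_
  rw [Real.norm_eq_abs, mul_left_comm, ← pow_succ']
  gcongr
  exact (norm_pow_le' a m.succ_pos).trans (by gcongr)

theorem hasSum_ps [CompleteSpace A] {c : ℕ → ℝ} {ρ : ℝ} (hc : Summable fun m => |c m| * ρ ^ m)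
    {a : A} (ha : ‖a‖ ≤ ρ) : HasSum (fun m => c m • a ^ (m + 1)) (ps c a) :=
  (Summable.of_norm_bounded (hc.mul_left ρ) (norm_ps_term_le c ha)).hasSum

theorem map_ps {B : Type*} [NormedCommRing B] [NormedAlgebra ℝ B] [CompleteSpace A] (φ : A →ₐ[ℝ] B)
    (hφ : Continuous φ) {c : ℕ → ℝ} {ρ : ℝ} (hc : Summable fun m => |c m| * ρ ^ m)
    {a : A} (ha : ‖a‖ ≤ ρ) : φ (ps c a) = ps c (φ a) := by
  have := (hasSum_ps hc ha).map φ hφ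
  simp only [Function.comp_def, map_smul, map_pow] at this
  exact this.tsum_eq.symm

theorem continuous_ps {X : Type*} [TopologicalSpace X] [CompleteSpace A] {c : ℕ → ℝ} {ρ : ℝ}
    (hc : Summable fun m => |c m| * ρ ^ m) {f : X → A} (hf : Continuous f) (h : ∀ x, ‖f x‖ ≤ ρ) :
    Continuous fun x => ps c (f x) :=
  continuous_tsum (fun m => (hf.pow (m + 1)).const_smul (c m)) (hc.mul_left ρ)
    fun m x => norm_ps_term_le c (h x) m

theorem BL.ps' [CompleteSpace A] {r N ρ : ℝ} {F : A → A} {c : ℕ → ℝ} (hr : 0 ≤ r)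
    (hc : Summable fun m => |c m| * ρ ^ m) (h : BL r N F) (hN : N ≤ ρ) :
    BL r ((∑' m, |c m| * ρ ^ m) * N) fun g => ps c (F g) := by
  have hN0 := h.nonneg hr
  rw [← tsum_mul_right]
  refine BL.tsum (fun m => ((h.pow m).smul (c m)).mono ?_) (hc.mul_right N)
  rw [pow_succ, ← mul_assoc]
  gcongr

/-- Uniform asymptotic control of a family of nonlinear maps: for small `r` and then small `ε`. -/
def OO {ι : Type*} (m : ℝ → ι → ℝ) (F : ℝ → ι → A → A) : Prop :=
  ∃ C, 0 ≤ C ∧ ∀ᶠ r in 𝓝[>] (0 : ℝ), ∀ᶠ ε in 𝓝[>] (0 : ℝ), ∀ z, BL r (C * m r z) (F ε z)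

namespace OO

variable {ι : Type*} {m m' : ℝ → ι → ℝ} {F F' : ℝ → ι → A → A}

theorem add (h : OO m F) (h' : OO m F') : OO m fun ε z g => F ε z g + F' ε z g := by
  obtain ⟨C, hC, h⟩ := h
  obtain ⟨C', hC', h'⟩ := h'
  refine ⟨C + C', add_nonneg hC hC', ?_⟩
  filter_upwards [h, h'] with r h h'
  filter_upwards [h, h'] with ε h h' z
  rw [add_mul]
  exact (h z).add (h' z)

theorem neg (h : OO m F) : OO m fun ε z g => -F ε z g := by
  obtain ⟨C, hC, h⟩ := h
  exact ⟨C, hC, h.mono fun r h => h.mono fun ε h z => (h z).neg⟩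

theorem sub (h : OO m F) (h' : OO m F') : OO m fun ε z g => F ε z g - F' ε z g := by
  simpa only [sub_eq_add_neg] using h.add h'.neg

theorem mul (h : OO m F) (h' : OO m' F') :
    OO (fun r z => m r z * m' r z) fun ε z g => F ε z g * F' ε z g := by
  obtain ⟨C, hC, h⟩ := h
  obtain ⟨C', hC', h'⟩ := h'
  refine ⟨C * C', mul_nonneg hC hC', ?_⟩
  filter_upwards [h, h'] with r h h'
  filter_upwards [h, h'] with ε h h' z
  rw [mul_mul_mul_comm]
  exact (h z).mul (h' z)

theorem mono (h : OO m F) {K : ℝ} (hK : 0 ≤ K)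
    (hm : ∀ᶠ r in 𝓝[>] (0 : ℝ), ∀ z, m r z ≤ K * m' r z) : OO m' F := by
  obtain ⟨C, hC, h⟩ := h
  refine ⟨C * K, mul_nonneg hC hK, ?_⟩
  filter_upwards [h, hm] with r h hm
  filter_upwards [h] with ε h z
  refine (h z).mono ?_
  rw [mul_assoc]
  exact mul_le_mul_of_nonneg_left (hm z) hC

theorem comp_le {T : ℝ → ι → A → A} {c : ℝ} (hT : ∀ ε z x y, T ε z (x - y) = T ε z x - T ε z y)
    (hc : ∀ᶠ ε in 𝓝[>] (0 : ℝ), ∀ z x, ‖T ε z x‖ ≤ c * ‖x‖) (hc0 : 0 ≤ c) (h : OO m F) :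
    OO m fun ε z g => T ε z (F ε z g) := by
  obtain ⟨C, hC, h⟩ := h
  refine ⟨c * C, mul_nonneg hc0 hC, ?_⟩
  filter_upwards [h] with r h
  filter_upwards [h, hc] with ε h hc z
  rw [mul_assoc]
  exact (h z).comp_le (hT ε z) (hc z) hc0

theorem smul {t : ℝ → ι → ℝ} {c : ℝ} (ht : ∀ᶠ ε in 𝓝[>] (0 : ℝ), ∀ z, |t ε z| ≤ c) (hc : 0 ≤ c)
    (h : OO m F) : OO m fun ε z g => t ε z • F ε z g :=
  h.comp_le (T := fun ε z x => t ε z • x) (fun _ _ _ _ => smul_sub _ _ _)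
    (ht.mono fun ε h z x => (norm_smul_le _ _).trans (by rw [Real.norm_eq_abs]; gcongr; exact h z)) hc

theorem const_smul (c : ℝ) (h : OO m F) : OO m fun ε z g => c • F ε z g :=
  h.smul (t := fun _ _ => c) (Eventually.of_forall fun _ _ => le_rfl) (abs_nonneg c)

theorem const (c : A) : OO (ι := ι) (fun _ _ => 1) fun _ _ _ => c := by
  refine ⟨2 * ‖c‖, by positivity, ?_⟩
  filter_upwards [self_mem_nhdsWithin] with r hr
  refine Eventually.of_forall fun ε z => ?_
  rw [mul_one]
  exact BL.const (le_of_lt hr) c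

theorem id' : OO (ι := ι) (A := A) (fun r _ => r) fun _ _ g => g :=
  ⟨2, zero_le_two, Eventually.of_forall fun _ => Eventually.of_forall fun _ _ => BL.id'⟩

theorem congr (h : OO m F) (e : ∀ᶠ ε in 𝓝[>] (0 : ℝ), ∀ z g, F ε z g = F' ε z g) : OO m F' := by
  obtain ⟨C, hC, h⟩ := h
  refine ⟨C, hC, h.mono fun r h => ?_⟩
  filter_upwards [h, e] with ε h e z
  have : F' ε z = F ε z := funext fun g => (e z g).symm
  rw [this]
  exact h z

theorem congr_gauge (h : OO m F) (e : ∀ r z, m r z = m' r z) : OO m' F := by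
  have : m = m' := funext₂ e
  rwa [← this]

theorem smul_tendsto {t : ℝ → ℝ} (ht : Tendsto t (𝓝[>] 0) (𝓝 0)) {μ : ℝ → ℝ}
    (hμ : ∀ r, 0 < r → 0 < μ r) (h : OO (fun _ _ => 1) F) :
    OO (fun r _ => μ r) fun ε z g => t ε • F ε z g := by
  obtain ⟨C, hC, h⟩ := h
  refine ⟨1, zero_le_one, ?_⟩
  filter_upwards [h, self_mem_nhdsWithin] with r h hr
  have h1 : Tendsto (fun ε => |t ε| * C) (𝓝[>] 0) (𝓝 0) := by
    simpa using ht.abs.mul_const C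
  filter_upwards [h, h1.eventually_le_const (hμ r hr)] with ε h h1 z
  refine ((h z).smul (t ε)).mono ?_
  linarith

theorem sum {κ : Type*} (s : Finset κ) {F : κ → ℝ → ι → A → A}
    (h : ∀ a ∈ s, OO m (F a)) : OO m fun ε z g => ∑ a ∈ s, F a ε z g := by
  classical
  induction s using Finset.induction_on with
  | empty =>
    refine ⟨0, le_rfl, ?_⟩
    filter_upwards [self_mem_nhdsWithin] with r hr
    refine Eventually.of_forall fun ε z => ?_
    simpa using BL.const (A := A) (le_of_lt hr) 0
  | insert a s ha ih =>
    simp only [Finset.sum_insert ha]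
    exact (h a (Finset.mem_insert_self a s)).add
      (ih fun b hb => h b (Finset.mem_insert_of_mem hb))

theorem prod {κ : Type*} (s : Finset κ) {F : κ → ℝ → ι → A → A}
    (h : ∀ a ∈ s, OO (fun _ _ => 1) (F a)) :
    OO (fun _ _ => 1) fun ε z g => ∏ a ∈ s, F a ε z g := by
  classical
  induction s using Finset.induction_on with
  | empty => simpa using const (ι := ι) (1 : A)
  | insert a s ha ih =>
    simp only [Finset.prod_insert ha]
    simpa only [mul_one] using (h a (Finset.mem_insert_self a s)).mul
      (ih fun b hb => h b (Finset.mem_insert_of_mem hb))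

theorem ps' [CompleteSpace A] {c : ℕ → ℝ} {ρ : ℝ} (hc : Summable fun k => |c k| * ρ ^ k)
    (hρ : ∀ᶠ r in 𝓝[>] (0 : ℝ), ∀ᶠ ε in 𝓝[>] (0 : ℝ), ∀ z, BL r ρ (F ε z)) (h : OO m F) :
    OO m fun ε z g => ps c (F ε z g) := by
  obtain ⟨C, hC, h⟩ := h
  by_cases hρ0 : 0 ≤ ρ
  · refine ⟨(∑' k, |c k| * ρ ^ k) * C, mul_nonneg (tsum_nonneg fun k => by positivity) hC, ?_⟩
    filter_upwards [h, hρ, self_mem_nhdsWithin] with r h hρ hr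
    filter_upwards [h, hρ] with ε h hρ z
    refine (((h z).min' (hρ z)).ps' (le_of_lt hr) hc (min_le_right _ _)).mono ?_
    rw [mul_assoc]
    exact mul_le_mul_of_nonneg_left (min_le_left _ _) (tsum_nonneg fun k => by positivity)
  · refine ⟨0, le_rfl, ?_⟩
    filter_upwards [hρ, self_mem_nhdsWithin] with r hρ hr
    filter_upwards [hρ] with ε hρ z
    exact absurd ((hρ z).nonneg (le_of_lt hr)) hρ0

theorem eventually_bdd (h : OO (fun _ _ => 1) F) : ∃ ρ, 0 ≤ ρ ∧
    ∀ᶠ r in 𝓝[>] (0 : ℝ), ∀ᶠ ε in 𝓝[>] (0 : ℝ), ∀ z, BL r ρ (F ε z) := by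
  obtain ⟨C, hC, h⟩ := h
  exact ⟨C, hC, by simpa only [mul_one] using h⟩

theorem eventually_small (h : OO (fun r _ => r) F) {ρ : ℝ} (hρ : 0 < ρ) :
    ∀ᶠ r in 𝓝[>] (0 : ℝ), ∀ᶠ ε in 𝓝[>] (0 : ℝ), ∀ z, BL r ρ (F ε z) := by
  obtain ⟨C, hC, h⟩ := h
  have h1 : Tendsto (fun r : ℝ => C * r) (𝓝[>] 0) (𝓝 0) := by
    have : Tendsto (fun r : ℝ => C * r) (𝓝 0) (𝓝 (C * 0)) := tendsto_id.const_mul C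
    rw [mul_zero] at this
    exact this.mono_left nhdsWithin_le_nhds
  filter_upwards [h, h1.eventually_le_const hρ] with r h h1
  filter_upwards [h] with ε h z using (h z).mono h1

theorem dom {κ : Type*} (s : Finset κ) {G : κ → ℝ → ι → A → A} {c : ℝ} (hc : 0 ≤ c)
    (h1 : ∀ᶠ ε in 𝓝[>] (0 : ℝ), ∀ z g, ‖F ε z g‖ ≤ c * ∑ a ∈ s, ‖G a ε z g‖)
    (h2 : ∀ᶠ ε in 𝓝[>] (0 : ℝ), ∀ z g g',
      ‖F ε z g - F ε z g'‖ ≤ c * ∑ a ∈ s, ‖G a ε z g - G a ε z g'‖)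
    (h0 : ∀ r, 0 < r → ∀ z, 0 ≤ m r z) (h : ∀ a ∈ s, OO m (G a)) : OO m F := by
  classical
  have key : ∃ C, 0 ≤ C ∧ ∀ᶠ r in 𝓝[>] (0 : ℝ), ∀ᶠ ε in 𝓝[>] (0 : ℝ), ∀ z, ∀ a ∈ s,
      BL r (C * m r z) (G a ε z) := by
    clear h1 h2
    induction s using Finset.induction_on with
    | empty => exact ⟨0, le_rfl, by simp⟩
    | insert a s ha ih =>
      obtain ⟨C, hC, hs⟩ := ih fun b hb => h b (Finset.mem_insert_of_mem hb)
      obtain ⟨C', hC', h⟩ := h a (Finset.mem_insert_self a s)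
      refine ⟨C + C', add_nonneg hC hC', ?_⟩
      filter_upwards [hs, h, self_mem_nhdsWithin] with r hs h hr
      filter_upwards [hs, h] with ε hs h z b hb
      rcases Finset.mem_insert.mp hb with rfl | hb
      · exact (h z).mono (by gcongr; exacts [h0 r hr z, by linarith])
      · exact (hs z b hb).mono (by gcongr; exacts [h0 r hr z, by linarith])
  obtain ⟨C, hC, h⟩ := key
  refine ⟨c * s.card * C, by positivity, ?_⟩
  filter_upwards [h] with r h
  filter_upwards [h, h1, h2] with ε h h1 h2 z
  rw [mul_assoc]
  exact BL.dom s hc (h1 z) (h2 z) (h z)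

theorem smul_gauge {t : ℝ → ι → ℝ} {τ : ι → ℝ} {c : ℝ} (hc : 0 ≤ c)
    (ht : ∀ᶠ ε in 𝓝[>] (0 : ℝ), ∀ z, |t ε z| ≤ c * τ z) (h : OO m F) :
    OO (fun r z => τ z * m r z) fun ε z g => t ε z • F ε z g := by
  obtain ⟨C, hC, h⟩ := h
  refine ⟨c * C, mul_nonneg hc hC, ?_⟩
  filter_upwards [h, self_mem_nhdsWithin] with r h hr
  filter_upwards [h, ht] with ε h ht z
  refine ((h z).smul (t ε z)).mono ?_
  have := mul_le_mul_of_nonneg_right (ht z) ((h z).nonneg (le_of_lt hr))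
  linarith

theorem one_of_id (h : OO (fun r _ => r) F) : OO (fun _ _ => 1) F :=
  h.mono zero_le_one (by
    filter_upwards [Ioc_mem_nhdsGT one_pos] with r hr z
    linarith [hr.2])

theorem const' (c : A) {μ : ℝ → ℝ} (hμ : ∀ r, 0 < r → 0 < μ r) {t : ℝ → ℝ}
    (ht : Tendsto t (𝓝[>] 0) (𝓝 0)) :
    OO (ι := ι) (fun r _ => μ r) fun ε _ _ => t ε • c :=
  OO.smul_tendsto ht hμ (OO.const c)

section integral

variable [MeasurableSpace ι]

theorem _root_.BL.integral [CompleteSpace A] {μ : Measure ι} {r : ℝ} {N : ι → ℝ} {F : ι → A → A}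
    (hr : 0 < r) (h : ∀ z, BL r (N z) (F z)) (hN : Integrable N μ)
    (hF : ∀ g, ‖g‖ ≤ r → AEStronglyMeasurable (fun z => F z g) μ) :
    BL r (∫ z, N z ∂μ) fun g => ∫ z, F z g ∂μ := fun g hg => by
  have hint : ∀ g, ‖g‖ ≤ r → Integrable (fun z => F z g) μ := fun g hg =>
    hN.mono' (hF g hg) (Eventually.of_forall fun z => by
      linarith [(h z g hg).1, norm_nonneg (F z g)])
  refine ⟨?_, fun g' hg' => ?_⟩
  · have := norm_integral_le_of_norm_le (hN.div_const 2) (f := fun z => F z g)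
      (Eventually.of_forall fun z => by linarith [(h z g hg).1])
    rw [integral_div] at this
    linarith
  · rw [← integral_sub (hint g hg) (hint g' hg')]
    have := norm_integral_le_of_norm_le (hN.mul_const (‖g - g'‖ / (2 * r)))
      (f := fun z => F z g - F z g') (Eventually.of_forall fun z => by
        rw [mul_div_assoc', le_div_iff₀' (by positivity)]
        exact (h z g hg).2 g' hg')
    rw [integral_mul_const, mul_div_assoc', le_div_iff₀' (by positivity)] at this
    exact this

theorem integral [CompleteSpace A] {ν : ℝ → Measure ι} {μ : ℝ → ℝ} {K : ℝ} (hK : 0 ≤ K)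
    (h : OO m F)
    (hm : ∀ᶠ r in 𝓝[>] (0 : ℝ), ∀ᶠ ε in 𝓝[>] (0 : ℝ),
      Integrable (m r) (ν ε) ∧ ∫ z, m r z ∂ν ε ≤ K * μ r)
    (hF : ∀ᶠ r in 𝓝[>] (0 : ℝ), ∀ᶠ ε in 𝓝[>] (0 : ℝ), ∀ g, ‖g‖ ≤ r →
      AEStronglyMeasurable (fun z => F ε z g) (ν ε)) :
    OO (ι := Unit) (fun r _ => μ r) fun ε _ g => ∫ z, F ε z g ∂ν ε := by
  obtain ⟨C, hC, h⟩ := h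
  refine ⟨C * K, mul_nonneg hC hK, ?_⟩
  filter_upwards [h, hm, hF, self_mem_nhdsWithin] with r h hm hF hr
  filter_upwards [h, hm, hF] with ε h hm hF _
  refine (BL.integral hr h (hm.1.const_mul C) hF).mono ?_
  rw [integral_const_mul, mul_assoc]
  exact mul_le_mul_of_nonneg_left hm.2 hC

end integral

theorem exists_fixedPoint [CompleteSpace A] {Q : ℝ → A → A}
    (h : OO (ι := Unit) (fun r _ => r * r) fun ε _ => Q ε) :
    ∀ᶠ r in 𝓝[>] (0 : ℝ), ∀ᶠ ε in 𝓝[>] (0 : ℝ), ∃ g, ‖g‖ ≤ r ∧ Q ε g = g ∧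
      ∀ g', ‖g'‖ ≤ r → Q ε g' = g' → g' = g := by
  obtain ⟨C, hC, h⟩ := h
  have h1 : Tendsto (fun r : ℝ => C * r) (𝓝[>] 0) (𝓝 0) := by
    have : Tendsto (fun r : ℝ => C * r) (𝓝 0) (𝓝 (C * 0)) := tendsto_id.const_mul C
    rw [mul_zero] at this
    exact this.mono_left nhdsWithin_le_nhds
  filter_upwards [h, h1.eventually_le_const one_pos, self_mem_nhdsWithin] with r h h1 hr
  have hr : 0 < r := hr
  filter_upwards [h] with ε h
  have hQ : BL r r (Q ε) := (h ()).mono (by nlinarith)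
  have hmaps : Set.MapsTo (Q ε) (Metric.closedBall 0 r) (Metric.closedBall 0 r) := fun g hg => by
    rw [mem_closedBall_zero_iff] at hg ⊢
    linarith [(hQ g hg).1, norm_nonneg (Q ε g)]
  have hlip : ∀ g, ‖g‖ ≤ r → ∀ g', ‖g'‖ ≤ r → ‖Q ε g - Q ε g'‖ ≤ 1 / 2 * ‖g - g'‖ :=
    fun g hg g' hg' => by
      have := (hQ g hg).2 g' hg'
      have h2 : r * (2 * ‖Q ε g - Q ε g'‖) ≤ r * ‖g - g'‖ := by linarith
      linarith [le_of_mul_le_mul_left h2 hr]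
  have hcon : ContractingWith (1 / 2 : NNReal) (hmaps.restrict (Q ε) _ _) :=
    ⟨by rw [div_lt_one] <;> norm_num, LipschitzWith.of_dist_le_mul fun x y => by
      rw [Subtype.dist_eq, Subtype.dist_eq, dist_eq_norm, dist_eq_norm]
      simpa using hlip x (mem_closedBall_zero_iff.mp x.2) y (mem_closedBall_zero_iff.mp y.2)⟩
  obtain ⟨g, hg, hfix, -⟩ := hcon.exists_fixedPoint' Metric.isClosed_closedBall.isComplete hmaps
    (x := 0) (by simpa using hr.le) (edist_ne_top _ _)
  rw [mem_closedBall_zero_iff] at hg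
  refine ⟨g, hg, hfix, fun g' hg' hfix' => ?_⟩
  have := hlip g' hg' g hg
  rw [hfix', hfix] at this
  have h3 : ‖g' - g‖ ≤ 0 := by linarith [norm_nonneg (g' - g)]
  exact sub_eq_zero.mp (norm_le_zero_iff.mp h3)

end OO

end BLcalc

end

section

namespace OO

variable {A ι : Type*} [NormedCommRing A] [NormedAlgebra ℝ A] {m m' : ℝ → ι → ℝ}

section det

set_option linter.unusedSectionVars false

variable {κ : Type*} [Fintype κ] [DecidableEq κ] {M : κ → κ → ℝ → ι → A → A}

theorem prod_one_add (s : Finset κ) {F : κ → ℝ → ι → A → A} (h1 : ∀ a, OO (fun _ _ => 1) (F a)) (hm : ∀ a, OO m (F a))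
    (hm' : ∀ a, OO m' (F a)) :
    OO (fun r z => m r z * m' r z) fun ε z g =>
      ∏ a ∈ s, (1 + F a ε z g) - 1 - ∑ a ∈ s, F a ε z g := by
  induction s using Finset.induction_on with
  | empty =>
    have : OO (fun r z => m r z * m' r z) fun (_ : ℝ) (_ : ι) (_ : A) => (0 : A) := by
      simpa using OO.sum (m := fun r z => m r z * m' r z) (∅ : Finset κ) (F := F) (by simp)
    simpa using this
  | insert a s ha ih =>
    have h2 : OO m' fun ε z g => (∑ b ∈ s, F b ε z g) := OO.sum s fun b _ => hm' b
    refine (((ih.mul ((OO.const 1).add (h1 a))).congr_gauge fun r z => mul_one _).add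
      ((hm a).mul h2)).congr (Eventually.of_forall fun ε z g => ?_)
    rw [Finset.prod_insert ha, Finset.sum_insert ha]
    ring

/-- `det (1 + M) = 1 + tr M` up to quadratic terms. -/
theorem det_one_add (h1 : ∀ a b, OO (fun _ _ => 1) (M a b)) (hm : ∀ a b, OO m (M a b))
    (hm' : ∀ a b, OO m' (M a b)) :
    OO (fun r z => m r z * m' r z) fun ε z g =>
      (1 + Matrix.of fun a b => M a b ε z g).det - 1 - ∑ a, M a a ε z g := by
  have key : ∀ σ ∈ (Finset.univ : Finset (Equiv.Perm κ)).erase 1,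
      OO (fun r z => m r z * m' r z) fun ε z g =>
        ((Equiv.Perm.sign σ : ℤ) : ℝ) • ∏ i, (1 + Matrix.of fun a b => M a b ε z g) (σ i) i := by
    intro σ hσ
    have hσ1 : σ ≠ 1 := Finset.ne_of_mem_erase hσ
    obtain ⟨i, hi⟩ : ∃ i, σ i ≠ i := by
      by_contra! h
      exact hσ1 (Equiv.ext h)
    have hj : σ (σ i) ≠ σ i := fun h => hi (σ.injective h)
    have hentry : ∀ a b, OO (fun _ _ => 1) fun ε z g =>
        (1 + Matrix.of fun a b => M a b ε z g) a b := fun a b => by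
      simpa only [Matrix.add_apply, Matrix.of_apply] using
        (OO.const ((1 : Matrix κ κ A) a b)).add (h1 a b)
    refine OO.const_smul _ (((((hm (σ i) i).mul (hm' (σ (σ i)) (σ i))).mul
      (OO.prod ((Finset.univ.erase i).erase (σ i)) fun b _ => hentry (σ b) b)).congr_gauge
        fun r z => mul_one _).congr (Eventually.of_forall fun ε z g => ?_))
    rw [← Finset.mul_prod_erase Finset.univ _ (Finset.mem_univ i),
      ← Finset.mul_prod_erase (Finset.univ.erase i) _
        (Finset.mem_erase.mpr ⟨hi, Finset.mem_univ (σ i)⟩), ← mul_assoc]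
    congr 2 <;> simp [hi, hj]
  refine ((OO.prod_one_add Finset.univ (fun a => h1 a a) (fun a => hm a a)
    fun a => hm' a a).add (OO.sum _ key)).congr
    (Eventually.of_forall fun ε z g => ?_)
  rw [Matrix.det_apply', ← Finset.add_sum_erase (Finset.univ : Finset (Equiv.Perm κ)) _ (Finset.mem_univ 1)]
  simp only [Equiv.Perm.sign_one, Units.val_one, Int.cast_one, one_mul, Equiv.Perm.one_apply,
    Matrix.add_apply, Matrix.one_apply_eq, Matrix.of_apply]
  have : ∀ (s : ℤ) (a : A), (s : ℝ) • a = (s : A) * a := fun s a => by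
    rw [Int.cast_smul_eq_zsmul, zsmul_eq_mul]
  simp only [this]
  ring

theorem det_one_add_sub_one (h1 : ∀ a b, OO (fun _ _ => 1) (M a b))
    (hm : ∀ a b, OO m (M a b)) :
    OO m fun ε z g => (1 + Matrix.of fun a b => M a b ε z g).det - 1 := by
  refine (((det_one_add (m' := fun _ _ => 1) h1 hm h1).congr_gauge
    fun r z => mul_one _).add (OO.sum Finset.univ fun a _ => hm a a)).congr
    (Eventually.of_forall fun ε z g => ?_)
  ring

end det
end OO

end

section

section NonlinearData

variable {n : ℕ}

/-- The directions used to parametrize the body. -/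
def Zs (e : Eucl n) : Set (Eucl n) := {z | ‖z‖ ≤ 1 ∧ z ≠ e ∧ z + ‖z‖ • e ≠ 0}

/-- Data of the perturbation problem. -/
structure NL (w : Wt n) where
  e : Eucl n
  norm_e : ‖e‖ = 1
  α : ℝ
  U : AA w
  LU : Fin n → Fin n → AA w
  LLU : Fin n → Fin n → Fin n → Fin n → AA w
  isL_U : ∀ i j, IsL i j U (LU i j)
  isL_LU : ∀ i j a b, IsL i j (LU a b) (LLU i j a b)
  ν : ℝ → Measure (Zs e)

namespace NL

variable {w : Wt n} (d : NL w)

def v (_ : NL w) (ε : ℝ) (g : AA w) : AA w := SS w ε g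

def u (ε : ℝ) (g : AA w) : AA w := d.U + d.v ε g

def Lu (ε : ℝ) (g : AA w) (i j : Fin n) : AA w := d.LU i j + LS w i j ε g

def LLu (ε : ℝ) (g : AA w) (i j a b : Fin n) : AA w := d.LLU i j a b + LLS w i j a b ε g

def x (i : Fin n) : AA w := XX w (eb i) d.e

def Lx (i j a : Fin n) : AA w := (if i = a then d.x j else 0) - if j = a then d.x i else 0

/-- The gradient of the `1`-homogeneous extension of `u`. -/
def p (ε : ℝ) (g : AA w) (i : Fin n) : AA w := d.x i * d.u ε g + ∑ a, d.x a * d.Lu ε g i a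

def Lp (ε : ℝ) (g : AA w) (j b i : Fin n) : AA w :=
  d.Lx j b i * d.u ε g + d.x i * d.Lu ε g j b +
    ∑ a, (d.Lx j b a * d.Lu ε g i a + d.x a * d.LLu ε g j b i a)

/-- The Hessian of the `1`-homogeneous extension of `u`. -/
def M (ε : ℝ) (g : AA w) (i j : Fin n) : AA w := ∑ b, d.x b * d.Lp ε g j b i

def sq (ε : ℝ) (g : AA w) : AA w := ∑ i, d.p ε g i * d.p ε g i

def T (z : Eucl n) (X : AA w) : AA w := RR w (gz d.e z) X

/-- The linear operator behind `NL.F`. -/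
def FT (ε : ℝ) (z : Eucl n) (X : AA w) : AA w := (ε / ‖z - d.e‖) • (‖z‖ ^ 3 • d.T z X - X)

def F (ε : ℝ) (z : Eucl n) (g : AA w) (i : Fin n) : AA w := d.FT ε z (d.p ε g i)

def ℓ (z : Eucl n) (i : Fin n) : AA w := XX w (eb i) (‖z - d.e‖⁻¹ • (z - d.e))

def E (ε : ℝ) (z : Eucl n) (g : AA w) : AA w :=
  ∑ i, ((2 : ℝ) • (d.ℓ z i * d.F ε z g i) + d.F ε z g i * d.F ε z g i)

/-- Taylor coefficients of `exp y - 1`. -/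
def _root_.cExp (m : ℕ) : ℝ := ((m + 1).factorial : ℝ)⁻¹

/-- Taylor coefficients of `(exp y - 1 - y) / y`. -/
def _root_.cExp' (m : ℕ) : ℝ := ((m + 2).factorial : ℝ)⁻¹

/-- Taylor coefficients of `log (1 + y)`. -/
def _root_.cLog (m : ℕ) : ℝ := (-1) ^ m / (m + 1)

def Y (ε : ℝ) (z : Eucl n) (g : AA w) : AA w :=
  -(‖z‖ ^ 4 • d.T z (d.u ε g)) - (‖z‖ ^ 6 / 2 * ε) • d.T z (d.sq ε g)

def G (ε : ℝ) (z : Eucl n) (g : AA w) (i j : Fin n) : AA w :=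
  ‖z‖ ^ 2 • d.T z (ε • d.M ε g i j + (3 * ε) • (d.p ε g i * d.x j))

/-- The integrand of the nonlocal term. -/
def B (ε : ℝ) (z : Eucl n) (g : AA w) : AA w :=
  (1 + ps cExp (d.Y ε z g)) * (1 + Matrix.of (d.G ε z g)).det *
    (1 + ps cExp ((-(d.α / 2)) • ps cLog (d.E ε z g)))

def N (ε : ℝ) (g : AA w) : AA w := ∫ z : Zs d.e, (d.B ε z g - 1) ∂d.ν ε

def Θ (ε : ℝ) (g : AA w) : AA w :=
  (1 + ps cExp ((-(ε / 2)) • d.sq ε g)) * (1 + ε • d.u ε g) * (1 + d.N ε g)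

/-- The fixed point map. -/
def Q (ε : ℝ) (g : AA w) : AA w :=
  -(d.v ε g * ps cExp' (d.v ε g)) +
    (d.Θ ε g * (1 + Matrix.of fun i j => ε • d.M ε g i j).det - 1 - ∑ i, ε • d.M ε g i i) +
    (ε * (n - 1)) • d.u ε g + ε • ((1 / 2 : ℝ) • ∑ i, ∑ j, d.LLU i j i j)

theorem isL_u (ε : ℝ) (g : AA w) (i j : Fin n) : IsL i j (d.u ε g) (d.Lu ε g i j) :=
  (d.isL_U i j).add (isL_LS i j ε g)

theorem isL_Lu (ε : ℝ) (g : AA w) (i j a b : Fin n) :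
    IsL i j (d.Lu ε g a b) (d.LLu ε g i j a b) :=
  (d.isL_LU i j a b).add (isL_LLS i j a b ε g)

theorem _root_.inner_eb_eb (i j : Fin n) : ⟪eb i, eb j⟫ = if i = j then (1 : ℝ) else 0 := by
  rw [EuclideanSpace.inner_single_left]
  simp

theorem isL_x (i j a : Fin n) : IsL i j (d.x a) (d.Lx i j a) := by
  have := isL_XX (w := w) i j (eb a) d.e
  simp only [inner_eb_eb, ite_smul, one_smul, zero_smul] at this
  exact this

theorem isL_p (ε : ℝ) (g : AA w) (j b i : Fin n) : IsL j b (d.p ε g i) (d.Lp ε g j b i) := by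
  refine ((d.isL_x j b i).mul (d.isL_u ε g j b)).add (IsL.sum _ fun a _ => ?_)
  exact (d.isL_x j b a).mul (d.isL_Lu ε g j b i a)

end NL
end NonlinearData

end

section

theorem OO.const_mul {A ι : Type*} [NormedCommRing A] [NormedAlgebra ℝ A] {m : ℝ → ι → ℝ}
    {F : ℝ → ι → A → A} (c : A) (h : OO m F) : OO m fun ε z g => c * F ε z g :=
  ((OO.const c).mul h).congr_gauge fun _ _ => one_mul _

theorem tendsto_sqrt_zero : Tendsto (fun ε : ℝ => √ε) (𝓝[>] 0) (𝓝 0) := by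
  have := Real.continuous_sqrt.tendsto 0
  rw [Real.sqrt_zero] at this
  exact this.mono_left nhdsWithin_le_nhds

theorem tendsto_id_zero : Tendsto (fun ε : ℝ => ε) (𝓝[>] 0) (𝓝 0) :=
  tendsto_id.mono_left nhdsWithin_le_nhds

namespace NL

variable {n : ℕ} {w : Wt n} (d : NL w) {ι : Type*}

theorem oo_v : OO (ι := ι) (fun r _ => r) fun ε _ g => d.v ε g :=
  OO.id'.comp_le (T := fun ε _ X => SS w ε X) (c := 1) (fun _ _ _ _ => map_sub _ _ _)
    (Eventually.of_forall fun ε _ X => by rw [one_mul]; exact norm_SS_le ε X) zero_le_one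

theorem oo_u : OO (ι := ι) (fun _ _ => 1) fun ε _ g => d.u ε g :=
  (OO.const d.U).add d.oo_v.one_of_id

theorem oo_sqrt_Lu (i j : Fin n) : OO (ι := ι) (fun r _ => r) fun ε _ g => √ε • d.Lu ε g i j := by
  refine ((OO.const' (d.LU i j) (fun _ => id) tendsto_sqrt_zero).add
    (OO.id'.comp_le (T := fun ε _ X => √ε • LS w i j ε X) (c := 1)
      (fun _ _ _ _ => by rw [map_sub, smul_sub]) ?_ zero_le_one)).congr
    (Eventually.of_forall fun ε z g => (smul_add _ _ _).symm)
  filter_upwards [self_mem_nhdsWithin] with ε hε z X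
  have hε : 0 < √ε := Real.sqrt_pos.mpr hε
  rw [norm_smul, Real.norm_of_nonneg hε.le, one_mul]
  calc √ε * ‖LS w i j ε X‖ ≤ √ε * ((√ε)⁻¹ * ‖X‖) := by
        gcongr; exact norm_LS_le i j (Real.sqrt_pos.mp hε) X
    _ = ‖X‖ := by rw [← mul_assoc, mul_inv_cancel₀ hε.ne', one_mul]

theorem oo_smul_of_sqrt {X : ℝ → ι → AA w → AA w}
    (h : OO (fun r _ => r) fun ε z g => √ε • X ε z g) :
    OO (fun r _ => r) fun ε z g => ε • X ε z g := by
  refine (h.smul (t := fun ε _ => √ε) (c := 1) ?_ zero_le_one).congr ?_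
  · filter_upwards [tendsto_sqrt_zero.eventually_le_const one_pos] with ε hε z
    rwa [abs_of_nonneg (Real.sqrt_nonneg _)]
  · filter_upwards [self_mem_nhdsWithin] with ε hε z g
    rw [smul_smul, Real.mul_self_sqrt (le_of_lt hε)]

theorem oo_LLu (i j a b : Fin n) :
    OO (ι := ι) (fun r _ => r) fun ε _ g => ε • d.LLu ε g i j a b := by
  refine ((OO.const' (d.LLU i j a b) (fun _ => id) tendsto_id_zero).add
    (OO.id'.comp_le (T := fun ε _ X => ε • LLS w i j a b ε X) (c := 2)
      (fun _ _ _ _ => by rw [map_sub, smul_sub]) ?_ zero_le_two)).congr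
    (Eventually.of_forall fun ε z g => (smul_add _ _ _).symm)
  filter_upwards [self_mem_nhdsWithin] with ε hε z X
  have hε : 0 < ε := hε
  rw [norm_smul, Real.norm_of_nonneg hε.le]
  calc ε * ‖LLS w i j a b ε X‖ ≤ ε * (2 / ε * ‖X‖) := by
        gcongr; exact norm_LLS_le i j a b hε X
    _ = 2 * ‖X‖ := by field_simp

theorem oo_sqrt_p (i : Fin n) : OO (ι := ι) (fun r _ => r) fun ε _ g => √ε • d.p ε g i := by
  refine (((OO.smul_tendsto tendsto_sqrt_zero (fun _ => id) d.oo_u).const_mul (d.x i)).add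
    (OO.sum Finset.univ fun a _ => (d.oo_sqrt_Lu i a).const_mul (d.x a))).congr
    (Eventually.of_forall fun ε z g => ?_)
  simp only [p, smul_add, Finset.smul_sum, mul_smul_comm]

theorem oo_p (i : Fin n) : OO (ι := ι) (fun r _ => r) fun ε _ g => ε • d.p ε g i :=
  oo_smul_of_sqrt (d.oo_sqrt_p i)

theorem oo_Lp (j b i : Fin n) : OO (ι := ι) (fun r _ => r) fun ε _ g => ε • d.Lp ε g j b i := by
  have hL : ∀ i j, OO (ι := ι) (fun r _ => r) fun ε _ g => ε • d.Lu ε g i j := fun i j =>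
    oo_smul_of_sqrt (d.oo_sqrt_Lu i j)
  refine ((((OO.smul_tendsto tendsto_id_zero (fun _ => id) d.oo_u).const_mul (d.Lx j b i)).add
    ((hL j b).const_mul (d.x i))).add (OO.sum Finset.univ fun a _ =>
      ((hL i a).const_mul (d.Lx j b a)).add ((d.oo_LLu j b i a).const_mul (d.x a)))).congr
    (Eventually.of_forall fun ε z g => ?_)
  simp only [Lp, smul_add, Finset.smul_sum, mul_smul_comm]

theorem oo_M (i j : Fin n) : OO (ι := ι) (fun r _ => r) fun ε _ g => ε • d.M ε g i j := by
  refine (OO.sum Finset.univ fun a _ => (d.oo_Lp j a i).const_mul (d.x a)).congr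
    (Eventually.of_forall fun ε z g => ?_)
  simp only [M, Finset.smul_sum, mul_smul_comm]

theorem oo_sq : OO (ι := ι) (fun r _ => r * r) fun ε _ g => ε • d.sq ε g := by
  refine (OO.sum Finset.univ fun i _ =>
    (d.oo_sqrt_p i).mul (d.oo_sqrt_p i)).congr ?_
  filter_upwards [self_mem_nhdsWithin] with ε hε z g
  have hε : 0 < ε := hε
  simp only [sq, Finset.smul_sum, smul_mul_smul_comm, Real.mul_self_sqrt hε.le]

theorem oo_T {m : ℝ → Zs d.e → ℝ} {X : ℝ → Zs d.e → AA w → AA w} (h : OO m X) :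
    OO m fun ε z g => d.T z (X ε z g) :=
  h.comp_le (T := fun _ (z : Zs d.e) X => d.T z X) (c := 1) (fun _ _ _ _ => map_sub _ _ _)
    (Eventually.of_forall fun ε _ X => by rw [one_mul]; exact norm_RR_le _ X) zero_le_one

end NL

end

section

namespace NL

variable {n : ℕ} {w : Wt n} (d : NL w)

theorem norm_ne_zero {z : Eucl n} {e : Eucl n} (hz : z ∈ Zs e) : 0 < ‖z‖ := by
  refine norm_pos_iff.mpr fun h => hz.2.2 ?_
  simp [h]

theorem norm_sub_pos {z : Eucl n} {e : Eucl n} (hz : z ∈ Zs e) : 0 < ‖z - e‖ :=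
  norm_pos_iff.mpr (sub_ne_zero.mpr hz.2.1)

theorem norm_T_le (z : Eucl n) (X : AA w) : ‖d.T z X‖ ≤ ‖X‖ := norm_RR_le _ X

theorem norm_smul_T_sub_le {z : Eucl n} (hz : z ∈ Zs d.e) {X : AA w} {X' : Fin n → Fin n → AA w}
    (h : ∀ i j, IsL i j X (X' i j)) :
    ‖‖z‖ ^ 3 • d.T z X - X‖ ≤ 11 * ‖z - d.e‖ * (‖X‖ + ∑ i, ∑ j, ‖X' i j‖) := by
  have hs := norm_ne_zero hz
  have hs1 : ‖z‖ ≤ 1 := hz.1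
  have hd := norm_sub_pos hz
  set s := ‖z‖ with hsdef
  set D := ‖X‖ + ∑ i, ∑ j, ‖X' i j‖
  have hXD : ‖X‖ ≤ D := le_add_of_nonneg_right (by positivity)
  have hD : 0 ≤ D := (norm_nonneg _).trans hXD
  have h1s : 1 - s ≤ ‖z - d.e‖ := by
    have := norm_sub_norm_le d.e z
    rwa [d.norm_e, norm_sub_rev] at this
  have hω : ‖s⁻¹ • z‖ = 1 := by
    rw [norm_smul, norm_inv, Real.norm_of_nonneg hs.le, ← hsdef, inv_mul_cancel₀ hs.ne']
  have hT : d.T z X = RR w (gz d.e (s⁻¹ • z)) X := by rw [T, gz_smul _ _ (inv_pos.mpr hs)]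
  have h1 := norm_RR_gz_sub_le d.norm_e hω h
  rw [← hT] at h1
  have h2 : s * ‖s⁻¹ • z - d.e‖ ≤ 2 * ‖z - d.e‖ := by
    calc s * ‖s⁻¹ • z - d.e‖ = ‖s • (s⁻¹ • z - d.e)‖ := by
          rw [norm_smul, Real.norm_of_nonneg hs.le]
      _ = ‖(z - d.e) + (1 - s) • d.e‖ := by
          rw [smul_sub, smul_smul, mul_inv_cancel₀ hs.ne']
          congr 1
          module
      _ ≤ ‖z - d.e‖ + ‖(1 - s) • d.e‖ := norm_add_le _ _
      _ ≤ _ := by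
          rw [norm_smul, d.norm_e, Real.norm_of_nonneg (by linarith)]
          linarith
  have e1 : s ^ 3 • d.T z X - X = s ^ 3 • (d.T z X - X) - (1 - s ^ 3) • X := by module
  have h3 : 1 - s ^ 3 ≤ 3 * ‖z - d.e‖ := by nlinarith [sq_nonneg s, sq_nonneg (1 - s)]
  have h4 : 0 ≤ 1 - s ^ 3 := by
    have := pow_le_one₀ hs.le hs1 (n := 3)
    linarith
  calc ‖s ^ 3 • d.T z X - X‖ ≤ s ^ 3 * ‖d.T z X - X‖ + (1 - s ^ 3) * ‖X‖ := by
        rw [e1]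
        refine (norm_sub_le _ _).trans (le_of_eq ?_)
        rw [norm_smul, norm_smul, Real.norm_of_nonneg (by positivity), Real.norm_of_nonneg h4]
    _ ≤ s ^ 3 * (4 * ‖s⁻¹ • z - d.e‖ * D) + 3 * ‖z - d.e‖ * D := by gcongr
    _ = s ^ 2 * (4 * (s * ‖s⁻¹ • z - d.e‖) * D) + 3 * ‖z - d.e‖ * D := by ring
    _ ≤ 1 * (4 * (2 * ‖z - d.e‖) * D) + 3 * ‖z - d.e‖ * D := by
        gcongr
        exact pow_le_one₀ hs.le hs1
    _ = _ := by ring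

theorem FT_sub (ε : ℝ) (z : Eucl n) (X Y : AA w) : d.FT ε z (X - Y) = d.FT ε z X - d.FT ε z Y := by
  simp only [FT, T, map_sub]
  module

theorem norm_FT_le {ε : ℝ} (hε : 0 ≤ ε) {z : Eucl n} (hz : z ∈ Zs d.e) {X : AA w}
    {X' : Fin n → Fin n → AA w} (h : ∀ i j, IsL i j X (X' i j)) :
    ‖d.FT ε z X‖ ≤ 11 * (‖ε • X‖ + ∑ i, ∑ j, ‖ε • X' i j‖) := by
  have hd := norm_sub_pos hz
  simp only [FT, norm_smul, Real.norm_of_nonneg hε, ← Finset.mul_sum, ← mul_add]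
  rw [Real.norm_of_nonneg (by positivity)]
  calc ε / ‖z - d.e‖ * ‖‖z‖ ^ 3 • d.T z X - X‖
      ≤ ε / ‖z - d.e‖ * (11 * ‖z - d.e‖ * (‖X‖ + ∑ i, ∑ j, ‖X' i j‖)) := by
        gcongr; exact d.norm_smul_T_sub_le hz h
    _ = _ := by field_simp

theorem norm_FT_le' {ε : ℝ} (hε : 0 ≤ ε) {z : Eucl n} (hz : z ∈ Zs d.e) (hz' : ‖z‖ ≤ 1 / 2)
    (X : AA w) : ‖d.FT ε z X‖ ≤ 4 * ‖ε • X‖ := by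
  have hd : 1 / 2 ≤ ‖z - d.e‖ := by
    have := norm_sub_norm_le d.e z
    rw [d.norm_e, norm_sub_rev] at this
    linarith
  rw [FT, norm_smul, norm_smul, Real.norm_of_nonneg hε, Real.norm_of_nonneg (by positivity)]
  have h1 : ‖‖z‖ ^ 3 • d.T z X - X‖ ≤ 2 * ‖X‖ := by
    refine (norm_sub_le _ _).trans ?_
    rw [norm_smul, Real.norm_of_nonneg (by positivity)]
    have h2 : ‖z‖ ^ 3 ≤ 1 := pow_le_one₀ (norm_nonneg _) hz.1
    nlinarith [d.norm_T_le z X, norm_nonneg (d.T z X)]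
  have h3 : ε / ‖z - d.e‖ ≤ ε / (1 / 2) := by gcongr
  calc ε / ‖z - d.e‖ * ‖‖z‖ ^ 3 • d.T z X - X‖ ≤ ε / (1 / 2) * (2 * ‖X‖) := by gcongr
    _ = _ := by ring

theorem oo_F (i : Fin n) : OO (fun r _ => r) fun ε (z : Zs d.e) g => d.F ε z g i := by
  have key : ∀ ε, 0 < ε → ∀ (z : Zs d.e) (X : AA w) (X' : Fin n → Fin n → AA w)
      (_ : ∀ i j, IsL i j X (X' i j)), ‖d.FT ε z X‖ ≤ 11 * ∑ a : Option (Fin n × Fin n),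
        ‖a.elim (ε • X) fun b => ε • X' b.1 b.2‖ := fun ε hε z X X' h => by
    rw [Fintype.sum_option, Fintype.sum_prod_type]
    exact d.norm_FT_le hε.le z.2 h
  refine OO.dom (Finset.univ : Finset (Option (Fin n × Fin n)))
    (G := fun a ε _ g => a.elim (ε • d.p ε g i) fun b => ε • d.Lp ε g b.1 b.2 i) (c := 11)
    (by norm_num) ?_ ?_ (fun r hr _ => hr.le) ?_
  · filter_upwards [self_mem_nhdsWithin] with ε hε z g
    exact key ε hε z (d.p ε g i) (fun j b => d.Lp ε g j b i) fun j b => d.isL_p ε g j b i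
  · filter_upwards [self_mem_nhdsWithin] with ε hε z g g'
    have := key ε hε z (d.p ε g i - d.p ε g' i) (fun j b => d.Lp ε g j b i - d.Lp ε g' j b i)
      fun j b => (d.isL_p ε g j b i).sub (d.isL_p ε g' j b i)
    rw [FT_sub] at this
    simp only [F]
    refine this.trans (le_of_eq ?_)
    congr 1
    refine Finset.sum_congr rfl fun a _ => ?_
    cases a <;> simp only [Option.elim, smul_sub]
  · rintro (_ | ⟨j, b⟩) -
    · exact d.oo_p i
    · exact d.oo_Lp j b i

/-- The gauge of the nonlocal terms. -/
def μ (e : Eucl n) (r : ℝ) (z : Zs e) : ℝ := ‖(z : Eucl n)‖ ^ 2 + r * r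

theorem μ_nonneg {e : Eucl n} (r : ℝ) (z : Zs e) : 0 ≤ μ e r z :=
  add_nonneg (sq_nonneg _) (mul_self_nonneg r)

theorem oo_F' (i : Fin n) : OO (μ d.e) fun ε (z : Zs d.e) g => d.F ε z g i := by
  classical
  let χ : Zs d.e → ℝ := fun z => if ‖(z : Eucl n)‖ ≤ 1 / 2 then 1 else 0
  have hχ0 : ∀ z, 0 ≤ χ z := fun z => by dsimp only [χ]; split_ifs <;> norm_num
  have hχ1 : ∀ z, 0 ≤ 1 - χ z := fun z => by dsimp only [χ]; split_ifs <;> norm_num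
  have h1 : OO (μ d.e) fun ε (z : Zs d.e) g => χ z • d.F ε z g i := by
    have key : ∀ ε, 0 < ε → ∀ (z : Zs d.e) (X : AA w),
        ‖χ z • d.FT ε z X‖ ≤ 4 * ∑ _a : Unit, ‖√ε • √ε • X‖ := fun ε hε z X => by
      rw [smul_smul, Real.mul_self_sqrt hε.le, Fintype.sum_unique]
      dsimp only [χ]
      split_ifs with h
      · rw [one_smul]; exact d.norm_FT_le' hε.le z.2 h X
      · rw [zero_smul, norm_zero]; positivity
    refine OO.dom (Finset.univ : Finset Unit) (G := fun _ ε _ g => √ε • √ε • d.p ε g i)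
      (c := 4) (by norm_num) ?_ ?_ (fun r _ z => μ_nonneg r z) fun _ _ => ?_
    · filter_upwards [self_mem_nhdsWithin] with ε hε z g using key ε hε z _
    · filter_upwards [self_mem_nhdsWithin] with ε hε z g g'
      have := key ε hε z (d.p ε g i - d.p ε g' i)
      simpa only [F, FT_sub, smul_sub] using this
    · refine (OO.smul_tendsto tendsto_sqrt_zero (μ := fun r => r * r)
        (fun r hr => mul_pos hr hr) (d.oo_sqrt_p i).one_of_id).mono zero_le_one
          (Eventually.of_forall fun r z => ?_)
      rw [one_mul]
      exact le_add_of_nonneg_left (by positivity)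
  have h2 : OO (μ d.e) fun ε (z : Zs d.e) g => (1 - χ z) • d.F ε z g i := by
    refine ((d.oo_F i).smul_gauge (t := fun _ z => 1 - χ z) (τ := fun z => 1 - χ z) (c := 1)
      zero_le_one (Eventually.of_forall fun ε z => by
        rw [abs_of_nonneg (hχ1 z), one_mul])).mono (K := 4) (by norm_num) ?_
    filter_upwards [Ioc_mem_nhdsGT one_pos] with r hr z
    dsimp only [χ]
    split_ifs with h
    · rw [sub_self, zero_mul]; exact mul_nonneg (by norm_num) (μ_nonneg r z)
    · unfold μ; nlinarith [hr.1, hr.2]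
  refine (h1.add h2).congr (Eventually.of_forall fun ε z g => ?_)
  module

end NL

end

section

section Coefficients

theorem summable_cExp (ρ : ℝ) : Summable fun m => |cExp m| * ρ ^ m := by
  refine Summable.of_norm_bounded (Real.summable_pow_div_factorial |ρ|) fun m => ?_
  rw [Real.norm_eq_abs, abs_mul, abs_abs, abs_pow, div_eq_inv_mul]
  gcongr
  rw [cExp, abs_of_pos (by positivity)]
  gcongr
  exact Nat.le_succ m

theorem summable_cExp' (ρ : ℝ) : Summable fun m => |cExp' m| * ρ ^ m := by
  refine Summable.of_norm_bounded (Real.summable_pow_div_factorial |ρ|) fun m => ?_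
  rw [Real.norm_eq_abs, abs_mul, abs_abs, abs_pow, div_eq_inv_mul]
  gcongr
  rw [cExp', abs_of_pos (by positivity)]
  gcongr
  exact Nat.le_add_right m 2

theorem summable_cLog : Summable fun m => |cLog m| * (1 / 2 : ℝ) ^ m := by
  refine Summable.of_norm_bounded summable_geometric_two fun m => ?_
  rw [Real.norm_eq_abs, abs_mul, abs_abs, abs_of_pos (by positivity : (0 : ℝ) < (1 / 2) ^ m)]
  refine mul_le_of_le_one_left (by positivity) ?_
  rw [cLog, abs_div, abs_pow, abs_neg, abs_one, one_pow, abs_of_pos (by positivity)]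
  exact div_le_one_of_le₀ (by linarith [(Nat.cast_nonneg m : (0 : ℝ) ≤ m)]) (by positivity)

end Coefficients

namespace OO

variable {A ι : Type*} [NormedCommRing A] [NormedAlgebra ℝ A] {m : ℝ → ι → ℝ}
    {F F' X Y : ℝ → ι → A → A}

theorem const_bdd {c : ℝ → ι → A} {K : ℝ} (hK : 0 ≤ K) (h : ∀ ε z, ‖c ε z‖ ≤ K) :
    OO (fun _ _ => 1) fun ε z _ => c ε z := by
  refine ⟨2 * K, by positivity, ?_⟩
  filter_upwards [self_mem_nhdsWithin] with r hr
  refine Eventually.of_forall fun ε z => (BL.const (le_of_lt hr) (c ε z)).mono ?_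
  linarith [h ε z]

theorem mul_one (h : OO m F) (h' : OO (fun _ _ => 1) F') :
    OO m fun ε z g => F ε z g * F' ε z g :=
  (h.mul h').congr_gauge fun _ _ => _root_.mul_one _

theorem one_mul (h : OO (fun _ _ => 1) F) (h' : OO m F') :
    OO m fun ε z g => F ε z g * F' ε z g :=
  (h.mul h').congr_gauge fun _ _ => _root_.one_mul _

theorem mul_sub_one (h : OO m fun ε z g => X ε z g - 1) (h1 : OO (fun _ _ => 1) fun ε z g => X ε z g - 1)
    (h' : OO m fun ε z g => Y ε z g - 1) : OO m fun ε z g => X ε z g * Y ε z g - 1 :=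
  ((h.add h').add (h1.one_mul h')).congr (Eventually.of_forall fun ε z g => by ring)

theorem ps_cExp [CompleteSpace A] (h : OO m F) (h1 : OO (fun _ _ => 1) F) :
    OO m fun ε z g => (1 + ps cExp (F ε z g)) - 1 := by
  obtain ⟨ρ, -, hρ⟩ := h1.eventually_bdd
  exact (h.ps' (summable_cExp ρ) hρ).congr (Eventually.of_forall fun ε z g => by ring)

end OO

namespace NL

variable {n : ℕ} {w : Wt n} (d : NL w)

theorem oo_μ_one {F : ℝ → Zs d.e → AA w → AA w} (h : OO (μ d.e) F) : OO (fun _ _ => 1) F := by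
  refine h.mono zero_le_two ?_
  filter_upwards [Ioc_mem_nhdsGT one_pos] with r hr z
  have h1 : ‖(z : Eucl n)‖ ^ 2 ≤ 1 := pow_le_one₀ (norm_nonneg _) z.2.1
  unfold μ
  nlinarith [hr.1, hr.2]

theorem oo_ℓ (i : Fin n) : OO (fun _ _ => 1) fun _ (z : Zs d.e) (_ : AA w) => d.ℓ z i := by
  refine OO.const_bdd (K := w.W 1) (w.pos 1).le fun _ z => ?_
  refine (norm_XX_le _ _).trans (mul_le_of_le_one_right (w.pos 1).le ?_)
  rw [PiLp.norm_single, norm_one, one_mul, norm_smul, norm_inv, norm_norm,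
    inv_mul_cancel₀ (norm_sub_pos z.2).ne']

theorem oo_E : OO (fun r _ => r) fun ε (z : Zs d.e) g => d.E ε z g :=
  OO.sum Finset.univ fun i _ => (((d.oo_ℓ i).one_mul (d.oo_F i)).const_smul 2).add
    ((d.oo_F i).mul_one (d.oo_F i).one_of_id)

theorem oo_E' : OO (μ d.e) fun ε (z : Zs d.e) g => d.E ε z g :=
  OO.sum Finset.univ fun i _ => (((d.oo_ℓ i).one_mul (d.oo_F' i)).const_smul 2).add
    ((d.oo_F' i).mul_one (d.oo_F i).one_of_id)

theorem E_small : ∀ᶠ r in 𝓝[>] (0 : ℝ), ∀ᶠ ε in 𝓝[>] (0 : ℝ), ∀ z : Zs d.e,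
    BL r (1 / 2) fun g => d.E ε z g := d.oo_E.eventually_small (by norm_num)

theorem oo_log : OO (μ d.e) fun ε (z : Zs d.e) g => (-(d.α / 2)) • ps cLog (d.E ε z g) :=
  (d.oo_E'.ps' summable_cLog d.E_small).const_smul _

theorem oo_Y : OO (μ d.e) fun ε (z : Zs d.e) g => d.Y ε z g := by
  refine OO.sub (OO.neg ?_) ?_
  · refine ((d.oo_T (X := fun ε _ g => d.u ε g) d.oo_u).smul_gauge
      (t := fun _ (z : Zs d.e) => ‖(z : Eucl n)‖ ^ 4)
      (τ := fun z => ‖(z : Eucl n)‖ ^ 2) zero_le_one (Eventually.of_forall fun ε z => ?_)).mono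
      zero_le_one (Eventually.of_forall fun r z => ?_)
    · have h1 : ‖(z : Eucl n)‖ ^ 2 ≤ 1 := pow_le_one₀ (norm_nonneg _) z.2.1
      rw [abs_of_nonneg (by positivity), one_mul]
      nlinarith [sq_nonneg ‖(z : Eucl n)‖]
    · unfold μ; nlinarith [mul_self_nonneg r]
  · refine (((d.oo_T (X := fun ε _ g => ε • d.sq ε g) d.oo_sq).smul
      (t := fun _ (z : Zs d.e) => ‖(z : Eucl n)‖ ^ 6 / 2) (c := 1)
      (Eventually.of_forall fun ε z => ?_) zero_le_one).mono (m' := μ d.e) zero_le_one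
      (Eventually.of_forall fun r z => ?_)).congr (Eventually.of_forall fun ε z g => ?_)
    · have h1 : ‖(z : Eucl n)‖ ^ 6 ≤ 1 := pow_le_one₀ (norm_nonneg _) z.2.1
      rw [abs_of_nonneg (by positivity)]
      linarith
    · rw [one_mul]; exact le_add_of_nonneg_left (by positivity)
    · simp only [T, map_smul, smul_smul]

theorem oo_G (i j : Fin n) : OO (μ d.e) fun ε (z : Zs d.e) g => d.G ε z g i j := by
  have h1 : OO (ι := Zs d.e) (fun r _ => r) fun ε z g => ε • d.M ε g i j + (3 * ε) • (d.p ε g i * d.x j) :=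
    (d.oo_M i j).add ((((d.oo_p i).const_mul (d.x j)).const_smul 3).congr
      (Eventually.of_forall fun ε z g => by rw [mul_smul_comm, smul_smul, mul_comm (d.x j)]))
  refine ((d.oo_T h1).smul_gauge
      (t := fun _ (z : Zs d.e) => ‖(z : Eucl n)‖ ^ 2)
      (τ := fun z => ‖(z : Eucl n)‖ ^ 2) zero_le_one (Eventually.of_forall fun ε z => ?_)).mono
      zero_le_one ?_
  · rw [abs_of_nonneg (by positivity), one_mul]
  · filter_upwards [Ioc_mem_nhdsGT one_pos] with r hr z
    unfold μ
    nlinarith [hr.1, hr.2, sq_nonneg ‖(z : Eucl n)‖]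

theorem oo_B : OO (μ d.e) fun ε (z : Zs d.e) g => d.B ε z g - 1 := by
  have h1 : OO (μ d.e) fun ε (z : Zs d.e) g => (1 + ps cExp (d.Y ε z g)) - 1 :=
    d.oo_Y.ps_cExp (d.oo_μ_one d.oo_Y)
  have h2 : OO (μ d.e) fun ε (z : Zs d.e) g => (1 + Matrix.of (d.G ε z g)).det - 1 :=
    OO.det_one_add_sub_one (M := fun i j ε (z : Zs d.e) g => d.G ε z g i j)
      (fun i j => d.oo_μ_one (d.oo_G i j)) d.oo_G
  have h3 : OO (μ d.e) fun ε (z : Zs d.e) g =>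
      (1 + ps cExp ((-(d.α / 2)) • ps cLog (d.E ε z g))) - 1 :=
    d.oo_log.ps_cExp (d.oo_μ_one d.oo_log)
  exact OO.mul_sub_one (h1.mul_sub_one (d.oo_μ_one h1) h2)
    (d.oo_μ_one (h1.mul_sub_one (d.oo_μ_one h1) h2)) h3

theorem continuous_T (X : AA w) : Continuous fun z : Zs d.e => d.T z X :=
  (continuous_RR X).comp (continuous_iff_continuousAt.mpr fun z =>
    (continuousAt_gz z.2.2.2).comp continuous_subtype_val.continuousAt)

theorem continuous_ℓ (i : Fin n) : Continuous fun z : Zs d.e => d.ℓ z i := by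
  refine (continuous_XX _).comp (Continuous.smul (Continuous.inv₀ (by fun_prop) fun z =>
    (norm_sub_pos z.2).ne') (by fun_prop))

theorem continuous_norm_val {e : Eucl n} : Continuous fun z : Zs e => ‖(z : Eucl n)‖ :=
  continuous_norm.comp continuous_subtype_val

theorem continuous_F (ε : ℝ) (g : AA w) (i : Fin n) : Continuous fun z : Zs d.e => d.F ε z g i := by
  have h1 := d.continuous_T (d.p ε g i)
  have h2 : Continuous fun z : Zs d.e => ε / ‖(z : Eucl n) - d.e‖ :=
    Continuous.div₀ continuous_const (by fun_prop) fun z => (norm_sub_pos z.2).ne'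
  have h3 : Continuous fun z : Zs d.e => ‖(z : Eucl n)‖ ^ 3 := continuous_norm_val.pow 3
  simp only [F, FT]
  exact h2.smul ((h3.smul h1).sub continuous_const)

theorem continuous_E (ε : ℝ) (g : AA w) : Continuous fun z : Zs d.e => d.E ε z g :=
  continuous_finsetSum _ fun i _ =>
    (((d.continuous_ℓ i).mul (d.continuous_F ε g i)).const_smul (2 : ℝ)).add
      ((d.continuous_F ε g i).mul (d.continuous_F ε g i))

theorem norm_RR_Y_le (ε : ℝ) (g : AA w) (z : Zs d.e) :
    ‖d.Y ε z g‖ ≤ ‖d.u ε g‖ + |ε| * ‖d.sq ε g‖ := by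
  have hz := pow_le_one₀ (norm_nonneg _) z.2.1 (n := 4)
  have hz' := pow_le_one₀ (norm_nonneg _) z.2.1 (n := 6)
  refine (norm_sub_le _ _).trans ?_
  rw [norm_neg, norm_smul, norm_smul, norm_mul, Real.norm_of_nonneg (by positivity),
    Real.norm_of_nonneg (by positivity), Real.norm_eq_abs]
  gcongr
  · exact (mul_le_of_le_one_left (norm_nonneg _) hz).trans (d.norm_T_le _ _)
  · exact mul_le_of_le_one_left (abs_nonneg _) (by linarith)
  · exact d.norm_T_le _ _

theorem continuous_Y (ε : ℝ) (g : AA w) : Continuous fun z : Zs d.e => d.Y ε z g := by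
  have h1 := d.continuous_T (d.u ε g)
  have h2 := d.continuous_T (d.sq ε g)
  have h3 : Continuous fun z : Zs d.e => ‖(z : Eucl n)‖ ^ 4 := continuous_norm_val.pow 4
  have h4 : Continuous fun z : Zs d.e => ‖(z : Eucl n)‖ ^ 6 / 2 * ε :=
    ((continuous_norm_val.pow 6).div_const 2).mul_const ε
  simp only [Y]
  exact (h3.smul h1).neg.sub (h4.smul h2)

theorem continuous_G (ε : ℝ) (g : AA w) (i j : Fin n) :
    Continuous fun z : Zs d.e => d.G ε z g i j := by
  have h1 := d.continuous_T (ε • d.M ε g i j + (3 * ε) • (d.p ε g i * d.x j))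
  have h3 : Continuous fun z : Zs d.e => ‖(z : Eucl n)‖ ^ 2 := continuous_norm_val.pow 2
  simp only [G]
  exact h3.smul h1

theorem continuous_B {ε : ℝ} {g : AA w} (h : ∀ z : Zs d.e, ‖d.E ε z g‖ ≤ 1 / 2) :
    Continuous fun z : Zs d.e => d.B ε z g := by
  have h1 := continuous_ps (summable_cExp _) (d.continuous_Y ε g) (d.norm_RR_Y_le ε g)
  have h2 : Continuous fun z : Zs d.e => (1 + Matrix.of (d.G ε z g)).det :=
    Continuous.matrix_det (continuous_const.add (continuous_matrix (d.continuous_G ε g)))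
  have h3 : Continuous fun z : Zs d.e => (-(d.α / 2)) • ps cLog (d.E ε z g) :=
    (continuous_ps summable_cLog (d.continuous_E ε g) h).const_smul (-(d.α / 2))
  have h4 : ∀ z : Zs d.e, ‖(-(d.α / 2)) • ps cLog (d.E ε z g)‖ ≤
      |(-(d.α / 2))| * ∑' m, (1 / 2) * (|cLog m| * (1 / 2) ^ m) := fun z => by
    rw [norm_smul, Real.norm_eq_abs]
    gcongr
    exact tsum_of_norm_bounded (summable_cLog.mul_left _).hasSum (norm_ps_term_le _ (h z))
  have h5 := continuous_ps (summable_cExp _) h3 h4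
  simp only [B]
  exact ((continuous_const.add h1).mul h2).mul (continuous_const.add h5)

/-- The measures are probability measures concentrating at the origin. -/
structure Conc : Prop where
  prob : ∀ᶠ ε in 𝓝[>] (0 : ℝ), IsProbabilityMeasure (d.ν ε)
  tendsto : Tendsto (fun ε => ∫ z, ‖(z : Eucl n)‖ ^ 2 ∂d.ν ε) (𝓝[>] 0) (𝓝 0)

variable {d}

theorem Conc.integrable (_ : d.Conc) {ε : ℝ} [IsProbabilityMeasure (d.ν ε)] (r : ℝ) :
    Integrable (μ d.e r) (d.ν ε) := by
  refine Integrable.of_bound (Continuous.aestronglyMeasurable (by unfold μ; fun_prop)) (1 + r * r)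
    (Eventually.of_forall fun z => ?_)
  rw [Real.norm_of_nonneg (μ_nonneg r z), μ]
  have := pow_le_one₀ (norm_nonneg _) z.2.1 (n := 2)
  linarith

theorem oo_N (hd : d.Conc) : OO (ι := Unit) (fun r _ => r * r) fun ε _ g => d.N ε g := by
  refine d.oo_B.integral (K := 2) zero_le_two ?_ ?_
  · filter_upwards [self_mem_nhdsWithin] with r hr
    have hr : 0 < r := hr
    filter_upwards [hd.prob, hd.tendsto.eventually_le_const (mul_pos hr hr)] with ε h1 h2
    refine ⟨hd.integrable r, ?_⟩
    have h3 := (hd.integrable (ε := ε) 0)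
    have h4 : μ d.e 0 = fun z : Zs d.e => ‖(z : Eucl n)‖ ^ 2 := by funext z; simp [μ]
    rw [h4] at h3
    simp only [μ]
    rw [integral_add h3 (integrable_const _), integral_const, probReal_univ, one_smul]
    linarith
  · filter_upwards [d.E_small] with r hr
    filter_upwards [hr] with ε hr g hg
    refine ((d.continuous_B fun z => ?_).sub continuous_const).aestronglyMeasurable
    linarith [((hr z) g hg).1, norm_nonneg (d.E ε z g)]

theorem oo_rr_one {F : ℝ → Unit → AA w → AA w} (h : OO (fun r _ => r * r) F) :
    OO (fun _ _ => 1) F := by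
  refine h.mono zero_le_one ?_
  filter_upwards [Ioc_mem_nhdsGT one_pos] with r hr z
  nlinarith [hr.1, hr.2]

theorem oo_Θ (hd : d.Conc) : OO (ι := Unit) (fun r _ => r * r) fun ε _ g => d.Θ ε g - 1 := by
  have h1 : OO (ι := Unit) (fun r _ => r * r) fun ε _ g => (-(ε / 2)) • d.sq ε g :=
    (d.oo_sq.const_smul (-(1 / 2))).congr (Eventually.of_forall fun ε _ g => by
      rw [smul_smul]; congr 1; ring)
  have h2 := h1.ps_cExp (oo_rr_one h1)
  have h3 : OO (ι := Unit) (fun r _ => r * r) fun ε _ g => (1 + ε • d.u ε g) - 1 :=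
    (OO.smul_tendsto tendsto_id_zero (μ := fun r => r * r) (fun r hr => mul_pos hr hr)
      d.oo_u).congr (Eventually.of_forall fun ε _ g => by ring)
  have h4 : OO (ι := Unit) (fun r _ => r * r) fun ε _ g => (1 + d.N ε g) - 1 :=
    (oo_N hd).congr (Eventually.of_forall fun ε _ g => by ring)
  have h5 := h2.mul_sub_one (oo_rr_one h2) h3
  exact h5.mul_sub_one (oo_rr_one h5) h4

theorem oo_Q (hd : d.Conc) : OO (ι := Unit) (fun r _ => r * r) fun ε _ g => d.Q ε g := by
  have hrr : ∀ r : ℝ, 0 < r → 0 < r * r := fun r hr => mul_pos hr hr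
  refine OO.add (OO.add (OO.add (OO.neg ?_) ?_) ?_) ?_
  · obtain ⟨ρ, -, hρ⟩ := (d.oo_v (ι := Unit)).one_of_id.eventually_bdd
    exact d.oo_v.mul (d.oo_v.ps' (summable_cExp' ρ) hρ)
  · have h1 : ∀ i j, OO (ι := Unit) (fun _ _ => 1) fun ε _ g => ε • d.M ε g i j :=
      fun i j => (d.oo_M i j).one_of_id
    have h2 := OO.det_one_add (κ := Fin n) (M := fun i j ε (_ : Unit) g => ε • d.M ε g i j)
      h1 d.oo_M d.oo_M
    have h3 := OO.det_one_add_sub_one (κ := Fin n) (M := fun i j ε (_ : Unit) g => ε • d.M ε g i j)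
      h1 h1
    refine (((oo_Θ hd).mul_one (h3.add (OO.const 1))).add h2).congr
      (Eventually.of_forall fun ε _ g => ?_)
    ring
  · exact ((OO.smul_tendsto tendsto_id_zero hrr d.oo_u).const_smul ((n : ℝ) - 1)).congr
      (Eventually.of_forall fun ε _ g => by rw [smul_smul, mul_comm])
  · have h1 : ∀ i j, OO (ι := Unit) (fun r _ => r * r) fun ε _ g => ε • d.LLU i j i j :=
      fun i j => OO.const' _ hrr tendsto_id_zero
    refine ((OO.sum Finset.univ fun i _ => OO.sum Finset.univ fun j _ => h1 i j).const_smul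
      (1 / 2)).congr (Eventually.of_forall fun ε _ g => ?_)
    rw [smul_comm ε]
    simp only [Finset.smul_sum]

end NL

end

section

section Transport

variable {n : ℕ} {w : Wt n}

theorem IsL.unique {i j : Fin n} {X X₁ X₂ : AA w} (h₁ : IsL i j X X₁) (h₂ : IsL i j X X₂) :
    X₁ = X₂ := AA_ext fun l => by rw [h₁, h₂]

theorem IsL.RR {i j : Fin n} {X X' : AA w} (h : IsL i j X X') (g : Gp n) :
    IsL i j (RR w g X) (RR w g X') := fun l => by
  rw [comp_RR, comp_RR, h, Lij_Rt _ _ _ (comp_mem _ _)]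

theorem RR_ps (g : Gp n) {c : ℕ → ℝ} {ρ : ℝ} (hc : Summable fun m => |c m| * ρ ^ m) {X : AA w}
    (hX : ‖X‖ ≤ ρ) : RR w g (ps c X) = ps c (RR w g X) :=
  map_ps (RRa w g) (RR w g).continuous hc hX

theorem RR_det (g : Gp n) (M : Fin n → Fin n → AA w) :
    RR w g (1 + Matrix.of M).det = (1 + Matrix.of fun i j => RR w g (M i j)).det := by
  rw [← RRa_apply, AlgHom.map_det]
  congr 1
  ext i j
  simp only [AlgHom.mapMatrix_apply, Matrix.map_apply, Matrix.add_apply, map_add, RRa_apply,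
    Matrix.of_apply, Matrix.one_apply]
  split_ifs
  · rw [RR_one]
  · rw [map_zero]

end Transport

namespace NL

variable {n : ℕ} {w : Wt n} (d : NL w)

/-- Invariance of the data under the stabilizer of the line through the base point. -/
structure Inv : Prop where
  U : ∀ (h : Gp n) (χ : ℝ), χ * χ = 1 → h.1 d.e = χ • d.e → RR w h d.U = d.U
  ν : ∀ (ε : ℝ) (h : Gp n) (χ : ℝ), χ * χ = 1 → h.1 d.e = χ • d.e → ∀ f : Eucl n → AA w,
    ∫ z : Zs d.e, f (χ • h.1 z) ∂d.ν ε = ∫ z : Zs d.e, f z ∂d.ν ε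

variable {d}

section

variable (hd : d.Inv) {h : Gp n} {χ : ℝ} (hχ : χ * χ = 1) (hh : h.1 d.e = χ • d.e)
include hd hχ hh

theorem RR_LU (i j : Fin n) : RR w h (d.LU i j) = d.LU i j := by
  have := (d.isL_U i j).RR h
  rw [hd.U h χ hχ hh] at this
  exact this.unique (d.isL_U i j)

theorem RR_LLU (i j a b : Fin n) : RR w h (d.LLU i j a b) = d.LLU i j a b := by
  have := (d.isL_LU i j a b).RR h
  rw [RR_LU hd hχ hh] at this
  exact this.unique (d.isL_LU i j a b)

theorem RR_v (ε : ℝ) (g : AA w) : RR w h (d.v ε g) = d.v ε (RR w h g) := RR_SS h ε g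

theorem RR_u (ε : ℝ) (g : AA w) : RR w h (d.u ε g) = d.u ε (RR w h g) := by
  simp only [u, map_add, hd.U h χ hχ hh, RR_v hd hχ hh]

theorem RR_Lu (ε : ℝ) (g : AA w) (i j : Fin n) :
    RR w h (d.Lu ε g i j) = d.Lu ε (RR w h g) i j := by
  simp only [Lu, map_add, RR_LU hd hχ hh, RR_LS]

theorem RR_x (i : Fin n) : RR w h (d.x i) = χ • d.x i := by
  rw [x, RR_XX, hh, XX_smul_right]

theorem RR_p (ε : ℝ) (g : AA w) (i : Fin n) :
    RR w h (d.p ε g i) = χ • d.p ε (RR w h g) i := by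
  simp only [p, map_add, map_sum, RR_mul, RR_x hd hχ hh, RR_u hd hχ hh, RR_Lu hd hχ hh, smul_add,
    Finset.smul_sum, smul_mul_assoc]

theorem RR_Lp (ε : ℝ) (g : AA w) (j b i : Fin n) :
    RR w h (d.Lp ε g j b i) = χ • d.Lp ε (RR w h g) j b i := by
  have h1 := (d.isL_p ε g j b i).RR h
  rw [RR_p hd hχ hh] at h1
  exact h1.unique ((d.isL_p ε (RR w h g) j b i).smul χ)

theorem RR_M (ε : ℝ) (g : AA w) (i j : Fin n) :
    RR w h (d.M ε g i j) = d.M ε (RR w h g) i j := by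
  simp only [M, map_sum, RR_mul, RR_x hd hχ hh, RR_Lp hd hχ hh, smul_mul_smul_comm, hχ, one_smul]

theorem RR_sq (ε : ℝ) (g : AA w) : RR w h (d.sq ε g) = d.sq ε (RR w h g) := by
  simp only [sq, map_sum, RR_mul, RR_p hd hχ hh, smul_mul_smul_comm, hχ, one_smul]

theorem RR_T (z : Eucl n) (X : AA w) : RR w h (d.T z X) = d.T (χ • h.1 z) (RR w h X) := by
  rw [T, T, RR_RR, RR_RR, mul_gz hχ hh]

theorem norm_act (z : Eucl n) : ‖χ • h.1 z‖ = ‖z‖ := by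
  have h1 : |χ| = 1 := by
    rw [← sq_eq_sq₀ (abs_nonneg _) zero_le_one, sq_abs, one_pow, pow_two, hχ]
  rw [norm_smul, Real.norm_eq_abs, h1, one_mul, Gp.norm_apply]

theorem act_sub (z : Eucl n) : χ • h.1 z - d.e = χ • h.1 (z - d.e) := by
  rw [map_sub, hh, smul_sub, smul_smul, hχ, one_smul]

theorem norm_act_sub (z : Eucl n) : ‖χ • h.1 z - d.e‖ = ‖z - d.e‖ := by
  rw [act_sub hd hχ hh, norm_act hd hχ hh]

theorem RR_F (ε : ℝ) (z : Eucl n) (g : AA w) (i : Fin n) :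
    RR w h (d.F ε z g i) = χ • d.F ε (χ • h.1 z) (RR w h g) i := by
  simp only [F, FT, map_smul, map_sub, RR_T hd hχ hh, RR_p hd hχ hh, norm_act hd hχ hh,
    norm_act_sub hd hχ hh]
  simp only [T, map_smul]
  module

theorem RR_ℓ (z : Eucl n) (i : Fin n) : RR w h (d.ℓ z i) = χ • d.ℓ (χ • h.1 z) i := by
  simp only [ℓ, RR_XX]
  rw [norm_act_sub hd hχ hh, act_sub hd hχ hh, map_smul, ← XX_smul_right, smul_comm χ, smul_smul χ,
    hχ, one_smul]

theorem RR_E (ε : ℝ) (z : Eucl n) (g : AA w) :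
    RR w h (d.E ε z g) = d.E ε (χ • h.1 z) (RR w h g) := by
  simp only [E, map_sum, map_add, map_smul, RR_mul, RR_F hd hχ hh, RR_ℓ hd hχ hh,
    smul_mul_smul_comm, hχ, one_smul]

theorem RR_Y (ε : ℝ) (z : Eucl n) (g : AA w) :
    RR w h (d.Y ε z g) = d.Y ε (χ • h.1 z) (RR w h g) := by
  simp only [Y, map_sub, map_neg, map_smul, RR_T hd hχ hh, RR_u hd hχ hh, RR_sq hd hχ hh,
    norm_act hd hχ hh]

theorem RR_G (ε : ℝ) (z : Eucl n) (g : AA w) (i j : Fin n) :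
    RR w h (d.G ε z g i j) = d.G ε (χ • h.1 z) (RR w h g) i j := by
  simp only [G, map_smul, map_add, RR_mul, RR_T hd hχ hh, RR_M hd hχ hh, RR_p hd hχ hh, RR_x hd hχ hh,
    norm_act hd hχ hh, smul_mul_smul_comm, hχ, one_smul]

theorem RR_B {ε : ℝ} {z : Eucl n} {g : AA w} (hE : ‖d.E ε z g‖ ≤ 1 / 2) :
    RR w h (d.B ε z g) = d.B ε (χ • h.1 z) (RR w h g) := by
  simp only [B, RR_mul, map_add, RR_one, RR_det]
  rw [RR_ps h (summable_cExp _) le_rfl, RR_ps h (summable_cExp _) le_rfl, map_smul,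
    RR_ps h summable_cLog hE]
  simp only [RR_Y hd hχ hh, RR_E hd hχ hh, RR_G hd hχ hh]

theorem RR_N {ε : ℝ} {g : AA w} (hE : ∀ z : Zs d.e, ‖d.E ε z g‖ ≤ 1 / 2)
    (hi : Integrable (fun z : Zs d.e => d.B ε z g - 1) (d.ν ε)) :
    RR w h (d.N ε g) = d.N ε (RR w h g) := by
  rw [N, N, ← ContinuousLinearMap.integral_comp_comm _ hi,
    ← hd.ν ε h χ hχ hh fun z => d.B ε z (RR w h g) - 1]
  refine integral_congr_ae (Eventually.of_forall fun z => ?_)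
  simp only [map_sub, RR_one, RR_B hd hχ hh (hE z)]

theorem RR_Q {ε : ℝ} {g : AA w} (hE : ∀ z : Zs d.e, ‖d.E ε z g‖ ≤ 1 / 2)
    (hi : Integrable (fun z : Zs d.e => d.B ε z g - 1) (d.ν ε)) :
    RR w h (d.Q ε g) = d.Q ε (RR w h g) := by
  simp only [Q, Θ, RR_mul, map_add, map_sub, map_neg, map_smul, map_sum, RR_one, RR_det]
  rw [RR_ps h (summable_cExp _) le_rfl, RR_ps h (summable_cExp' _) le_rfl]
  simp only [map_smul, RR_N hd hχ hh hE hi, RR_v hd hχ hh, RR_u hd hχ hh, RR_sq hd hχ hh,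
    RR_M hd hχ hh, RR_LLU hd hχ hh]

end

theorem exists_invariant_fixedPoint (hc : d.Conc) (hd : d.Inv) :
    ∀ᶠ r in 𝓝[>] (0 : ℝ), ∀ᶠ ε in 𝓝[>] (0 : ℝ), ∃ g, ‖g‖ ≤ r ∧ d.Q ε g = g ∧
      (∀ (h : Gp n) (χ : ℝ), χ * χ = 1 → h.1 d.e = χ • d.e → RR w h g = g) ∧
      (∀ z : Zs d.e, ‖d.E ε z g‖ ≤ 1 / 2) ∧
      Integrable (fun z : Zs d.e => d.B ε z g - 1) (d.ν ε) := by
  obtain ⟨C, hC, hB⟩ := d.oo_B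
  filter_upwards [OO.exists_fixedPoint (oo_Q hc), d.E_small, hB] with r hr hE hB
  filter_upwards [hr, hE, hB, hc.prob] with ε ⟨g, hg, hfix, huniq⟩ hE hB hp
  have hE' : ∀ z : Zs d.e, ‖d.E ε z g‖ ≤ 1 / 2 := fun z => by
    linarith [(hE z g hg).1, norm_nonneg (d.E ε z g)]
  have hi : Integrable (fun z : Zs d.e => d.B ε z g - 1) (d.ν ε) := by
    refine ((hc.integrable r).const_mul C).mono'
      ((d.continuous_B hE').sub continuous_const).aestronglyMeasurable
      (Eventually.of_forall fun z => ?_)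
    linarith [(hB z g hg).1, norm_nonneg (d.B ε z g - 1)]
  refine ⟨g, hg, hfix, fun h χ hχ hh => ?_, hE', hi⟩
  refine huniq _ ((norm_RR_le h g).trans hg) ?_
  rw [← RR_Q hd hχ hh hE' hi, hfix]

end NL

end

section

section SphereFunctions

variable {n : ℕ}

/-- A group element carrying the unit vector `e` to the direction of `x`, for every `x ≠ 0`. -/
def sec (e x : Eucl n) : Gp n :=
  open Classical in if x + ‖x‖ • e ≠ 0 then gz e x else gref e

theorem sec_apply {e : Eucl n} (he : ‖e‖ = 1) (x : Eucl n) : ‖x‖ • (sec e x).1 e = x := by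
  by_cases h : x + ‖x‖ • e ≠ 0
  · rw [sec, if_pos h, gz_apply he h]
  · rw [sec, if_neg h, gref_self he, smul_neg, neg_eq_iff_add_eq_zero, add_comm, not_not.mp h]

theorem sec_inv_apply {e : Eucl n} (he : ‖e‖ = 1) (x : Eucl n) : (sec e x)⁻¹.1 x = ‖x‖ • e := by
  have h := congrArg (sec e x)⁻¹.1 (sec_apply he x)
  rw [map_smul, Gp.inv_apply_apply] at h
  exact h.symm

theorem inner_eb (a : Fin n) (x : Eucl n) : ⟪eb a, x⟫ = x a := by simp [PiLp.inner_apply]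

/-- Functions of `k e` only. -/
def IsInvFun (e : Eucl n) (y : C(Gp n, ℝ)) : Prop := ∀ h : Gp n, h.1 e = e → Rt h y = y

theorem IsInvFun.apply_eq {e : Eucl n} {y : C(Gp n, ℝ)} (hy : IsInvFun e y) {k k' : Gp n}
    (h : k.1 e = k'.1 e) : y k = y k' := by
  have h1 : (k⁻¹ * k').1 e = e := by
    change (k⁻¹).1 (k'.1 e) = e
    rw [← h, Gp.inv_apply_apply]
  have h2 := congrArg (fun f : C(Gp n, ℝ) => f k) (hy _ h1)
  simpa using h2.symm

theorem IsInvFun.Lij {e : Eucl n} {y : C(Gp n, ℝ)} (hy : IsInvFun e y) {l : ℕ} (hl : y ∈ Vp n l)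
    (i j : Fin n) : IsInvFun e (Lij i j y) := fun h hh => by
  rw [← Lij_Rt h i j hl, hy h hh]

/-- The `0`-homogeneous function on `ℝⁿ` induced by a function on the group. -/
def shp (e : Eucl n) (y : C(Gp n, ℝ)) (x : Eucl n) : ℝ := y (sec e x)

theorem shp_eq {e : Eucl n} (he : ‖e‖ = 1) {y : C(Gp n, ℝ)} (hy : IsInvFun e y) {x : Eucl n}
    (hx : x ≠ 0) {k : Gp n} (hk : ‖x‖ • k.1 e = x) : shp e y x = y k := by
  refine hy.apply_eq (smul_right_injective _ (norm_ne_zero_iff.mpr hx) ?_)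
  change ‖x‖ • (sec e x).1 e = ‖x‖ • k.1 e
  rw [sec_apply he, hk]

theorem shp_smul {e : Eucl n} (he : ‖e‖ = 1) {y : C(Gp n, ℝ)} (hy : IsInvFun e y) {x : Eucl n}
    (hx : x ≠ 0) {c : ℝ} (hc : 0 < c) : shp e y (c • x) = shp e y x :=
  shp_eq he hy (smul_ne_zero hc.ne' hx) (by
    rw [norm_smul, Real.norm_of_nonneg hc.le, mul_smul, sec_apply he])

theorem differentiableAt_gref {b : Eucl n} (hb : b ≠ 0) :
    DifferentiableAt ℝ (fun b => (gref b).1) b := by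
  have h : ‖b‖ ^ 2 ≠ 0 := by positivity
  change DifferentiableAt ℝ (fun b : Eucl n => ContinuousLinearMap.id ℝ (Eucl n) -
    (2 / ‖b‖ ^ 2) • ContinuousLinearMap.smulRightL ℝ _ _ (innerSL ℝ b) b) b
  have h1 : DifferentiableAt ℝ (fun b : Eucl n => 2 / ‖b‖ ^ 2) b :=
    ((hasStrictFDerivAt_norm_sq b).hasFDerivAt.differentiableAt.fun_inv h).const_mul 2
  have h2 : DifferentiableAt ℝ (fun b : Eucl n =>
      ContinuousLinearMap.smulRightL ℝ (Eucl n) (Eucl n) (innerSL ℝ b) b) b := by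
    have h3 : DifferentiableAt ℝ (fun b : Eucl n =>
        ContinuousLinearMap.smulRightL ℝ (Eucl n) (Eucl n) (innerSL ℝ b)) b :=
      ((ContinuousLinearMap.smulRightL ℝ (Eucl n) (Eucl n)).comp
        (innerSL ℝ : Eucl n →L[ℝ] _)).differentiableAt
    exact h3.clm_apply differentiableAt_id
  exact (differentiableAt_const _).sub (h1.fun_smul h2)

theorem differentiableAt_gz {e z : Eucl n} (hz : z ≠ 0) (hz' : z + ‖z‖ • e ≠ 0) :
    DifferentiableAt ℝ (fun z => (gz e z).1) z := by
  have h : DifferentiableAt ℝ (fun z : Eucl n => z + ‖z‖ • e) z :=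
    differentiableAt_id.add ((differentiableAt_id.norm ℝ hz).smul_const e)
  have h1 : DifferentiableAt ℝ (fun z : Eucl n => (gref (z + ‖z‖ • e)).1) z :=
    DifferentiableAt.comp (f := fun z : Eucl n => z + ‖z‖ • e) z (differentiableAt_gref hz') h
  exact h1.mul_const (gref e).1

theorem shp_eventuallyEq {e : Eucl n} (he : ‖e‖ = 1) {y : C(Gp n, ℝ)} (hy : IsInvFun e y)
    {x : Eucl n} (hx : x ≠ 0) :
    shp e y =ᶠ[𝓝 x] fun x' => y (sec e x * gz e ((sec e x)⁻¹.1 x')) := by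
  have hc : Continuous fun x' : Eucl n => (sec e x)⁻¹.1 x' + ‖(sec e x)⁻¹.1 x'‖ • e := by fun_prop
  have h0 := sec_inv_apply he x
  have h1 : (sec e x)⁻¹.1 x + ‖(sec e x)⁻¹.1 x‖ • e ≠ 0 := by
    rw [Gp.norm_apply, h0, ← two_smul ℝ, smul_smul]
    refine smul_ne_zero ?_ (norm_ne_zero_iff.mp (by rw [he]; exact one_ne_zero))
    have := norm_ne_zero_iff.mpr hx
    positivity
  filter_upwards [hc.continuousAt.eventually_ne h1, eventually_ne_nhds hx] with x' hx' hx0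
  refine shp_eq he hy hx0 ?_
  change ‖x'‖ • (sec e x).1 ((gz e ((sec e x)⁻¹.1 x')).1 e) = x'
  rw [← Gp.norm_apply (sec e x)⁻¹ x', ← map_smul, gz_apply he hx', Gp.apply_inv_apply]

theorem differentiableAt_shp {e : Eucl n} (he : ‖e‖ = 1) {y : C(Gp n, ℝ)} (hy : IsInvFun e y)
    (hs : IsSm y) {x : Eucl n} (hx : x ≠ 0) : DifferentiableAt ℝ (shp e y) x := by
  refine DifferentiableAt.congr_of_eventuallyEq ?_ (shp_eventuallyEq he hy hx)
  obtain ⟨F, hF, hyF⟩ := hs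
  have h0 := sec_inv_apply he x
  have hx' := norm_ne_zero_iff.mpr hx
  have he0 : e ≠ 0 := norm_ne_zero_iff.mp (by rw [he]; exact one_ne_zero)
  have h1 : (sec e x)⁻¹.1 x ≠ 0 := by rw [h0]; exact smul_ne_zero hx' he0
  have h2 : (sec e x)⁻¹.1 x + ‖(sec e x)⁻¹.1 x‖ • e ≠ 0 := by
    rw [Gp.norm_apply, h0, ← two_smul ℝ, smul_smul]
    exact smul_ne_zero (by positivity) he0
  have h3 : DifferentiableAt ℝ (fun x' => (sec e x).1 * (gz e ((sec e x)⁻¹.1 x')).1) x := by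
    have h4 : DifferentiableAt ℝ (fun x' => (gz e ((sec e x)⁻¹.1 x')).1) x :=
      DifferentiableAt.comp (g := fun z => (gz e z).1) x (differentiableAt_gz h1 h2)
        ((sec e x)⁻¹.1).differentiableAt
    exact h4.const_mul _
  have h5 : (fun x' => y (sec e x * gz e ((sec e x)⁻¹.1 x'))) =
      fun x' => F ((sec e x).1 * (gz e ((sec e x)⁻¹.1 x')).1) := funext fun x' => hyF _
  rw [h5]
  exact DifferentiableAt.comp (g := F) x
    ((hF (sec e x * gz e ((sec e x)⁻¹.1 x))).differentiableAt (by simp)) h3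

theorem fderiv_shp_skew {e : Eucl n} (he : ‖e‖ = 1) {y : C(Gp n, ℝ)} (hy : IsInvFun e y)
    (hs : IsSm y) {x : Eucl n} (hx : x ≠ 0) (A : Sk n) :
    fderiv ℝ (shp e y) x (A.1 x) = Ld A y (sec e x) := by
  have h1 : HasDerivAt (fun t => (exG A t).1 x) (A.1 x) 0 := by
    have := (hasDerivAt_exG A).clm_apply (hasDerivAt_const (0 : ℝ) x)
    simpa using this
  have h0 : (exG A 0).1 x = x := by rw [exG_zero]; rfl
  have h2 : HasDerivAt (fun t => shp e y ((exG A t).1 x)) (fderiv ℝ (shp e y) x (A.1 x)) 0 := by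
    refine HasFDerivAt.comp_hasDerivAt (l := shp e y) (f := fun t => (exG A t).1 x) 0 ?_ h1
    rw [h0]
    exact (differentiableAt_shp he hy hs hx).hasFDerivAt
  refine h2.unique ?_
  refine (hasLD_Ld A hs (sec e x)).congr_of_eventuallyEq (Eventually.of_forall fun t => ?_)
  refine shp_eq he hy (fun h => hx ?_) ?_
  · rw [← norm_eq_zero, Gp.norm_apply] at h
    exact norm_eq_zero.mp h
  · change ‖(exG A t).1 x‖ • (exG A t).1 ((sec e x).1 e) = _
    rw [Gp.norm_apply, ← map_smul, sec_apply he]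

theorem fderiv_shp_self {e : Eucl n} (he : ‖e‖ = 1) {y : C(Gp n, ℝ)} (hy : IsInvFun e y)
    (hs : IsSm y) {x : Eucl n} (hx : x ≠ 0) : fderiv ℝ (shp e y) x x = 0 := by
  have h1 : HasDerivAt (fun t : ℝ => (1 + t) • x) x 0 := by
    have := ((hasDerivAt_id (0 : ℝ)).const_add 1).smul_const x
    simpa using this
  have h2 : HasDerivAt (fun t : ℝ => shp e y ((1 + t) • x)) (fderiv ℝ (shp e y) x x) 0 := by
    refine HasFDerivAt.comp_hasDerivAt (l := shp e y) (f := fun t : ℝ => (1 + t) • x) 0 ?_ h1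
    rw [add_zero, one_smul]
    exact (differentiableAt_shp he hy hs hx).hasFDerivAt
  refine h2.unique ((hasDerivAt_const (0 : ℝ) (shp e y x)).congr_of_eventuallyEq ?_)
  filter_upwards [eventually_gt_nhds (show (-1 : ℝ) < 0 by norm_num)] with t ht
  exact shp_smul he hy hx (by linarith)

/-- The candidate gradient of a `0`-homogeneous function in terms of rotational derivatives. -/
def rotGrad (L : Fin n → Fin n → ℝ) (x : Eucl n) : Eucl n →L[ℝ] ℝ :=
  ∑ i, ((‖x‖ ^ 2)⁻¹ * ∑ j, x j * L i j) • EuclideanSpace.proj i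

theorem rotGrad_single (L : Fin n → Fin n → ℝ) (x : Eucl n) (i : Fin n) :
    rotGrad L x (eb i) = (‖x‖ ^ 2)⁻¹ * ∑ j, x j * L i j := by
  simp [rotGrad, Finset.sum_ite_eq', PiLp.single_apply]

theorem clm_ext_eb {φ ψ : Eucl n →L[ℝ] ℝ} (h : ∀ i, φ (eb i) = ψ (eb i)) : φ = ψ := by
  refine ContinuousLinearMap.ext fun v => ?_
  rw [← sum_inner_eb v, map_sum, map_sum]
  exact Finset.sum_congr rfl fun i _ => by rw [map_smul, map_smul, h]

theorem hasFDerivAt_shp {e : Eucl n} (he : ‖e‖ = 1) {y : C(Gp n, ℝ)} (hy : IsInvFun e y)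
    (hs : IsSm y) {x : Eucl n} (hx : x ≠ 0) :
    HasFDerivAt (shp e y) (rotGrad (fun i j => shp e (Lij i j y) x) x) x := by
  refine (differentiableAt_shp he hy hs hx).hasFDerivAt.congr_fderiv (clm_ext_eb fun i => ?_)
  have hx' : ‖x‖ ^ 2 ≠ 0 := by positivity
  rw [rotGrad_single, eq_inv_mul_iff_mul_eq₀ hx']
  have h1 : ∀ j, x j * shp e (Lij i j y) x =
      fderiv ℝ (shp e y) x (x j ^ 2 • eb i - (x i * x j) • eb j) := fun j => by
    rw [shp, Lij, ← fderiv_shp_skew he hy hs hx, ← smul_eq_mul, ← map_smul, wd_apply]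
    congr 1
    rw [inner_eb, inner_eb]
    module
  simp only [h1]
  rw [← map_sum, ← smul_eq_mul, ← map_smul, Finset.sum_sub_distrib, ← Finset.sum_smul]
  have h2 : ∑ j, x j ^ 2 = ‖x‖ ^ 2 := by simp [EuclideanSpace.norm_sq_eq]
  have h3 : ∑ j, (x i * x j) • eb j = x i • x := by
    refine Eq.trans ?_ (congrArg (x i • ·) (sum_inner_eb x))
    rw [Finset.smul_sum]
    refine Finset.sum_congr rfl fun j _ => ?_
    rw [mul_smul, inner_eb]
  rw [h2, h3, map_sub, map_smul (fderiv ℝ (shp e y) x) (x i) x, fderiv_shp_self he hy hs hx,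
    smul_zero, sub_zero]

/-- `L_ij` on functions of `k e` is recovered from the tangential gradient. -/
theorem Lij_relation {e : Eucl n} (he : ‖e‖ = 1) {l : ℕ} {y : C(Gp n, ℝ)} (hy : IsInvFun e y)
    (hl : y ∈ Vp n l) (k : Gp n) (i j : Fin n) :
    Lij i j y k = (k.1 e) j * ∑ a, (k.1 e) a * Lij i a y k -
      (k.1 e) i * ∑ a, (k.1 e) a * Lij j a y k := by
  have hn : ‖k.1 e‖ = 1 := by rw [Gp.norm_apply, he]
  have hx : k.1 e ≠ 0 := norm_ne_zero_iff.mp (by rw [hn]; exact one_ne_zero)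
  have hk : ∀ i j, shp e (Lij i j y) (k.1 e) = Lij i j y k := fun i j =>
    shp_eq he (hy.Lij hl i j) hx (by rw [hn, one_smul])
  have hs := isSm_of_mem hl
  have h1 := fderiv_shp_skew he hy hs hx (wd (eb i) (eb j))
  rw [(hasFDerivAt_shp he hy hs hx).fderiv, wd_apply, map_sub, map_smul, map_smul, rotGrad_single,
    rotGrad_single, inner_eb, inner_eb, hn] at h1
  simp only [hk, one_pow, inv_one, one_mul, smul_eq_mul] at h1
  rw [h1]
  exact (hk i j).symm

/-- Rapidly decreasing sequences of levelwise functions of `k e`. -/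
structure IsRapid (e : Eucl n) (Z : ℕ → C(Gp n, ℝ)) : Prop where
  mem : ∀ l, Z l ∈ Vp n l
  inv : ∀ l, IsInvFun e (Z l)
  decay : ∀ P : ℕ, ∃ C, ∀ l : ℕ, (1 + l : ℝ) ^ P * ‖Z l‖ ≤ C

theorem IsRapid.Lij {e : Eucl n} {Z : ℕ → C(Gp n, ℝ)} (h : IsRapid e Z) (i j : Fin n) :
    IsRapid e fun l => Lij i j (Z l) where
  mem l := Lij_mem i j (h.mem l)
  inv l := (h.inv l).Lij (h.mem l) i j
  decay P := by
    obtain ⟨C, hC⟩ := h.decay (P + n * n + 1)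
    refine ⟨‖(wd (eb i) (eb j)).1‖ * C, fun l => ?_⟩
    have h1 := norm_le_of_mem_Vp (Lij_mem i j (h.mem l))
    have h2 : n2 (_root_.Lij i j (Z l)) ≤ _ := n2_Ld_le (wd (eb i) (eb j)) (h.mem l)
    calc (1 + l : ℝ) ^ P * ‖_root_.Lij i j (Z l)‖
        ≤ (1 + l : ℝ) ^ P * ((1 + l) ^ (n * n) *
          ((1 + l : ℝ) * ‖(wd (eb i) (eb j)).1‖ * ‖Z l‖)) := by
          gcongr
          refine h1.trans ?_
          gcongr
          refine h2.trans ?_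
          gcongr
          · exact n2_nonneg _
          · linarith
          · exact n2_le_norm _
      _ = ‖(wd (eb i) (eb j)).1‖ * ((1 + l : ℝ) ^ (P + n * n + 1) * ‖Z l‖) := by ring
      _ ≤ _ := by gcongr; exact hC l

theorem IsRapid.summable {e : Eucl n} {Z : ℕ → C(Gp n, ℝ)} (h : IsRapid e Z) :
    Summable fun l => ‖Z l‖ := by
  obtain ⟨C, hC⟩ := h.decay 2
  have h1 : Summable fun l : ℕ => C * (1 / ((l + 1 : ℕ) : ℝ) ^ 2) :=
    ((summable_nat_add_iff 1).mpr (Real.summable_one_div_nat_pow.mpr one_lt_two)).mul_left C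
  refine h1.of_nonneg_of_le (fun l => norm_nonneg _) fun l => ?_
  rw [mul_one_div, le_div_iff₀' (by positivity)]
  refine le_of_eq_of_le ?_ (hC l)
  push_cast; ring

/-- The function on `ℝⁿ ∖ {0}` induced by a sequence. -/
def shs (e : Eucl n) (Z : ℕ → C(Gp n, ℝ)) (x : Eucl n) : ℝ := ∑' l, shp e (Z l) x

theorem IsRapid.summable_shp {e : Eucl n} {Z : ℕ → C(Gp n, ℝ)} (h : IsRapid e Z) (x : Eucl n) :
    Summable fun l => shp e (Z l) x :=
  h.summable.of_norm_bounded fun l => (Z l).norm_coe_le_norm _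

theorem norm_rotGrad_le (L : Fin n → Fin n → ℝ) (x : Eucl n) :
    ‖rotGrad L x‖ ≤ ‖x‖⁻¹ * ∑ i, ∑ j, |L i j| := by
  refine (norm_sum_le _ _).trans ?_
  rw [Finset.mul_sum]
  refine Finset.sum_le_sum fun i _ => ?_
  have h1 : ‖(EuclideanSpace.proj i : Eucl n →L[ℝ] ℝ)‖ ≤ 1 :=
    ContinuousLinearMap.opNorm_le_bound _ zero_le_one fun v => by
      rw [one_mul]; exact PiLp.norm_apply_le v i
  have h2 : |∑ j, x j * L i j| ≤ ‖x‖ * ∑ j, |L i j| := by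
    rw [Finset.mul_sum]
    refine (Finset.abs_sum_le_sum_abs _ _).trans (Finset.sum_le_sum fun j _ => ?_)
    rw [abs_mul]
    gcongr
    exact PiLp.norm_apply_le x j
  have h0 : 0 ≤ ∑ j, |L i j| := Finset.sum_nonneg fun _ _ => abs_nonneg _
  rw [norm_smul, norm_mul, Real.norm_eq_abs, Real.norm_eq_abs, abs_of_nonneg (by positivity)]
  calc _ ≤ (‖x‖ ^ 2)⁻¹ * (‖x‖ * ∑ j, |L i j|) * 1 := by gcongr
    _ = _ := by
      rcases eq_or_ne x 0 with rfl | hx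
      · simp
      have := norm_ne_zero_iff.mpr hx
      field_simp

theorem IsRapid.hasFDerivAt {e : Eucl n} (he : ‖e‖ = 1) {Z : ℕ → C(Gp n, ℝ)} (h : IsRapid e Z)
    {x : Eucl n} (hx : x ≠ 0) :
    HasFDerivAt (shs e Z) (rotGrad (fun i j => shs e (fun l => _root_.Lij i j (Z l)) x) x) x := by
  have hx' : 0 < ‖x‖ := norm_pos_iff.mpr hx
  have hb : ∀ x' ∈ Metric.ball x (‖x‖ / 2), ‖x‖ / 2 < ‖x'‖ := fun x' hx' => by
    rw [mem_ball_iff_norm'] at hx'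
    linarith [norm_sub_norm_le x x']
  have h0 : ∀ x' ∈ Metric.ball x (‖x‖ / 2), x' ≠ 0 := fun x' hx' =>
    norm_ne_zero_iff.mp (by linarith [hb x' hx'])
  have key := hasFDerivAt_tsum_of_isPreconnected
    (u := fun l => (‖x‖ / 2)⁻¹ * ∑ i, ∑ j, ‖_root_.Lij i j (Z l)‖)
    (f := fun l => shp e (Z l))
    (f' := fun l x => rotGrad (fun i j => shp e (_root_.Lij i j (Z l)) x) x)
    ((summable_sum fun i _ => summable_sum fun j _ => (h.Lij i j).summable).mul_left _)
    Metric.isOpen_ball (convex_ball x (‖x‖ / 2)).isPreconnected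
    (fun l x' hx' => hasFDerivAt_shp he (h.inv l) (isSm_of_mem (h.mem l)) (h0 x' hx'))
    (fun l x' hx' => (norm_rotGrad_le _ _).trans (by
      have := hb x' hx'
      gcongr
      exact (_root_.Lij _ _ (Z l)).norm_coe_le_norm _))
    (Metric.mem_ball_self (half_pos hx')) (h.summable_shp x) (Metric.mem_ball_self (half_pos hx'))
  refine key.congr_fderiv (clm_ext_eb fun i => ?_)
  have hs : ∀ i j, HasSum (fun l => shp e (_root_.Lij i j (Z l)) x)
      (shs e (fun l => _root_.Lij i j (Z l)) x) := fun i j => ((h.Lij i j).summable_shp x).hasSum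
  have h2 : HasSum (fun l => rotGrad (fun i j => shp e (_root_.Lij i j (Z l)) x) x)
      (rotGrad (fun i j => shs e (fun l => _root_.Lij i j (Z l)) x) x) := by
    unfold rotGrad
    exact hasSum_sum fun i _ =>
      ((hasSum_sum fun j _ => (hs i j).mul_left _).mul_left _).smul_const _
  rw [h2.tsum_eq]

theorem IsRapid.contDiffOn {e : Eucl n} (he : ‖e‖ = 1) {Z : ℕ → C(Gp n, ℝ)} (h : IsRapid e Z) :
    ContDiffOn ℝ (⊤ : ℕ∞) (shs e Z) {0}ᶜ := by
  refine contDiffOn_infty.mpr fun m => ?_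
  induction m generalizing Z with
  | zero =>
    exact contDiffOn_zero.mpr fun x hx => (h.hasFDerivAt he hx).continuousAt.continuousWithinAt
  | succ m ih =>
    rw [Nat.cast_add, Nat.cast_one]
    refine (contDiffOn_succ_iff_fderiv_of_isOpen isOpen_compl_singleton).mpr
      ⟨fun x hx => (h.hasFDerivAt he hx).differentiableAt.differentiableWithinAt, fun h => absurd h (by simp), ?_⟩
    refine ContDiffOn.congr ?_ fun x hx => (h.hasFDerivAt he hx).fderiv
    unfold rotGrad
    refine ContDiffOn.sum fun i _ => ContDiffOn.fun_smul (ContDiffOn.mul ?_ ?_) contDiffOn_const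
    · refine ContDiffOn.inv (contDiff_norm_sq ℝ).contDiffOn fun x hx => ?_
      have := norm_ne_zero_iff.mpr hx
      positivity
    · refine ContDiffOn.sum fun j _ => ContDiffOn.mul ?_ (ih (h.Lij i j))
      exact (EuclideanSpace.proj j : Eucl n →L[ℝ] ℝ).contDiff.contDiffOn

end SphereFunctions

end

section

section SphereEval

variable {n : ℕ} {w : Wt n}

/-- The weights dominate every polynomial. -/
def Wt.Super (w : Wt n) : Prop := ∀ P : ℕ, ∃ C, ∀ l : ℕ, (1 + l : ℝ) ^ P ≤ C * w.W l

/-- Elements fixed by the translations which fix `e`. -/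
def IsInv (e : Eucl n) (X : AA w) : Prop := ∀ h : Gp n, h.1 e = e → RR w h X = X

theorem IsInv.comp {e : Eucl n} {X : AA w} (hX : IsInv e X) (l : ℕ) : IsInvFun e (comp X l) :=
  fun h hh => by rw [← comp_RR, hX h hh]

theorem IsInv.isRapid (hw : w.Super) {e : Eucl n} {X : AA w} (hX : IsInv e X) :
    IsRapid e (_root_.comp X) where
  mem l := comp_mem X l
  inv l := hX.comp l
  decay P := by
    obtain ⟨C, hC⟩ := hw (P + n * n)
    refine ⟨C * ‖X‖, fun l => ?_⟩
    have hC0 : 0 ≤ C := by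
      have := (pow_pos (by positivity : (0 : ℝ) < 1 + l) (P + n * n)).trans_le (hC l)
      exact (pos_of_mul_pos_left this (w.pos l).le).le
    calc (1 + l : ℝ) ^ P * ‖_root_.comp X l‖
        ≤ (1 + l : ℝ) ^ P * ((1 + l) ^ (n * n) * n2 (_root_.comp X l)) := by
          gcongr; exact norm_le_of_mem_Vp (comp_mem X l)
      _ = (1 + l : ℝ) ^ (P + n * n) * n2 (_root_.comp X l) := by ring
      _ ≤ C * w.W l * n2 (_root_.comp X l) := by
          gcongr
          · exact n2_nonneg _
          · exact hC l
      _ = C * (w.W l * n2 (_root_.comp X l)) := by ring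
      _ ≤ _ := by gcongr; exact n2_comp_le X l

/-- The `0`-homogeneous function induced by an element of the algebra. -/
def sph (e : Eucl n) (X : AA w) (x : Eucl n) : ℝ := evk w (sec e x) X

theorem shs_comp (e : Eucl n) (X : AA w) : shs e (comp X) = sph e X :=
  funext fun x => (hasSum_evk (sec e x) X).tsum_eq

theorem IsInv.evk_eq {e : Eucl n} {X : AA w} (hX : IsInv e X) {k k' : Gp n}
    (h : k.1 e = k'.1 e) : evk w k X = evk w k' X := by
  rw [← (hasSum_evk k X).tsum_eq, ← (hasSum_evk k' X).tsum_eq]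
  exact tsum_congr fun l => (hX.comp l).apply_eq h

theorem sph_eq {e : Eucl n} (he : ‖e‖ = 1) {X : AA w} (hX : IsInv e X) {x : Eucl n}
    (hx : x ≠ 0) {k : Gp n} (hk : ‖x‖ • k.1 e = x) : sph e X x = evk w k X := by
  refine hX.evk_eq (smul_right_injective _ (norm_ne_zero_iff.mpr hx) ?_)
  change ‖x‖ • (sec e x).1 e = ‖x‖ • k.1 e
  rw [sec_apply he, hk]

theorem hasFDerivAt_sph (hw : w.Super) {e : Eucl n} (he : ‖e‖ = 1) {X : AA w}
    {X' : Fin n → Fin n → AA w} (hX : IsInv e X) (hL : ∀ i j, IsL i j X (X' i j)) {x : Eucl n}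
    (hx : x ≠ 0) :
    HasFDerivAt (sph e X) (rotGrad (fun i j => sph e (X' i j) x) x) x := by
  have h := (hX.isRapid hw).hasFDerivAt he hx
  rw [shs_comp] at h
  refine h.congr_fderiv (congrArg (rotGrad · x) (funext fun i => funext fun j => ?_))
  rw [← shs_comp]
  exact congrArg (shs e · x) (funext fun l => (hL i j l).symm)

theorem contDiffOn_sph (hw : w.Super) {e : Eucl n} (he : ‖e‖ = 1) {X : AA w} (hX : IsInv e X) :
    ContDiffOn ℝ (⊤ : ℕ∞) (sph e X) {0}ᶜ := by
  rw [← shs_comp]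
  exact (hX.isRapid hw).contDiffOn he

theorem IsInv.of_isL {e : Eucl n} {X X' : AA w} {i j : Fin n} (hX : IsInv e X)
    (hL : IsL i j X X') : IsInv e X' := fun h hh => AA_ext fun l => by
  rw [comp_RR, hL l]
  exact (hX.comp l).Lij (comp_mem X l) i j h hh

theorem evk_relation {e : Eucl n} (he : ‖e‖ = 1) {X : AA w}
    {X' : Fin n → Fin n → AA w} (hX : IsInv e X) (hL : ∀ i j, IsL i j X (X' i j)) (k : Gp n)
    (i j : Fin n) :
    evk w k (X' i j) = (k.1 e) j * ∑ a, (k.1 e) a * evk w k (X' i a) -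
      (k.1 e) i * ∑ a, (k.1 e) a * evk w k (X' j a) := by
  have h : ∀ i, HasSum (fun l => ∑ a, (k.1 e) a * Lij i a (comp X l) k)
      (∑ a, (k.1 e) a * evk w k (X' i a)) := fun i =>
    hasSum_sum fun a _ => ((hasSum_evk k (X' i a)).congr_fun fun l => by rw [hL i a l]).mul_left _
  refine (hasSum_evk k (X' i j)).unique ?_
  refine (((h i).mul_left _).sub ((h j).mul_left _)).congr_fun fun l => ?_
  rw [hL i j l]
  exact Lij_relation he (hX.comp l) (comp_mem X l) k i j

end SphereEval

end

section

theorem exp_eq_ps (y : ℝ) : Real.exp y = 1 + ps cExp y := by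
  have h := NormedSpace.expSeries_div_hasSum_exp (𝔸 := ℝ) y
  rw [← Real.exp_eq_exp_ℝ] at h
  have h2 := (hasSum_nat_add_iff' 1).mpr h
  have h3 := hasSum_ps (summable_cExp |y|) (a := y) le_rfl
  have h4 := h2.unique (h3.congr_fun fun m => by
    simp only [cExp, smul_eq_mul]; rw [div_eq_inv_mul])
  simp at h4
  linarith

theorem exp_eq_ps' (y : ℝ) : Real.exp y = 1 + y + y * ps cExp' y := by
  have h := NormedSpace.expSeries_div_hasSum_exp (𝔸 := ℝ) y
  rw [← Real.exp_eq_exp_ℝ] at h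
  have h2 := (hasSum_nat_add_iff' 2).mpr h
  have h3 := (hasSum_ps (summable_cExp' |y|) (a := y) le_rfl).mul_left y
  have h4 := h2.unique (h3.congr_fun fun m => by
    simp only [cExp', smul_eq_mul]; rw [div_eq_inv_mul]; ring)
  simp [Finset.sum_range_succ] at h4
  linarith

theorem log_eq_ps {y : ℝ} (hy : |y| ≤ 1 / 2) : Real.log (1 + y) = ps cLog y := by
  have h := Real.hasSum_pow_div_log_of_abs_lt_one (x := -y) (by rw [abs_neg]; linarith)
  have h3 := hasSum_ps summable_cLog (a := y) (by rwa [Real.norm_eq_abs])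
  have h4 := h.neg.unique (h3.congr_fun fun m => by
    simp only [cLog, smul_eq_mul]; rw [neg_pow]; ring)
  rw [← h4]; ring_nf

section RealEquation

variable {n : ℕ} {w : Wt n}

theorem continuous_evk (k : Gp n) : Continuous (evk w k) := (evkL w k).continuous

theorem evk_ps (k : Gp n) {c : ℕ → ℝ} {ρ : ℝ} (hc : Summable fun m => |c m| * ρ ^ m) {X : AA w}
    (hX : ‖X‖ ≤ ρ) : evk w k (ps c X) = ps c (evk w k X) :=
  map_ps (evk w k) (continuous_evk k) hc hX

theorem evk_expm1 (k : Gp n) (X : AA w) : evk w k (1 + ps cExp X) = Real.exp (evk w k X) := by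
  rw [map_add, map_one, evk_ps k (summable_cExp ‖X‖) le_rfl, exp_eq_ps]

theorem evk_det (k : Gp n) {m : ℕ} (f : Fin m → Fin m → AA w) :
    evk w k (1 + Matrix.of f).det = (1 + Matrix.of fun i j => evk w k (f i j)).det := by
  rw [AlgHom.map_det]
  congr 1
  ext i j
  simp [Matrix.one_apply, apply_ite (evk w k)]

namespace NL

variable {d : NL w} {ε : ℝ} {g : AA w}

theorem evk_x (k : Gp n) (i : Fin n) : evk w k (d.x i) = (k.1 d.e) i := by
  rw [x, evk_XX, inner_eb]

theorem sum_sq_apply (k : Gp n) : ∑ i, (k.1 d.e) i * (k.1 d.e) i = 1 := by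
  have : ‖k.1 d.e‖ ^ 2 = 1 := by rw [Gp.norm_apply, d.norm_e, one_pow]
  rw [EuclideanSpace.norm_sq_eq] at this
  rw [← this]
  exact Finset.sum_congr rfl fun i _ => by rw [Real.norm_eq_abs, sq_abs, pow_two]

theorem Lu_anti (hu : IsInv d.e (d.u ε g)) (i j : Fin n) : d.Lu ε g i j = (-1 : ℝ) • d.Lu ε g j i :=
  AA_ext fun l => by
    rw [comp_smul, d.isL_u ε g i j l, d.isL_u ε g j i l]
    ext k
    have h := Lij_relation d.norm_e (hu.comp l) (comp_mem _ l) k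
    rw [ContinuousMap.smul_apply, h i j, h j i, smul_eq_mul]
    ring

theorem LLu_anti (hu : IsInv d.e (d.u ε g)) (i j a b : Fin n) :
    d.LLu ε g i j a b = (-1 : ℝ) • d.LLu ε g i j b a := by
  refine (d.isL_Lu ε g i j a b).unique ?_
  rw [Lu_anti hu a b]
  exact (d.isL_Lu ε g i j b a).smul _

theorem trace_identity {X : Fin n → ℝ} (hX : ∑ i, X i * X i = 1) (u : ℝ) {a : Fin n → Fin n → ℝ}
    (ha : ∀ i j, a i j = -a j i) {b : Fin n → Fin n → Fin n → Fin n → ℝ}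
    (hb : ∀ i j p q, b i j p q = -b i j q p)
    (hr : ∀ i j p q, b i j p q = X j * ∑ c, X c * b i c p q - X i * ∑ c, X c * b j c p q) :
    ∑ i, ∑ m, X m * (((if i = i then X m else 0) - if m = i then X i else 0) * u + X i * a i m +
      ∑ c, (((if i = c then X m else 0) - if m = c then X i else 0) * a i c + X c * b i m i c)) =
      (n - 1) * u + 1 / 2 * ∑ i, ∑ j, b i j i j := by
  have e1 : ∑ i, ∑ m, X m * (((if i = i then X m else 0) - if m = i then X i else 0) * u) =
      (n - 1) * u := by
    have : ∀ i : Fin n, ∑ m, X m * (((if i = i then X m else 0) - if m = i then X i else 0) * u) =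
        u - X i * X i * u := fun i => by
      rw [Finset.sum_congr rfl fun m _ => (show X m * (((if i = i then X m else 0) -
        if m = i then X i else 0) * u) = X m * X m * u - if m = i then X m * X i * u else 0 by
          rw [if_pos rfl]; split_ifs <;> ring)]
      rw [Finset.sum_sub_distrib, ← Finset.sum_mul, hX, Finset.sum_ite_eq' Finset.univ i]
      simp
    rw [Finset.sum_congr rfl fun i _ => this i, Finset.sum_sub_distrib, ← Finset.sum_mul, hX]
    simp; ring
  have ha0 : ∀ i, a i i = 0 := fun i => by linarith [ha i i]
  have e3 : ∀ i m, ∑ c, ((if i = c then X m else 0) - if m = c then X i else 0) * a i c =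
      -(X i * a i m) := fun i m => by
    simp only [sub_mul, ite_mul, zero_mul, Finset.sum_sub_distrib, Finset.sum_ite_eq,
      Finset.mem_univ, if_true, ha0]
    ring
  have e4 : ∑ i, ∑ j, b i j i j = 2 * ∑ i, ∑ m, X m * ∑ c, X c * b i m i c := by
    have h1 : ∀ i j, b i j i j =
        ∑ c, X j * (X c * b i c i j) + ∑ c, X i * (X c * b j c j i) := fun i j => by
      conv_lhs => rw [hr]
      rw [Finset.mul_sum, Finset.mul_sum, sub_eq_add_neg, ← Finset.sum_neg_distrib]
      congr 1
      refine Finset.sum_congr rfl fun c _ => ?_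
      rw [hb j c i j]; ring
    simp only [h1, Finset.sum_add_distrib]
    have h2 : ∑ i, ∑ j, ∑ c, X i * (X c * b j c j i) = ∑ i, ∑ j, ∑ c, X j * (X c * b i c i j) :=
      Finset.sum_comm
    have h3 : ∑ i, ∑ m, X m * ∑ c, X c * b i m i c =
        ∑ i, ∑ j, ∑ c, X j * (X c * b i c i j) := by
      refine Finset.sum_congr rfl fun i _ => ?_
      rw [Finset.sum_comm]
      refine Finset.sum_congr rfl fun m _ => ?_
      rw [Finset.mul_sum]
      refine Finset.sum_congr rfl fun c _ => ?_
      ring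
    rw [h2, h3]; ring
  have h0 : ∀ i m, X m * (((if i = i then X m else 0) - if m = i then X i else 0) * u +
      X i * a i m + ∑ c, (((if i = c then X m else 0) - if m = c then X i else 0) * a i c +
        X c * b i m i c)) =
      X m * (((if i = i then X m else 0) - if m = i then X i else 0) * u) +
        X m * ∑ c, X c * b i m i c := fun i m => by
    rw [Finset.sum_add_distrib, e3]; ring
  rw [Finset.sum_congr rfl fun i _ => Finset.sum_congr rfl fun m _ => h0 i m]
  rw [Finset.sum_congr rfl fun i _ => Finset.sum_add_distrib, Finset.sum_add_distrib, e1, e4]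
  ring

theorem evk_trace (hu : IsInv d.e (d.u ε g)) (k : Gp n) :
    ∑ i, evk w k (d.M ε g i i) =
      (n - 1) * evk w k (d.u ε g) + 1 / 2 * ∑ i, ∑ j, evk w k (d.LLu ε g i j i j) := by
  rw [← trace_identity (X := fun i => (k.1 d.e) i) (a := fun i j => evk w k (d.Lu ε g i j))
    (b := fun i j p q => evk w k (d.LLu ε g i j p q)) (sum_sq_apply k) (evk w k (d.u ε g))
    (fun i j => by rw [Lu_anti hu, map_smul, smul_eq_mul, neg_one_mul])
    (fun i j p q => by rw [LLu_anti hu, map_smul, smul_eq_mul, neg_one_mul])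
    (fun i j p q => evk_relation d.norm_e (hu.of_isL (d.isL_u ε g p q))
      (fun i j => d.isL_Lu ε g i j p q) k i j)]
  simp only [M, Lp, Lx, map_sum, map_mul, map_add, map_sub, evk_x, apply_ite (evk w k), map_zero]

theorem _root_.comp_sum {ι : Type*} (s : Finset ι) (X : ι → AA w) (l : ℕ) :
    comp (∑ i ∈ s, X i) l = ∑ i ∈ s, comp (X i) l := by
  induction s using Finset.cons_induction with
  | empty => simp [_root_.comp_zero]
  | cons a s ha ih => rw [Finset.sum_cons, Finset.sum_cons, _root_.comp_add, ih]

/-- The equation defining `v` through the resolvent. -/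
theorem v_sub_Cas (hε : 0 < ε) (g : AA w) :
    d.v ε g - ε • ((1 / 2 : ℝ) • ∑ i, ∑ j, LLS w i j i j ε g) = g := AA_ext fun l => by
  have h := resol_sub_Cas (posp_pos ε).le (⟨comp g l, comp_mem g l⟩ : Vp n l)
  rw [Cas_apply] at h
  have h2 : posp ε = ε := posp_eq hε
  simp only [_root_.comp_sub, _root_.comp_smul, comp_sum, comp_LLS, v, comp_SS]
  refine Eq.trans ?_ h
  congr 2
  exact h2.symm

theorem evk_B (k : Gp n) (z : Eucl n) (h : ‖d.E ε z g‖ ≤ 1 / 2) :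
    evk w k (d.B ε z g) = Real.exp (evk w k (d.Y ε z g)) *
      (1 + Matrix.of fun i j => evk w k (d.G ε z g i j)).det *
      (1 + evk w k (d.E ε z g)) ^ (-(d.α / 2)) := by
  have h1 : |evk w k (d.E ε z g)| ≤ 1 / 2 := (abs_evk_le k _).trans h
  have h2 := abs_le.1 h1
  rw [B, map_mul, map_mul, evk_expm1, evk_det, evk_expm1, map_smul, evk_ps k summable_cLog h,
    ← log_eq_ps h1, Real.rpow_def_of_pos (by linarith), smul_eq_mul, mul_comm (Real.log _)]

theorem evk_N (k : Gp n) [IsProbabilityMeasure (d.ν ε)]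
    (hB : Integrable (fun z : Zs d.e => d.B ε z g - 1) (d.ν ε)) :
    1 + evk w k (d.N ε g) = ∫ z : Zs d.e, evk w k (d.B ε z g) ∂d.ν ε := by
  have h := (evkL w k).integral_comp_comm hB
  have hi := (evkL w k).integrable_comp hB
  simp only [evkL_apply] at h hi
  rw [N, ← h]
  have : ∀ z : Zs d.e, evk w k (d.B ε z g) = evk w k (d.B ε z g - 1) + 1 := fun z => by
    rw [map_sub, map_one]; ring
  simp_rw [this]
  rw [integral_add hi (integrable_const _)]
  simp [add_comm]

/-- The scalar equation satisfied by a fixed point. -/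
theorem evk_fixedPoint (hε : 0 < ε) (hg : d.Q ε g = g) (hu : IsInv d.e (d.u ε g))
    [IsProbabilityMeasure (d.ν ε)]
    (hB : Integrable (fun z : Zs d.e => d.B ε z g - 1) (d.ν ε)) (k : Gp n) :
    Real.exp (evk w k (d.v ε g)) =
      Real.exp (-(ε / 2) * evk w k (d.sq ε g)) * (1 + ε * evk w k (d.u ε g)) *
        (∫ z : Zs d.e, evk w k (d.B ε z g) ∂d.ν ε) *
        (1 + Matrix.of fun i j => ε * evk w k (d.M ε g i j)).det := by
  have h := congrArg (evk w k) ((v_sub_Cas (d := d) hε g).trans hg.symm)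
  have ht := evk_trace hu k
  have hd := evk_det k fun i j => ε • d.M ε g i j
  simp only [map_smul, smul_eq_mul] at hd
  have hLLu : ∀ i j, evk w k (d.LLu ε g i j i j) =
      evk w k (d.LLU i j i j) + evk w k (LLS w i j i j ε g) := fun i j => by
    rw [LLu, map_add]
  simp only [hLLu, Finset.sum_add_distrib] at ht
  have hv : evk w k (ps cExp' (d.v ε g)) = ps cExp' (evk w k (d.v ε g)) :=
    evk_ps k (summable_cExp' ‖d.v ε g‖) le_rfl
  simp only [Q, Θ, map_add, map_sub, map_mul, map_neg, map_smul, map_sum, map_one, smul_eq_mul,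
    hd, hv, ← Finset.mul_sum] at h
  rw [ht] at h
  have he := evk_expm1 k ((-(ε / 2)) • d.sq ε g)
  rw [map_add, map_one, map_smul, smul_eq_mul] at he
  rw [he, evk_N k hB] at h
  rw [exp_eq_ps']
  linear_combination h

end NL
end RealEquation

end

section

section Geometry

variable {n : ℕ}

/-- A small even `1`-homogeneous perturbation `W` of the norm, with gradient `P` and Hessian `A`. -/
structure IsPert (κ : ℝ) (W : Eucl n → ℝ) (P : Eucl n → Eucl n) (A : Eucl n → Eucl n →L[ℝ] Eucl n) :
    Prop where
  κ_pos : 0 < κ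
  κ_le : κ ≤ 1 / 100
  grad : ∀ x, x ≠ 0 → HasGradientAt W (P x) x
  deriv : ∀ x, x ≠ 0 → HasFDerivAt P (A x) x
  euler : ∀ x, ⟪x, P x⟫ = W x
  homog : ∀ c : ℝ, 0 < c → ∀ x, P (c • x) = P x
  even : ∀ x, W (-x) = W x
  norm_P : ∀ x, ‖P x‖ ≤ κ
  norm_A : ∀ x, x ≠ 0 → ‖A x‖ ≤ κ / ‖x‖
  smooth : ContDiffOn ℝ (⊤ : ℕ∞) W {(0 : Eucl n)}ᶜ

/-- The convex set with support function `R (‖x‖ + W x)`. -/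
def bodyOf (R : ℝ) (W : Eucl n → ℝ) : Set (Eucl n) := {y | ∀ x, ⟪x, y⟫ ≤ R * (‖x‖ + W x)}

namespace IsPert

variable {κ : ℝ} {W : Eucl n → ℝ} {P : Eucl n → Eucl n} {A : Eucl n → Eucl n →L[ℝ] Eucl n}
  (h : IsPert κ W P A)
theorem half_le_norm {x y : Eucl n} (hx : ‖x‖ = 1) (hy : ‖y‖ = 1) (hxy : ‖x - y‖ ≤ 1) {t : ℝ}
    (ht0 : 0 ≤ t) (ht1 : t ≤ 1) : 1 / 2 ≤ ‖y + t • (x - y)‖ := by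
  rcases le_total t (1 / 2) with ht | ht
  · have := norm_sub_norm_le y (-(t • (x - y)))
    rw [norm_neg, norm_smul, Real.norm_of_nonneg ht0, sub_neg_eq_add] at this
    nlinarith [norm_nonneg (x - y)]
  · have := norm_sub_norm_le x ((1 - t) • (x - y))
    rw [norm_smul, Real.norm_of_nonneg (by linarith)] at this
    have e : x - (1 - t) • (x - y) = y + t • (x - y) := by module
    rw [e] at this
    nlinarith [norm_nonneg (x - y)]

theorem _root_.hasFDerivAt_norm_of_ne {x : Eucl n} (hx : x ≠ 0) :
    HasFDerivAt (fun x : Eucl n => ‖x‖) (innerSL ℝ (‖x‖⁻¹ • x)) x := by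
  have h2 := ((hasStrictFDerivAt_norm_sq x).hasFDerivAt).sqrt
    (by simpa using hx)
  have e : (fun x : Eucl n => √(‖x‖ ^ 2)) = fun x => ‖x‖ := by
    ext; rw [Real.sqrt_sq (norm_nonneg _)]
  rw [e] at h2
  refine h2.congr_fderiv ?_
  ext v
  have hp := (norm_pos_iff.2 hx).ne'
  rw [Real.sqrt_sq (norm_nonneg x)]
  simp
  field_simp

include h

theorem W_zero : W 0 = 0 := by rw [← h.euler, inner_zero_left]

theorem W_smul {c : ℝ} (hc : 0 < c) (x : Eucl n) : W (c • x) = c * W x := by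
  rw [← h.euler, ← h.euler, h.homog c hc, real_inner_smul_left]

theorem abs_W_le (x : Eucl n) : |W x| ≤ κ * ‖x‖ := by
  rw [← h.euler, mul_comm]
  exact (abs_real_inner_le_norm _ _).trans (mul_le_mul_of_nonneg_left (h.norm_P x) (norm_nonneg _))

theorem P_unit {x : Eucl n} (hx : x ≠ 0) : P (‖x‖⁻¹ • x) = P x :=
  h.homog _ (inv_pos.2 (norm_pos_iff.2 hx)) x

theorem inner_A {x : Eucl n} (hx : x ≠ 0) (v : Eucl n) : ⟪x, A x v⟫ = 0 := by
  have h1 := (hasFDerivAt_id x).inner ℝ (h.deriv x hx)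
  have h2 := (h.grad x hx).hasFDerivAt
  have h3 := (h1.congr_of_eventuallyEq (Eventually.of_forall fun y => (h.euler y).symm)).unique h2
  have h4 := congrArg (fun L : Eucl n →L[ℝ] ℝ => L v) h3
  simp [fderivInnerCLM_apply] at h4
  linarith [h4, real_inner_comm v (P x), real_inner_comm x (A x v)]

theorem norm_A_le {x v : Eucl n} (hx : 1 / 2 ≤ ‖x‖) : ‖A x v‖ ≤ 2 * κ * ‖v‖ := by
  have h0 : x ≠ 0 := norm_pos_iff.1 (by linarith)
  refine ((A x).le_opNorm v).trans (mul_le_mul_of_nonneg_right ((h.norm_A x h0).trans ?_)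
    (norm_nonneg v))
  rw [div_le_iff₀ (by linarith)]
  nlinarith [h.κ_pos]

theorem hasDerivAt_segment {x y : Eucl n} (hx : ‖x‖ = 1) (hy : ‖y‖ = 1) (hxy : ‖x - y‖ ≤ 1) {t : ℝ}
    (ht : t ∈ Set.Icc (0 : ℝ) 1) :
    HasDerivAt (fun t : ℝ => P (y + t • (x - y))) (A (y + t • (x - y)) (x - y)) t := by
  have h0 : y + t • (x - y) ≠ 0 :=
    norm_pos_iff.1 (by linarith [half_le_norm hx hy hxy ht.1 ht.2])
  refine (h.deriv _ h0).comp_hasDerivAt (f := fun t : ℝ => y + t • (x - y)) t ?_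
  simpa using ((hasDerivAt_id t).smul_const (x - y)).const_add y

theorem norm_P_sub_le {x y : Eucl n} (hx : ‖x‖ = 1) (hy : ‖y‖ = 1) :
    ‖P x - P y‖ ≤ 2 * κ * ‖x - y‖ := by
  rcases le_total ‖x - y‖ 1 with hxy | hxy
  · have := norm_image_sub_le_of_norm_deriv_le_segment_01' (C := 2 * κ * ‖x - y‖)
      (fun t ht => (h.hasDerivAt_segment hx hy hxy ht).hasDerivWithinAt)
      (fun t ht => h.norm_A_le (half_le_norm hx hy hxy ht.1 ht.2.le))
    simpa using this
  · have := norm_sub_le (P x) (P y)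
    nlinarith [h.norm_P x, h.norm_P y, h.κ_pos]

theorem inner_P_sub_le {x y : Eucl n} (hx : ‖x‖ = 1) (hy : ‖y‖ = 1) :
    |⟪x, P x - P y⟫| ≤ 2 * κ * ‖x - y‖ ^ 2 := by
  rcases le_total ‖x - y‖ 1 with hxy | hxy
  · have := norm_image_sub_le_of_norm_deriv_le_segment_01'
      (f := fun t : ℝ => ⟪x, P (y + t • (x - y))⟫) (C := 2 * κ * ‖x - y‖ ^ 2)
      (fun t ht => ((innerSL ℝ x).hasFDerivAt.comp_hasDerivAt t
        (h.hasDerivAt_segment hx hy hxy ht)).hasDerivWithinAt)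
      (fun t ht => by
        have h1 := half_le_norm hx hy hxy ht.1 ht.2.le
        have h0 : y + t • (x - y) ≠ 0 := norm_pos_iff.1 (by linarith)
        have e : (innerSL ℝ x) (A (y + t • (x - y)) (x - y)) =
            ⟪(1 - t) • (x - y), A (y + t • (x - y)) (x - y)⟫ := by
          rw [innerSL_apply_apply, show (1 - t) • (x - y) = x - (y + t • (x - y)) by module,
            inner_sub_left, h.inner_A h0, sub_zero]
        rw [e]
        refine (norm_inner_le_norm _ _).trans ?_
        rw [norm_smul, Real.norm_of_nonneg (by linarith [ht.2])]
        have h3 := h.norm_A_le (v := x - y) h1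
        have h4 : (1 - t) * ‖x - y‖ ≤ ‖x - y‖ := by nlinarith [norm_nonneg (x - y), ht.1]
        calc _ ≤ ‖x - y‖ * (2 * κ * ‖x - y‖) :=
              mul_le_mul h4 h3 (norm_nonneg _) (norm_nonneg _)
          _ = _ := by ring)
    simpa [inner_sub_right] using this
  · refine (abs_real_inner_le_norm _ _).trans ?_
    rw [hx, one_mul]
    refine (h.norm_P_sub_le hx hy).trans ?_
    have := h.κ_pos
    nlinarith [mul_nonneg this.le (sub_nonneg.2 hxy), norm_nonneg (x - y)]

/-- The supporting hyperplane inequality. -/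
theorem inner_le_of_norm_eq_one {x y : Eucl n} (hx : ‖x‖ = 1) (hy : ‖y‖ = 1) :
    ⟪x, y + P y⟫ ≤ 1 + W x := by
  have h1 := (abs_le.1 (h.inner_P_sub_le hx hy)).1
  rw [inner_sub_right, h.euler] at h1
  have h2 := norm_sub_sq_real x y
  rw [hx, hy] at h2
  rw [inner_add_right]
  nlinarith [h.κ_le, sq_nonneg ‖x - y‖]

theorem inner_le {x y : Eucl n} (hy : ‖y‖ = 1) : ⟪x, y + P y⟫ ≤ ‖x‖ + W x := by
  by_cases hx : x = 0
  · simp [hx, h.W_zero]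
  · have hp := norm_pos_iff.2 hx
    have h1 := h.inner_le_of_norm_eq_one (x := ‖x‖⁻¹ • x)
      (by rw [norm_smul, norm_inv, norm_norm, inv_mul_cancel₀ hp.ne']) hy
    rw [real_inner_smul_left, h.W_smul (inv_pos.2 hp), inv_mul_le_iff₀ hp] at h1
    refine h1.trans_eq ?_
    field_simp

theorem le_norm_add (x : Eucl n) : 99 / 100 * ‖x‖ ≤ ‖x‖ + W x := by
  have := (abs_le.1 (h.abs_W_le x)).1
  nlinarith [h.κ_le, norm_nonneg x]

theorem smul_mem_bodyOf {R : ℝ} (hR : 0 < R) {y : Eucl n} (hy : ‖y‖ = 1) :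
    R • (y + P y) ∈ bodyOf R W := fun x => by
  rw [real_inner_smul_right]
  exact mul_le_mul_of_nonneg_left (h.inner_le hy) hR.le

theorem suppFun_bodyOf {R : ℝ} (hR : 0 < R) (x : Eucl n) :
    suppFun (bodyOf R W) x = R * (‖x‖ + W x) := by
  refine IsGreatest.csSup_eq ⟨?_, ?_⟩
  · by_cases hx : x = 0
    · refine ⟨0, fun y => ?_, by simp [hx, h.W_zero]⟩
      rw [inner_zero_right]
      exact mul_nonneg hR.le ((by positivity : (0 : ℝ) ≤ 99 / 100 * ‖y‖).trans (h.le_norm_add y))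
    · have hp := norm_pos_iff.2 hx
      have hu : ‖‖x‖⁻¹ • x‖ = 1 := by rw [norm_smul, norm_inv, norm_norm, inv_mul_cancel₀ hp.ne']
      refine ⟨_, h.smul_mem_bodyOf hR hu, ?_⟩
      simp only
      rw [real_inner_smul_right, inner_add_right, h.P_unit hx, h.euler, real_inner_smul_right,
        real_inner_self_eq_norm_sq]
      field_simp
  · rintro _ ⟨y, hy, rfl⟩
    exact hy x

theorem hasGradientAt_norm_add {R : ℝ} {x : Eucl n} (hx : x ≠ 0) :
    HasGradientAt (fun x => R * (‖x‖ + W x)) (R • (‖x‖⁻¹ • x + P x)) x := by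
  have h1 := hasFDerivAt_norm_of_ne hx
  rw [hasGradientAt_iff_hasFDerivAt]
  have h3 := (h1.add (h.grad x hx).hasFDerivAt).const_mul R
  refine h3.congr_fderiv ?_
  ext v
  simp

theorem gradient_suppFun {R : ℝ} (hR : 0 < R) {x : Eucl n} (hx : x ≠ 0) :
    gradient (suppFun (bodyOf R W)) x = R • (‖x‖⁻¹ • x + P x) := by
  rw [funext (h.suppFun_bodyOf hR)]
  exact (h.hasGradientAt_norm_add hx).gradient

theorem isCompact_bodyOf {R : ℝ} (hR : 0 < R) : IsCompact (bodyOf R W) := by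
  refine Metric.isCompact_of_isClosed_isBounded ?_ ?_
  · rw [bodyOf, Set.ofPred_forall]
    exact isClosed_iInter fun x => isClosed_le (by fun_prop) continuous_const
  · refine (Metric.isBounded_closedBall (x := (0 : Eucl n)) (r := 2 * R)).subset fun y hy => ?_
    rw [mem_closedBall_zero_iff]
    have h1 := hy y
    rw [real_inner_self_eq_norm_sq] at h1
    have h2 := (abs_le.1 (h.abs_W_le y)).2
    by_contra! h3
    have h4 := h.κ_le
    have h5 : ‖y‖ + W y < 2 * ‖y‖ := by nlinarith [norm_nonneg y]
    nlinarith

theorem zero_mem_interior_bodyOf {R : ℝ} (hR : 0 < R) : (0 : Eucl n) ∈ interior (bodyOf R W) := by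
  rw [mem_interior]
  refine ⟨Metric.ball 0 (R / 2), fun y hy x => ?_, Metric.isOpen_ball,
    Metric.mem_ball_self (by positivity)⟩
  rw [mem_ball_zero_iff] at hy
  refine (real_inner_le_norm _ _).trans ?_
  have h1 := h.le_norm_add x
  nlinarith [norm_nonneg x, mul_nonneg (norm_nonneg x) (sub_nonneg.2 hy.le)]

omit h in
theorem convex_bodyOf {R : ℝ} : Convex ℝ (bodyOf R W) := fun y hy z hz a b ha hb hab x => by
  rw [inner_add_right, real_inner_smul_right, real_inner_smul_right]
  calc _ ≤ a * (R * (‖x‖ + W x)) + b * (R * (‖x‖ + W x)) :=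
        add_le_add (mul_le_mul_of_nonneg_left (hy x) ha) (mul_le_mul_of_nonneg_left (hz x) hb)
    _ = _ := by rw [← add_mul, hab, one_mul]

theorem neg_mem_bodyOf {R : ℝ} {y : Eucl n} (hy : y ∈ bodyOf R W) : -y ∈ bodyOf R W := fun x => by
  have := hy (-x)
  rwa [norm_neg, h.even, inner_neg_left, ← inner_neg_right] at this

theorem contDiffOn_suppFun {R : ℝ} (hR : 0 < R) :
    ContDiffOn ℝ (⊤ : ℕ∞) (suppFun (bodyOf R W)) {(0 : Eucl n)}ᶜ := by
  rw [funext (h.suppFun_bodyOf hR)]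
  refine contDiffOn_const.mul (ContDiffOn.add (fun x hx => ?_) h.smooth)
  exact (contDiffAt_norm ℝ hx).contDiffWithinAt

theorem curvDet_bodyOf {R : ℝ} (hR : 0 < R) {x : Eucl n} (hx : ‖x‖ = 1) :
    curvDet (suppFun (bodyOf R W)) x =
      R ^ (n - 1) * LinearMap.det ((1 + A x : Eucl n →L[ℝ] Eucl n) : Eucl n →ₗ[ℝ] Eucl n) := by
  have h0 : x ≠ 0 := norm_pos_iff.1 (by linarith)
  have h1 : HasFDerivAt (fun x : Eucl n => ‖x‖⁻¹) (-(innerSL ℝ x)) x := by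
    refine ((hasDerivAt_inv (norm_ne_zero_iff.2 h0)).comp_hasFDerivAt x
      (hasFDerivAt_norm_of_ne h0)).congr_fderiv ?_
    ext v
    simp [hx]
  have h2 : HasFDerivAt (fun y => gradient (suppFun (bodyOf R W)) y)
      (R • (ContinuousLinearMap.id ℝ (Eucl n) - (innerSL ℝ x).smulRight x + A x)) x := by
    refine (((h1.smul (hasFDerivAt_id x)).add (h.deriv x h0)).const_smul R).congr_of_eventuallyEq
      ?_ |>.congr_fderiv ?_
    · filter_upwards [isOpen_compl_singleton.mem_nhds h0] with y hy
      exact h.gradient_suppFun hR hy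
    · ext v
      simp [hx]
      ring
  have h3 : LinearMap.det (LinearMap.transvection (((R⁻¹ - 1) • (innerₗ (Eucl n) x))) x) = R⁻¹ := by
    rw [LinearMap.transvection.det]
    simp [hx]
  have h4 : ((R • (ContinuousLinearMap.id ℝ (Eucl n) - (innerSL ℝ x).smulRight x + A x) :
      Eucl n →L[ℝ] Eucl n) : Eucl n →ₗ[ℝ] Eucl n) + rankOne x =
      (R • LinearMap.transvection ((R⁻¹ - 1) • (innerₗ (Eucl n) x)) x) ∘ₗ
        ((1 + A x : Eucl n →L[ℝ] Eucl n) : Eucl n →ₗ[ℝ] Eucl n) := by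
    refine LinearMap.ext fun v => ?_
    have h5 := h.inner_A h0 v
    simp [LinearMap.transvection.apply, rankOne, inner_add_right, h5, smul_smul]
    rw [← mul_assoc, mul_sub, mul_inv_cancel₀ hR.ne']
    module
  have hn : n ≠ 0 := by
    rintro rfl
    exact h0 (Subsingleton.elim _ _)
  rw [curvDet, h2.fderiv, h4, LinearMap.det_comp, LinearMap.det_smul, h3, finrank_euclideanSpace_fin]
  congr 1
  obtain ⟨m, rfl⟩ := Nat.exists_eq_succ_of_ne_zero hn
  rw [pow_succ, mul_assoc, mul_inv_cancel₀ hR.ne', mul_one]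
  rfl

omit h in
theorem _root_.det_one_add_pos {B : Eucl n →L[ℝ] Eucl n} (hB : ‖B‖ < 1) :
    0 < LinearMap.det ((1 + B : Eucl n →L[ℝ] Eucl n) : Eucl n →ₗ[ℝ] Eucl n) := by
  by_contra! hneg
  let D : ℝ → ℝ := fun t => (1 + t • B : Eucl n →L[ℝ] Eucl n).det
  have hc : Continuous D := ContinuousLinearMap.continuous_det.comp (by fun_prop)
  have h1 : (0 : ℝ) ∈ Set.Icc (D 1) (D 0) :=
    ⟨by simpa [D, ContinuousLinearMap.det] using hneg, by simp [D, ContinuousLinearMap.det]⟩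
  obtain ⟨t, ht, h2⟩ := intermediate_value_Icc' zero_le_one hc.continuousOn h1
  have h3 := LinearMap.bot_lt_ker_of_det_eq_zero (f := ((1 + t • B : Eucl n →L[ℝ] Eucl n) :
    Eucl n →ₗ[ℝ] Eucl n)) h2
  obtain ⟨v, hv, hv0⟩ := Submodule.exists_mem_ne_zero_of_ne_bot h3.ne'
  have h4 : v + t • B v = 0 := hv
  have h5 : ‖v‖ ≤ ‖B‖ * ‖v‖ := by
    calc ‖v‖ = ‖t • B v‖ := by rw [← norm_neg (t • B v), ← eq_neg_of_add_eq_zero_left h4]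
      _ ≤ 1 * (‖B‖ * ‖v‖) := by
        rw [norm_smul, Real.norm_of_nonneg ht.1]
        exact mul_le_mul ht.2 (B.le_opNorm v) (norm_nonneg _) zero_le_one
      _ = _ := one_mul _
  nlinarith [norm_pos_iff.2 hv0]

theorem isSmoothBody_bodyOf {R : ℝ} (hR : 0 < R) : IsSmoothBody (bodyOf R W) := by
  refine ⟨h.isCompact_bodyOf hR, convex_bodyOf, h.zero_mem_interior_bodyOf hR,
    fun _ => h.neg_mem_bodyOf, h.contDiffOn_suppFun hR, fun x hx => ?_⟩
  rw [mem_sphere_zero_iff_norm] at hx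
  rw [h.curvDet_bodyOf hR hx]
  refine mul_pos (pow_pos hR _) (det_one_add_pos ?_)
  have := h.norm_A x (norm_pos_iff.1 (by linarith))
  rw [hx, div_one] at this
  linarith [h.κ_le]

end IsPert
end Geometry

end

section

section Parametrization

variable {n : ℕ}

/-- Parametrization of `bodyOf 1 W` by the unit ball, extended to the whole space. -/
def parM (P : Eucl n → Eucl n) (z : Eucl n) : Eucl n := z + ((min ‖z‖ 1) ^ 2 * ‖z‖) • P z

/-- Parametrization of `bodyOf 1 W` by the unit ball. -/
def par (P : Eucl n → Eucl n) (z : Eucl n) : Eucl n := z + ‖z‖ ^ 3 • P z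

/-- The derivative of `par P`. -/
def parD (P : Eucl n → Eucl n) (A : Eucl n → Eucl n →L[ℝ] Eucl n) (z : Eucl n) :
    Eucl n →L[ℝ] Eucl n :=
  1 + (‖z‖ ^ 3 • A z + (innerSL ℝ ((3 * ‖z‖) • z)).smulRight (P z))

theorem parM_eq_par (P : Eucl n → Eucl n) {z : Eucl n} (hz : ‖z‖ ≤ 1) : parM P z = par P z := by
  rw [parM, par, min_eq_left hz]
  congr 2

theorem abs_min_sq_mul_sub_le {r s : ℝ} (hr : 0 ≤ r) (hs : 0 ≤ s) :
    |(min r 1) ^ 2 * r - (min s 1) ^ 2 * s| ≤ 3 * |r - s| := by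
  have key : ∀ {r s : ℝ}, 0 ≤ s → s ≤ r →
      |(min r 1) ^ 2 * r - (min s 1) ^ 2 * s| ≤ 3 * |r - s| := fun {r s} hs hsr => by
    rw [abs_of_nonneg (sub_nonneg.2 hsr)]
    rcases le_total r 1 with h1 | h1 <;> rcases le_total s 1 with h2 | h2
    · rw [min_eq_left h1, min_eq_left h2, abs_le]
      have e : r ^ 2 * r - s ^ 2 * s = (r - s) * (r ^ 2 + r * s + s ^ 2) := by ring
      have h3 : r ^ 2 + r * s + s ^ 2 ≤ 3 := by nlinarith
      have h4 : 0 ≤ r ^ 2 + r * s + s ^ 2 := by nlinarith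
      rw [e]
      constructor <;> nlinarith
    · rw [min_eq_left h1, min_eq_right h2, abs_le]
      constructor <;> nlinarith
    · rw [min_eq_right h1, min_eq_left h2, abs_le]
      have h3 : 1 - s ^ 3 ≤ 3 * (1 - s) := by nlinarith [sq_nonneg (1 - s)]
      have h4 : 0 ≤ 1 - s ^ 3 := sub_nonneg.2 (pow_le_one₀ hs h2)
      constructor <;> nlinarith
    · rw [min_eq_right h1, min_eq_right h2, abs_le]
      constructor <;> nlinarith
  rcases le_total s r with h | h
  · exact key hs h
  · rw [abs_sub_comm, abs_sub_comm r s]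
    exact key hr h

namespace IsPert

variable {κ : ℝ} {W : Eucl n → ℝ} {P : Eucl n → Eucl n} {A : Eucl n → Eucl n →L[ℝ] Eucl n}
  (h : IsPert κ W P A)
include h

theorem norm_mul_norm_P_sub_le (x y : Eucl n) : ‖x‖ * ‖P x - P y‖ ≤ 4 * κ * ‖x - y‖ := by
  have hκ := h.κ_pos
  by_cases hx : x = 0
  · rw [hx, norm_zero, zero_mul]; positivity
  by_cases hy : y = 0
  · rw [hy, sub_zero]
    have := norm_sub_le (P x) (P 0)
    nlinarith [norm_nonneg x, h.norm_P x, h.norm_P 0]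
  have hxp := norm_pos_iff.2 hx
  have hyp := norm_pos_iff.2 hy
  have h1 := h.norm_P_sub_le (x := ‖x‖⁻¹ • x) (y := ‖y‖⁻¹ • y)
    (by rw [norm_smul, norm_inv, norm_norm, inv_mul_cancel₀ hxp.ne'])
    (by rw [norm_smul, norm_inv, norm_norm, inv_mul_cancel₀ hyp.ne'])
  rw [h.P_unit hx, h.P_unit hy] at h1
  have h2 : ‖x‖ * ‖‖x‖⁻¹ • x - ‖y‖⁻¹ • y‖ ≤ 2 * ‖x - y‖ := by
    have e : ‖x‖ • (‖x‖⁻¹ • x - ‖y‖⁻¹ • y) = (x - y) + (‖y‖ - ‖x‖) • ‖y‖⁻¹ • y := by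
      rw [smul_sub, smul_inv_smul₀ hxp.ne', sub_smul, smul_inv_smul₀ hyp.ne']
      abel
    calc ‖x‖ * ‖‖x‖⁻¹ • x - ‖y‖⁻¹ • y‖ = ‖(x - y) + (‖y‖ - ‖x‖) • ‖y‖⁻¹ • y‖ := by
          rw [← e, norm_smul, norm_norm]
      _ ≤ ‖x - y‖ + |‖y‖ - ‖x‖| * 1 := by
          refine (norm_add_le _ _).trans_eq ?_
          rw [norm_smul _ (‖y‖⁻¹ • y), norm_smul _ y, norm_inv, norm_norm,
            inv_mul_cancel₀ hyp.ne', Real.norm_eq_abs]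
      _ ≤ 2 * ‖x - y‖ := by
          have := abs_norm_sub_norm_le y x
          rw [norm_sub_rev] at this
          linarith
  calc ‖x‖ * ‖P x - P y‖ ≤ ‖x‖ * (2 * κ * ‖‖x‖⁻¹ • x - ‖y‖⁻¹ • y‖) :=
        mul_le_mul_of_nonneg_left h1 hxp.le
    _ = 2 * κ * (‖x‖ * ‖‖x‖⁻¹ • x - ‖y‖⁻¹ • y‖) := by ring
    _ ≤ 2 * κ * (2 * ‖x - y‖) := mul_le_mul_of_nonneg_left h2 (by positivity)
    _ = _ := by ring

theorem approximates :
    ApproximatesLinearOn (parM P) (ContinuousLinearEquiv.refl ℝ (Eucl n) : Eucl n →L[ℝ] Eucl n)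
      Set.univ (1 / 2) := by
  rintro x - y -
  have hκ := h.κ_pos
  have e : parM P x - parM P y - (ContinuousLinearEquiv.refl ℝ (Eucl n) : Eucl n →L[ℝ] Eucl n)
      (x - y) = (min ‖x‖ 1) ^ 2 • (‖x‖ • (P x - P y)) +
        ((min ‖x‖ 1) ^ 2 * ‖x‖ - (min ‖y‖ 1) ^ 2 * ‖y‖) • P y := by
    simp only [parM, ContinuousLinearEquiv.coe_coe,
      ContinuousLinearEquiv.refl_apply]
    module
  rw [e]
  have h1 : (min ‖x‖ 1) ^ 2 ≤ 1 :=
    pow_le_one₀ (le_min (norm_nonneg _) zero_le_one) (min_le_right _ _)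
  have h2 := abs_min_sq_mul_sub_le (norm_nonneg x) (norm_nonneg y)
  have h3 := abs_norm_sub_norm_le x y
  calc _ ≤ 1 * (4 * κ * ‖x - y‖) + (3 * ‖x - y‖) * κ := by
        refine (norm_add_le _ _).trans (add_le_add ?_ ?_)
        · rw [norm_smul, norm_smul, norm_norm, Real.norm_of_nonneg (sq_nonneg _)]
          exact mul_le_mul h1 (h.norm_mul_norm_P_sub_le x y) (by positivity) zero_le_one
        · rw [norm_smul, Real.norm_eq_abs]
          exact mul_le_mul (h2.trans (by linarith)) (h.norm_P y) (norm_nonneg _) (by positivity)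
    _ ≤ ((1 / 2 : NNReal) : ℝ) * ‖x - y‖ := by
        push_cast
        nlinarith [h.κ_le, norm_nonneg (x - y)]

omit h in
theorem half_lt : Subsingleton (Eucl n) ∨
    (1 / 2 : NNReal) < ‖((ContinuousLinearEquiv.refl ℝ (Eucl n)).symm :
      Eucl n →L[ℝ] Eucl n)‖₊⁻¹ := by
  rcases subsingleton_or_nontrivial (Eucl n) with hs | hs
  · exact Or.inl hs
  · refine Or.inr ?_
    have : ‖((ContinuousLinearEquiv.refl ℝ (Eucl n)).symm : Eucl n →L[ℝ] Eucl n)‖₊ = 1 := by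
      ext
      exact ContinuousLinearMap.norm_id
    rw [this, inv_one]
    exact NNReal.half_lt_self one_ne_zero

theorem parM_bijective : Function.Bijective (parM P) :=
  ⟨Set.injOn_univ.1 (h.approximates.injOn half_lt), h.approximates.surjective half_lt⟩

theorem injOn_par : Set.InjOn (par P) (Metric.closedBall 0 1) := fun x hx y hy hxy => by
  rw [mem_closedBall_zero_iff] at hx hy
  rw [← parM_eq_par P hx, ← parM_eq_par P hy] at hxy
  exact h.parM_bijective.1 hxy

theorem image_par {R : ℝ} (hR : 0 < R) :
    (fun z => R • par P z) '' Metric.closedBall 0 1 = bodyOf R W := by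
  ext y
  constructor
  · rintro ⟨z, hz, rfl⟩ x
    rw [mem_closedBall_zero_iff] at hz
    rw [real_inner_smul_right]
    refine mul_le_mul_of_nonneg_left ?_ hR.le
    have h1 := h.le_norm_add x
    by_cases hz0 : z = 0
    · simp only [hz0, par, norm_zero]
      simp
      linarith [norm_nonneg x]
    have hp := norm_pos_iff.2 hz0
    have hu : ‖‖z‖⁻¹ • z‖ = 1 := by rw [norm_smul, norm_inv, norm_norm, inv_mul_cancel₀ hp.ne']
    have h2 := h.inner_le (x := x) hu
    have h3 : ⟪x, ‖z‖⁻¹ • z⟫ ≤ ‖x‖ := (real_inner_le_norm _ _).trans (by rw [hu, mul_one])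
    rw [h.P_unit hz0, inner_add_right] at h2
    have e : ⟪x, par P z⟫ = ‖z‖ * ((1 - ‖z‖ ^ 2) * ⟪x, ‖z‖⁻¹ • z⟫ +
        ‖z‖ ^ 2 * (⟪x, ‖z‖⁻¹ • z⟫ + ⟪x, P z⟫)) := by
      rw [par, inner_add_right, real_inner_smul_right, real_inner_smul_right]
      field_simp
      ring
    rw [e]
    set s := ‖z‖
    have hs2 : 0 ≤ 1 - s ^ 2 := sub_nonneg.2 (pow_le_one₀ hp.le hz)
    calc s * ((1 - s ^ 2) * ⟪x, s⁻¹ • z⟫ + s ^ 2 * (⟪x, s⁻¹ • z⟫ + ⟪x, P z⟫))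
        ≤ s * ((1 - s ^ 2) * (100 / 99 * (‖x‖ + W x)) + s ^ 2 * (‖x‖ + W x)) := by
          gcongr
          linarith
      _ = (s * (1 - s ^ 2) * (100 / 99) + s ^ 3) * (‖x‖ + W x) := by ring
      _ ≤ 1 * (‖x‖ + W x) := by
          refine mul_le_mul_of_nonneg_right ?_ (by linarith [norm_nonneg x])
          nlinarith [mul_nonneg hp.le hs2, sq_nonneg (1 - s), pow_pos hp 3,
            mul_nonneg (sub_nonneg.2 hz) (sq_nonneg s)]
      _ = _ := one_mul _
  · intro hy
    obtain ⟨z, hz⟩ := h.parM_bijective.2 (R⁻¹ • y)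
    have hy' : y = R • parM P z := by rw [hz, smul_inv_smul₀ hR.ne']
    by_cases hz1 : ‖z‖ ≤ 1
    · exact ⟨z, mem_closedBall_zero_iff.2 hz1, by simp only; rw [← parM_eq_par P hz1, hy']⟩
    · exfalso
      rw [not_le] at hz1
      have h1 := hy z
      rw [hy', real_inner_smul_right, parM, min_eq_right hz1.le, inner_add_right,
        real_inner_smul_right, h.euler, real_inner_self_eq_norm_sq] at h1
      have h2 := le_of_mul_le_mul_left h1 hR
      have h3 := h.le_norm_add z
      nlinarith

theorem hasFDerivAt_par {z : Eucl n} (hz : z ≠ 0) : HasFDerivAt (par P) (parD P A z) z := by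
  have h1 := ((hasFDerivAt_norm_of_ne hz).pow 3).smul (h.deriv z hz)
  refine ((hasFDerivAt_id z).add h1).congr_fderiv ?_
  have hp := (norm_pos_iff.2 hz).ne'
  ext v
  simp [parD]
  field_simp
  simp

theorem hasFDerivAt_par_zero : HasFDerivAt (par P) (1 : Eucl n →L[ℝ] Eucl n) 0 := by
  refine HasFDerivAt.of_isLittleO ?_
  have e : (fun z : Eucl n => par P z - par P 0 - (1 : Eucl n →L[ℝ] Eucl n) (z - 0)) =
      fun z => ‖z‖ ^ 3 • P z := by
    ext1 z; simp [par]
  rw [e]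
  have h2 : (fun z : Eucl n => ‖z‖ ^ 3 • P z) =O[𝓝 0] fun z => ‖z - 0‖ ^ 3 := by
    refine Asymptotics.IsBigO.of_bound κ (Eventually.of_forall fun z => ?_)
    rw [norm_smul, sub_zero, mul_comm]
    exact mul_le_mul_of_nonneg_right (h.norm_P z) (norm_nonneg _)
  exact h2.trans_isLittleO (Asymptotics.isLittleO_pow_sub_sub (m := 3) 0 (by norm_num))

omit h in
theorem parD_zero : parD P A 0 = 1 := by
  simp only [parD, norm_zero]
  simp

theorem hasFDerivAt_par' (z : Eucl n) : HasFDerivAt (par P) (parD P A z) z := by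
  by_cases hz : z = 0
  · rw [hz, parD_zero]
    exact h.hasFDerivAt_par_zero
  · exact h.hasFDerivAt_par hz

theorem det_parD_pos {z : Eucl n} (hz : ‖z‖ ≤ 1) : 0 < (parD P A z).det := by
  by_cases hz0 : z = 0
  · rw [hz0, parD_zero]
    simp [ContinuousLinearMap.det]
  refine det_one_add_pos ?_
  have hp := norm_pos_iff.2 hz0
  calc _ ≤ ‖z‖ ^ 3 * (κ / ‖z‖) + (3 * ‖z‖ * ‖z‖) * κ := by
        refine (norm_add_le _ _).trans (add_le_add ?_ ?_)
        · rw [norm_smul, norm_pow, norm_norm]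
          exact mul_le_mul_of_nonneg_left (h.norm_A z hz0) (by positivity)
        · rw [ContinuousLinearMap.norm_smulRight_apply, innerSL_apply_norm, norm_smul,
            Real.norm_of_nonneg (by positivity)]
          exact mul_le_mul_of_nonneg_left (h.norm_P z) (by positivity)
    _ = 4 * κ * ‖z‖ ^ 2 := by field_simp; ring
    _ ≤ 4 * κ * 1 := mul_le_mul_of_nonneg_left (pow_le_one₀ hp.le hz) (by linarith [h.κ_pos])
    _ < 1 := by linarith [h.κ_le]

theorem integral_bodyOf {R : ℝ} (hR : 0 < R) (F : Eucl n → ℝ) :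
    ∫ y in bodyOf R W, F y =
      ∫ z in Metric.closedBall 0 1, R ^ n * (parD P A z).det * F (R • par P z) := by
  rw [← h.image_par hR, integral_image_eq_integral_abs_det_fderiv_smul (f := fun z => R • par P z) volume
    Metric.isClosed_closedBall.measurableSet
    (fun z _ => ((h.hasFDerivAt_par' z).const_smul R).hasFDerivWithinAt)
    (fun x hx y hy hxy => h.injOn_par hx hy (smul_right_injective _ hR.ne' hxy))]
  refine setIntegral_congr_fun Metric.isClosed_closedBall.measurableSet fun z hz => ?_
  have h1 : (R • parD P A z).det = R ^ n * (parD P A z).det := by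
    rw [ContinuousLinearMap.det, ContinuousLinearMap.toLinearMap_smul, LinearMap.det_smul,
      finrank_euclideanSpace_fin]
  simp only [smul_eq_mul]
  rw [h1, abs_of_pos (mul_pos (pow_pos hR n) (h.det_parD_pos (mem_closedBall_zero_iff.1 hz)))]

end IsPert
end Parametrization

end

section

section GaussianWeight

open Metric Set

variable {n : ℕ}

/-- The kernel `|z - e|^(-α)` against a Gaussian of variance `ε`. -/
def gaussKer (α : ℝ) (e : Eucl n) (ε : ℝ) (z : Eucl n) : ℝ :=
  Real.exp (-‖z‖ ^ 2 / (2 * ε)) / ‖z - e‖ ^ α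

def gaussMass (α : ℝ) (e : Eucl n) (ε : ℝ) : ℝ := ∫ z in closedBall 0 1, gaussKer α e ε z

/-- The normalized Gaussian weight on the parameter set. -/
def gaussProb (α : ℝ) (e : Eucl n) (ε : ℝ) : Measure (Zs e) :=
  Measure.comap Subtype.val ((ENNReal.ofReal (gaussMass α e ε))⁻¹ •
    (volume : Measure (Eucl n)).withDensity fun z => ENNReal.ofReal (gaussKer α e ε z))

theorem measurableSet_Zs (e : Eucl n) : MeasurableSet (Zs e) := by
  have h1 : MeasurableSet {z : Eucl n | ‖z‖ ≤ 1} := measurableSet_le (by fun_prop) (by fun_prop)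
  have h2 : MeasurableSet {z : Eucl n | z ≠ e} := (measurableSet_singleton e).compl
  have h3 : MeasurableSet {z : Eucl n | z + ‖z‖ • e ≠ 0} :=
    (isClosed_singleton.preimage (f := fun z : Eucl n => z + ‖z‖ • e)
      (by fun_prop)).measurableSet.compl
  exact h1.inter (h2.inter h3)

theorem Zs_ae_eq (hn : 2 ≤ n) (e : Eucl n) :
    (Zs e : Set (Eucl n)) =ᵐ[volume] closedBall (0 : Eucl n) 1 := by
  have hs : volume ((Submodule.span ℝ {e} : Submodule ℝ (Eucl n)) : Set (Eucl n)) = 0 := by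
    refine Measure.addHaar_submodule _ _ fun h => ?_
    have h1 := finrank_span_le_card (R := ℝ) ({e} : Set (Eucl n))
    rw [h, finrank_top, finrank_euclideanSpace, Fintype.card_fin, Set.toFinset_singleton,
      Finset.card_singleton] at h1
    omega
  refine (ae_eq_set).2 ⟨?_, measure_mono_null ?_ hs⟩
  · refine measure_mono_null (t := ∅) (fun z hz => ?_) measure_empty
    exact hz.2 (mem_closedBall_zero_iff.2 hz.1.1)
  · rintro z ⟨hz, hz'⟩
    by_contra hsp
    refine hz' ⟨mem_closedBall_zero_iff.1 hz, ?_, fun h => hsp ?_⟩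
    · rintro rfl
      exact hsp (Submodule.mem_span_singleton_self z)
    · rw [add_eq_zero_iff_eq_neg.1 h]
      exact neg_mem (Submodule.smul_mem _ _ (Submodule.mem_span_singleton_self e))

theorem measurable_gaussKer (α : ℝ) (e : Eucl n) (ε : ℝ) : Measurable (gaussKer α e ε) := by
  unfold gaussKer
  fun_prop

theorem gaussKer_nonneg (α : ℝ) (e : Eucl n) (ε : ℝ) (z : Eucl n) : 0 ≤ gaussKer α e ε z := by
  unfold gaussKer
  positivity

theorem integrableOn_riesz (hn : 1 ≤ n) {α : ℝ} (hα : α < n) (e : Eucl n) {s : Set (Eucl n)}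
    (hs : Bornology.IsBounded s) : IntegrableOn (fun z : Eucl n => (‖z - e‖ ^ α)⁻¹) s := by
  have h0 : LocallyIntegrable (fun z : Eucl n => (‖z‖ ^ α)⁻¹) := by
    refine locallyIntegrable_of_norm_le_rpow (α := α) (C := 1) (by simpa using hn)
      (by simpa using hα) (Eventually.of_forall fun x => ?_)
      (by have : Measurable fun z : Eucl n => (‖z‖ ^ α)⁻¹ := by fun_prop
          exact this.aestronglyMeasurable)
    rw [Real.norm_of_nonneg (by positivity), Real.rpow_neg (norm_nonneg _), one_mul]
  have h1 : IntegrableOn (fun z : Eucl n => (‖z‖ ^ α)⁻¹) ((fun z => z - e) '' closure s) :=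
    h0.integrableOn_isCompact ((isCompact_of_isClosed_isBounded isClosed_closure
      hs.closure).image (by fun_prop))
  have h2 := (measurePreserving_sub_right (volume : Measure (Eucl n)) e).integrableOn_image
    (MeasurableEquiv.subRight e).measurableEmbedding (f := fun z : Eucl n => (‖z‖ ^ α)⁻¹)
    (s := closure s)
  exact (h2.1 h1).mono_set subset_closure

theorem gaussKer_le (α : ℝ) (e : Eucl n) {ε : ℝ} (hε : 0 < ε) (z : Eucl n) :
    gaussKer α e ε z ≤ (‖z - e‖ ^ α)⁻¹ := by
  rw [gaussKer, div_eq_mul_inv]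
  refine mul_le_of_le_one_left (by positivity) (Real.exp_le_one_iff.2 ?_)
  rw [neg_div]
  exact neg_nonpos.2 (by positivity)

theorem integrableOn_gaussKer (hn : 1 ≤ n) {α : ℝ} (hα : α < n) (e : Eucl n) {ε : ℝ} (hε : 0 < ε)
    {s : Set (Eucl n)} (hs : Bornology.IsBounded s) : IntegrableOn (gaussKer α e ε) s := by
  refine (integrableOn_riesz hn hα e hs).mono' (measurable_gaussKer α e ε).aestronglyMeasurable
    (Eventually.of_forall fun z => ?_)
  rw [Real.norm_of_nonneg (gaussKer_nonneg ..)]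
  exact gaussKer_le α e hε z

theorem integral_riesz_pos (hn : 1 ≤ n) {α : ℝ} (hα : α < n) (e : Eucl n) {r : ℝ} (hr : 0 < r) :
    0 < ∫ z in closedBall (0 : Eucl n) r, (‖z - e‖ ^ α)⁻¹ := by
  rw [setIntegral_pos_iff_support_of_nonneg_ae (Eventually.of_forall fun z => by positivity)
    (integrableOn_riesz hn hα e isBounded_closedBall)]
  have hne : Nontrivial (Eucl n) := by
    have : Nonempty (Fin n) := ⟨⟨0, hn⟩⟩
    infer_instance
  refine lt_of_lt_of_le (measure_closedBall_pos volume (0 : Eucl n) hr) ?_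
  rw [← measure_sdiff_null (s := closedBall (0 : Eucl n) r) (measure_singleton e)]
  refine measure_mono fun z hz => ⟨?_, hz.1⟩
  have : 0 < ‖z - e‖ := norm_pos_iff.2 (sub_ne_zero.2 hz.2)
  exact (by positivity : (0 : ℝ) < (‖z - e‖ ^ α)⁻¹).ne'

theorem le_gaussMass (hn : 1 ≤ n) {α : ℝ} (hα : α < n) (e : Eucl n) {ε : ℝ} (hε : 0 < ε) {r : ℝ}
    (h1 : r ≤ 1) : Real.exp (-r ^ 2 / (2 * ε)) *
      ∫ z in closedBall (0 : Eucl n) r, (‖z - e‖ ^ α)⁻¹ ≤ gaussMass α e ε := by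
  rw [← integral_const_mul]
  refine le_trans (setIntegral_mono_on ((integrableOn_riesz hn hα e isBounded_closedBall).const_mul _)
    (integrableOn_gaussKer hn hα e hε isBounded_closedBall) measurableSet_closedBall
    fun z hz => ?_) (setIntegral_mono_set (integrableOn_gaussKer hn hα e hε isBounded_closedBall)
      (Eventually.of_forall fun z => gaussKer_nonneg ..)
      (closedBall_subset_closedBall h1).eventuallyLE)
  simp only [gaussKer, div_eq_mul_inv]
  have hz' : ‖z‖ ≤ r := mem_closedBall_zero_iff.1 hz
  refine mul_le_mul_of_nonneg_right (Real.exp_le_exp.2 ?_) (by positivity)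
  rw [neg_mul, neg_mul, neg_le_neg_iff]
  gcongr

theorem gaussMass_pos (hn : 1 ≤ n) {α : ℝ} (hα : α < n) (e : Eucl n) {ε : ℝ} (hε : 0 < ε) :
    0 < gaussMass α e ε :=
  lt_of_lt_of_le (mul_pos (Real.exp_pos _) (integral_riesz_pos hn hα e one_pos))
    (le_gaussMass hn hα e hε le_rfl)

theorem integral_gaussProb (hn : 2 ≤ n) (α : ℝ) (e : Eucl n) (ε : ℝ) {X : Type*}
    [NormedAddCommGroup X] [NormedSpace ℝ X] (F : Eucl n → X) :
    ∫ z : Zs e, F z ∂gaussProb α e ε =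
      (gaussMass α e ε)⁻¹ • ∫ z in closedBall 0 1, gaussKer α e ε z • F z := by
  have hc : 0 ≤ gaussMass α e ε := integral_nonneg fun z => gaussKer_nonneg ..
  rw [gaussProb, integral_subtype_comap (measurableSet_Zs e), Measure.restrict_smul,
    integral_smul_measure, ENNReal.toReal_inv, ENNReal.toReal_ofReal hc,
    setIntegral_congr_set (withDensity_absolutelyContinuous _ _ |>.ae_eq (Zs_ae_eq hn e)),
    setIntegral_withDensity_eq_setIntegral_toReal_smul
      (measurable_gaussKer α e ε).ennreal_ofReal (Eventually.of_forall fun z => ENNReal.ofReal_lt_top)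
      _ measurableSet_closedBall]
  simp_rw [ENNReal.toReal_ofReal (gaussKer_nonneg ..)]

theorem isProbabilityMeasure_gaussProb (hn : 2 ≤ n) {α : ℝ} (hα : α < n) (e : Eucl n) {ε : ℝ}
    (hε : 0 < ε) : IsProbabilityMeasure (gaussProb α e ε) := by
  have hn1 : 1 ≤ n := by omega
  have hc := gaussMass_pos hn1 hα e hε
  refine ⟨?_⟩
  rw [gaussProb, (MeasurableEmbedding.subtype_coe (measurableSet_Zs e)).comap_apply, image_univ,
    Subtype.range_coe, Measure.smul_apply, withDensity_apply _ (measurableSet_Zs e),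
    setLIntegral_congr (Zs_ae_eq hn e), smul_eq_mul, ← ofReal_integral_eq_lintegral_ofReal
      (integrableOn_gaussKer hn1 hα e hε isBounded_closedBall)
      (Eventually.of_forall fun z => gaussKer_nonneg ..)]
  exact ENNReal.inv_mul_cancel (ENNReal.ofReal_pos.2 hc).ne' ENNReal.ofReal_ne_top

theorem setIntegral_closedBall_comp {X : Type*} [NormedAddCommGroup X] [NormedSpace ℝ X]
    (L : Eucl n ≃ₗᵢ[ℝ] Eucl n) (F : Eucl n → X) :
    ∫ z in closedBall 0 1, F (L z) = ∫ z in closedBall 0 1, F z := by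
  have h := L.measurePreserving.setIntegral_preimage_emb
    L.toHomeomorph.measurableEmbedding F (closedBall 0 1)
  rwa [show (L ⁻¹' closedBall 0 1) = closedBall (0 : Eucl n) 1 by
    ext z; simp] at h

theorem tendsto_gaussProb (hn : 2 ≤ n) {α : ℝ} (hα : α < n) (e : Eucl n) :
    Tendsto (fun ε => ∫ z : Zs e, ‖(z : Eucl n)‖ ^ 2 ∂gaussProb α e ε) (𝓝[>] 0) (𝓝 0) := by
  have hn1 : 1 ≤ n := by omega
  have key : ∀ δ, 0 < δ → δ ≤ 1 → ∀ ε, 0 < ε →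
      ∫ z : Zs e, ‖(z : Eucl n)‖ ^ 2 ∂gaussProb α e ε ≤ δ ^ 2 +
        (∫ z in closedBall (0 : Eucl n) 1, (‖z - e‖ ^ α)⁻¹) /
          (∫ z in closedBall (0 : Eucl n) (δ / 2), (‖z - e‖ ^ α)⁻¹) *
          Real.exp (-(3 * δ ^ 2 / 8 * ε⁻¹)) := by
    intro δ hδ hδ1 ε hε
    have hc := gaussMass_pos hn1 hα e hε
    have hm := integral_riesz_pos hn1 hα e (half_pos hδ)
    set m := ∫ z in closedBall (0 : Eucl n) (δ / 2), (‖z - e‖ ^ α)⁻¹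
    have hM := integral_riesz_pos hn1 hα e one_pos
    have hi := integrableOn_gaussKer hn1 hα e hε (s := closedBall (0 : Eucl n) 1)
      isBounded_closedBall
    have hr := integrableOn_riesz hn1 hα e (s := closedBall (0 : Eucl n) 1) isBounded_closedBall
    rw [integral_gaussProb hn α e ε (fun z => ‖z‖ ^ 2), smul_eq_mul, inv_mul_le_iff₀ hc]
    have h1 : ∫ z in closedBall (0 : Eucl n) 1, gaussKer α e ε z • ‖z‖ ^ 2 ≤
        ∫ z in closedBall (0 : Eucl n) 1,
          (δ ^ 2 * gaussKer α e ε z + Real.exp (-δ ^ 2 / (2 * ε)) * (‖z - e‖ ^ α)⁻¹) := by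
      refine integral_mono_of_nonneg (Eventually.of_forall fun z => ?_)
        ((hi.const_mul _).add (hr.const_mul _)) ?_
      · exact mul_nonneg (gaussKer_nonneg ..) (by positivity)
      · filter_upwards [ae_restrict_mem measurableSet_closedBall] with z hz
        have hz1 : ‖z‖ ≤ 1 := mem_closedBall_zero_iff.1 hz
        have hg := gaussKer_nonneg α e ε z
        rw [smul_eq_mul]
        rcases le_total ‖z‖ δ with h | h
        · have : gaussKer α e ε z * ‖z‖ ^ 2 ≤ δ ^ 2 * gaussKer α e ε z := by
            rw [mul_comm]; gcongr
          have : 0 ≤ Real.exp (-δ ^ 2 / (2 * ε)) * (‖z - e‖ ^ α)⁻¹ := by positivity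
          linarith
        · have h2 : gaussKer α e ε z * ‖z‖ ^ 2 ≤ gaussKer α e ε z :=
            mul_le_of_le_one_right hg (pow_le_one₀ (norm_nonneg _) hz1)
          have h3 : gaussKer α e ε z ≤ Real.exp (-δ ^ 2 / (2 * ε)) * (‖z - e‖ ^ α)⁻¹ := by
            rw [gaussKer, div_eq_mul_inv]
            gcongr
          have : 0 ≤ δ ^ 2 * gaussKer α e ε z := by positivity
          linarith
    rw [integral_add (hi.const_mul _) (hr.const_mul _), integral_const_mul,
      integral_const_mul] at h1
    refine h1.trans ?_
    have h4 := le_gaussMass hn1 hα e hε (r := δ / 2) (by linarith)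
    have h5 : Real.exp (-δ ^ 2 / (2 * ε)) =
        Real.exp (-(δ / 2) ^ 2 / (2 * ε)) * Real.exp (-(3 * δ ^ 2 / 8 * ε⁻¹)) := by
      rw [← Real.exp_add]
      congr 1
      field_simp
      ring
    set M := ∫ z in closedBall (0 : Eucl n) 1, (‖z - e‖ ^ α)⁻¹
    rw [mul_add, mul_comm (gaussMass α e ε)]
    change δ ^ 2 * gaussMass α e ε + _ ≤ _
    refine add_le_add le_rfl ?_
    rw [h5]
    calc _ = (Real.exp (-(δ / 2) ^ 2 / (2 * ε)) * m) *
          (M / m * Real.exp (-(3 * δ ^ 2 / 8 * ε⁻¹))) := by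
          field_simp
      _ ≤ gaussMass α e ε * (M / m * Real.exp (-(3 * δ ^ 2 / 8 * ε⁻¹))) :=
          mul_le_mul_of_nonneg_right h4 (by positivity)
      _ = _ := by ring
  refine Metric.tendsto_nhds.2 fun η hη => ?_
  set δ := min 1 (η / 2)
  have hδ : 0 < δ := lt_min one_pos (half_pos hη)
  have hδ2 : δ ^ 2 ≤ η / 2 := by
    have h1 : δ ≤ 1 := min_le_left _ _
    have h2 : δ ≤ η / 2 := min_le_right _ _
    nlinarith
  have ht : Tendsto (fun ε : ℝ => (∫ z in closedBall (0 : Eucl n) 1, (‖z - e‖ ^ α)⁻¹) /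
      (∫ z in closedBall (0 : Eucl n) (δ / 2), (‖z - e‖ ^ α)⁻¹) *
      Real.exp (-(3 * δ ^ 2 / 8 * ε⁻¹))) (𝓝[>] 0) (𝓝 0) := by
    have h1 : Tendsto (fun ε : ℝ => 3 * δ ^ 2 / 8 * ε⁻¹) (𝓝[>] 0) atTop :=
      tendsto_inv_nhdsGT_zero.const_mul_atTop (by positivity)
    have h2 := (Real.tendsto_exp_neg_atTop_nhds_zero.comp h1).const_mul
      ((∫ z in closedBall (0 : Eucl n) 1, (‖z - e‖ ^ α)⁻¹) /
        (∫ z in closedBall (0 : Eucl n) (δ / 2), (‖z - e‖ ^ α)⁻¹))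
    rwa [mul_zero] at h2
  filter_upwards [self_mem_nhdsWithin, ht.eventually (gt_mem_nhds (half_pos hη))] with ε hε h
  have h0 : 0 ≤ ∫ z : Zs e, ‖(z : Eucl n)‖ ^ 2 ∂gaussProb α e ε :=
    integral_nonneg fun z => by positivity
  rw [dist_zero_right, Real.norm_of_nonneg h0]
  linarith [key δ hδ (min_le_left _ _) ε hε]

/-- An element of the orthogonal group as an isometric equivalence. -/
def Gp.toEquiv (g : Gp n) : Eucl n ≃ₗᵢ[ℝ] Eucl n where
  toFun := g.1
  invFun := (g⁻¹).1
  map_add' := map_add g.1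
  map_smul' := map_smul g.1
  left_inv := Gp.inv_apply_apply g
  right_inv := Gp.apply_inv_apply g
  norm_map' := Gp.norm_apply g

theorem setIntegral_closedBall_rotate {X : Type*} [NormedAddCommGroup X] [NormedSpace ℝ X]
    (g : Gp n) (F : Eucl n → X) :
    ∫ z in closedBall 0 1, F (g.1 z) = ∫ z in closedBall 0 1, F z :=
  setIntegral_closedBall_comp g.toEquiv F

theorem gaussKer_smul_rotate (α : ℝ) (e : Eucl n) (ε : ℝ) {h : Gp n} {χ : ℝ} (hχ : χ * χ = 1)
    (he : h.1 e = χ • e) (z : Eucl n) : gaussKer α e ε (χ • h.1 z) = gaussKer α e ε z := by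
  have hn : ‖χ‖ = 1 := by
    rw [Real.norm_eq_abs]
    exact (pow_left_inj₀ (abs_nonneg _) zero_le_one two_ne_zero).1 (by rw [sq_abs, pow_two, hχ]; simp)
  have h1 : χ • h.1 z - e = χ • h.1 (z - e) := by
    rw [map_sub, he, smul_sub, smul_smul, hχ, one_smul]
  rw [gaussKer, gaussKer, h1, norm_smul, norm_smul, hn, one_mul, one_mul, Gp.norm_apply,
    Gp.norm_apply]

theorem integral_gaussProb_smul_rotate (hn : 2 ≤ n) (α : ℝ) (e : Eucl n) (ε : ℝ) {h : Gp n} {χ : ℝ}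
    (hχ : χ * χ = 1) (he : h.1 e = χ • e) {X : Type*} [NormedAddCommGroup X] [NormedSpace ℝ X]
    (F : Eucl n → X) : ∫ z : Zs e, F (χ • h.1 z) ∂gaussProb α e ε =
      ∫ z : Zs e, F z ∂gaussProb α e ε := by
  rw [integral_gaussProb hn α e ε (fun z => F (χ • h.1 z)), integral_gaussProb hn α e ε F]
  congr 1
  have h1 := setIntegral_closedBall_rotate h fun z => gaussKer α e ε (χ • z) • F (χ • z)
  simp_rw [gaussKer_smul_rotate α e ε hχ he] at h1
  rw [h1]
  rcases mul_self_eq_one_iff.1 hχ with rfl | rfl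
  · simp_rw [one_smul]
  · simp_rw [neg_one_smul]
    exact setIntegral_closedBall_comp (LinearIsometryEquiv.neg ℝ)
      fun z => gaussKer α e ε z • F z

theorem conc_gaussProb (hn : 2 ≤ n) {w : Wt n} (d : NL w) {α : ℝ} (hα : α < n)
    (hν : ∀ ε, d.ν ε = gaussProb α d.e ε) : d.Conc := by
  constructor
  · filter_upwards [self_mem_nhdsWithin] with ε hε
    rw [hν]
    exact isProbabilityMeasure_gaussProb hn hα d.e hε
  · simp_rw [hν]
    exact tendsto_gaussProb hn hα d.e

theorem inv_gaussProb (hn : 2 ≤ n) {w : Wt n} (d : NL w) {α : ℝ}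
    (hν : ∀ ε, d.ν ε = gaussProb α d.e ε)
    (hU : ∀ (h : Gp n) (χ : ℝ), χ * χ = 1 → h.1 d.e = χ • d.e → RR w h d.U = d.U) : d.Inv := by
  refine ⟨hU, fun ε h χ hχ he f => ?_⟩
  rw [hν]
  exact integral_gaussProb_smul_rotate hn α d.e ε hχ he f

end GaussianWeight

end

section

namespace NL

variable {n : ℕ} {w : Wt n} (d : NL w) (ε : ℝ) (g : AA w)

/-- The perturbation of the support function. -/
def suppPert (z : Eucl n) : ℝ := ε * (‖z‖ * sph d.e (d.u ε g) z)

/-- The gradient of `NL.suppPert`. -/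
def gradPert (z : Eucl n) : Eucl n := ∑ i, (ε * sph d.e (d.p ε g i) z) • eb i

/-- The Hessian of `NL.suppPert`. -/
def hessPert (z : Eucl n) : Eucl n →L[ℝ] Eucl n :=
  ∑ i, (ε • rotGrad (fun a b => sph d.e (d.Lp ε g a b i) z) z).smulRight (eb i)

variable {d ε g}

theorem norm_smul_rotGrad_le (ε : ℝ) {L : Fin n → Fin n → ℝ} {x : Eucl n} (hx : x ≠ 0)
    {m : Fin n → ℝ} (hm : ∀ j, ∑ b, x b * L j b = ‖x‖ * m j) :
    ‖ε • rotGrad L x‖ ≤ (∑ j, |ε * m j|) / ‖x‖ := by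
  have hx' : 0 < ‖x‖ := norm_pos_iff.2 hx
  have h1 : ε • rotGrad L x = ∑ j, ((ε * m j) / ‖x‖) • EuclideanSpace.proj j := by
    rw [rotGrad, Finset.smul_sum]
    refine Finset.sum_congr rfl fun j _ => ?_
    rw [hm, smul_smul]
    congr 1
    field_simp
  rw [h1, Finset.sum_div]
  refine (norm_sum_le _ _).trans (Finset.sum_le_sum fun j _ => ?_)
  have h2 : ‖(EuclideanSpace.proj j : Eucl n →L[ℝ] ℝ)‖ ≤ 1 :=
    ContinuousLinearMap.opNorm_le_bound _ zero_le_one fun v => by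
      rw [one_mul]; exact PiLp.norm_apply_le v j
  rw [norm_smul, Real.norm_eq_abs, abs_div, abs_of_pos hx']
  exact mul_le_of_le_one_right (by positivity) h2

section

variable (hd : d.Inv)
  (hg : ∀ (h : Gp n) (χ : ℝ), χ * χ = 1 → h.1 d.e = χ • d.e → RR w h g = g)
include hd hg

theorem isInv_u : IsInv d.e (d.u ε g) := fun h hh => by
  have h1 : h.1 d.e = (1 : ℝ) • d.e := by rw [one_smul, hh]
  rw [RR_u hd (one_mul 1) h1, hg h 1 (one_mul 1) h1]

theorem isInv_p (i : Fin n) : IsInv d.e (d.p ε g i) := fun h hh => by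
  have h1 : h.1 d.e = (1 : ℝ) • d.e := by rw [one_smul, hh]
  rw [RR_p hd (one_mul 1) h1, hg h 1 (one_mul 1) h1, one_smul]

theorem isInv_Lp (j b i : Fin n) : IsInv d.e (d.Lp ε g j b i) :=
  (isInv_p hd hg i).of_isL (d.isL_p ε g j b i)

theorem evk_u_neg {k k' : Gp n} (h : k'.1 d.e = -k.1 d.e) :
    evk w k' (d.u ε g) = evk w k (d.u ε g) := by
  have h1 : (k⁻¹ * k').1 d.e = (-1 : ℝ) • d.e := by
    change k⁻¹.1 (k'.1 d.e) = _
    rw [h, map_neg, Gp.inv_apply_apply, neg_one_smul]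
  have h2 := RR_u hd (by norm_num) h1 ε g
  rw [hg _ (-1) (by norm_num) h1] at h2
  nth_rewrite 2 [← h2]
  rw [evk_RR, mul_inv_cancel_left]

omit hd hg in
theorem evk_p (k : Gp n) (i : Fin n) : evk w k (d.p ε g i) =
    (k.1 d.e) i * evk w k (d.u ε g) + ∑ a, (k.1 d.e) a * evk w k (d.Lu ε g i a) := by
  simp only [p, map_add, map_mul, map_sum, evk_x]

theorem sum_mul_evk_p (k : Gp n) :
    ∑ i, (k.1 d.e) i * evk w k (d.p ε g i) = evk w k (d.u ε g) := by
  have h0 : ∑ i, (k.1 d.e) i * ∑ a, (k.1 d.e) a * evk w k (d.Lu ε g i a) = 0 := by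
    have h1 : ∑ i, (k.1 d.e) i * ∑ a, (k.1 d.e) a * evk w k (d.Lu ε g i a) =
        -∑ i, (k.1 d.e) i * ∑ a, (k.1 d.e) a * evk w k (d.Lu ε g i a) := by
      simp only [Finset.mul_sum]
      nth_rewrite 1 [Finset.sum_comm]
      rw [← Finset.sum_neg_distrib]
      refine Finset.sum_congr rfl fun i _ => ?_
      rw [← Finset.sum_neg_distrib]
      refine Finset.sum_congr rfl fun a _ => ?_
      rw [Lu_anti (isInv_u hd hg) a i, map_smul]
      simp only [smul_eq_mul]
      ring
    linarith
  simp_rw [evk_p, mul_add, Finset.sum_add_distrib]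
  rw [h0, add_zero]
  simp_rw [← mul_assoc]
  rw [← Finset.sum_mul, sum_sq_apply, one_mul]

theorem gradPert_eq {k : Gp n} {x : Eucl n} (hx : x ≠ 0) (hk : ‖x‖ • k.1 d.e = x) :
    d.gradPert ε g x = ∑ i, (ε * evk w k (d.p ε g i)) • eb i := by
  simp only [gradPert, sph_eq d.norm_e (isInv_p hd hg _) hx hk]

theorem suppPert_eq {k : Gp n} {x : Eucl n} (hx : x ≠ 0) (hk : ‖x‖ • k.1 d.e = x) :
    d.suppPert ε g x = ε * (‖x‖ * evk w k (d.u ε g)) := by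
  simp only [suppPert, sph_eq d.norm_e (isInv_u hd hg) hx hk]

theorem sum_mul_sph_Lp {k : Gp n} {x : Eucl n} (hx : x ≠ 0) (hk : ‖x‖ • k.1 d.e = x)
    (i j : Fin n) : ∑ b, x b * sph d.e (d.Lp ε g j b i) x = ‖x‖ * evk w k (d.M ε g i j) := by
  simp only [sph_eq d.norm_e (isInv_Lp hd hg _ _ _) hx hk, M, map_sum, map_mul, evk_x,
    Finset.mul_sum]
  refine Finset.sum_congr rfl fun b _ => ?_
  nth_rewrite 1 [← hk]
  simp only [PiLp.smul_apply, smul_eq_mul, mul_assoc]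

theorem hessPert_eb {k : Gp n} {x : Eucl n} (hx : x ≠ 0) (hk : ‖x‖ • k.1 d.e = x) (j : Fin n) :
    d.hessPert ε g x (eb j) = ∑ i, (ε * evk w k (d.M ε g i j) / ‖x‖) • eb i := by
  have hx' : 0 < ‖x‖ := norm_pos_iff.2 hx
  simp only [hessPert, sum_apply, ContinuousLinearMap.smulRight_apply,
    smul_apply, rotGrad_single, sum_mul_sph_Lp hd hg hx hk, smul_eq_mul]
  refine Finset.sum_congr rfl fun i _ => ?_
  congr 1
  field_simp

theorem isPert (hw : w.Super) (hε : 0 < ε) {κ η : ℝ} (hκ : 0 < κ) (hκ1 : κ ≤ 1 / 100)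
    (hη : n * (n * η) ≤ κ) (hη' : n * η ≤ κ) (hp : ∀ i, ‖ε • d.p ε g i‖ ≤ η)
    (hM : ∀ i j, ‖ε • d.M ε g i j‖ ≤ η) :
    IsPert κ (d.suppPert ε g) (d.gradPert ε g) (d.hessPert ε g) where
  κ_pos := hκ
  κ_le := hκ1
  grad x hx := by
    have hx' : 0 < ‖x‖ := norm_pos_iff.2 hx
    have h := ((hasFDerivAt_norm_of_ne hx).mul (hasFDerivAt_sph hw d.norm_e (isInv_u hd hg)
      (d.isL_u ε g) hx)).const_mul ε
    rw [hasGradientAt_iff_hasFDerivAt]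
    refine h.congr_fderiv (clm_ext_eb fun i => ?_)
    have hk := sec_apply d.norm_e x
    have hi : ∀ i, x i = ‖x‖ * ((sec d.e x).1 d.e) i := fun i => by
      nth_rewrite 1 [← hk]
      rw [PiLp.smul_apply, smul_eq_mul]
    have h1 : ⟪d.gradPert ε g x, eb i⟫ = ε * evk w (sec d.e x) (d.p ε g i) := by
      rw [real_inner_comm, inner_eb, gradPert_eq hd hg hx hk]
      simp [Finset.sum_apply, Pi.single_apply]
    rw [InnerProductSpace.toDual_apply_apply, h1, evk_p]
    simp only [smul_apply, add_apply, rotGrad_single, innerSL_apply_apply, smul_eq_mul]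
    rw [real_inner_comm, inner_eb, PiLp.smul_apply, smul_eq_mul, hi i, sph]
    simp only [sph, hi, mul_assoc]
    rw [← Finset.mul_sum]
    field_simp
    ring
  deriv x hx := by
    refine HasFDerivAt.fun_sum fun i _ => ?_
    exact ((hasFDerivAt_sph hw d.norm_e (isInv_p hd hg i) (fun j b => d.isL_p ε g j b i)
      hx).const_mul ε).smul_const (eb i)
  euler x := by
    rcases eq_or_ne x 0 with rfl | hx
    · simp [suppPert]
    have hk := sec_apply d.norm_e x
    rw [gradPert_eq hd hg hx hk, suppPert_eq hd hg hx hk, ← sum_mul_evk_p hd hg, inner_sum,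
      Finset.mul_sum, Finset.mul_sum]
    refine Finset.sum_congr rfl fun i _ => ?_
    rw [inner_smul_right, real_inner_comm, inner_eb]
    have hi : x i = ‖x‖ * ((sec d.e x).1 d.e) i := by
      nth_rewrite 1 [← hk]
      rw [PiLp.smul_apply, smul_eq_mul]
    rw [hi]
    ring
  homog c hc x := by
    rcases eq_or_ne x 0 with rfl | hx
    · rw [smul_zero]
    have hk := sec_apply d.norm_e x
    rw [gradPert_eq hd hg hx hk, gradPert_eq hd hg (smul_ne_zero hc.ne' hx) (k := sec d.e x)]
    rw [norm_smul, Real.norm_of_nonneg hc.le, mul_smul, hk]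
  even x := by
    rcases eq_or_ne x 0 with rfl | hx
    · rw [neg_zero]
    have hk := sec_apply d.norm_e x
    have hk' := sec_apply d.norm_e (-x)
    rw [suppPert_eq hd hg hx hk, suppPert_eq hd hg (neg_ne_zero.2 hx) hk', norm_neg,
      evk_u_neg hd hg (k := sec d.e x)]
    refine smul_right_injective _ (norm_ne_zero_iff.mpr hx) ?_
    change ‖x‖ • (sec d.e (-x)).1 d.e = ‖x‖ • (-(sec d.e x).1 d.e)
    rw [smul_neg, hk, ← norm_neg, hk']
  norm_P x := by
    refine (norm_sum_le _ _).trans (le_trans (Finset.sum_le_sum fun i _ => ?_)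
      (le_trans (b := ∑ _ : Fin n, η) le_rfl (by simpa using hη')))
    rw [norm_smul, PiLp.norm_single, norm_one, mul_one, Real.norm_eq_abs, sph, ← smul_eq_mul,
      ← map_smul]
    exact (abs_evk_le _ _).trans (hp i)
  norm_A x hx := by
    have hx' : 0 < ‖x‖ := norm_pos_iff.2 hx
    have hk := sec_apply d.norm_e x
    refine (norm_sum_le _ _).trans (le_trans (Finset.sum_le_sum (g := fun _ => n * η / ‖x‖)
      fun i _ => ?_) ?_)
    · rw [ContinuousLinearMap.norm_smulRight_apply, PiLp.norm_single, norm_one, mul_one]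
      refine (norm_smul_rotGrad_le ε hx fun j => sum_mul_sph_Lp hd hg hx hk i j).trans ?_
      gcongr
      refine le_trans (Finset.sum_le_sum (g := fun _ => η) fun j _ => ?_) (by simp)
      rw [← smul_eq_mul, ← map_smul]
      exact (abs_evk_le _ _).trans (hM i j)
    · rw [Finset.sum_const, Finset.card_univ, Fintype.card_fin, nsmul_eq_mul, mul_div_assoc']
      gcongr
  smooth := by
    refine contDiffOn_const.mul (ContDiffOn.mul (fun x hx => ?_)
      (contDiffOn_sph hw d.norm_e (isInv_u hd hg)))
    exact (contDiffAt_norm ℝ hx).contDiffWithinAt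

end

end NL

end

section

section Coordinates

variable {n : ℕ}

theorem det_eq_of_apply_eb {L : Eucl n →L[ℝ] Eucl n} {m : Fin n → Fin n → ℝ}
    (h : ∀ j, L (eb j) = ∑ i, m i j • eb i) :
    LinearMap.det (L : Eucl n →ₗ[ℝ] Eucl n) = (Matrix.of m).det := by
  rw [← LinearMap.det_toLin (EuclideanSpace.basisFun (Fin n) ℝ).toBasis]
  congr 1
  refine (EuclideanSpace.basisFun (Fin n) ℝ).toBasis.ext fun j => ?_
  rw [Matrix.toLin_self]
  simpa using h j

theorem sum_smul_eb (a : Fin n → ℝ) (i : Fin n) : (∑ j, a j • eb j : Eucl n) i = a i := by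
  simp [Finset.sum_apply, Pi.single_apply]

theorem norm_sq_eq_sum (x : Eucl n) : ‖x‖ ^ 2 = ∑ i, x i * x i := by
  rw [EuclideanSpace.norm_sq_eq]
  exact Finset.sum_congr rfl fun i _ => by rw [Real.norm_eq_abs, sq_abs, pow_two]

end Coordinates

namespace NL

variable {n : ℕ} {w : Wt n} {d : NL w} {ε : ℝ} {g : AA w}

theorem evk_sq (k : Gp n) :
    evk w k (d.sq ε g) = ∑ i, evk w k (d.p ε g i) * evk w k (d.p ε g i) := by
  simp only [sq, map_sum, map_mul]

section

variable (hd : d.Inv)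
  (hg : ∀ (h : Gp n) (χ : ℝ), χ * χ = 1 → h.1 d.e = χ • d.e → RR w h g = g)
include hd hg

theorem gradPert_apply {k : Gp n} {x : Eucl n} (hx : x ≠ 0) (hk : ‖x‖ • k.1 d.e = x) (i : Fin n) :
    d.gradPert ε g x i = ε * evk w k (d.p ε g i) := by
  rw [gradPert_eq hd hg hx hk, sum_smul_eb]

theorem norm_gradPert_sq {k : Gp n} {x : Eucl n} (hx : x ≠ 0) (hk : ‖x‖ • k.1 d.e = x) :
    ‖d.gradPert ε g x‖ ^ 2 = ε ^ 2 * evk w k (d.sq ε g) := by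
  rw [norm_sq_eq_sum, evk_sq, Finset.mul_sum]
  refine Finset.sum_congr rfl fun i _ => ?_
  rw [gradPert_apply hd hg hx hk]
  ring

theorem inner_gradPert {k : Gp n} {x : Eucl n} (hx : x ≠ 0) (hk : ‖x‖ • k.1 d.e = x) :
    ⟪x, d.gradPert ε g x⟫ = ε * (‖x‖ * evk w k (d.u ε g)) := by
  rw [gradPert_eq hd hg hx hk, ← sum_mul_evk_p hd hg, inner_sum, Finset.mul_sum, Finset.mul_sum]
  refine Finset.sum_congr rfl fun i _ => ?_
  rw [inner_smul_right, real_inner_comm, inner_eb]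
  have hi : x i = ‖x‖ * (k.1 d.e) i := by
    nth_rewrite 1 [← hk]
    rw [PiLp.smul_apply, smul_eq_mul]
  rw [hi]
  ring

theorem det_one_add_hessPert {k : Gp n} {x : Eucl n} (hx : ‖x‖ = 1) (hk : k.1 d.e = x) :
    LinearMap.det ((1 + d.hessPert ε g x : Eucl n →L[ℝ] Eucl n) : Eucl n →ₗ[ℝ] Eucl n) =
      (1 + Matrix.of fun i j => ε * evk w k (d.M ε g i j)).det := by
  have hx0 : x ≠ 0 := fun h => by simp [h] at hx
  rw [det_eq_of_apply_eb (m := fun i j => (if i = j then 1 else 0) + ε * evk w k (d.M ε g i j))]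
  · congr 1
  · intro j
    rw [add_apply, hessPert_eb hd hg hx0 (k := k) (by rw [hx, hk, one_smul])]
    simp [add_smul, Finset.sum_add_distrib, hx]

theorem norm_add_gradPert_sq {k : Gp n} {x : Eucl n} (hx : ‖x‖ = 1) (hk : k.1 d.e = x) :
    ‖x + d.gradPert ε g x‖ ^ 2 =
      1 + 2 * (ε * evk w k (d.u ε g)) + ε ^ 2 * evk w k (d.sq ε g) := by
  have hx0 : x ≠ 0 := fun h => by simp [h] at hx
  have hk' : ‖x‖ • k.1 d.e = x := by rw [hx, hk, one_smul]
  rw [norm_add_sq_real, norm_gradPert_sq hd hg hx0 hk', inner_gradPert hd hg hx0 hk', hx]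
  ring

variable (k : Gp n) {z : Eucl n} (hz : z + ‖z‖ • d.e ≠ 0)
include hz

omit hd hg in
theorem ne_zero_of_mem : z ≠ 0 := by
  rintro rfl
  simp at hz

omit hd hg in
theorem smul_mul_gz : ‖k.1 z‖ • (k * gz d.e z).1 d.e = k.1 z := by
  change ‖k.1 z‖ • k.1 ((gz d.e z).1 d.e) = _
  rw [Gp.norm_apply, ← map_smul, gz_apply d.norm_e hz]

omit hd hg in
theorem rotate_ne_zero : k.1 z ≠ 0 := by
  rw [← norm_ne_zero_iff, Gp.norm_apply, norm_ne_zero_iff]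
  exact ne_zero_of_mem hz

omit hd hg hz in
theorem evk_T (X : AA w) : evk w k (d.T z X) = evk w (k * gz d.e z) X := evk_RR k _ X

theorem norm_par_sq : ‖par (d.gradPert ε g) (k.1 z)‖ ^ 2 = ‖z‖ ^ 2 +
    2 * ε * ‖z‖ ^ 4 * evk w k (d.T z (d.u ε g)) +
      ε ^ 2 * ‖z‖ ^ 6 * evk w k (d.T z (d.sq ε g)) := by
  rw [par, norm_add_sq_real, norm_smul, mul_pow, inner_smul_right,
    norm_gradPert_sq hd hg (rotate_ne_zero k hz) (smul_mul_gz k hz),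
    inner_gradPert hd hg (rotate_ne_zero k hz) (smul_mul_gz k hz), evk_T, evk_T, norm_pow, norm_norm,
    Gp.norm_apply]
  ring

theorem det_parD : (parD (d.gradPert ε g) (d.hessPert ε g) (k.1 z)).det =
    (1 + Matrix.of fun i j => evk w k (d.G ε z g i j)).det := by
  have hx := rotate_ne_zero k hz
  have hk := smul_mul_gz k hz
  have hz0 : 0 < ‖z‖ := norm_pos_iff.2 (ne_zero_of_mem hz)
  have hi : ∀ j, (k.1 z) j = ‖z‖ * ((k * gz d.e z).1 d.e) j := fun j => by
    nth_rewrite 1 [← hk]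
    rw [PiLp.smul_apply, smul_eq_mul, Gp.norm_apply]
  rw [ContinuousLinearMap.det,
    det_eq_of_apply_eb (m := fun i j => (if i = j then 1 else 0) + evk w k (d.G ε z g i j))]
  · congr 1
  · intro j
    have h1 : ∀ i, evk w k (d.G ε z g i j) =
        ‖z‖ ^ 3 * (ε * evk w (k * gz d.e z) (d.M ε g i j) / ‖z‖) +
          3 * ‖z‖ * (k.1 z) j * (ε * evk w (k * gz d.e z) (d.p ε g i)) := fun i => by
      simp only [G, map_smul, evk_T, map_add, map_mul, evk_x, smul_eq_mul, hi]
      field_simp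
    rw [parD, add_apply, add_apply, smul_apply, hessPert_eb hd hg hx hk,
      ContinuousLinearMap.smulRight_apply, innerSL_apply_apply, real_inner_smul_left,
      real_inner_comm, inner_eb, gradPert_eq hd hg hx hk, Gp.norm_apply]
    simp only [h1, add_smul, Finset.sum_add_distrib, Finset.smul_sum, smul_smul]
    simp

theorem norm_par_sub_sq (hze : z ≠ d.e) :
    ‖par (d.gradPert ε g) (k.1 z) - (k.1 d.e + d.gradPert ε g (k.1 d.e))‖ ^ 2 =
      ‖z - d.e‖ ^ 2 * (1 + evk w k (d.E ε z g)) := by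
  have hx := rotate_ne_zero k hz
  have hk := smul_mul_gz k hz
  have hke : ‖k.1 d.e‖ = 1 := by rw [Gp.norm_apply, d.norm_e]
  have hs : 0 < ‖z - d.e‖ := norm_pos_iff.2 (sub_ne_zero.2 hze)
  have hF : ∀ i, ‖z - d.e‖ * evk w k (d.F ε z g i) =
      (‖z‖ ^ 3 • d.gradPert ε g (k.1 z) - d.gradPert ε g (k.1 d.e)) i := fun i => by
    rw [PiLp.sub_apply, PiLp.smul_apply, gradPert_apply hd hg hx hk,
      gradPert_apply hd hg (k := k) (norm_ne_zero_iff.1 (by rw [hke]; exact one_ne_zero))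
        (by rw [hke, one_smul]), F, FT, map_smul, map_sub, map_smul, evk_T]
    simp only [smul_eq_mul]
    field_simp
  have hℓ : ∀ i, ‖z - d.e‖ * evk w k (d.ℓ z i) = (k.1 (z - d.e)) i := fun i => by
    rw [ℓ, evk_XX, inner_eb, map_smul, PiLp.smul_apply, smul_eq_mul, mul_inv_cancel_left₀ hs.ne']
  have h1 : par (d.gradPert ε g) (k.1 z) - (k.1 d.e + d.gradPert ε g (k.1 d.e)) =
      k.1 (z - d.e) + (‖z‖ ^ 3 • d.gradPert ε g (k.1 z) - d.gradPert ε g (k.1 d.e)) := by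
    rw [par, Gp.norm_apply, map_sub]
    abel
  have h2 : ‖z - d.e‖ ^ 2 = ∑ i, (k.1 (z - d.e)) i * (k.1 (z - d.e)) i := by
    rw [← norm_sq_eq_sum, Gp.norm_apply]
  rw [h1, norm_sq_eq_sum, mul_add, mul_one]
  nth_rewrite 1 [h2]
  simp only [E, map_sum, map_add, map_mul, map_smul, smul_eq_mul, Finset.mul_sum]
  rw [← Finset.sum_add_distrib]
  refine Finset.sum_congr rfl fun i _ => ?_
  rw [PiLp.add_apply, ← hF, ← hℓ]
  ring

end

end NL

end

section

namespace NL

variable {n : ℕ} {w : Wt n} {d : NL w} {ε : ℝ} {g : AA w}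

theorem one_add_evk_E_pos (k : Gp n) {z : Eucl n} (hE : ‖d.E ε z g‖ ≤ 1 / 2) :
    0 < 1 + evk w k (d.E ε z g) := by
  have := neg_abs_le (evk w k (d.E ε z g))
  have := abs_evk_le k (d.E ε z g)
  linarith

section

variable (hd : d.Inv)
  (hg : ∀ (h : Gp n) (χ : ℝ), χ * χ = 1 → h.1 d.e = χ • d.e → RR w h g = g)
include hd hg

theorem chord_integrand {R : ℝ} (hR : 0 < R) (hε : ε = (R ^ 2)⁻¹) (k : Gp n) {z : Eucl n}
    (hz : z ∈ Zs d.e) (hE : ‖d.E ε z g‖ ≤ 1 / 2) :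
    (parD (d.gradPert ε g) (d.hessPert ε g) (k.1 z)).det *
      (Real.exp (-‖R • par (d.gradPert ε g) (k.1 z)‖ ^ 2 / 2) /
        ‖R • par (d.gradPert ε g) (k.1 z) -
          R • (k.1 d.e + d.gradPert ε g (k.1 d.e))‖ ^ d.α) =
      (R ^ d.α)⁻¹ * (gaussKer d.α d.e ε z * evk w k (d.B ε z g)) := by
  have hs : 0 < ‖z - d.e‖ := norm_pos_iff.2 (sub_ne_zero.2 hz.2.1)
  have hE1 := one_add_evk_E_pos k hE
  have h1 : ‖R • par (d.gradPert ε g) (k.1 z)‖ ^ 2 = ‖z‖ ^ 2 / ε - 2 * evk w k (d.Y ε z g) := by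
    rw [norm_smul, mul_pow, norm_par_sq hd hg k hz.2.2, Real.norm_of_nonneg hR.le, Y, map_sub,
      map_neg, map_smul, map_smul, smul_eq_mul, smul_eq_mul, hε]
    field_simp
    ring
  have h2 : ‖R • par (d.gradPert ε g) (k.1 z) - R • (k.1 d.e + d.gradPert ε g (k.1 d.e))‖ ^ d.α =
      R ^ d.α * (‖z - d.e‖ ^ d.α * (1 + evk w k (d.E ε z g)) ^ (d.α / 2)) := by
    have h3 := norm_par_sub_sq (ε := ε) hd hg k hz.2.2 hz.2.1
    have h4 : ‖par (d.gradPert ε g) (k.1 z) - (k.1 d.e + d.gradPert ε g (k.1 d.e))‖ =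
        ‖z - d.e‖ * (1 + evk w k (d.E ε z g)) ^ (1 / 2 : ℝ) := by
      rw [← Real.sqrt_eq_rpow, ← Real.sqrt_sq (norm_nonneg (z - d.e)), ← Real.sqrt_mul (by positivity),
        ← h3, Real.sqrt_sq (norm_nonneg _)]
    rw [← smul_sub, norm_smul, Real.norm_of_nonneg hR.le, h4,
      Real.mul_rpow hR.le (by positivity), Real.mul_rpow hs.le (by positivity),
      ← Real.rpow_mul hE1.le]
    ring_nf
  have h5 : Real.exp (-‖R • par (d.gradPert ε g) (k.1 z)‖ ^ 2 / 2) =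
      Real.exp (-‖z‖ ^ 2 / (2 * ε)) * Real.exp (evk w k (d.Y ε z g)) := by
    rw [← Real.exp_add, h1]
    congr 1
    field_simp
    ring
  rw [h2, h5, det_parD hd hg k hz.2.2, evk_B k z hE, gaussKer, Real.rpow_neg hE1.le]
  have := Real.rpow_pos_of_pos hR d.α
  have := Real.rpow_pos_of_pos hs d.α
  have := Real.rpow_pos_of_pos hE1 (d.α / 2)
  field_simp

theorem chord_integral (hn : 2 ≤ n) (hν : ∀ ε, d.ν ε = gaussProb d.α d.e ε) (hα : d.α < n)
    {κ R : ℝ} (hR : 0 < R)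
    (hε : ε = (R ^ 2)⁻¹) (hP : IsPert κ (d.suppPert ε g) (d.gradPert ε g) (d.hessPert ε g))
    (hE : ∀ z : Zs d.e, ‖d.E ε z g‖ ≤ 1 / 2) (k : Gp n) :
    ∫ y in bodyOf R (d.suppPert ε g), Real.exp (-‖y‖ ^ 2 / 2) /
        ‖y - R • (k.1 d.e + d.gradPert ε g (k.1 d.e))‖ ^ d.α =
      R ^ n * (R ^ d.α)⁻¹ * gaussMass d.α d.e ε * ∫ z : Zs d.e, evk w k (d.B ε z g) ∂d.ν ε := by
  have hε0 : 0 < ε := by rw [hε]; positivity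
  have hc := gaussMass_pos (by omega) hα d.e hε0
  rw [hP.integral_bodyOf hR, ← setIntegral_closedBall_rotate k, hν,
    integral_gaussProb hn d.α d.e ε (fun z => evk w k (d.B ε z g)), smul_eq_mul,
    mul_assoc _ (gaussMass _ _ _), mul_inv_cancel_left₀ hc.ne',
    ← integral_const_mul, ← setIntegral_congr_set (Zs_ae_eq hn d.e),
    ← setIntegral_congr_set (Zs_ae_eq hn d.e)]
  refine setIntegral_congr_fun (measurableSet_Zs d.e) fun z hz => ?_
  have h := chord_integrand hd hg hR hε k hz (hE ⟨z, hz⟩)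
  simp only [smul_eq_mul]
  rw [mul_assoc, h, mul_assoc]

theorem chord_equation (hn : 2 ≤ n) {q : ℝ} (hq : d.α = n - q + 1) (hα : d.α < n)
    (hν : ∀ ε, d.ν ε = gaussProb d.α d.e ε) {κ R : ℝ} (hR : 0 < R)
    (hε : ε = (R ^ 2)⁻¹) (hP : IsPert κ (d.suppPert ε g) (d.gradPert ε g) (d.hessPert ε g))
    (hE : ∀ z : Zs d.e, ‖d.E ε z g‖ ≤ 1 / 2) (hQ : d.Q ε g = g)
    (hB : Integrable (fun z : Zs d.e => d.B ε z g - 1) (d.ν ε)) :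
    ∃ τ : ℝ, 0 < τ ∧ ∀ k : Gp n,
      τ * Vtilde q (bodyOf R (d.suppPert ε g))
          (gradient (suppFun (bodyOf R (d.suppPert ε g))) (k.1 d.e)) *
        suppFun (bodyOf R (d.suppPert ε g)) (k.1 d.e) *
        curvDet (suppFun (bodyOf R (d.suppPert ε g))) (k.1 d.e) =
      Real.exp (-evk w k d.U) := by
  have hε0 : 0 < ε := by rw [hε]; positivity
  have hc := gaussMass_pos (by omega) hα d.e hε0
  have hRα := Real.rpow_pos_of_pos hR d.α
  set K := 2 * Real.exp (-R ^ 2 / 2) * (R ^ n * (R ^ d.α)⁻¹ * gaussMass d.α d.e ε) * R * R ^ (n - 1)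
    with hK
  have hK0 : 0 < K := by positivity
  refine ⟨K⁻¹, inv_pos.2 hK0, fun k => ?_⟩
  have hx : ‖k.1 d.e‖ = 1 := by rw [Gp.norm_apply, d.norm_e]
  have hx0 : k.1 d.e ≠ 0 := fun h => by simp [h] at hx
  have hprob : IsProbabilityMeasure (d.ν ε) := by
    rw [hν]; exact isProbabilityMeasure_gaussProb hn hα d.e hε0
  have h1 := evk_fixedPoint hε0 hQ (isInv_u hd hg) hB k
  rw [hP.gradient_suppFun hR hx0, hP.suppFun_bodyOf hR, hP.curvDet_bodyOf hR hx, hx, inv_one,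
    one_smul, Vtilde, ← hq, chord_integral hd hg hn hν hα hR hε hP hE,
    suppPert_eq hd hg hx0 (k := k) (by rw [hx, one_smul]), hx, one_mul,
    det_one_add_hessPert hd hg hx rfl]
  have h2 : Real.exp (-‖R • (k.1 d.e + d.gradPert ε g (k.1 d.e))‖ ^ 2 / 2) =
      Real.exp (-R ^ 2 / 2) * (Real.exp (-evk w k (d.u ε g)) *
        Real.exp (-(ε / 2) * evk w k (d.sq ε g))) := by
    rw [← Real.exp_add, ← Real.exp_add, norm_smul, mul_pow, norm_add_gradPert_sq hd hg hx rfl,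
      Real.norm_of_nonneg hR.le, hε]
    congr 1
    field_simp
    ring
  have h3 : Real.exp (-evk w k d.U) =
      Real.exp (-evk w k (d.u ε g)) * Real.exp (evk w k (d.v ε g)) := by
    rw [← Real.exp_add, u, map_add]
    congr 1
    ring
  rw [h3, h1, h2, inv_mul_eq_div, div_mul_eq_mul_div, div_mul_eq_mul_div, div_eq_iff hK0.ne', hK]
  ring

end

end NL

end

section

namespace NL

variable {n : ℕ} {w : Wt n} {d : NL w}

theorem pert_small (d : NL w) {η : ℝ} (hη : 0 < η) :
    ∀ᶠ r in 𝓝[>] (0 : ℝ), ∀ᶠ ε in 𝓝[>] (0 : ℝ), ∀ g : AA w, ‖g‖ ≤ r →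
      (∀ i, ‖ε • d.p ε g i‖ ≤ η) ∧ ∀ i j, ‖ε • d.M ε g i j‖ ≤ η := by
  have h1 := eventually_all.2 fun i => (d.oo_p (ι := Unit) i).eventually_small hη
  have h2 := eventually_all.2 fun i => eventually_all.2 fun j =>
    (d.oo_M (ι := Unit) i j).eventually_small hη
  filter_upwards [h1, h2] with r h1 h2
  have h2' := eventually_all.2 fun i => eventually_all.2 (h2 i)
  filter_upwards [eventually_all.2 h1, h2'] with ε h1 h2 g hg
  refine ⟨fun i => ?_, fun i j => ?_⟩
  · linarith [(h1 i () g hg).1, norm_nonneg (ε • d.p ε g i)]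
  · linarith [(h2 i j () g hg).1, norm_nonneg (ε • d.M ε g i j)]

theorem exists_body (hn : 2 ≤ n) {q : ℝ} (hq : d.α = n - q + 1) (hα : d.α < n)
    (hν : ∀ ε, d.ν ε = gaussProb d.α d.e ε) (hw : w.Super)
    (hU : ∀ (h : Gp n) (χ : ℝ), χ * χ = 1 → h.1 d.e = χ • d.e → RR w h d.U = d.U) :
    ∃ (Ω : Set (Eucl n)) (τ : ℝ), 0 < τ ∧ IsSmoothBody Ω ∧ ∀ k : Gp n,
      τ * Vtilde q Ω (gradient (suppFun Ω) (k.1 d.e)) * suppFun Ω (k.1 d.e) *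
        curvDet (suppFun Ω) (k.1 d.e) = Real.exp (-evk w k d.U) := by
  have hd := inv_gaussProb hn d hν hU
  have hn0 : (0 : ℝ) < n := by exact_mod_cast (by omega : 0 < n)
  have hn1 : (1 : ℝ) ≤ n := by exact_mod_cast (by omega : 1 ≤ n)
  set η : ℝ := 1 / (100 * (n * n)) with hη
  have hη0 : 0 < η := by positivity
  obtain ⟨r, h1, h2⟩ := ((exists_invariant_fixedPoint (conc_gaussProb hn d hα hν) hd).and
    (d.pert_small hη0)).exists
  obtain ⟨ε, ⟨⟨g, hgr, hQ, hg, hE, hB⟩, h2⟩, hε⟩ := ((h1.and h2).and self_mem_nhdsWithin).exists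
  have hε : 0 < ε := hε
  have hP := isPert hd hg hw hε (κ := 1 / 100) (by norm_num) le_rfl
    (η := η) (by rw [hη]; field_simp; rfl)
    (by rw [hη, mul_one_div, div_le_div_iff₀ (by positivity) (by norm_num)]; nlinarith)
    (h2 g hgr).1 (h2 g hgr).2
  have hR : 0 < (√ε)⁻¹ := inv_pos.2 (Real.sqrt_pos.2 hε)
  have hεR : ε = ((√ε)⁻¹ ^ 2)⁻¹ := by rw [inv_pow, inv_inv, Real.sq_sqrt hε.le]
  obtain ⟨τ, hτ, h⟩ := chord_equation hd hg hn hq hα hν hR hεR hP hE hQ hB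
  exact ⟨_, τ, hτ, hP.isSmoothBody_bodyOf hR, h⟩

end NL

end

section

variable {n : ℕ}

theorem exists_contDiff_eq_log {m : ℝ} (hm : 0 < m) :
    ∃ L : ℝ → ℝ, ContDiff ℝ (⊤ : ℕ∞) L ∧ ∀ t, m ≤ t → L t = Real.log t := by
  refine ⟨fun t => Real.smoothTransition (2 * t / m - 1) * Real.log t, ?_, fun t ht => ?_⟩
  · rw [contDiff_iff_contDiffAt]
    intro t
    by_cases h0 : t = 0
    · have : (fun t => Real.smoothTransition (2 * t / m - 1) * Real.log t) =ᶠ[𝓝 t]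
          fun _ => (0 : ℝ) := by
        filter_upwards [Iio_mem_nhds (show t < m / 2 by rw [h0]; positivity)] with s hs
        rw [Real.smoothTransition.zero_of_nonpos, zero_mul]
        rw [sub_nonpos, div_le_one hm]
        linarith [Set.mem_Iio.1 hs]
      exact contDiffAt_const.congr_of_eventuallyEq this
    · refine ContDiffAt.mul ?_ (Real.contDiffAt_log.2 h0)
      exact (Real.smoothTransition.contDiff.comp (by fun_prop : ContDiff ℝ (⊤ : ℕ∞)
        fun t : ℝ => 2 * t / m - 1)).contDiffAt
  · dsimp only
    rw [Real.smoothTransition.one_of_one_le, one_mul]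
    rw [le_sub_iff_add_le, le_div_iff₀ hm]
    linarith

theorem exists_smooth_compact_eq_neg_log {f : Eucl n → ℝ} (hf : ContDiff ℝ (⊤ : ℕ∞) f)
    (hpos : ∀ x ∈ Metric.sphere (0 : Eucl n) 1, 0 < f x) :
    ∃ φ : Eucl n → ℝ, ContDiff ℝ (⊤ : ℕ∞) φ ∧ HasCompactSupport φ ∧
      ∀ x ∈ Metric.sphere (0 : Eucl n) 1, φ x = -Real.log (f x) := by
  obtain ⟨m, hm, hmf⟩ : ∃ m, 0 < m ∧ ∀ x ∈ Metric.sphere (0 : Eucl n) 1, m ≤ f x := by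
    rcases (Metric.sphere (0 : Eucl n) 1).eq_empty_or_nonempty with he | hne
    · exact ⟨1, one_pos, by simp [he]⟩
    · obtain ⟨x, hx, hmin⟩ := (isCompact_sphere (0 : Eucl n) 1).exists_isMinOn hne
        hf.continuous.continuousOn
      exact ⟨f x, hpos x hx, fun y hy => hmin hy⟩
  obtain ⟨L, hL, hLlog⟩ := exists_contDiff_eq_log hm
  let B : ContDiffBump (0 : Eucl n) := ⟨1, 2, one_pos, one_lt_two⟩
  refine ⟨fun x => B x * -L (f x), B.contDiff.mul (hL.comp hf).neg, B.hasCompactSupport.mul_right,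
    fun x hx => ?_⟩
  dsimp only
  rw [B.one_of_mem_closedBall (Metric.sphere_subset_closedBall hx), one_mul, hLlog _ (hmf x hx)]

theorem exists_cos_integral {φ : Eucl n → ℝ} (hφ : ContDiff ℝ (⊤ : ℕ∞) φ)
    (hc : HasCompactSupport φ) :
    ∃ ω : Eucl n → ℝ, Continuous ω ∧ (∀ P : ℕ, Integrable fun ξ => ‖ξ‖ ^ P * |ω ξ|) ∧
      ∀ x, φ x = φ (-x) → φ x = ∫ ξ, Real.cos (2 * Real.pi * ⟪ξ, x⟫) * ω ξ := by
  let g : SchwartzMap (Eucl n) ℂ := HasCompactSupport.toSchwartzMap (f := fun x => (φ x : ℂ))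
    (hc.comp_left (g := fun t : ℝ => (t : ℂ)) Complex.ofReal_zero)
    (Complex.ofRealCLM.contDiff.comp hφ)
  let G : SchwartzMap (Eucl n) ℂ := FourierTransform.fourier g
  have hi : ∀ P : ℕ, Integrable fun ξ => ‖ξ‖ ^ P * |(G ξ).re| := fun P => by
    refine (G.integrable_pow_mul volume P).mono' ?_ (.of_forall fun ξ => ?_)
    · have := G.continuous
      exact (by fun_prop : Continuous fun ξ => ‖ξ‖ ^ P * |(G ξ).re|).aestronglyMeasurable
    · rw [Real.norm_eq_abs, abs_of_nonneg (by positivity)]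
      gcongr
      exact Complex.abs_re_le_norm _
  refine ⟨fun ξ => (G ξ).re, Complex.continuous_re.comp G.continuous, hi, ?_⟩
  have hinv : ∀ x, φ x = ∫ ξ, (Real.cos (2 * Real.pi * ⟪ξ, x⟫) * (G ξ).re -
      Real.sin (2 * Real.pi * ⟪ξ, x⟫) * (G ξ).im) := by
    intro x
    have h1 : (FourierTransformInv.fourierInv G : SchwartzMap (Eucl n) ℂ) x = g x := by
      rw [FourierTransform.fourierInv_fourier_eq]
    rw [SchwartzMap.fourierInv_coe, Real.fourierInv_eq'] at h1
    have h2 := congrArg Complex.re h1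
    have h3 : Integrable fun ξ : Eucl n =>
        Complex.exp (((2 * Real.pi * ⟪ξ, x⟫ : ℝ) : ℂ) * Complex.I) • G ξ := by
      refine G.integrable.norm.mono' ?_ (.of_forall fun ξ => ?_)
      · have := G.continuous
        exact (by fun_prop : Continuous fun ξ : Eucl n =>
          Complex.exp (((2 * Real.pi * ⟪ξ, x⟫ : ℝ) : ℂ) * Complex.I) • G ξ).aestronglyMeasurable
      · rw [norm_smul, Complex.norm_exp_ofReal_mul_I, one_mul]
    have h4 := integral_re h3
    change _ = φ x at h2
    rw [← h2]
    change RCLike.re (∫ ξ : Eucl n,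
      Complex.exp (((2 * Real.pi * ⟪ξ, x⟫ : ℝ) : ℂ) * Complex.I) • G ξ) = _
    rw [← h4]
    refine integral_congr_ae (.of_forall fun ξ => ?_)
    simp only [smul_eq_mul, RCLike.re_eq_complex_re, Complex.mul_re, Complex.exp_ofReal_mul_I_re,
      Complex.exp_ofReal_mul_I_im]
  intro x hx
  have ha := hinv x
  have hb := hinv (-x)
  have hbd : ∀ x : Eucl n, ∀ T : ℝ → ℝ, Continuous T → (∀ t, |T t| ≤ 1) → ∀ S : ℂ → ℝ,
      Continuous S → (∀ z, |S z| ≤ ‖z‖) →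
      Integrable fun ξ => T (2 * Real.pi * ⟪ξ, x⟫) * S (G ξ) := by
    intro x T hT hT1 S hS hS1
    refine G.integrable.norm.mono' ?_ (.of_forall fun ξ => ?_)
    · have := G.continuous
      exact (by fun_prop : Continuous fun ξ =>
        T (2 * Real.pi * ⟪ξ, x⟫) * S (G ξ)).aestronglyMeasurable
    · rw [norm_mul, Real.norm_eq_abs, Real.norm_eq_abs]
      calc _ ≤ 1 * ‖G ξ‖ := by gcongr; exacts [hT1 _, hS1 _]
        _ = _ := one_mul _
  have hcos := hbd x _ Real.continuous_cos Real.abs_cos_le_one _ Complex.continuous_re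
    Complex.abs_re_le_norm
  have hsin := hbd x _ Real.continuous_sin Real.abs_sin_le_one _ Complex.continuous_im
    Complex.abs_im_le_norm
  simp only [inner_neg_right, mul_neg, Real.cos_neg, Real.sin_neg, neg_mul, sub_neg_eq_add] at hb
  rw [integral_sub hcos hsin] at ha
  rw [integral_add hcos hsin] at hb
  linarith

/-- The Taylor polynomial of the cosine of degree `2N`. -/
def cosTaylor (N : ℕ) (z : ℝ) : ℝ :=
  ∑ m ∈ Finset.range (N + 1), (-1) ^ m * z ^ (2 * m) / (2 * m).factorial

theorem abs_cos_sub_cosTaylor_le {N : ℕ} {z : ℝ} (hz : |z| ≤ N / 4) :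
    |Real.cos z - cosTaylor N z| ≤ (1 / 2) ^ N := by
  have h1 := Real.hasSum_cos z
  have h2 := Real.hasSum_cosh (2 * |z|)
  rw [← hasSum_nat_add_iff' (N + 1)] at h1
  have h3 : HasSum (fun m => (1 / 4 : ℝ) ^ N * ((2 * |z|) ^ (2 * m) / (2 * m).factorial))
    ((1 / 4) ^ N * Real.cosh (2 * |z|)) := h2.mul_left _
  have h4 := (summable_nat_add_iff (N + 1)).2 h3.summable
  have h5 : ∀ m, ‖(-1) ^ (m + (N + 1)) * z ^ (2 * (m + (N + 1))) / (2 * (m + (N + 1))).factorial‖ ≤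
      (1 / 4 : ℝ) ^ N * ((2 * |z|) ^ (2 * (m + (N + 1))) / (2 * (m + (N + 1))).factorial) := by
    intro m
    rw [norm_div, norm_mul, norm_pow, norm_neg, norm_one, one_pow, one_mul, norm_pow,
      Real.norm_eq_abs, Real.norm_of_nonneg (Nat.cast_nonneg _), ← mul_div_assoc]
    gcongr
    have : (1 / 4 : ℝ) ^ N * (2 * |z|) ^ (2 * (m + (N + 1))) =
        4 ^ (m + 1) * |z| ^ (2 * (m + (N + 1))) := by
      rw [mul_pow, pow_mul 2, show (2 : ℝ) ^ 2 = 4 by norm_num, show m + (N + 1) = N + (m + 1) by ring,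
        pow_add 4, ← mul_assoc, ← mul_assoc, ← mul_pow]
      norm_num
    rw [this]
    exact le_mul_of_one_le_left (by positivity) (one_le_pow₀ (by norm_num))
  have h6 := tsum_of_norm_bounded h4.hasSum h5
  rw [h1.tsum_eq, Real.norm_eq_abs] at h6
  refine h6.trans ?_
  have h7 : ∑' m, (1 / 4 : ℝ) ^ N * ((2 * |z|) ^ (2 * (m + (N + 1))) / (2 * (m + (N + 1))).factorial)
      ≤ (1 / 4) ^ N * Real.cosh (2 * |z|) := by
    rw [← h3.tsum_eq, ← h3.summable.sum_add_tsum_nat_add (N + 1)]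
    exact le_add_of_nonneg_left (Finset.sum_nonneg fun m _ => by positivity)
  refine h7.trans ?_
  have h8 : Real.cosh (2 * |z|) ≤ Real.exp (2 * |z|) := by
    rw [Real.cosh_eq]
    have : Real.exp (-(2 * |z|)) ≤ Real.exp (2 * |z|) :=
      Real.exp_le_exp.2 (by linarith [abs_nonneg z])
    linarith
  have h9 : Real.exp (2 * |z|) ≤ 2 ^ N := by
    have e1 : Real.exp (1 / 2) ≤ 2 := by
      have h := Real.exp_one_lt_d9
      have : Real.exp (1 / 2) ^ 2 = Real.exp 1 := by rw [← Real.exp_nat_mul]; norm_num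
      nlinarith [Real.exp_pos (1 / 2)]
    calc Real.exp (2 * |z|) ≤ Real.exp (N * (1 / 2)) := Real.exp_le_exp.2 (by linarith)
      _ = Real.exp (1 / 2) ^ N := Real.exp_nat_mul _ _
      _ ≤ 2 ^ N := by gcongr
  calc (1 / 4 : ℝ) ^ N * Real.cosh (2 * |z|) ≤ (1 / 4) ^ N * 2 ^ N := by
        gcongr; exact h8.trans h9
    _ = (1 / 2) ^ N := by rw [← mul_pow]; norm_num

end

section

variable {n : ℕ}

theorem integral_mem_of_finiteDimensional {X F : Type*} [MeasurableSpace X] {μ : Measure X}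
    [NormedAddCommGroup F] [NormedSpace ℝ F] [CompleteSpace F] (V : Submodule ℝ F)
    [FiniteDimensional ℝ V] {f : X → F} (hf : Integrable f μ) (hV : ∀ x, f x ∈ V) :
    ∫ x, f x ∂μ ∈ V := by
  obtain ⟨p, hp⟩ := Submodule.ClosedComplemented.of_finiteDimensional V
  have h := (V.subtypeL.comp p).integral_comp_comm hf
  have h1 : ∀ x, (V.subtypeL.comp p) (f x) = f x := fun x => by
    have := hp ⟨f x, hV x⟩
    simpa using congrArg Subtype.val this
  simp only [h1] at h
  rw [h]
  exact (p (∫ x, f x ∂μ)).2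

theorem continuous_cf_left (e : Eucl n) : Continuous fun ξ : Eucl n => cf ξ e :=
  LinearMap.continuous_of_finiteDimensional (F' := C(Gp n, ℝ))
    { toFun := fun ξ => cf ξ e
      map_add' := fun v v' => cf_add_left v v' e
      map_smul' := fun c v => cf_smul_left c v e }

theorem Vp_pow_mem {j : ℕ} {y : C(Gp n, ℝ)} (hy : y ∈ Vp n j) (m : ℕ) : y ^ m ∈ Vp n (j * m) := by
  induction m with
  | zero => exact one_mem_Vp _
  | succ m ih => exact Vp_mul_mem ih hy

/-- The Taylor polynomial of `k ↦ cos (2π ⟪ξ, k e⟫)`. -/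
def cosPoly (e : Eucl n) (N : ℕ) (ξ : Eucl n) : C(Gp n, ℝ) :=
  ∑ m ∈ Finset.range (N + 1),
    ((-1) ^ m * (2 * Real.pi) ^ (2 * m) / (2 * m).factorial : ℝ) • cf ξ e ^ (2 * m)

theorem cosPoly_apply (e : Eucl n) (N : ℕ) (ξ : Eucl n) (k : Gp n) :
    cosPoly e N ξ k = cosTaylor N (2 * Real.pi * ⟪ξ, k.1 e⟫) := by
  simp only [cosPoly, cosTaylor, ContinuousMap.sum_apply, ContinuousMap.smul_apply,
    ContinuousMap.pow_apply, cf_apply, smul_eq_mul]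
  refine Finset.sum_congr rfl fun m _ => ?_
  rw [mul_pow]
  ring

theorem cosPoly_mem (e : Eucl n) (N : ℕ) (ξ : Eucl n) : cosPoly e N ξ ∈ Vp n (2 * N) := by
  refine Submodule.sum_mem _ fun m hm => Submodule.smul_mem _ _ ?_
  have := Vp_pow_mem (cf_mem_Vp ξ e) (2 * m)
  exact Vp_mono (by have := Finset.mem_range.1 hm; omega) this

theorem cosPoly_invariant {e : Eucl n} {h : Gp n} {χ : ℝ} (hχ : χ * χ = 1) (he : h.1 e = χ • e)
    (N : ℕ) (ξ : Eucl n) (k : Gp n) : cosPoly e N ξ (k * h) = cosPoly e N ξ k := by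
  simp only [cosPoly_apply, cosTaylor]
  refine Finset.sum_congr rfl fun m _ => ?_
  have h1 : ⟪ξ, (k * h).1 e⟫ = χ * ⟪ξ, k.1 e⟫ := by
    change ⟪ξ, k.1 (h.1 e)⟫ = _
    rw [he, map_smul, inner_smul_right]
  rw [h1, mul_left_comm, mul_pow χ, pow_mul χ, pow_two χ, hχ, one_pow, one_mul]

def cosInt (e : Eucl n) (ω : Eucl n → ℝ) (N : ℕ) : C(Gp n, ℝ) :=
  ∫ ξ in Metric.closedBall 0 (N / 32 : ℝ), ω ξ • cosPoly e N ξ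

section

variable {e : Eucl n} {ω : Eucl n → ℝ} (hω : Continuous ω)

include hω

theorem integrableOn_cosInt (e : Eucl n) (N : ℕ) :
    IntegrableOn (fun ξ => ω ξ • cosPoly e N ξ) (Metric.closedBall 0 (N / 32 : ℝ)) := by
  refine ContinuousOn.integrableOn_compact (isCompact_closedBall _ _) (Continuous.continuousOn ?_)
  have := continuous_cf_left e
  unfold cosPoly
  fun_prop

theorem cosInt_apply (e : Eucl n) (N : ℕ) (k : Gp n) :
    cosInt e ω N k = ∫ ξ in Metric.closedBall 0 (N / 32 : ℝ), ω ξ * cosPoly e N ξ k :=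
  ((ContinuousMap.evalCLM ℝ k).integral_comp_comm (integrableOn_cosInt hω e N)).symm

theorem cosInt_mem (e : Eucl n) (N : ℕ) : cosInt e ω N ∈ Vp n (2 * N) :=
  integral_mem_of_finiteDimensional _ (integrableOn_cosInt hω e N)
    fun ξ => Submodule.smul_mem _ _ (cosPoly_mem e N ξ)

theorem Rt_cosInt {h : Gp n} {χ : ℝ} (hχ : χ * χ = 1) (he : h.1 e = χ • e) (N : ℕ) :
    Rt h (cosInt e ω N) = cosInt e ω N := by
  ext k
  change cosInt e ω N (k * h) = _
  simp only [cosInt_apply hω, cosPoly_invariant hχ he]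

theorem exists_cosInt_error_le (hi : ∀ P : ℕ, Integrable fun ξ => ‖ξ‖ ^ P * |ω ξ|) (he : ‖e‖ = 1)
    (P : ℕ) : ∃ C, ∀ (N : ℕ) (k : Gp n), (1 + N : ℝ) ^ P *
      |(∫ ξ, Real.cos (2 * Real.pi * ⟪ξ, k.1 e⟫) * ω ξ) - cosInt e ω N k| ≤ C := by
  obtain ⟨C, hC⟩ : ∃ C, ∀ N : ℕ, (1 + N : ℝ) ^ P * (1 / 2) ^ N ≤ C := by
    have h := (tendsto_pow_const_mul_const_pow_of_abs_lt_one P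
      (show |(1 / 2 : ℝ)| < 1 by rw [abs_of_pos] <;> norm_num)).comp (tendsto_add_atTop_nat 1)
    obtain ⟨C, hC⟩ := h.bddAbove_range
    refine ⟨2 * C, fun N => ?_⟩
    have := hC ⟨N, rfl⟩
    simp only [Function.comp_apply, Nat.cast_add, Nat.cast_one, pow_succ (1 / 2 : ℝ)] at this
    rw [add_comm (1 : ℝ)]
    linarith
  have hC0 : 0 ≤ C := le_trans (by positivity) (hC 0)
  have hi0 : Integrable fun ξ => |ω ξ| := by simpa using hi 0
  have hb : Integrable fun ξ => (C + 32 ^ P * (2 ^ P * (1 + ‖ξ‖ ^ P))) * |ω ξ| := by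
    have := (hi0.const_mul (C + 32 ^ P * 2 ^ P)).add ((hi P).const_mul (32 ^ P * 2 ^ P))
    refine this.congr (.of_forall fun ξ => ?_)
    simp only [Pi.add_apply]
    ring
  refine ⟨∫ ξ, (C + 32 ^ P * (2 ^ P * (1 + ‖ξ‖ ^ P))) * |ω ξ|, fun N k => ?_⟩
  set S := Metric.closedBall (0 : Eucl n) (N / 32 : ℝ)
  have hS : MeasurableSet S := Metric.isClosed_closedBall.measurableSet
  have hcos : Integrable fun ξ => Real.cos (2 * Real.pi * ⟪ξ, k.1 e⟫) * ω ξ := by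
    refine hi0.mono' ?_ (.of_forall fun ξ => ?_)
    · exact (by fun_prop : Continuous fun ξ =>
        Real.cos (2 * Real.pi * ⟪ξ, k.1 e⟫) * ω ξ).aestronglyMeasurable
    · rw [norm_mul, Real.norm_eq_abs, Real.norm_eq_abs]
      exact mul_le_of_le_one_left (abs_nonneg _) (Real.abs_cos_le_one _)
  have hpol : Integrable (S.indicator fun ξ => ω ξ * cosPoly e N ξ k) := by
    rw [integrable_indicator_iff hS]
    exact (ContinuousMap.evalCLM ℝ k).integrable_comp (integrableOn_cosInt hω e N)
  rw [cosInt_apply hω, ← integral_indicator hS, ← integral_sub hcos hpol]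
  calc (1 + N : ℝ) ^ P * |∫ ξ, (Real.cos (2 * Real.pi * ⟪ξ, k.1 e⟫) * ω ξ -
        S.indicator (fun ξ => ω ξ * cosPoly e N ξ k) ξ)|
      ≤ (1 + N : ℝ) ^ P * ∫ ξ, |Real.cos (2 * Real.pi * ⟪ξ, k.1 e⟫) * ω ξ -
        S.indicator (fun ξ => ω ξ * cosPoly e N ξ k) ξ| := by
        gcongr
        exact abs_integral_le_integral_abs
    _ = ∫ ξ, (1 + N : ℝ) ^ P * |Real.cos (2 * Real.pi * ⟪ξ, k.1 e⟫) * ω ξ -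
        S.indicator (fun ξ => ω ξ * cosPoly e N ξ k) ξ| := (integral_const_mul _ _).symm
    _ ≤ _ := by
        refine integral_mono ((hcos.sub hpol).abs.const_mul _) hb fun ξ => ?_
        dsimp only
        by_cases hξ : ξ ∈ S
        · rw [Set.indicator_of_mem hξ, cosPoly_apply, mul_comm (ω ξ), ← sub_mul, abs_mul,
            ← mul_assoc]
          gcongr
          have hz : |2 * Real.pi * ⟪ξ, k.1 e⟫| ≤ N / 4 := by
            have h1 : |⟪ξ, k.1 e⟫| ≤ N / 32 := by
              refine (abs_real_inner_le_norm _ _).trans ?_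
              rw [Gp.norm_apply, he, mul_one]
              simpa [S] using hξ
            rw [abs_mul, abs_of_pos Real.two_pi_pos]
            calc 2 * Real.pi * |⟪ξ, k.1 e⟫| ≤ 8 * (N / 32) := by
                  gcongr
                  linarith [Real.pi_le_four]
              _ = N / 4 := by ring
          refine ((mul_le_mul_of_nonneg_left (abs_cos_sub_cosTaylor_le hz)
            (by positivity)).trans (hC N)).trans ?_
          exact le_add_of_nonneg_right (by positivity)
        · rw [Set.indicator_of_notMem hξ, sub_zero, abs_mul, ← mul_assoc]
          gcongr
          have h1 : (N : ℝ) ≤ 32 * ‖ξ‖ := by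
            have : (N / 32 : ℝ) < ‖ξ‖ := by simpa [S] using hξ
            linarith
          have h2 : (1 + N : ℝ) ≤ 32 * (1 + ‖ξ‖) := by linarith
          have h3 : (1 + ‖ξ‖) ^ P ≤ 2 ^ P * (1 + ‖ξ‖ ^ P) := by
            have h4 : 1 + ‖ξ‖ ≤ 2 * max 1 ‖ξ‖ := by
              linarith [le_max_left 1 ‖ξ‖, le_max_right 1 ‖ξ‖]
            calc (1 + ‖ξ‖) ^ P ≤ (2 * max 1 ‖ξ‖) ^ P := by gcongr
              _ = 2 ^ P * (max 1 ‖ξ‖) ^ P := mul_pow _ _ _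
              _ ≤ 2 ^ P * (1 + ‖ξ‖ ^ P) := by
                gcongr
                rcases max_cases 1 ‖ξ‖ with ⟨h, _⟩ | ⟨h, _⟩ <;> rw [h]
                · rw [one_pow]; exact le_add_of_nonneg_right (by positivity)
                · exact le_add_of_nonneg_left zero_le_one
          calc (1 + N : ℝ) ^ P * |Real.cos (2 * Real.pi * ⟪ξ, k.1 e⟫)|
              ≤ (32 * (1 + ‖ξ‖)) ^ P * 1 := by
                gcongr
                exact Real.abs_cos_le_one _
            _ = 32 ^ P * (1 + ‖ξ‖) ^ P := by rw [mul_one, mul_pow]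
            _ ≤ 32 ^ P * (2 ^ P * (1 + ‖ξ‖ ^ P)) := by gcongr
            _ ≤ _ := le_add_of_nonneg_left hC0

end

end

section

variable {n : ℕ}

theorem exists_Vp_expansion {e : Eucl n} (he : ‖e‖ = 1) {φ : Eucl n → ℝ}
    (hφ : ContDiff ℝ (⊤ : ℕ∞) φ) (hc : HasCompactSupport φ)
    (hev : ∀ x ∈ Metric.sphere (0 : Eucl n) 1, φ x = φ (-x)) :
    ∃ y : ℕ → C(Gp n, ℝ), (∀ l, y l ∈ Vp n l) ∧
      (∀ (h : Gp n) (χ : ℝ), χ * χ = 1 → h.1 e = χ • e → ∀ l, Rt h (y l) = y l) ∧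
      (∀ P : ℕ, ∃ C, ∀ l : ℕ, (1 + l : ℝ) ^ P * ‖y l‖ ≤ C) ∧
      ∀ k : Gp n, Tendsto (fun L => ∑ l ∈ Finset.range L, y l k) atTop (𝓝 (φ (k.1 e))) := by
  obtain ⟨ω, hω, hi, hrep⟩ := exists_cos_integral hφ hc
  have hke : ∀ k : Gp n, φ (k.1 e) = ∫ ξ, Real.cos (2 * Real.pi * ⟪ξ, k.1 e⟫) * ω ξ := fun k =>
    hrep _ (hev _ (by rw [mem_sphere_zero_iff_norm, Gp.norm_apply, he]))
  have herr := exists_cosInt_error_le hω hi he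
  simp only [← hke] at herr
  let Q : ℕ → C(Gp n, ℝ) := fun l => l.casesOn 0 fun l => cosInt e ω (l / 2)
  have hQ : ∀ l, Q (l + 1) = cosInt e ω (l / 2) := fun _ => rfl
  refine ⟨fun l => Q (l + 1) - Q l, fun l => ?_, fun h χ hχ hh l => ?_, fun P => ?_, fun k => ?_⟩
  · refine Submodule.sub_mem _ (Vp_mono (by omega) (cosInt_mem hω e (l / 2))) ?_
    cases l with
    | zero => exact Submodule.zero_mem _
    | succ l => exact Vp_mono (by omega) (cosInt_mem hω e (l / 2))
  · rw [map_sub]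
    congr 1
    · exact Rt_cosInt hω hχ hh _
    · cases l with
      | zero => exact map_zero _
      | succ l => exact Rt_cosInt hω hχ hh _
  · obtain ⟨C, hC⟩ := herr P
    have hC0 : 0 ≤ C := le_trans (by positivity) (hC 0 1)
    have key : ∀ (l N : ℕ) (k : Gp n), 1 + l ≤ 3 * (1 + N) →
        (1 + l : ℝ) ^ P * |φ (k.1 e) - cosInt e ω N k| ≤ 3 ^ P * C := by
      intro l N k h
      have h' : (1 + l : ℝ) ≤ 3 * (1 + N) := by exact_mod_cast h
      calc (1 + l : ℝ) ^ P * |φ (k.1 e) - cosInt e ω N k|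
          ≤ (3 * (1 + N)) ^ P * |φ (k.1 e) - cosInt e ω N k| := by gcongr
        _ = 3 ^ P * ((1 + N) ^ P * |φ (k.1 e) - cosInt e ω N k|) := by rw [mul_pow, mul_assoc]
        _ ≤ _ := by gcongr; exact hC N k
    refine ⟨‖Q 1 - Q 0‖ + 2 * (3 ^ P * C), fun l => ?_⟩
    cases l with
    | zero =>
      simp only [Nat.cast_zero, add_zero, one_pow, one_mul, zero_add]
      exact le_add_of_nonneg_right (by positivity)
    | succ l =>
      refine le_add_of_nonneg_of_le (norm_nonneg _) ?_
      have hp : (0 : ℝ) < (1 + (l + 1 : ℕ)) ^ P := by positivity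
      rw [← le_div_iff₀' hp, ContinuousMap.norm_le _ (by positivity)]
      intro k
      dsimp only
      rw [le_div_iff₀' hp, hQ, hQ, ContinuousMap.sub_apply, Real.norm_eq_abs]
      have h1 := key (l + 1) ((l + 1) / 2) k (by omega)
      have h2 := key (l + 1) (l / 2) k (by omega)
      have h3 : |cosInt e ω ((l + 1) / 2) k - cosInt e ω (l / 2) k| ≤
          |φ (k.1 e) - cosInt e ω ((l + 1) / 2) k| + |φ (k.1 e) - cosInt e ω (l / 2) k| := by
        rw [abs_sub_comm (φ _) (cosInt e ω ((l + 1) / 2) k)]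
        exact abs_sub_le _ _ _
      calc _ ≤ _ := mul_le_mul_of_nonneg_left h3 hp.le
        _ ≤ _ := by rw [mul_add]; linarith
  · have h1 : ∀ L, ∑ l ∈ Finset.range L, (Q (l + 1) - Q l) k = Q L k := fun L => by
      simp only [ContinuousMap.sub_apply]
      rw [Finset.sum_range_sub fun l => Q l k]
      exact sub_zero _
    simp only [h1]
    rw [← tendsto_add_atTop_iff_nat 1]
    obtain ⟨C, hC⟩ := herr 1
    have h2 : Tendsto (fun N : ℕ => cosInt e ω N k) atTop (𝓝 (φ (k.1 e))) := by
      rw [tendsto_iff_norm_sub_tendsto_zero]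
      have h3 : Tendsto (fun N : ℕ => C * (1 / ((N : ℝ) + 1))) atTop (𝓝 0) := by
        simpa using tendsto_one_div_add_atTop_nhds_zero_nat.const_mul C
      refine squeeze_zero (fun _ => norm_nonneg _) (fun N => ?_) h3
      rw [mul_one_div, le_div_iff₀ (by positivity), norm_sub_rev, Real.norm_eq_abs, mul_comm,
        add_comm, ← pow_one (1 + (N : ℝ))]
      exact hC N k
    exact h2.comp (Nat.tendsto_div_const_atTop two_ne_zero)

theorem exists_superpolynomial_Wt {y : ℕ → C(Gp n, ℝ)}
    (hy : ∀ P : ℕ, ∃ C, ∀ l : ℕ, (1 + l : ℝ) ^ P * ‖y l‖ ≤ C) :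
    ∃ w : Wt n, w.Super ∧ ∀ z : ℕ → C(Gp n, ℝ), (∃ B, ∀ l, n2 (z l) ≤ B * (1 + l : ℝ) ^ 2 * n2 (y l)) →
      Summable fun l => w.W l * n2 (z l) := by
  obtain ⟨w, hw1, hwm, hws, hwy⟩ := exists_weight (fun l => norm_nonneg (y l)) hy
  have hw0 : ∀ l, 0 < w l := fun l => one_pos.trans_le (hw1 l)
  refine ⟨⟨fun l => 2 ^ (n * n) * w l * (1 + l : ℝ) ^ (n * n), fun l => ?_, fun {j k} hjk => ?_⟩,
    fun P => ?_, fun z ⟨B, hB⟩ => ?_⟩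
  · refine le_mul_of_one_le_left (by positivity) ?_
    exact one_le_mul_of_one_le_of_one_le (one_le_pow₀ one_le_two) (hw1 l)
  · have h1 : (1 + (j + k : ℕ) : ℝ) ≤ 2 * (1 + k) := by
      have : (j : ℝ) ≤ k := by exact_mod_cast hjk
      push_cast
      linarith
    calc 2 ^ (n * n) * w (j + k) * (1 + (j + k : ℕ) : ℝ) ^ (n * n) * (1 + j : ℝ) ^ (n * n)
        ≤ 2 ^ (n * n) * (w j * w k) * (2 * (1 + k)) ^ (n * n) * (1 + j : ℝ) ^ (n * n) := by
          have := hw0 j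
          have := hw0 k
          gcongr
          exact hwm j k
      _ = _ := by rw [mul_pow]; ring
  · obtain ⟨C, hC⟩ := hws P
    have hC0 : 0 ≤ C := by
      by_contra! h
      have h1 := hC 0
      have : C * w 0 < 0 := mul_neg_of_neg_of_pos h (hw0 0)
      simp at h1
      linarith
    refine ⟨C, fun l => (hC l).trans ?_⟩
    gcongr
    dsimp only
    calc w l = 1 * w l * 1 := by ring
      _ ≤ _ := by
        have := hw0 l
        gcongr
        · exact one_le_pow₀ one_le_two
        · exact one_le_pow₀ (by simp)
  · obtain ⟨C, hC⟩ := hwy (n * n + 4)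
    have hs : Summable fun l : ℕ => 2 ^ (n * n) * |B| * C * (1 / (1 + l : ℝ) ^ 2) := by
      refine Summable.mul_left _ ?_
      have := (summable_nat_add_iff 1).2 (Real.summable_one_div_nat_pow.2 one_lt_two)
      refine this.congr fun l => ?_
      rw [Nat.cast_add, Nat.cast_one, add_comm]
    refine Summable.of_nonneg_of_le (fun l => ?_) (fun l => ?_) hs
    · have := hw0 l
      have : 0 ≤ n2 (z l) := norm_nonneg _
      dsimp only
      positivity
    · have := hw0 l
      have hp : (0 : ℝ) < (1 + l) ^ 2 := by positivity
      rw [mul_one_div, le_div_iff₀ hp]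
      dsimp only
      have h1 : n2 (z l) ≤ |B| * (1 + l : ℝ) ^ 2 * ‖y l‖ := by
        refine (hB l).trans ?_
        have : 0 ≤ n2 (y l) := norm_nonneg _
        gcongr
        · exact le_abs_self B
        · exact n2_le_norm _
      calc 2 ^ (n * n) * w l * (1 + l : ℝ) ^ (n * n) * n2 (z l) * (1 + l : ℝ) ^ 2
          ≤ 2 ^ (n * n) * w l * (1 + l : ℝ) ^ (n * n) * (|B| * (1 + l : ℝ) ^ 2 * ‖y l‖) *
            (1 + l : ℝ) ^ 2 := by gcongr
        _ = 2 ^ (n * n) * |B| * (w l * ((1 + l : ℝ) ^ (n * n + 4) * ‖y l‖)) := by ring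
        _ ≤ _ := by gcongr; exact hC l

theorem exists_n2_Lij_le (i j : Fin n) : ∃ B, 0 ≤ B ∧ ∀ (l : ℕ) (y : C(Gp n, ℝ)), y ∈ Vp n l →
    n2 (Lij i j y) ≤ B * (1 + l) * n2 y := by
  refine ⟨‖(wd (eb i) (eb j) : Sk n).1‖, norm_nonneg _, fun l y hy => (n2_Ld_le _ hy).trans ?_⟩
  have : 0 ≤ n2 y := norm_nonneg _
  rw [mul_comm (l : ℝ)]
  gcongr
  linarith

theorem exists_lift
    {y : ℕ → C(Gp n, ℝ)} (hy : ∀ l, y l ∈ Vp n l)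
    (hd : ∀ P : ℕ, ∃ C, ∀ l : ℕ, (1 + l : ℝ) ^ P * ‖y l‖ ≤ C) :
    ∃ (w : Wt n) (U : AA w) (LU : Fin n → Fin n → AA w)
      (LLU : Fin n → Fin n → Fin n → Fin n → AA w), w.Super ∧ (∀ l, comp U l = y l) ∧
      (∀ i j, IsL i j U (LU i j)) ∧ ∀ i j a b, IsL i j (LU a b) (LLU i j a b) := by
  obtain ⟨w, hw, hs⟩ := exists_superpolynomial_Wt hd
  have h0 : Summable fun l => w.W l * n2 (y l) := hs y ⟨1, fun l => by
    have : 0 ≤ n2 (y l) := norm_nonneg _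
    rw [one_mul]
    exact le_mul_of_one_le_left this (one_le_pow₀ (by simp))⟩
  have h1 : ∀ i j, Summable fun l => w.W l * n2 (Lij i j (y l)) := fun i j => by
    obtain ⟨B, hB0, hB⟩ := exists_n2_Lij_le i j
    refine hs _ ⟨B, fun l => (hB l _ (hy l)).trans ?_⟩
    have : 0 ≤ n2 (y l) := norm_nonneg _
    gcongr
    exact le_self_pow₀ (by simp) two_ne_zero
  have h2 : ∀ i j a b, Summable fun l => w.W l * n2 (Lij i j (Lij a b (y l))) := fun i j a b => by
    obtain ⟨B, hB0, hB⟩ := exists_n2_Lij_le i j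
    obtain ⟨B', hB0', hB'⟩ := exists_n2_Lij_le a b
    refine hs _ ⟨B * B', fun l => (hB l _ (Lij_mem a b (hy l))).trans ?_⟩
    have : 0 ≤ n2 (y l) := norm_nonneg _
    calc B * (1 + l) * n2 (Lij a b (y l)) ≤ B * (1 + l) * (B' * (1 + l) * n2 (y l)) := by
          gcongr
          exact hB' l _ (hy l)
      _ = _ := by ring
  exact ⟨w, ofFun w y hy h0, fun i j => ofFun w _ (fun l => Lij_mem i j (hy l)) (h1 i j),
    fun i j a b => ofFun w _ (fun l => Lij_mem i j (Lij_mem a b (hy l))) (h2 i j a b), hw,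
    fun l => rfl, fun i j l => rfl, fun i j a b l => rfl⟩

end

/-- Smooth even solution to the log-Gaussian chord Minkowski problem.
For `n ≥ 2`, `q > 2` and a positive smooth even function `f` on `S^{n-1}`, there exist an
origin-symmetric convex body `Ω` with smooth strictly convex boundary and a constant
`τ₂ > 0` whose support function `h` satisfies
`τ₂ Ṽ_{γ,q}(Ω, ∇h + h x) h det(∇²h + h I) = f` on `S^{n-1}`. -/
theorem log_gaussian_chord_minkowski_smooth_even_solution
    (n : ℕ) (hn : 2 ≤ n) (q : ℝ) (hq : 2 < q)
    (f : Eucl n → ℝ) (hf : ContDiff ℝ (⊤ : ℕ∞) f)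
    (hfpos : ∀ x ∈ Metric.sphere (0 : Eucl n) 1, 0 < f x)
    (hfeven : ∀ x : Eucl n, f (-x) = f x) :
    ∃ (Ω : Set (Eucl n)) (τ₂ : ℝ), 0 < τ₂ ∧ IsSmoothBody Ω ∧
      ∀ x ∈ Metric.sphere (0 : Eucl n) 1,
        τ₂ * Vtilde q Ω (gradient (suppFun Ω) x) * suppFun Ω x *
          curvDet (suppFun Ω) x = f x := by
  obtain ⟨e, he⟩ : ∃ e : Eucl n, ‖e‖ = 1 := ⟨eb ⟨0, by omega⟩, by simp [eb]⟩
  obtain ⟨φ, hφ, hc, hφf⟩ := exists_smooth_compact_eq_neg_log hf hfpos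
  obtain ⟨y, hy, hinv, hd, hlim⟩ := exists_Vp_expansion he hφ hc fun x hx => by
    rw [hφf x hx, hφf (-x) (by simpa using hx), hfeven]
  obtain ⟨w, U, LU, LLU, hw, hU, hLU, hLLU⟩ := exists_lift hy hd
  let d : NL w := ⟨e, he, n - q + 1, U, LU, LLU, hLU, hLLU, gaussProb (n - q + 1) e⟩
  obtain ⟨Ω, τ, hτ, hΩ, heq⟩ := d.exists_body hn (q := q) rfl (by change (n : ℝ) - q + 1 < n; linarith)
    (fun _ => rfl) hw fun h χ hχ hh => AA_ext fun l => by
      change Rt h (comp U l) = comp U l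
      rw [hU]
      exact hinv h χ hχ hh l
  refine ⟨Ω, τ, hτ, hΩ, fun x hx => ?_⟩
  have hx1 : ‖x‖ = 1 := by simpa using hx
  have hk : (sec e x).1 e = x := by
    have := sec_apply he x
    rwa [hx1, one_smul] at this
  have h := heq (sec e x)
  change _ * Vtilde q Ω (gradient (suppFun Ω) ((sec e x).1 e)) * suppFun Ω ((sec e x).1 e) *
    curvDet (suppFun Ω) ((sec e x).1 e) = _ at h
  rw [hk] at h
  rw [h]
  have h1 : evk w (sec e x) U = φ x := by
    have h2 := (hasSum_evk (sec e x) U).tendsto_sum_nat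
    simp only [hU] at h2
    rw [tendsto_nhds_unique h2 (hlim (sec e x)), hk]
  change Real.exp (-evk w (sec e x) U) = _
  rw [h1, hφf x hx, neg_neg, Real.exp_log (hfpos x hx)]
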